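/- For every continuous map f ∈ C(S³, S²), the second homotopy group π₂(C(S³, S²), f) of the mapping space based at f is isomorphic to ℤ × ℤ/2ℤ. -/

import Mathlib

open Topology

/-- The unit sphere `S^m ⊆ ℝ^{m+1}` centered at the origin. -/
noncomputable def Sph (m : ℕ) : Set (EuclideanSpace ℝ (Fin (m + 1))) :=
  Metric.sphere (0 : EuclideanSpace ℝ (Fin (m + 1))) 1

/-- The north pole `N = (0, …, 0, 1) ∈ S^m`. -/
noncomputable def northPole (m : ℕ) : Sph m :=
  ⟨EuclideanSpace.single (Fin.last m) (1 : ℝ), by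
    simp [Sph, EuclideanSpace.norm_single]⟩

noncomputable section

open Topology unitInterval
open scoped Kronecker Quaternion

/-- Homotopy of (continuous) maps through maps satisfying `P`. -/
def Htp {Z M : Type*} [TopologicalSpace Z] [TopologicalSpace M] (P : (Z → M) → Prop)
    (F G : Z → M) : Prop :=
  ∃ H : I → Z → M, Continuous (fun p : I × Z => H p.1 p.2) ∧ H 0 = F ∧ H 1 = G ∧ ∀ t, P (H t)

namespace Htp

variable {Z Z' M M' : Type*} [TopologicalSpace Z] [TopologicalSpace M] [TopologicalSpace Z']
  [TopologicalSpace M'] {P : (Z → M) → Prop} {F G K : Z → M}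

theorem cont_left (h : Htp P F G) : Continuous F := by
  obtain ⟨H, hc, h0, -, -⟩ := h
  rw [← h0]
  exact hc.comp (Continuous.prodMk_right (0 : I))

theorem cont_right (h : Htp P F G) : Continuous G := by
  obtain ⟨H, hc, -, h0, -⟩ := h
  rw [← h0]
  exact hc.comp (Continuous.prodMk_right (1 : I))

theorem prop_left (h : Htp P F G) : P F := by
  obtain ⟨H, hc, h0, -, hp⟩ := h
  exact h0 ▸ hp 0

theorem prop_right (h : Htp P F G) : P G := by
  obtain ⟨H, hc, -, h1, hp⟩ := h
  exact h1 ▸ hp 1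

theorem refl (hF : Continuous F) (hP : P F) : Htp P F F :=
  ⟨fun _ => F, hF.comp continuous_snd, rfl, rfl, fun _ => hP⟩

theorem symm (h : Htp P F G) : Htp P G F := by
  obtain ⟨H, hc, h0, h1, hp⟩ := h
  refine ⟨fun t => H (σ t), ?_, by simpa using h1, by simpa using h0, fun t => hp _⟩
  exact hc.comp (by fun_prop : Continuous fun p : I × Z => (σ p.1, p.2))

theorem iff_homotopicWith (hF : Continuous F) (hG : Continuous G) :
    Htp P F G ↔ ContinuousMap.HomotopicWith ⟨F, hF⟩ ⟨G, hG⟩ (fun f => P f) := by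
  constructor
  · rintro ⟨H, hc, h0, h1, hp⟩
    exact ⟨⟨⟨⟨fun p => H p.1 p.2, hc⟩, fun x => by simp [h0], fun x => by simp [h1]⟩, hp⟩⟩
  · rintro ⟨H⟩
    refine ⟨fun t x => H (t, x), H.continuous, ?_, ?_, fun t => H.prop t⟩
    · ext x; simp
    · ext x; simp

theorem trans (h : Htp P F G) (h' : Htp P G K) : Htp P F K :=
  (iff_homotopicWith h.cont_left h'.cont_right).2
    (((iff_homotopicWith h.cont_left h.cont_right).1 h).trans
      ((iff_homotopicWith h'.cont_left h'.cont_right).1 h'))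

theorem mono {Q : (Z → M) → Prop} (h : Htp P F G) (hPQ : ∀ f, Continuous f → P f → Q f) :
    Htp Q F G := by
  obtain ⟨H, hc, h0, h1, hp⟩ := h
  exact ⟨H, hc, h0, h1, fun t => hPQ _ (hc.comp (Continuous.prodMk_right t)) (hp t)⟩

/-- Transport a homotopy along an operation on maps which is continuous in families. -/
theorem map {Q : (Z' → M') → Prop} (h : Htp P F G) (Φ : (Z → M) → (Z' → M'))
    (hΦ : ∀ H : I → Z → M, Continuous (fun p : I × Z => H p.1 p.2) →
      Continuous (fun p : I × Z' => Φ (H p.1) p.2))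
    (hPQ : ∀ f, Continuous f → P f → Q (Φ f)) : Htp Q (Φ F) (Φ G) := by
  obtain ⟨H, hc, h0, h1, hp⟩ := h
  exact ⟨fun t => Φ (H t), hΦ H hc, by simp [h0], by simp [h1],
    fun t => hPQ _ (hc.comp (Continuous.prodMk_right t)) (hp t)⟩

theorem postcomp {Q : (Z → M') → Prop} (h : Htp P F G) (φ : M → M') (hφ : Continuous φ)
    (hPQ : ∀ f, Continuous f → P f → Q (φ ∘ f)) : Htp Q (φ ∘ F) (φ ∘ G) :=
  h.map (fun f => φ ∘ f) (fun H hc => hφ.comp hc) hPQ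

end Htp

/-- Homotopy through maps with values in `U`. -/
abbrev FHtp {Z M : Type*} [TopologicalSpace Z] [TopologicalSpace M] (U : Set M)
    (F G : Z → M) : Prop := Htp (fun f => ∀ z, f z ∈ U) F G

/-- Data for one step of real Bott periodicity in a real star algebra. -/
structure BDat (ι A : Type*) [Ring A] [StarRing A] [Algebra ℝ A] where
  c : ι → A
  ε : ι → ℝ
  e : A
  f : A
  τ : A
  e_star : star e = -e
  e_sq : e * e = -1
  e_c : ∀ l, e * c l = ε l • (c l * e)
  f_star : star f = -f
  f_sq : f * f = -1
  f_c : ∀ l, f * c l = ε l • (c l * f)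
  f_e : f * e = -(e * f)
  τ_left : star τ * τ = 1
  τ_right : τ * star τ = 1
  τ_c : ∀ l, τ * c l = c l * τ
  τ_e : τ * e = e * τ
  τ_f : τ * f = -(f * τ)
  ε_sq : ∀ l, ε l * ε l = 1

abbrev M3 (A : Type*) := Matrix (Fin 3) (Fin 3) A

section mat3
variable {A : Type*}

theorem continuous_mat3 {Z : Type*} [TopologicalSpace Z] [TopologicalSpace A]
    {a b c d e f g h i : Z → A} (ha : Continuous a) (hb : Continuous b) (hc : Continuous c)
    (hd : Continuous d) (he : Continuous e) (hf : Continuous f) (hg : Continuous g)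
    (hh : Continuous h) (hi : Continuous i) :
    Continuous (fun z => (!![a z, b z, c z; d z, e z, f z; g z, h z, i z] : M3 A)) := by
  refine continuous_matrix fun k l => ?_
  fin_cases k <;> fin_cases l <;> assumption

variable [Ring A]

theorem star_mat3 [StarRing A] (a b c d e f g h i : A) :
    star (!![a, b, c; d, e, f; g, h, i] : M3 A) =
      !![star a, star d, star g; star b, star e, star h; star c, star f, star i] := by
  ext k l; fin_cases k <;> fin_cases l <;> rfl

/-- The block diagonal matrix `diag(a, b, c)`. -/
def dg (a b c : A) : M3 A := !![a, 0, 0; 0, b, 0; 0, 0, c]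

theorem dg_mul (a b c a' b' c' : A) : dg a b c * dg a' b' c' = dg (a * a') (b * b') (c * c') := by
  simp [dg]

theorem dg_one : dg (1 : A) 1 1 = 1 := by simp [dg, Matrix.one_fin_three]

theorem dg_neg (a b c : A) : -dg a b c = dg (-a) (-b) (-c) := by
  ext k l; fin_cases k <;> fin_cases l <;> simp [dg]

theorem dg_smul [Algebra ℝ A] (r : ℝ) (a b c : A) : r • dg a b c = dg (r • a) (r • b) (r • c) := by
  ext k l; fin_cases k <;> fin_cases l <;> simp [dg]

theorem dg_add (a b c a' b' c' : A) : dg a b c + dg a' b' c' = dg (a + a') (b + b') (c + c') := by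
  ext k l; fin_cases k <;> fin_cases l <;> simp [dg]

theorem star_dg [StarRing A] (a b c : A) : star (dg a b c) = dg (star a) (star b) (star c) := by
  simp [dg, star_mat3]

theorem isUnit_dg {a b c : A} (ha : IsUnit a) (hb : IsUnit b) (hc : IsUnit c) :
    IsUnit (dg a b c) := by
  obtain ⟨a, rfl⟩ := ha
  obtain ⟨b, rfl⟩ := hb
  obtain ⟨c, rfl⟩ := hc
  exact ⟨⟨dg ↑a ↑b ↑c, dg ↑a⁻¹ ↑b⁻¹ ↑c⁻¹, by rw [dg_mul]; simp [dg_one],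
    by rw [dg_mul]; simp [dg_one]⟩, rfl⟩

/-- An invertible symmetric block pattern. -/
theorem isUnit_pattern {P g Q e : A} (he : e * e = -1) (hP : IsUnit P) :
    IsUnit (!![P, g, 0; g, Q, e; 0, e, 0] : M3 A) := by
  have h1 : IsUnit (!![1, 0, -(g * e); 0, 1, -(Q * e); 0, 0, 1] : M3 A) :=
    ⟨⟨_, !![1, 0, g * e; 0, 1, Q * e; 0, 0, 1],
      by simp [Matrix.one_fin_three],
      by simp [Matrix.one_fin_three]⟩, rfl⟩
  have h2 : IsUnit (!![1, 0, 0; 0, 1, 0; -(e * g), 0, 1] : M3 A) :=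
    ⟨⟨_, !![1, 0, 0; 0, 1, 0; e * g, 0, 1],
      by simp [Matrix.one_fin_three],
      by simp [Matrix.one_fin_three]⟩, rfl⟩
  obtain ⟨P, rfl⟩ := hP
  have h3 : IsUnit (!![↑P, 0, 0; 0, 0, e; 0, e, 0] : M3 A) :=
    ⟨⟨_, !![↑P⁻¹, 0, 0; 0, 0, -e; 0, -e, 0],
      by simp [Matrix.one_fin_three, he],
      by simp [Matrix.one_fin_three, he]⟩, rfl⟩
  have : (!![↑P, g, 0; g, Q, e; 0, e, 0] : M3 A) =
      !![1, 0, -(g * e); 0, 1, -(Q * e); 0, 0, 1] * !![↑P, 0, 0; 0, 0, e; 0, e, 0] *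
        !![1, 0, 0; 0, 1, 0; -(e * g), 0, 1] := by
    simp [mul_assoc, he]
    simp [← mul_assoc, he]
  rw [this]
  exact (h1.mul h3).mul h2

/-- A matrix over the image of a commutative ring is invertible if its determinant is. -/
theorem isUnit_map_of_det {R : Type*} [CommRing R] (φ : R →+* A) (M : M3 R)
    (h : IsUnit (φ M.det)) : IsUnit (M.map φ) := by
  obtain ⟨u, hu⟩ := h
  have key : ∀ N : M3 R, N = M.det • (1 : M3 R) → N.map φ = dg (u : A) u u := by
    rintro N rfl
    ext k l
    fin_cases k <;> fin_cases l <;> simp [dg, hu]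
  have hD : IsUnit (dg (u : A) u u) := isUnit_dg u.isUnit u.isUnit u.isUnit
  have e1 : M.map φ * M.adjugate.map φ = dg (u : A) u u := by
    rw [← Matrix.map_mul]; exact key _ (Matrix.mul_adjugate M)
  have e2 : M.adjugate.map φ * M.map φ = dg (u : A) u u := by
    rw [← Matrix.map_mul]; exact key _ (Matrix.adjugate_mul M)
  obtain ⟨D, hD⟩ := hD
  refine isUnit_iff_exists_and_exists.2 ⟨⟨M.adjugate.map φ * (↑D⁻¹ : M3 A), ?_⟩,
    ⟨(↑D⁻¹ : M3 A) * M.adjugate.map φ, ?_⟩⟩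
  · rw [← mul_assoc, e1, ← hD]; simp
  · rw [mul_assoc, e2, ← hD]; simp

end mat3

namespace BDat

variable {ι A : Type*} [Ring A] [StarRing A] [Algebra ℝ A] [StarModule ℝ A] (D : BDat ι A)

/-- The real vector space of skew elements with the prescribed commutation relations. -/
def S : Submodule ℝ A where
  carrier := {a | star a = -a ∧ ∀ l, a * D.c l = D.ε l • (D.c l * a)}
  add_mem' := by
    rintro a b ⟨ha, ha'⟩ ⟨hb, hb'⟩
    refine ⟨by rw [star_add, ha, hb, neg_add], fun l => ?_⟩
    rw [add_mul, ha', hb', mul_add, smul_add]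
  zero_mem' := by simp
  smul_mem' := by
    rintro r a ⟨ha, ha'⟩
    refine ⟨by simp [ha], fun l => ?_⟩
    rw [smul_mul_assoc, ha', mul_smul_comm, smul_comm]

/-- The invertible elements of `S`. -/
def Y : Set A := {a | a ∈ D.S ∧ IsUnit a}

/-- The elements of `Y` anticommuting with `e`. -/
def Yp : Set A := {b | b ∈ D.Y ∧ b * D.e = -(D.e * b)}

theorem e_mem : D.e ∈ D.S := ⟨D.e_star, D.e_c⟩
theorem f_mem : D.f ∈ D.S := ⟨D.f_star, D.f_c⟩

theorem isUnit_of_sq {a : A} (h : a * a = -1) : IsUnit a :=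
  ⟨⟨a, -a, by simp [h], by simp [h]⟩, rfl⟩

theorem e_unit : IsUnit D.e := isUnit_of_sq D.e_sq
theorem f_unit : IsUnit D.f := isUnit_of_sq D.f_sq
theorem e_Y : D.e ∈ D.Y := ⟨D.e_mem, D.e_unit⟩
theorem f_Yp : D.f ∈ D.Yp := ⟨⟨D.f_mem, D.f_unit⟩, D.f_e⟩

theorem conj_mem {a u : A} (ha : a ∈ D.S) (hu : ∀ l, u * D.c l = D.c l * u)
    (hu' : ∀ l, star u * D.c l = D.c l * star u) : u * a * star u ∈ D.S := by
  refine ⟨by simp [ha.1, mul_assoc], fun l => ?_⟩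
  rw [mul_assoc, hu', ← mul_assoc, mul_assoc u, ha.2, mul_smul_comm, smul_mul_assoc,
    ← mul_assoc u, hu, mul_assoc, mul_assoc, mul_assoc]

theorem conj_Y {a u : A} (ha : a ∈ D.Y) (hu : ∀ l, u * D.c l = D.c l * u)
    (hu' : ∀ l, star u * D.c l = D.c l * star u) (h : IsUnit u) : u * a * star u ∈ D.Y :=
  ⟨D.conj_mem ha.1 hu hu', (h.mul ha.2).mul h.star⟩

theorem mul_comm_c {a b : A} (ha : a ∈ D.S) (hb : b ∈ D.S) (l : ι) :
    a * b * D.c l = D.c l * (a * b) := by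
  rw [mul_assoc, hb.2, mul_smul_comm, ← mul_assoc, ha.2, smul_mul_assoc, smul_smul, D.ε_sq,
    one_smul, mul_assoc]

theorem star_τ_c (l : ι) : star D.τ * D.c l = D.c l * star D.τ := by
  calc star D.τ * D.c l = star D.τ * (D.c l * D.τ) * star D.τ := by
        rw [mul_assoc, mul_assoc (D.c l), D.τ_right, mul_one]
    _ = D.c l * star D.τ := by rw [← D.τ_c, ← mul_assoc, D.τ_left, one_mul]

/-- The data on `3 × 3` block matrices. -/
def m3 : BDat ι (M3 A) where
  c l := dg (D.c l) (D.c l) (D.c l)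
  ε := D.ε
  e := dg D.e D.e D.e
  f := dg D.f D.f D.f
  τ := dg D.τ D.τ D.τ
  e_star := by simp [star_dg, D.e_star, dg_neg]
  e_sq := by simp [dg_mul, D.e_sq, ← dg_one, dg_neg]
  e_c l := by simp [dg_mul, dg_smul, D.e_c]
  f_star := by simp [star_dg, D.f_star, dg_neg]
  f_sq := by simp [dg_mul, D.f_sq, ← dg_one, dg_neg]
  f_c l := by simp [dg_mul, dg_smul, D.f_c]
  f_e := by simp [dg_mul, dg_neg, D.f_e]
  τ_left := by simp [star_dg, dg_mul, D.τ_left, dg_one]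
  τ_right := by simp [star_dg, dg_mul, D.τ_right, dg_one]
  τ_c l := by simp [dg_mul, D.τ_c]
  τ_e := by simp [dg_mul, D.τ_e]
  τ_f := by simp [dg_mul, dg_neg, D.τ_f]
  ε_sq := D.ε_sq

theorem mem_m3_comm {M : M3 A} (h : ∀ i j l, M i j * D.c l = D.c l * M i j) (l : ι) :
    M * D.m3.c l = D.m3.c l * M := by
  ext i j
  fin_cases i <;> fin_cases j <;> simp [m3, dg, Matrix.mul_apply, Fin.sum_univ_three, h]

theorem mem_m3_S {a b c d f g : A} (ha : a ∈ D.S) (hb : b ∈ D.S) (hc : c ∈ D.S) (hd : d ∈ D.S)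
    (hf : f ∈ D.S) (hg : g ∈ D.S) : (!![a, b, c; b, d, f; c, f, g] : M3 A) ∈ D.m3.S := by
  refine ⟨?_, fun l => ?_⟩
  · rw [star_mat3, ha.1, hb.1, hc.1, hd.1, hf.1, hg.1]
    ext i j
    fin_cases i <;> fin_cases j <;> simp
  · ext i j
    fin_cases i <;> fin_cases j <;> simp [m3, dg, Matrix.mul_apply, Fin.sum_univ_three, ha.2,
      hb.2, hc.2, hd.2, hf.2, hg.2]

theorem dg_mem_S {a b c : A} (ha : a ∈ D.S) (hb : b ∈ D.S) (hc : c ∈ D.S) :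
    dg a b c ∈ D.m3.S :=
  D.mem_m3_S ha D.S.zero_mem D.S.zero_mem hb D.S.zero_mem hc

theorem dg_mem_Y {a b c : A} (ha : a ∈ D.Y) (hb : b ∈ D.Y) (hc : c ∈ D.Y) :
    dg a b c ∈ D.m3.Y :=
  ⟨D.dg_mem_S ha.1 hb.1 hc.1, isUnit_dg ha.2 hb.2 hc.2⟩

theorem dg_mem_Yp {a b c : A} (ha : a ∈ D.Yp) (hb : b ∈ D.Yp) (hc : c ∈ D.Yp) :
    dg a b c ∈ D.m3.Yp := by
  refine ⟨D.dg_mem_Y ha.1 hb.1 hc.1, ?_⟩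
  simp [m3, dg_mul, dg_neg, ha.2, hb.2, hc.2]

end BDat

/-- `cos (π s)`. -/
def cs (s : I) : ℝ := Real.cos (Real.pi * s)
/-- `sin (π s)`. -/
def sn (s : I) : ℝ := Real.sin (Real.pi * s)

@[fun_prop] theorem continuous_cs : Continuous cs := by unfold cs; fun_prop
@[fun_prop] theorem continuous_sn : Continuous sn := by unfold sn; fun_prop
@[simp] theorem cs_zero : cs 0 = 1 := by simp [cs]
@[simp] theorem cs_one : cs 1 = -1 := by simp [cs]
@[simp] theorem sn_zero : sn 0 = 0 := by simp [sn]
@[simp] theorem sn_one : sn 1 = 0 := by simp [sn]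
theorem cs_sn (s : I) : cs s ^ 2 + sn s ^ 2 = 1 := by simp [cs, sn]

/-- The real frame used to linearize. -/
def fr (x y : ℝ) : M3 ℝ := !![x, -y / 2, y / 2; 2 * y, x, -x; 0, 1 / 2, 1 / 2]

section
variable {A : Type*} [Ring A] [Algebra ℝ A]

/-- The real frame used to linearize, with values in `A`. -/
def frA (A : Type*) [Ring A] [Algebra ℝ A] (x y : ℝ) : M3 A := (fr x y).map (algebraMap ℝ A)

theorem isUnit_frA {x y : ℝ} (h : x ^ 2 + y ^ 2 = 1) : IsUnit (frA A x y) := by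
  refine isUnit_map_of_det _ _ ?_
  have : (fr x y).det = 1 := by
    simp [fr, Matrix.det_fin_three]; nlinarith
  rw [this]; simp

variable [StarRing A] [StarModule ℝ A]

theorem star_algebraMap_real (r : ℝ) : star (algebraMap ℝ A r) = algebraMap ℝ A r := by
  rw [Algebra.algebraMap_eq_smul_one, star_smul]; simp

theorem frA_conj (x y : ℝ) (P g Q e : A) :
    star (frA A x y) * !![P, g, 0; g, Q, e; 0, e, 0] * frA A x y =
    Matrix.of fun i j => (fr x y 0 i * fr x y 0 j) • P +
      (fr x y 0 i * fr x y 1 j + fr x y 1 i * fr x y 0 j) • g + (fr x y 1 i * fr x y 1 j) • Q +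
      (fr x y 1 i * fr x y 2 j + fr x y 2 i * fr x y 1 j) • e := by
  ext i j
  simp only [frA, Matrix.mul_apply, Fin.sum_univ_three, Matrix.star_apply, Matrix.map_apply,
    star_algebraMap_real]
  generalize fr x y = N
  simp only [Algebra.algebraMap_eq_smul_one, smul_mul_assoc, mul_smul_comm, one_mul, mul_one,
    Matrix.of_apply, Matrix.cons_val', Matrix.cons_val_zero, Matrix.cons_val_one,
    Matrix.cons_val]
  module

end

/-- `1 / √2`. -/
def rr : ℝ := √(1 / 2)

theorem rr_rr : rr * rr = 1 / 2 := Real.mul_self_sqrt (by norm_num)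

namespace BDat

variable {ι A : Type*} [Ring A] [StarRing A] [Algebra ℝ A] [StarModule ℝ A] (D : BDat ι A)

/-- The linear path from `e` to `-e` through `b`. -/
def pen (b : A) (s : I) : A := cs s • D.e + sn s • b

/-- Families of paths in `Y` from `e` to `-e`. -/
def PathP {X : Type*} (F : X × I → A) : Prop :=
  ∀ x, F (x, 0) = D.e ∧ F (x, 1) = -D.e ∧ ∀ s, F (x, s) ∈ D.Y

theorem e_e (z : A) : D.e * (D.e * z) = -z := by rw [← mul_assoc, D.e_sq, neg_one_mul]
theorem f_f (z : A) : D.f * (D.f * z) = -z := by rw [← mul_assoc, D.f_sq, neg_one_mul]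
theorem f_e' (z : A) : D.f * (D.e * z) = -(D.e * (D.f * z)) := by
  rw [← mul_assoc, D.f_e, neg_mul, mul_assoc]
theorem τ_e' (z : A) : D.τ * (D.e * z) = D.e * (D.τ * z) := by
  rw [← mul_assoc, D.τ_e, mul_assoc]
theorem τ_f' (z : A) : D.τ * (D.f * z) = -(D.f * (D.τ * z)) := by
  rw [← mul_assoc, D.τ_f, neg_mul, mul_assoc]

/-- A unitary block matrix carrying `diag(e, -e)` to `diag(e, e)` and the antidiagonal matrix
with entries `e` to `diag(f, f)`. -/
def V : M3 A :=
  !![1, 0, 0; 0, rr • (1 : A), rr • (D.e * D.f); 0, rr • D.τ,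
    -(rr • (D.τ * D.e * D.f))]

theorem star_V : star D.V = !![1, 0, 0; 0, rr • (1 : A), rr • star D.τ;
    0, -(rr • (D.e * D.f)), rr • ((D.e * D.f) * star D.τ)] := by
  rw [V, star_mat3]
  ext i j
  fin_cases i <;> fin_cases j <;> simp [D.e_star, D.f_star, D.f_e, mul_assoc]

theorem V_c (l : ι) : D.V * D.m3.c l = D.m3.c l * D.V := by
  have h := D.mul_comm_c D.e_mem D.f_mem l
  have h' := D.τ_c l
  refine D.mem_m3_comm (fun i j l => ?_) l
  have h := D.mul_comm_c D.e_mem D.f_mem l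
  have h' := D.τ_c l
  have h2 : D.τ * D.e * D.f * D.c l = D.c l * (D.τ * D.e * D.f) := by
    rw [mul_assoc D.τ, mul_assoc D.τ, h, ← mul_assoc, h', mul_assoc]
  fin_cases i <;> fin_cases j <;> simp [V, h, h', h2]

theorem star_V_c (l : ι) : star D.V * D.m3.c l = D.m3.c l * star D.V := by
  rw [star_V]
  refine D.mem_m3_comm (fun i j l => ?_) l
  have h := D.mul_comm_c D.e_mem D.f_mem l
  have h' := D.star_τ_c l
  have h2 : D.e * D.f * star D.τ * D.c l = D.c l * (D.e * D.f * star D.τ) := by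
    rw [mul_assoc, h', ← mul_assoc, h, mul_assoc]
  fin_cases i <;> fin_cases j <;> simp [h, h', h2]

theorem V_conj (a : A) (x y : ℝ) :
    D.V * !![a, 0, 0; 0, x • D.e, y • D.e; 0, y • D.e, -(x • D.e)] * star D.V =
      dg a (x • D.e + y • D.f) (x • D.e + y • D.f) := by
  have hr : ∀ z : A, rr • rr • z = (1 / 2 : ℝ) • z := fun z => by rw [smul_smul, rr_rr]
  rw [star_V, V, dg]
  simp only [Matrix.mul_fin_three]
  ext i j
  fin_cases i <;> fin_cases j <;>
    simp [add_mul, mul_assoc, hr, smul_comm x, smul_comm y, D.e_e, D.f_f, D.f_e', D.f_e,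
      D.f_sq, D.τ_e', D.τ_f', D.τ_right] <;> module

theorem V_unitary : D.V * star D.V = 1 := by
  have hr : ∀ z : A, rr • rr • z = (1 / 2 : ℝ) • z := fun z => by rw [smul_smul, rr_rr]
  rw [star_V, V, Matrix.one_fin_three]
  simp only [Matrix.mul_fin_three]
  ext i j
  fin_cases i <;> fin_cases j <;>
    simp [mul_assoc, hr, D.e_e, D.f_f, D.f_e',
      D.e_sq, D.f_sq, D.τ_e', D.τ_right, D.τ_e] <;> module

theorem V_unitary' : star D.V * D.V = 1 := by
  have hr : ∀ z : A, rr • rr • z = (1 / 2 : ℝ) • z := fun z => by rw [smul_smul, rr_rr]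
  have h : ∀ z : A, star D.τ * (D.τ * z) = z := fun z => by
    rw [← mul_assoc, D.τ_left, one_mul]
  rw [star_V, V, Matrix.one_fin_three]
  simp only [Matrix.mul_fin_three]
  ext i j
  fin_cases i <;> fin_cases j <;>
    simp [mul_assoc, hr, h, D.f_e', D.e_sq, D.f_sq, D.τ_left] <;> module

theorem isUnit_V : IsUnit D.V := ⟨⟨D.V, star D.V, D.V_unitary, D.V_unitary'⟩, rfl⟩

end BDat

section
variable {A : Type*} [Ring A]

/-- A shear in the last two block coordinates. -/
def sh (v : A) : M3 A := !![1, 0, 0; 0, 1 + v, v; 0, -v, 1 - v]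

theorem sh_zero : sh (0 : A) = 1 := by simp [sh, Matrix.one_fin_three]

theorem sh_mul_neg (v : A) : sh v * sh (-v) = 1 := by
  rw [sh, sh, Matrix.mul_fin_three, Matrix.one_fin_three]
  ext i j
  fin_cases i <;> fin_cases j <;> simp <;> noncomm_ring

theorem isUnit_sh (v : A) : IsUnit (sh v) :=
  ⟨⟨sh v, sh (-v), sh_mul_neg v, by simpa using sh_mul_neg (-v)⟩, rfl⟩

theorem star_sh [StarRing A] (v : A) :
    star (sh v) = !![1, 0, 0; 0, 1 + star v, -star v; 0, star v, 1 - star v] := by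
  rw [sh, star_mat3]; simp

end

namespace BDat

variable {ι A : Type*} [Ring A] [StarRing A] [Algebra ℝ A] [StarModule ℝ A] (D : BDat ι A)

theorem sh_c {v : A} (h : ∀ l, v * D.c l = D.c l * v) (l : ι) :
    sh v * D.m3.c l = D.m3.c l * sh v := by
  refine D.mem_m3_comm (fun i j l => ?_) l
  fin_cases i <;> fin_cases j <;> simp [sh, add_mul, mul_add, sub_mul, mul_sub, h]

theorem star_sh_c {v : A} (h : ∀ l, star v * D.c l = D.c l * star v) (l : ι) :
    star (sh v) * D.m3.c l = D.m3.c l * star (sh v) := by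
  rw [star_sh]
  refine D.mem_m3_comm (fun i j l => ?_) l
  fin_cases i <;> fin_cases j <;> simp [add_mul, mul_add, sub_mul, mul_sub, h]

theorem frA_c (x y : ℝ) (l : ι) : frA A x y * D.m3.c l = D.m3.c l * frA A x y :=
  D.mem_m3_comm (fun i j l => by simp [frA, Algebra.commutes]) l

theorem star_frA_c (x y : ℝ) (l : ι) : star (frA A x y) * D.m3.c l = D.m3.c l * star (frA A x y) :=
  D.mem_m3_comm (fun i j l => by
    simp only [Matrix.star_apply, frA, Matrix.map_apply, star_algebraMap_real, Algebra.commutes]) l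

/-- The shear parameter. -/
def shp (R : A) : A := (1 / 2 : ℝ) • (R * D.e)

theorem star_shp {R : A} (hR : R ∈ D.S) : star (D.shp R) = (1 / 2 : ℝ) • (D.e * R) := by
  simp [shp, D.e_star, hR.1]

theorem shp_c {R : A} (hR : R ∈ D.S) (l : ι) : D.shp R * D.c l = D.c l * D.shp R := by
  rw [shp, smul_mul_assoc, D.mul_comm_c hR D.e_mem, mul_smul_comm]

theorem star_shp_c {R : A} (hR : R ∈ D.S) (l : ι) :
    star (D.shp R) * D.c l = D.c l * star (D.shp R) := by
  rw [D.star_shp hR, smul_mul_assoc, D.mul_comm_c D.e_mem hR, mul_smul_comm]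

/-- The symmetric linearization before normalization of the ends. -/
def lin (x y : ℝ) (p R : A) : M3 A :=
  !![p, y • D.e, y • D.e; y • D.e, x • D.e + R, -R; y • D.e, -R, -(x • D.e) + R]

theorem lin_mem {p R : A} (hp : p ∈ D.S) (hR : R ∈ D.S) (x y : ℝ) : D.lin x y p R ∈ D.m3.S := by
  have he := D.e_mem
  exact D.mem_m3_S hp (D.S.smul_mem _ he) (D.S.smul_mem _ he)
    (D.S.add_mem (D.S.smul_mem _ he) hR) (D.S.neg_mem hR)
    (D.S.add_mem (D.S.neg_mem (D.S.smul_mem _ he)) hR)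

/-- The normalizing matrix. -/
def nrm (R : A) : M3 A := D.V * sh (D.shp R)

theorem nrm_c {R : A} (hR : R ∈ D.S) (l : ι) : D.nrm R * D.m3.c l = D.m3.c l * D.nrm R := by
  rw [nrm, mul_assoc, D.sh_c (D.shp_c hR), ← mul_assoc, D.V_c, mul_assoc]

theorem star_nrm_c {R : A} (hR : R ∈ D.S) (l : ι) :
    star (D.nrm R) * D.m3.c l = D.m3.c l * star (D.nrm R) := by
  rw [nrm, star_mul, mul_assoc, D.star_V_c, ← mul_assoc, D.star_sh_c (D.star_shp_c hR), mul_assoc]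

theorem isUnit_nrm (R : A) : IsUnit (D.nrm R) := D.isUnit_V.mul (isUnit_sh _)

theorem conj_nrm_mem {R : A} (hR : R ∈ D.S) {M : M3 A} (hM : M ∈ D.m3.S) :
    D.nrm R * M * star (D.nrm R) ∈ D.m3.S :=
  D.m3.conj_mem hM (D.nrm_c hR) (D.star_nrm_c hR)

theorem conj_nrm_Y {R : A} (hR : R ∈ D.S) {M : M3 A} (hM : M ∈ D.m3.Y) :
    D.nrm R * M * star (D.nrm R) ∈ D.m3.Y :=
  D.m3.conj_Y hM (D.nrm_c hR) (D.star_nrm_c hR) (D.isUnit_nrm R)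

/-- Normalization makes the initial coefficient standard. -/
theorem nrm_conj {R : A} (hR : R ∈ D.S) :
    D.nrm R * D.lin 1 0 D.e R * star (D.nrm R) = D.m3.e := by
  have h1 : sh (D.shp R) * D.lin 1 0 D.e R * star (sh (D.shp R)) =
      !![D.e, 0, 0; 0, (1 : ℝ) • D.e, (0 : ℝ) • D.e; 0, (0 : ℝ) • D.e, -((1 : ℝ) • D.e)] := by
    have hh : ∀ z : A, R * (D.e * (D.e * z)) = - (R * z) := fun z => by rw [D.e_e]; simp
    rw [star_sh, D.star_shp hR, sh, lin, shp]
    simp only [Matrix.mul_fin_three]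
    ext i j
    fin_cases i <;> fin_cases j <;>
      simp [mul_add, add_mul, mul_assoc, D.e_sq, D.e_e, sub_mul, mul_sub] <;> module
  have h2 : D.nrm R * D.lin 1 0 D.e R * star (D.nrm R) =
      D.V * (sh (D.shp R) * D.lin 1 0 D.e R * star (sh (D.shp R))) * star D.V := by
    rw [nrm, star_mul]; simp only [mul_assoc]
  rw [h2, h1, V_conj]
  simp [m3]

theorem lin_neg (p R : A) : D.lin (-1) 0 (-p) (-R) = -D.lin 1 0 p R := by
  ext i j
  fin_cases i <;> fin_cases j <;> simp [lin]
  all_goals abel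

/-- The linearization in terms of a frame. -/
theorem frA_conj_interp {x y : ℝ} (h : x ^ 2 + y ^ 2 = 1) (t : ℝ) (p R : A) :
    star (frA A x y) * !![x ^ 2 • p + (4 * y ^ 2) • R,
        (t * (x * y / 2)) • (p - (4 : ℝ) • R), 0;
      (t * (x * y / 2)) • (p - (4 : ℝ) • R), t • ((y ^ 2 / 4) • p + x ^ 2 • R), D.e; 0, D.e, 0] *
      frA A x y =
    t • D.lin x y p R + (1 - t) • (star (frA A x y) *
      !![x ^ 2 • p + (4 * y ^ 2) • R, 0, 0; 0, 0, D.e; 0, D.e, 0] * frA A x y) := by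
  have e2 : (x ^ 2 + y ^ 2) ^ 2 = 1 := by rw [h]; ring
  rw [frA_conj, frA_conj]
  ext i j
  fin_cases i <;> fin_cases j <;> simp [lin, fr]
  all_goals match_scalars
  all_goals first
    | (field_simp; ring1)
    | linear_combination t * e2
    | linear_combination -t * e2

end BDat

/-- First reparametrization used to run two paths one after the other. -/
def wα (u s : I) : I := ⟨min 1 ((1 + u) * s), by
  have := u.2.1; have := s.2.1
  exact ⟨le_min zero_le_one (by positivity), min_le_left _ _⟩⟩
/-- Second reparametrization used to run two paths one after the other. -/
def wβ (u s : I) : I := ⟨max 0 ((1 + u) * s - u), by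
  have := u.2.1; have := s.2.2; have := u.2.2
  exact ⟨le_max_left _ _, max_le zero_le_one (by nlinarith)⟩⟩

@[fun_prop] theorem continuous_wα : Continuous fun p : I × I => wα p.1 p.2 := by
  unfold wα; fun_prop
@[fun_prop] theorem continuous_wβ : Continuous fun p : I × I => wβ p.1 p.2 := by
  unfold wβ; fun_prop
@[simp] theorem wα_zero_left (s : I) : wα 0 s = s := by
  ext; simp [wα, s.2.2]
@[simp] theorem wβ_zero_left (s : I) : wβ 0 s = s := by
  ext; simp [wβ, s.2.1]
@[simp] theorem wα_zero (u : I) : wα u 0 = 0 := by ext; simp [wα]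
@[simp] theorem wβ_zero (u : I) : wβ u 0 = 0 := by
  ext; simp [wβ, u.2.1]
@[simp] theorem wα_one (u : I) : wα u 1 = 1 := by
  ext; simp [wα, u.2.1]
@[simp] theorem wβ_one (u : I) : wβ u 1 = 1 := by ext; simp [wβ]
theorem wα_or_wβ (s : I) : wα 1 s = 1 ∨ wβ 1 s = 0 := by
  rcases le_total (1 : ℝ) ((1 + 1) * s) with h | h
  · left; ext; simp [wα, h]
  · right; ext; simp [wβ, h]

theorem sn_nonneg (s : I) : 0 ≤ sn s :=
  Real.sin_nonneg_of_nonneg_of_le_pi (mul_nonneg Real.pi_pos.le s.2.1)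
    (by nlinarith [s.2.2, Real.pi_pos])

/-- The real matrices interpolating between the two normal forms. -/
def nmat (t x y : ℝ) : M3 ℝ :=
  !![-1 + t * y ^ 2, t * (y + x * y / 2), t * (y - x * y / 2);
    t * (y + x * y / 2), x - t * y ^ 2 / 4, (1 - t) * y + t * y ^ 2 / 4;
    t * (y - x * y / 2), (1 - t) * y + t * y ^ 2 / 4, -x - t * y ^ 2 / 4]

theorem nmat_det {t x y : ℝ} (h : x ^ 2 + y ^ 2 = 1) (hy : 0 ≤ y) (ht : 0 ≤ t) (ht' : t ≤ 1) :
    0 < (nmat t x y).det := by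
  have e : (nmat t x y).det = (1 - t * y ^ 2) * (x ^ 2 + (1 - t) ^ 2 * y ^ 2 +
      (1 - t) * t * y ^ 3 / 2) + t ^ 2 * y ^ 2 * (2 * x ^ 2 + t * y ^ 2 +
      2 * (1 - t) * y * (1 - x ^ 2 / 4)) := by
    rw [nmat, Matrix.det_fin_three]
    simp
    ring
  have hy1 : y ^ 2 ≤ 1 := by nlinarith [sq_nonneg x]
  have hx1 : x ^ 2 ≤ 1 := by nlinarith [sq_nonneg y]
  have h1 : 0 ≤ 1 - t * y ^ 2 := by nlinarith [sq_nonneg y]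
  have h2 : 0 ≤ 1 - t := by linarith
  have h3 : 0 ≤ 1 - x ^ 2 / 4 := by linarith
  rw [e]
  by_cases hx : x = 0
  · have hy' : y = 1 := by subst hx; nlinarith
    subst hx hy'
    by_cases h0 : t = 0
    · subst h0; norm_num
    · have : 0 < t := lt_of_le_of_ne ht (Ne.symm h0)
      have : 0 < t ^ 2 * 1 ^ 2 * (2 * 0 ^ 2 + t * 1 ^ 2 + 2 * (1 - t) * 1 * (1 - 0 ^ 2 / 4)) := by
        have : 0 ≤ 2 * (1 - t) * 1 * (1 - 0 ^ 2 / 4) := by norm_num; linarith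
        have : 0 < 2 * 0 ^ 2 + t * 1 ^ 2 + 2 * (1 - t) * 1 * (1 - 0 ^ 2 / 4) := by
          norm_num; linarith
        positivity
      have : 0 ≤ (1 - t * 1 ^ 2) * (0 ^ 2 + (1 - t) ^ 2 * 1 ^ 2 + (1 - t) * t * 1 ^ 3 / 2) := by
        positivity
      linarith
  · have hx2 : 0 < x ^ 2 := by positivity
    by_cases h0 : t * y ^ 2 = 1
    · have : t = 1 := by nlinarith [sq_nonneg y]
      subst this
      have : y ^ 2 = 1 := by linarith
      nlinarith
    · have h4 : 0 < 1 - t * y ^ 2 := lt_of_le_of_ne h1 (by contrapose! h0; linarith)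
      positivity

namespace BDat

variable {ι A : Type*} [Ring A] [StarRing A] [Algebra ℝ A] [StarModule ℝ A] (D : BDat ι A)

/-- Families of paths in `Y` from `g` to `-g`. -/
def PathQ {X : Type*} (g : A) (F : X × I → A) : Prop :=
  ∀ x, F (x, 0) = g ∧ F (x, 1) = -g ∧ ∀ s, F (x, s) ∈ D.Y

theorem pen_mem (b : A) (hb : b ∈ D.S) (s : I) : D.pen b s ∈ D.S :=
  D.S.add_mem (D.S.smul_mem _ D.e_mem) (D.S.smul_mem _ hb)

/-- The block matrix `F p pᵀ + e (q nᵀ + n qᵀ)` for the frame `p, q, n`. -/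
def bas (F : A) (x y : ℝ) : M3 A :=
  star (frA A x y) * !![F, 0, 0; 0, 0, D.e; 0, D.e, 0] * frA A x y

theorem bas_mem {F : A} (hF : F ∈ D.S) (x y : ℝ) : D.bas F x y ∈ D.m3.S := by
  have := D.m3.conj_mem (u := star (frA A x y)) (a := !![F, 0, 0; 0, 0, D.e; 0, D.e, 0])
    (D.mem_m3_S hF D.S.zero_mem D.S.zero_mem D.S.zero_mem D.e_mem D.S.zero_mem)
    (D.star_frA_c x y) (by rw [star_star]; exact D.frA_c x y)
  rwa [star_star] at this

theorem bas_Y {F : A} (hF : F ∈ D.Y) {x y : ℝ} (h : x ^ 2 + y ^ 2 = 1) : D.bas F x y ∈ D.m3.Y :=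
  ⟨D.bas_mem hF.1 x y,
    ((isUnit_frA h).star.mul (isUnit_pattern D.e_sq hF.2)).mul (isUnit_frA h)⟩

/-- A simplified form of `bas`. -/
def leg (t x y : ℝ) (F : A) : M3 A :=
  !![F + (t * y ^ 2) • D.e, (t * (y + x * y / 2)) • D.e, (t * (y - x * y / 2)) • D.e;
    (t * (y + x * y / 2)) • D.e, (x - t * y ^ 2 / 4) • D.e, ((1 - t) * y + t * y ^ 2 / 4) • D.e;
    (t * (y - x * y / 2)) • D.e, ((1 - t) * y + t * y ^ 2 / 4) • D.e, (-x - t * y ^ 2 / 4) • D.e]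

theorem leg_mem {F : A} (hF : F ∈ D.S) (t x y : ℝ) : D.leg t x y F ∈ D.m3.S := by
  have h := fun r : ℝ => D.S.smul_mem r D.e_mem
  exact D.mem_m3_S (D.S.add_mem hF (h _)) (h _) (h _) (h _) (h _) (h _)

theorem leg_zero_eq (F : A) (x y : ℝ) : D.leg 0 x y F =
    !![F, 0, 0; 0, x • D.e, y • D.e; 0, y • D.e, -(x • D.e)] := by
  ext i j; fin_cases i <;> fin_cases j <;> simp [leg]

theorem leg_end (F : A) (t : ℝ) : D.leg t 1 0 F = dg F D.e (-D.e) := by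
  ext i j; fin_cases i <;> fin_cases j <;> simp [leg, dg]

theorem leg_end' (t : ℝ) : D.leg t (-1) 0 (-D.e) = -dg D.e D.e (-D.e) := by
  ext i j; fin_cases i <;> fin_cases j <;> simp [leg, dg]

theorem leg_neg_e (t x y : ℝ) : D.leg t x y (-D.e) =
    (nmat t x y).map (algebraMap ℝ A) * dg D.e D.e D.e := by
  ext i j
  fin_cases i <;> fin_cases j <;>
    simp [leg, dg, nmat, Matrix.mul_apply, Fin.sum_univ_three, ← Algebra.smul_def]
  all_goals simp only [add_smul, mul_smul, neg_smul]
  all_goals module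

theorem leg_Y {F : A} (hF : F ∈ D.Y) {t x y : ℝ} (ht : 0 ≤ t) (ht' : t ≤ 1)
    (h : (x = 1 ∧ y = 0) ∨ (F = -D.e ∧ x ^ 2 + y ^ 2 = 1 ∧ 0 ≤ y)) : D.leg t x y F ∈ D.m3.Y := by
  refine ⟨D.leg_mem hF.1 _ _ _, ?_⟩
  obtain ⟨rfl, rfl⟩ | ⟨rfl, h, hy⟩ := h
  · rw [leg_end]; exact isUnit_dg hF.2 D.e_unit D.e_unit.neg
  · rw [leg_neg_e]
    refine (isUnit_map_of_det _ _ ?_).mul (isUnit_dg D.e_unit D.e_unit D.e_unit)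
    exact (IsUnit.mk0 _ (nmat_det h hy ht ht').ne').map _

theorem bas_eq_leg (F : A) (x y : ℝ)
    (h : (x = 1 ∧ y = 0) ∨ (F = -D.e ∧ x ^ 2 + y ^ 2 = 1)) : D.bas F x y = D.leg 1 x y F := by
  rw [bas, frA_conj]
  obtain ⟨rfl, rfl⟩ | ⟨rfl, h⟩ := h
  · ext i j
    fin_cases i <;> fin_cases j <;> simp [leg, fr] <;> module
  · have h' : x ^ 2 = 1 - y ^ 2 := by linarith
    ext i j
    fin_cases i <;> fin_cases j <;> simp [leg, fr] <;> match_scalars <;>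
      first | (field_simp; ring1) | linear_combination -h

theorem leg_zero_unit {F : A} (hF : IsUnit F) {x y : ℝ} (h : x ^ 2 + y ^ 2 = 1) :
    IsUnit (D.leg 0 x y F) := by
  have e := D.V_conj F x y
  rw [← D.leg_zero_eq] at e
  have e2 : D.leg 0 x y F = star D.V *
      dg F (x • D.e + y • D.f) (x • D.e + y • D.f) * D.V := by
    rw [← e]
    simp only [← mul_assoc, D.V_unitary', one_mul]
    rw [mul_assoc, D.V_unitary', mul_one]
  have hu : IsUnit (x • D.e + y • D.f) := by
    refine isUnit_of_sq ?_
    simp only [add_mul, mul_add, smul_mul_assoc, mul_smul_comm, D.e_sq, D.f_sq, D.f_e]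
    have : (-1 : A) = -((x ^ 2 + y ^ 2) • (1 : A)) := by rw [h, one_smul]
    rw [this]
    match_scalars <;> first | ring1 | linear_combination (-(x ^ 2 + y ^ 2)) * h
  rw [e2]
  exact (D.isUnit_V.star.mul (isUnit_dg hF hu hu)).mul D.isUnit_V

variable [TopologicalSpace A] [IsTopologicalRing A] [ContinuousStar A] [ContinuousSMul ℝ A]
  {X : Type*} [TopologicalSpace X]

theorem continuous_frA {Z : Type*} [TopologicalSpace Z] {x y : Z → ℝ} (hx : Continuous x)
    (hy : Continuous y) : Continuous fun z => frA A (x z) (y z) := by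
  have hc : Continuous (algebraMap ℝ A) := continuous_algebraMap ℝ A
  refine Continuous.matrix_map (A := fun z => fr (x z) (y z)) ?_ hc
  unfold fr
  apply continuous_mat3 <;> fun_prop

theorem continuous_bas {Z : Type*} [TopologicalSpace Z] {x y : Z → ℝ} {F : Z → A}
    (hF : Continuous F) (hx : Continuous x)
    (hy : Continuous y) : Continuous fun z => D.bas (F z) (x z) (y z) := by
  have h := continuous_frA (A := A) hx hy
  have h2 : Continuous fun z => (!![F z, 0, 0; 0, 0, D.e; 0, D.e, 0] : M3 A) := by
    apply continuous_mat3 <;> fun_prop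
  unfold bas
  exact (h.star.mul h2).mul h

theorem continuous_leg {Z : Type*} [TopologicalSpace Z] {t x y : Z → ℝ} {F : Z → A}
    (ht : Continuous t) (hx : Continuous x)
    (hy : Continuous y) (hF : Continuous F) : Continuous fun z => D.leg (t z) (x z) (y z) (F z) := by
  unfold leg
  apply continuous_mat3 <;> fun_prop

theorem htp_V {F G : X × I → M3 A} (h : Htp (D.m3.PathQ (dg D.e D.e (-D.e))) F G) :
    Htp D.m3.PathP (fun z => D.V * F z * star D.V) (fun z => D.V * G z * star D.V) := by
  refine h.postcomp (fun a => D.V * a * star D.V) (by fun_prop) fun f _ hf x => ?_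
  have e := D.V_conj D.e 1 0
  have e2 : (!![D.e, 0, 0; 0, (1 : ℝ) • D.e, (0 : ℝ) • D.e; 0, (0 : ℝ) • D.e, -((1 : ℝ) • D.e)] :
      M3 A) = dg D.e D.e (-D.e) := by simp [dg]
  have e3 : D.V * dg D.e D.e (-D.e) * star D.V = D.m3.e := by
    rw [← e2, e]; simp [m3]
  obtain ⟨h0, h1, h2⟩ := hf x
  refine ⟨by rw [Function.comp_apply, h0, e3],
    by rw [Function.comp_apply, h1, mul_neg, neg_mul, e3], fun s => ?_⟩
  exact D.m3.conj_Y (h2 s) D.V_c D.star_V_c D.isUnit_V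

/-- Stabilization of families of paths. -/
def spath (F : X × I → A) (z : X × I) : M3 A := dg (F z) (D.pen D.f z.2) (D.pen D.f z.2)

theorem htp_bas {F : X × I → A} (hc : Continuous F) (hF : D.PathP F) :
    Htp D.m3.PathP (fun z => D.V * D.bas (F z) (cs z.2) (sn z.2) * star D.V) (D.spath F) := by
  have hend : ∀ x, D.leg 0 1 0 (F (x, 0)) = dg D.e D.e (-D.e) := fun x => by
    rw [leg_end, (hF x).1]
  have hend' : ∀ x, D.leg 0 (-1) 0 (F (x, 1)) = -dg D.e D.e (-D.e) := fun x => by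
    rw [(hF x).2.1, leg_end']
  have b0 : D.bas D.e 1 0 = dg D.e D.e (-D.e) := by
    rw [bas_eq_leg _ _ _ _ (Or.inl ⟨rfl, rfl⟩), leg_end]
  have b1 : D.bas (-D.e) (-1) 0 = -dg D.e D.e (-D.e) := by
    rw [bas_eq_leg _ _ _ _ (Or.inr ⟨rfl, by norm_num⟩), leg_end']
  have step1 : Htp (D.m3.PathQ (dg D.e D.e (-D.e)))
      (fun z : X × I => D.bas (F z) (cs z.2) (sn z.2))
      (fun z : X × I => D.bas (F (z.1, wα 1 z.2)) (cs (wβ 1 z.2)) (sn (wβ 1 z.2))) := by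
    refine ⟨fun u z => D.bas (F (z.1, wα u z.2)) (cs (wβ u z.2)) (sn (wβ u z.2)), ?_, ?_, rfl, ?_⟩
    · apply continuous_bas <;> fun_prop
    · ext z; simp
    · intro u x
      refine ⟨?_, ?_, fun s => D.bas_Y ((hF x).2.2 _) (cs_sn _)⟩
      · simp [(hF x).1, b0]
      · simp [(hF x).2.1, b1]
  have hh : ∀ s, (cs (wβ 1 s) = 1 ∧ sn (wβ 1 s) = 0) ∨ wα 1 s = 1 := fun s => by
    rcases wα_or_wβ s with h | h
    · exact Or.inr h
    · left; simp [h]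
  have step2 : Htp (D.m3.PathQ (dg D.e D.e (-D.e)))
      (fun z : X × I => D.bas (F (z.1, wα 1 z.2)) (cs (wβ 1 z.2)) (sn (wβ 1 z.2)))
      (fun z : X × I => D.leg 0 (cs (wβ 1 z.2)) (sn (wβ 1 z.2)) (F (z.1, wα 1 z.2))) := by
    refine Htp.symm ⟨fun t z => D.leg t (cs (wβ 1 z.2)) (sn (wβ 1 z.2)) (F (z.1, wα 1 z.2)),
      ?_, rfl, ?_, ?_⟩
    · apply continuous_leg <;> fun_prop
    · ext1 z
      refine (D.bas_eq_leg _ _ _ ?_).symm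
      rcases hh z.2 with h | h
      · exact Or.inl h
      · exact Or.inr ⟨by rw [h, (hF _).2.1], cs_sn _⟩
    · intro t x
      refine ⟨?_, ?_, fun s => D.leg_Y ((hF x).2.2 _) t.2.1 t.2.2 ?_⟩
      · simp [(hF x).1, leg_end]
      · simp [(hF x).2.1, leg_end']
      · rcases hh s with h | h
        · exact Or.inl h
        · exact Or.inr ⟨by rw [h, (hF x).2.1], cs_sn _, sn_nonneg _⟩
  have step3 : Htp (D.m3.PathQ (dg D.e D.e (-D.e)))
      (fun z : X × I => D.leg 0 (cs (wβ 1 z.2)) (sn (wβ 1 z.2)) (F (z.1, wα 1 z.2)))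
      (fun z : X × I => D.leg 0 (cs z.2) (sn z.2) (F z)) := by
    refine Htp.symm ⟨fun u z => D.leg 0 (cs (wβ u z.2)) (sn (wβ u z.2)) (F (z.1, wα u z.2)),
      ?_, ?_, rfl, ?_⟩
    · apply continuous_leg <;> fun_prop
    · ext z; simp
    · intro u x
      refine ⟨by simpa using hend x, by simpa using hend' x, fun s =>
        ⟨D.leg_mem ((hF x).2.2 _).1 _ _ _, D.leg_zero_unit ((hF x).2.2 _).2 (cs_sn _)⟩⟩
  have := D.htp_V (step1.trans (step2.trans step3))
  convert this using 2 with z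
  rw [leg_zero_eq, V_conj]
  rfl

/-- Undoing the linearization. -/
theorem htp_lin {p R : X × I → A} (hp : Continuous p) (hR : Continuous R) (hpS : ∀ z, p z ∈ D.S)
    (hRS : ∀ z, R z ∈ D.S) (hp0 : ∀ x, p (x, 0) = D.e) (hp1 : ∀ x, p (x, 1) = -D.e)
    (hR1 : ∀ x, R (x, 1) = -R (x, 0))
    (hu : ∀ z, IsUnit (cs z.2 ^ 2 • p z + (4 * sn z.2 ^ 2) • R z)) :
    Htp D.m3.PathP
      (fun z => D.nrm (R (z.1, 0)) * D.lin (cs z.2) (sn z.2) (p z) (R z) *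
        star (D.nrm (R (z.1, 0))))
      (D.spath fun z => cs z.2 ^ 2 • p z + (4 * sn z.2 ^ 2) • R z) := by
  have hPS : ∀ z : X × I, cs z.2 ^ 2 • p z + (4 * sn z.2 ^ 2) • R z ∈ D.S := fun z =>
    D.S.add_mem (D.S.smul_mem _ (hpS z)) (D.S.smul_mem _ (hRS z))
  have hb : ∀ q : A, ∀ t : ℝ, t • D.lin 1 0 D.e q + (1 - t) • D.bas D.e 1 0 =
      D.lin 1 0 D.e (t • q) := fun q t => by
    rw [bas_eq_leg _ _ _ _ (Or.inl ⟨rfl, rfl⟩), leg_end]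
    ext i j; fin_cases i <;> fin_cases j <;> simp [lin, dg] <;> module
  have hb' : ∀ q : A, ∀ t : ℝ, t • D.lin (-1) 0 (-D.e) (-q) + (1 - t) • D.bas (-D.e) (-1) 0 =
      -D.lin 1 0 D.e (t • q) := fun q t => by
    rw [bas_eq_leg _ _ _ _ (Or.inr ⟨rfl, by norm_num⟩), leg_end', lin_neg, ← hb,
      bas_eq_leg _ _ _ _ (Or.inl ⟨rfl, rfl⟩), leg_end]
    module
  have hc : Continuous fun z : X × I => cs z.2 ^ 2 • p z + (4 * sn z.2 ^ 2) • R z := by fun_prop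
  refine Htp.trans (G := fun z => D.V * D.bas (cs z.2 ^ 2 • p z + (4 * sn z.2 ^ 2) • R z)
      (cs z.2) (sn z.2) * star D.V) (Htp.symm ⟨fun t z => D.nrm ((t : ℝ) • R (z.1, 0)) *
        ((t : ℝ) • D.lin (cs z.2) (sn z.2) (p z) (R z) + (1 - t : ℝ) •
          D.bas (cs z.2 ^ 2 • p z + (4 * sn z.2 ^ 2) • R z) (cs z.2) (sn z.2)) *
        star (D.nrm ((t : ℝ) • R (z.1, 0))), ?_, ?_, ?_, ?_⟩) (D.htp_bas hc ?_)
  · have h1 : Continuous fun q : I × X × I => D.bas (cs q.2.2 ^ 2 • p q.2 + (4 * sn q.2.2 ^ 2) •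
        R q.2) (cs q.2.2) (sn q.2.2) := by apply continuous_bas <;> fun_prop
    have h2 : Continuous fun q : I × X × I => D.lin (cs q.2.2) (sn q.2.2) (p q.2) (R q.2) := by
      unfold lin; apply continuous_mat3 <;> fun_prop
    have h3 : Continuous fun q : I × X × I => D.nrm ((q.1 : ℝ) • R (q.2.1, 0)) := by
      unfold nrm sh shp
      refine continuous_const.mul ?_
      apply continuous_mat3 <;> fun_prop
    exact (h3.mul (((continuous_subtype_val.comp continuous_fst).smul h2).add
      ((continuous_const.sub (continuous_subtype_val.comp continuous_fst)).smul h1))).mul h3.star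
  · ext1 z; simp [nrm, sh_zero, shp]
  · ext1 z; simp
  · intro t x
    have hSt : (t : ℝ) • R (x, 0) ∈ D.S := D.S.smul_mem _ (hRS _)
    refine ⟨?_, ?_, fun s => D.conj_nrm_Y hSt ⟨D.m3.S.add_mem (D.m3.S.smul_mem _
      (D.lin_mem (hpS _) (hRS _) _ _)) (D.m3.S.smul_mem _ (D.bas_mem (hPS _) _ _)), ?_⟩⟩
    · have := hb (R (x, 0)) t
      simp only [cs_zero, sn_zero, hp0]
      simp only [one_pow, one_smul, ne_eq, OfNat.ofNat_ne_zero, not_false_eq_true, zero_pow,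
        mul_zero, zero_smul, add_zero]
      rw [this, D.nrm_conj hSt]
    · have := hb' (R (x, 0)) t
      simp only [cs_one, sn_one, hp1, hR1]
      simp only [neg_sq, one_pow, one_smul, ne_eq, OfNat.ofNat_ne_zero, not_false_eq_true, zero_pow,
        mul_zero, zero_smul, add_zero]
      rw [this, mul_neg, neg_mul, D.nrm_conj hSt]
    · have := D.frA_conj_interp (cs_sn s) t (p (x, s)) (R (x, s))
      rw [bas, ← this]
      exact ((isUnit_frA (cs_sn s)).star.mul (isUnit_pattern D.e_sq (hu (x, s)))).mul
        (isUnit_frA (cs_sn s))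
  · exact fun x => ⟨by simp [hp0], by simp [hp1], fun s => ⟨hPS _, hu _⟩⟩

end BDat

namespace BDat

variable {ι A : Type*} [Ring A] [StarRing A] [Algebra ℝ A] [StarModule ℝ A] (D : BDat ι A)

/-- Elements whose pencil with `e` is invertible. -/
def Zs : Set A := {b | b ∈ D.S ∧ ∀ s, IsUnit (D.pen b s)}

theorem isUnit_comb (hpos : ∀ a : A, IsUnit (1 + star a * a)) {b : A} (hb : b ∈ D.Yp) {r t : ℝ}
    (h : r ≠ 0 ∨ t ≠ 0) : IsUnit (r • D.e + t • b) := by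
  by_cases hr : r = 0
  · have ht : t ≠ 0 := by tauto
    rw [hr, zero_smul, zero_add]
    exact hb.1.2.smul (Units.mk0 t ht)
  · have h2 : (r • D.e + t • b) * (r • D.e + t • b) =
        (-(r ^ 2)) • (1 + star ((t / r) • b) * ((t / r) • b)) := by
      rw [star_smul, hb.1.1.1]
      simp only [add_mul, mul_add, smul_mul_assoc, mul_smul_comm, D.e_sq, hb.2]
      simp only [star_trivial, smul_neg, neg_mul, smul_add, smul_smul]
      match_scalars <;> field_simp <;> ring
    have h3 : IsUnit ((r • D.e + t • b) * (r • D.e + t • b)) := by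
      rw [h2]; exact (hpos _).smul (Units.mk0 (-(r ^ 2)) (by simpa using hr))
    exact (Commute.isUnit_mul_iff (Commute.refl _)).1 h3 |>.1

theorem isUnit_pen (hpos : ∀ a : A, IsUnit (1 + star a * a)) {b : A} (hb : b ∈ D.Yp) (s : I) :
    IsUnit (D.pen b s) := by
  refine D.isUnit_comb hpos hb ?_
  by_contra! h
  have := cs_sn s
  rw [h.1, h.2] at this
  norm_num at this

theorem Yp_sub_Zs (hpos : ∀ a : A, IsUnit (1 + star a * a)) : D.Yp ⊆ D.Zs := fun _ hb =>
  ⟨hb.1.1, fun s => D.isUnit_pen hpos hb s⟩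

/-- Second coefficient of a linear path between two normal forms. -/
def mid (s : ℝ) (b : A) : M3 A :=
  !![s ^ 2 • b, (1 - s) • D.e - (s * (1 - s) / 2) • b, (1 - s) • D.e + (s * (1 - s) / 2) • b;
    (1 - s) • D.e - (s * (1 - s) / 2) • b, ((1 - s) ^ 2 / 4) • b,
      s • D.e - ((1 - s) ^ 2 / 4) • b;
    (1 - s) • D.e + (s * (1 - s) / 2) • b, s • D.e - ((1 - s) ^ 2 / 4) • b,
      ((1 - s) ^ 2 / 4) • b]

theorem mid_mem {b : A} (hb : b ∈ D.S) (s : ℝ) : D.mid s b ∈ D.m3.S := by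
  have h := fun r : ℝ => D.S.smul_mem r D.e_mem
  have h' := fun r : ℝ => D.S.smul_mem r hb
  exact D.mem_m3_S (h' _) (D.S.sub_mem (h _) (h' _)) (D.S.add_mem (h _) (h' _)) (h' _)
    (D.S.sub_mem (h _) (h' _)) (h' _)

open Polynomial in
theorem isUnit_mid (hpos : ∀ a : A, IsUnit (1 + star a * a)) {b : A} (hb : b ∈ D.Yp) (s t : I) :
    IsUnit (cs t • dg D.e D.e (-D.e) + sn t • D.mid s b) := by
  have hxy := cs_sn t
  generalize cs t = x at *
  generalize sn t = y at *
  obtain ⟨s, hs0, hs1⟩ := s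
  dsimp only
  obtain ⟨r, rfl⟩ : ∃ r, s = 1 - r := ⟨1 - s, by ring⟩
  set K : A := -(D.e * b) with hK
  have heK : D.e * K = b := by rw [hK, mul_neg, D.e_e, neg_neg]
  let P : ℝ → ℝ → ℝ[X] := fun p q => C p + C q * X
  have hP : ∀ p q, aeval K (P p q) = p • 1 + q • K := fun p q => by
    simp [P, Algebra.algebraMap_eq_smul_one]
  let N : M3 ℝ[X] := !![P x (y * (1 - r) ^ 2), P (y * r) (-(y * ((1 - r) * r / 2))),
      P (y * r) (y * ((1 - r) * r / 2));
    P (y * r) (-(y * ((1 - r) * r / 2))), P x (y * (r ^ 2 / 4)),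
      P (y * (1 - r)) (-(y * (r ^ 2 / 4)));
    P (y * r) (y * ((1 - r) * r / 2)), P (y * (1 - r)) (-(y * (r ^ 2 / 4))),
      P (-x) (y * (r ^ 2 / 4))]
  have hN : x • dg D.e D.e (-D.e) + y • D.mid (1 - r) b =
      dg D.e D.e D.e * N.map (aeval K).toRingHom := by
    clear_value P
    ext i j
    fin_cases i <;> fin_cases j <;>
      simp [mid, dg, N, Matrix.mul_apply, Fin.sum_univ_three, mul_add, hP, heK] <;> module
  rw [hN]
  refine (isUnit_dg D.e_unit D.e_unit D.e_unit).mul (isUnit_map_of_det _ _ ?_)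
  set α := -x ^ 3 - (1 - r) ^ 2 * x * y ^ 2 + 2 * (1 - r) * r ^ 2 * y ^ 3 with hα
  set β := y * (-(1 - r) ^ 2 * x ^ 2 - ((1 - r) ^ 4 + r ^ 4) * y ^ 2 -
    3 / 2 * (1 - r) * r ^ 2 * x * y) with hβ
  have hdet : N.det = C α + C β * X := by
    refine Polynomial.funext fun z => ?_
    rw [Matrix.det_fin_three]
    simp only [N, P, hα, hβ, Matrix.of_apply, Matrix.cons_val', Matrix.cons_val_zero,
      Matrix.cons_val_one, Matrix.cons_val, eval_add, eval_sub, eval_mul, eval_C, eval_X]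
    ring
  rw [hdet]
  have : ((aeval K).toRingHom : ℝ[X] →+* A) (C α + C β * X) = -(D.e * (α • D.e + β • b)) := by
    simp [mul_add, D.e_sq, ← heK, Algebra.algebraMap_eq_smul_one, D.e_e, add_comm]
  rw [this]
  refine (D.e_unit.mul (D.isUnit_comb hpos hb ?_)).neg
  by_contra! h
  have hy : y = 0 := by
    by_contra hy
    have hq := (mul_eq_zero.1 h.2).resolve_left hy
    by_cases h1 : 1 - r = 0
    · have : r = 1 := by linarith
      subst this
      norm_num at hq
      exact hy hq
    · have : 0 < (1 - r) ^ 4 * y ^ 2 := by positivity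
      nlinarith [sq_nonneg ((1 - r) * x + 3 / 4 * r ^ 2 * y), sq_nonneg (r ^ 2 * y)]
  rw [hα, hy] at h
  have hx : x = 0 := by simpa using h.1
  rw [hx, hy] at hxy
  norm_num at hxy

theorem V_conj_e : D.V * dg D.e D.e (-D.e) * star D.V = D.m3.e := by
  have e := D.V_conj D.e 1 0
  have e2 : (!![D.e, 0, 0; 0, (1 : ℝ) • D.e, (0 : ℝ) • D.e; 0, (0 : ℝ) • D.e, -((1 : ℝ) • D.e)] :
      M3 A) = dg D.e D.e (-D.e) := by simp [dg]
  rw [← e2, e]; simp [m3]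

theorem pen_V_conj (M : M3 A) (s : I) : D.m3.pen (D.V * M * star D.V) s =
    D.V * (cs s • dg D.e D.e (-D.e) + sn s • M) * star D.V := by
  rw [pen, ← V_conj_e]
  simp [mul_add, add_mul]

theorem lin_lin (x y : ℝ) (pa pb Ra Rb : A) : D.lin x y (x • pa + y • pb) (x • Ra + y • Rb) =
    x • D.lin 1 0 pa Ra + y • D.lin 0 1 pb Rb := by
  ext i j; fin_cases i <;> fin_cases j <;> simp [lin] <;> module

theorem pen_nrm_conj {R : A} (hR : R ∈ D.S) (M : M3 A) (s : I) :
    D.m3.pen (D.nrm R * M * star (D.nrm R)) s =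
    D.nrm R * (cs s • D.lin 1 0 D.e R + sn s • M) * star (D.nrm R) := by
  rw [pen, ← D.nrm_conj hR]
  simp [mul_add, add_mul]

/-- The second coefficient of the linearization of a linear pencil. -/
def lam (b : A) : M3 A := D.nrm ((1 / 4 : ℝ) • D.e) * D.lin 0 1 b ((1 / 4 : ℝ) • b) *
  star (D.nrm ((1 / 4 : ℝ) • D.e))

variable [TopologicalSpace A] [IsTopologicalRing A] [ContinuousStar A] [ContinuousSMul ℝ A]
  {X : Type*} [TopologicalSpace X]

theorem continuous_nrm {Z : Type*} [TopologicalSpace Z] {R : Z → A} (h : Continuous R) :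
    Continuous fun z => D.nrm (R z) := by
  unfold nrm sh shp
  refine continuous_const.mul ?_
  apply continuous_mat3 <;> fun_prop

theorem continuous_lin {Z : Type*} [TopologicalSpace Z] {x y : Z → ℝ} {p R : Z → A}
    (hx : Continuous x) (hy : Continuous y) (hp : Continuous p) (hR : Continuous R) :
    Continuous fun z => D.lin (x z) (y z) (p z) (R z) := by
  unfold lin; apply continuous_mat3 <;> fun_prop

theorem htp_lam (hpos : ∀ a : A, IsUnit (1 + star a * a)) {b : X → A} (hc : Continuous b)
    (hb : ∀ x, b x ∈ D.Yp) :
    FHtp D.m3.Zs (fun x => D.lam (b x)) (fun x => dg (b x) D.f D.f) := by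
  have hS := fun r : ℝ => D.S.smul_mem r D.e_mem
  refine Htp.trans (G := fun x => D.V * D.mid 0 (b x) * star D.V) ?_ ?_
  · refine ⟨fun u x => D.nrm (((1 - u) / 4 : ℝ) • D.e) * D.lin 0 1 ((1 - u : ℝ) • b x)
      ((1 / 4 : ℝ) • b x) * star (D.nrm (((1 - u) / 4 : ℝ) • D.e)), ?_, ?_, ?_, ?_⟩
    · have h1 : Continuous fun p : I × X => D.nrm (((1 - p.1) / 4 : ℝ) • D.e) :=
        D.continuous_nrm (by fun_prop)
      have h2 : Continuous fun p : I × X => D.lin 0 1 ((1 - p.1 : ℝ) • b p.2)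
        ((1 / 4 : ℝ) • b p.2) := by apply continuous_lin <;> fun_prop
      exact (h1.mul h2).mul h1.star
    · ext1 x; simp [lam]
    · ext1 x
      have : D.nrm (0 : A) = D.V := by simp [nrm, shp, sh_zero]
      simp only [Set.Icc.coe_one, sub_self, zero_div, zero_smul, this]
      congr 2
      ext i j; fin_cases i <;> fin_cases j <;> simp [lin, mid]
    · intro u x
      have hbS := (hb x).1.1
      refine ⟨D.conj_nrm_mem (hS _) (D.lin_mem (D.S.smul_mem _ hbS) (D.S.smul_mem _ hbS) _ _),
        fun s => ?_⟩
      rw [D.pen_nrm_conj (hS _), ← lin_lin]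
      refine ((D.isUnit_nrm _).mul ?_).mul (D.isUnit_nrm _).star
      have h := D.frA_conj_interp (cs_sn s) 1 (cs s • D.e + sn s • (1 - u : ℝ) • b x)
        (cs s • ((1 - u : ℝ) / 4) • D.e + sn s • (1 / 4 : ℝ) • b x)
      rw [sub_self, zero_smul, add_zero, one_smul ℝ (D.lin _ _ _ _)] at h
      rw [← h]
      refine ((isUnit_frA (cs_sn s)).star.mul (isUnit_pattern D.e_sq ?_)).mul
        (isUnit_frA (cs_sn s))
      have e : cs s ^ 2 • (cs s • D.e + sn s • (1 - u : ℝ) • b x) + (4 * sn s ^ 2) •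
          (cs s • ((1 - u : ℝ) / 4) • D.e + sn s • (1 / 4 : ℝ) • b x) =
          (cs s * (cs s ^ 2 + (1 - u) * sn s ^ 2)) • D.e +
            (sn s * ((1 - u) * cs s ^ 2 + sn s ^ 2)) • b x := by
        simp only [smul_add, smul_smul]
        match_scalars <;> ring
      rw [e]
      refine D.isUnit_comb hpos (hb x) ?_
      have hu : (0 : ℝ) ≤ 1 - u := by linarith [u.2.2]
      have hxy := cs_sn s
      generalize cs s = x at *
      generalize sn s = y at *
      by_cases hx : x = 0
      · right
        have hy : y ≠ 0 := by rintro rfl; rw [hx] at hxy; norm_num at hxy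
        positivity
      · left; positivity
  · have hm : Continuous fun p : I × X => D.mid p.1 (b p.2) := by
      unfold mid; apply continuous_mat3 <;> fun_prop
    have hV : Continuous fun _ : I × X => D.V := continuous_const
    refine ⟨fun s x => D.V * D.mid s (b x) * star D.V, (hV.mul hm).mul hV.star, ?_, ?_, ?_⟩
    · simp
    · ext1 x
      have h := D.V_conj (b x) 0 1
      simp only [zero_smul, neg_zero, one_smul, zero_add] at h
      have h2 : D.mid ((1 : I) : ℝ) (b x) = !![b x, 0, 0; 0, 0, D.e; 0, D.e, 0] := by
        ext i j; fin_cases i <;> fin_cases j <;> simp [mid]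
      beta_reduce
      rw [h2, h]
    · intro s x
      refine ⟨D.m3.conj_mem (D.mid_mem (hb x).1.1 _) D.V_c D.star_V_c, fun t => ?_⟩
      rw [pen_V_conj]
      exact (D.isUnit_V.mul (D.isUnit_mid hpos (hb x) s t)).mul D.isUnit_V.star

end BDat

namespace BDat

variable {ι A : Type*} [Ring A] [StarRing A] [Algebra ℝ A] [StarModule ℝ A] (D : BDat ι A)

/-- The path `∑ y ^ (2 * k) (x a_k + y b_k)` with coefficients `c k = (a_k, b_k)`. -/
def pev (m : ℕ) (c : ℕ → A × A) (s : I) : A :=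
  ∑ k ∈ Finset.range (m + 1), sn s ^ (2 * k) • (cs s • (c k).1 + sn s • (c k).2)

/-- Coefficients of polynomial paths of units starting at `e`. -/
def PolySet (m : ℕ) : Set (ℕ → A × A) :=
  {c | (c 0).1 = D.e ∧ (∀ k, (c k).1 ∈ D.S ∧ (c k).2 ∈ D.S) ∧ ∀ s, IsUnit (pev m c s)}

/-- Coefficients of a linear pencil. -/
def stdc (b : A) : ℕ → A × A := fun k => if k = 0 then (D.e, b) else 0

theorem pev_stdc (m : ℕ) (b : A) (s : I) : pev m (D.stdc b) s = D.pen b s := by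
  rw [pev, Finset.sum_range_succ']
  simp [stdc, pen]

theorem pev_zero (c : ℕ → A × A) (s : I) : pev 0 c s = cs s • (c 0).1 + sn s • (c 0).2 := by
  simp [pev]

theorem isUnit_lin {x y : ℝ} (hxy : x ^ 2 + y ^ 2 = 1) {p R : A}
    (h : IsUnit (x ^ 2 • p + (4 * y ^ 2) • R)) : IsUnit (D.lin x y p R) := by
  have h2 := D.frA_conj_interp hxy 1 p R
  rw [sub_self, zero_smul, add_zero, one_smul ℝ (D.lin _ _ _ _)] at h2
  rw [← h2]
  exact ((isUnit_frA hxy).star.mul (isUnit_pattern D.e_sq h)).mul (isUnit_frA hxy)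

/-- The rank one block. -/
def mm (a : A) : M3 A := !![0, 0, 0; 0, a, -a; 0, -a, a]

theorem lin_add_mm (x y : ℝ) (p R a : A) : D.lin x y p (R + a) = D.lin x y p R + mm a := by
  ext i j; fin_cases i <;> fin_cases j <;> simp [lin, mm] <;> abel

/-- The mean of the two lowest first coefficients. -/
def lamR (c : ℕ → A × A) : A := (1 / 4 : ℝ) • (D.e + (c 1).1)

/-- Linearization of coefficients. -/
def Lam (c : ℕ → A × A) : ℕ → M3 A × M3 A := fun k =>
  if k = 0 then (D.nrm (D.lamR c) * D.lin 1 0 D.e (D.lamR c) * star (D.nrm (D.lamR c)),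
    D.nrm (D.lamR c) * D.lin 0 1 (c 0).2 ((1 / 4 : ℝ) • ((c 0).2 + (c 1).2)) *
      star (D.nrm (D.lamR c)))
  else (D.nrm (D.lamR c) * mm ((1 / 4 : ℝ) • (c (k + 1)).1) * star (D.nrm (D.lamR c)),
    D.nrm (D.lamR c) * mm ((1 / 4 : ℝ) • (c (k + 1)).2) * star (D.nrm (D.lamR c)))

theorem Lam_stdc (b : A) : D.Lam (D.stdc b) = D.m3.stdc (D.lam b) := by
  have hm : mm (0 : A) = 0 := by ext i j; fin_cases i <;> fin_cases j <;> simp [mm]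
  have hR : D.lamR (D.stdc b) = (1 / 4 : ℝ) • D.e := by simp [lamR, stdc]
  ext1 k
  by_cases hk : k = 0
  · subst hk
    simp only [Lam, hR, if_true, D.nrm_conj (D.S.smul_mem (1 / 4 : ℝ) D.e_mem)]
    simp [stdc, lam]
  · simp [Lam, stdc, hk, hm]

/-- The auxiliary path `(p₀ + P') / 4`. -/
def lamRR (m : ℕ) (c : ℕ → A × A) (s : I) : A :=
  (1 / 4 : ℝ) • (cs s • D.e + sn s • (c 0).2) + (1 / 4 : ℝ) • pev m (fun k => c (k + 1)) s

theorem pev_succ {c : ℕ → A × A} (h : (c 0).1 = D.e) (m : ℕ) (s : I) :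
    pev (m + 1) c s = cs s ^ 2 • (cs s • D.e + sn s • (c 0).2) +
      (4 * sn s ^ 2) • D.lamRR m c s := by
  have hx : cs s ^ 2 = 1 - sn s ^ 2 := by linarith [cs_sn s]
  have hsum : ∑ k ∈ Finset.range (m + 1),
      sn s ^ (2 * (k + 1)) • (cs s • (c (k + 1)).1 + sn s • (c (k + 1)).2) =
      sn s ^ 2 • pev m (fun k => c (k + 1)) s := by
    rw [pev, Finset.smul_sum]
    exact Finset.sum_congr rfl fun k _ => by rw [smul_smul]; ring_nf
  rw [pev, Finset.sum_range_succ', hsum, lamRR, hx, h]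
  generalize pev m (fun k => c (k + 1)) s = q
  simp only [mul_zero, pow_zero]
  match_scalars <;> ring

theorem pev_Lam (m : ℕ) (c : ℕ → A × A) (s : I) : pev m (D.Lam c) s =
    D.nrm (D.lamR c) * D.lin (cs s) (sn s) (cs s • D.e + sn s • (c 0).2) (D.lamRR m c s) *
      star (D.nrm (D.lamR c)) := by
  set N := D.nrm (D.lamR c) with hN
  have h1 : D.lamRR m c s = (cs s • D.lamR c + sn s • (1 / 4 : ℝ) • ((c 0).2 + (c 1).2)) +
      ∑ k ∈ Finset.range m, sn s ^ (2 * (k + 1)) • (cs s • (1 / 4 : ℝ) • (c (k + 2)).1 +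
        sn s • (1 / 4 : ℝ) • (c (k + 2)).2) := by
    rw [lamRR, lamR, pev, Finset.sum_range_succ', smul_add _ (∑ k ∈ _, _), Finset.smul_sum]
    have : ∀ k ∈ Finset.range m, (1 / 4 : ℝ) • sn s ^ (2 * (k + 1)) •
        (cs s • (c (k + 1 + 1)).1 + sn s • (c (k + 1 + 1)).2) =
        sn s ^ (2 * (k + 1)) • (cs s • (1 / 4 : ℝ) • (c (k + 2)).1 +
        sn s • (1 / 4 : ℝ) • (c (k + 2)).2) := fun k _ => by
      match_scalars <;> ring
    rw [Finset.sum_congr rfl this]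
    generalize (∑ k ∈ Finset.range m, sn s ^ (2 * (k + 1)) •
      (cs s • (1 / 4 : ℝ) • (c (k + 2)).1 + sn s • (1 / 4 : ℝ) • (c (k + 2)).2)) = q
    simp only [mul_zero, pow_zero, zero_add]
    match_scalars <;> ring
  have h2 : ∀ (x : A) (n : ℕ) (f : ℕ → ℝ) (g : ℕ → A),
      D.lin (cs s) (sn s) (cs s • D.e + sn s • (c 0).2) (x + ∑ k ∈ Finset.range n, f k • g k) =
      D.lin (cs s) (sn s) (cs s • D.e + sn s • (c 0).2) x +
        ∑ k ∈ Finset.range n, f k • mm (g k) := fun x n f g => by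
    induction n with
    | zero => simp
    | succ n ih =>
      have h0 : mm (f n • g n) = f n • mm (g n) := by
        ext i j; fin_cases i <;> fin_cases j <;> simp [mm]
      rw [Finset.sum_range_succ, ← add_assoc, lin_add_mm, ih, Finset.sum_range_succ, h0, add_assoc]
  have h3 : ∀ a b : A, mm (cs s • a + sn s • b) = cs s • mm a + sn s • mm b := fun a b => by
    ext i j; fin_cases i <;> fin_cases j <;> simp [mm] <;> abel
  rw [h1, h2, pev, Finset.sum_range_succ', lin_lin]
  simp only [h3, mul_add, add_mul, Finset.mul_sum, Finset.sum_mul, mul_smul_comm, smul_mul_assoc]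
  rw [add_comm]
  congr 1
  · simp [Lam, hN]

theorem mm_mem {a : A} (h : a ∈ D.S) : mm a ∈ D.m3.S :=
  D.mem_m3_S D.S.zero_mem D.S.zero_mem D.S.zero_mem h (D.S.neg_mem h) h

theorem lamR_mem {m : ℕ} {c : ℕ → A × A} (hc : c ∈ D.PolySet m) : D.lamR c ∈ D.S :=
  D.S.smul_mem _ (D.S.add_mem D.e_mem (hc.2.1 1).1)

theorem Lam_mem {m : ℕ} {c : ℕ → A × A} (hc : c ∈ D.PolySet (m + 1)) :
    D.Lam c ∈ D.m3.PolySet m := by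
  have hR := D.lamR_mem hc
  have hS := fun r : ℝ => fun {a : A} (h : a ∈ D.S) => D.S.smul_mem r h
  obtain ⟨h0, hcS, hu⟩ := hc
  refine ⟨?_, fun k => ?_, fun s => ?_⟩
  · simp [Lam, D.nrm_conj hR]
  · by_cases hk : k = 0
    · simp only [Lam, hk, if_true]
      exact ⟨D.conj_nrm_mem hR (D.lin_mem D.e_mem hR _ _), D.conj_nrm_mem hR
        (D.lin_mem (hcS 0).2 (hS _ (D.S.add_mem (hcS 0).2 (hcS 1).2)) _ _)⟩
    · simp only [Lam, hk, if_false]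
      exact ⟨D.conj_nrm_mem hR (D.mm_mem (hS _ (hcS _).1)),
        D.conj_nrm_mem hR (D.mm_mem (hS _ (hcS _).2))⟩
  · rw [pev_Lam]
    refine ((D.isUnit_nrm _).mul (D.isUnit_lin (cs_sn s) ?_)).mul (D.isUnit_nrm _).star
    rw [← D.pev_succ h0]
    exact hu s

theorem pev_mem {m : ℕ} {c : ℕ → A × A} (hc : ∀ k, (c k).1 ∈ D.S ∧ (c k).2 ∈ D.S) (s : I) :
    pev m c s ∈ D.S :=
  D.S.sum_mem fun k _ => D.S.smul_mem _ (D.S.add_mem (D.S.smul_mem _ (hc k).1)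
    (D.S.smul_mem _ (hc k).2))

variable [TopologicalSpace A] [IsTopologicalRing A] [ContinuousStar A] [ContinuousSMul ℝ A]
  {X : Type*} [TopologicalSpace X]

theorem continuous_pev (m : ℕ) {c : X → ℕ → A × A} (hc : Continuous c) :
    Continuous fun z : X × I => pev m (c z.1) z.2 := by
  unfold pev; fun_prop

theorem continuous_Lam : Continuous D.Lam := by
  have hR : Continuous D.lamR := by unfold lamR; fun_prop
  have hN := D.continuous_nrm hR
  have hmm : ∀ f : (ℕ → A × A) → A, Continuous f → Continuous fun c => mm (f c) := fun f hf => by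
    unfold mm; apply continuous_mat3 <;> fun_prop
  refine continuous_pi fun k => ?_
  by_cases hk : k = 0
  · simp only [Lam, hk, if_true]
    refine Continuous.prodMk ((hN.mul ?_).mul hN.star) ((hN.mul ?_).mul hN.star)
    · apply continuous_lin <;> fun_prop
    · apply continuous_lin <;> fun_prop
  · simp only [Lam, hk, if_false]
    exact Continuous.prodMk ((hN.mul (hmm _ (by fun_prop))).mul hN.star)
      ((hN.mul (hmm _ (by fun_prop))).mul hN.star)

theorem htp_pev_Lam {m : ℕ} {c : X → ℕ → A × A} (hc : Continuous c)
    (hP : ∀ x, c x ∈ D.PolySet (m + 1)) :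
    Htp D.m3.PathP (fun z : X × I => pev m (D.Lam (c z.1)) z.2)
      (D.spath fun z => pev (m + 1) (c z.1) z.2) := by
  have hRc : Continuous fun z : X × I => D.lamRR m (c z.1) z.2 := by
    unfold lamRR
    have := continuous_pev m (c := fun x k => c x (k + 1)) (by fun_prop)
    fun_prop
  have hS := fun r : ℝ => fun {a : A} (h : a ∈ D.S) => D.S.smul_mem r h
  have h0 : ∀ x, D.lamRR m (c x) 0 = D.lamR (c x) := fun x => by
    rw [lamRR, lamR, pev, Finset.sum_range_succ']
    simp
  have key := D.htp_lin (p := fun z : X × I => cs z.2 • D.e + sn z.2 • (c z.1 0).2)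
    (R := fun z => D.lamRR m (c z.1) z.2) (by fun_prop) hRc
    (fun z => D.S.add_mem (hS _ D.e_mem) (hS _ ((hP _).2.1 0).2))
    (fun z => D.S.add_mem (hS _ (D.S.add_mem (hS _ D.e_mem) (hS _ ((hP _).2.1 0).2)))
      (hS _ (D.pev_mem (fun k => (hP z.1).2.1 (k + 1)) _)))
    (fun x => by simp) (fun x => by simp)
    (fun x => by simp [h0]; rw [lamRR, lamR, pev, Finset.sum_range_succ']; simp; abel)
    (fun z => by rw [← D.pev_succ (hP _).1]; exact (hP _).2.2 _)
  convert key using 1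
  · ext1 z; rw [pev_Lam, h0]
  · ext1 z; simp only [spath, D.pev_succ (hP z.1).1]

end BDat

abbrev Mat (κ : Type) := Matrix κ κ ℝ

namespace BDat

section map
variable {ι A B : Type*} [Ring A] [StarRing A] [Algebra ℝ A] [StarModule ℝ A]
  [Ring B] [StarRing B] [Algebra ℝ B] [StarModule ℝ B] (D : BDat ι A) (φ : A ≃⋆ₐ[ℝ] B)

/-- Transport along an isomorphism. -/
def map : BDat ι B where
  c l := φ (D.c l)
  ε := D.ε
  e := φ D.e
  f := φ D.f
  τ := φ D.τ
  e_star := by rw [← map_star, D.e_star, map_neg]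
  e_sq := by rw [← map_mul, D.e_sq, map_neg, map_one]
  e_c l := by rw [← map_mul, D.e_c, map_smul, map_mul]
  f_star := by rw [← map_star, D.f_star, map_neg]
  f_sq := by rw [← map_mul, D.f_sq, map_neg, map_one]
  f_c l := by rw [← map_mul, D.f_c, map_smul, map_mul]
  f_e := by rw [← map_mul, D.f_e, map_neg, map_mul]
  τ_left := by rw [← map_star, ← map_mul, D.τ_left, map_one]
  τ_right := by rw [← map_star, ← map_mul, D.τ_right, map_one]
  τ_c l := by rw [← map_mul, D.τ_c, map_mul]
  τ_e := by rw [← map_mul, D.τ_e, map_mul]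
  τ_f := by rw [← map_mul, D.τ_f, map_neg, map_mul]
  ε_sq := D.ε_sq

variable {D} {a : A}

theorem map_mem_S (h : a ∈ D.S) : φ a ∈ (D.map φ).S :=
  ⟨by rw [← map_star, h.1, map_neg], fun l => by
    simp only [map]; rw [← map_mul, h.2, map_smul, map_mul]⟩

theorem map_mem_Y (h : a ∈ D.Y) : φ a ∈ (D.map φ).Y := ⟨map_mem_S φ h.1, h.2.map φ⟩

theorem map_mem_Yp (h : a ∈ D.Yp) : φ a ∈ (D.map φ).Yp :=
  ⟨map_mem_Y φ h.1, by simp only [map]; rw [← map_mul, h.2, map_neg, map_mul]⟩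

theorem map_pen (a : A) (s : I) : φ (D.pen a s) = (D.map φ).pen (φ a) s := by
  simp [pen, map]

theorem map_mem_Zs (h : a ∈ D.Zs) : φ a ∈ (D.map φ).Zs :=
  ⟨map_mem_S φ h.1, fun s => by rw [← map_pen]; exact (h.2 s).map φ⟩

/-- Coefficientwise transport. -/
def mapc (c : ℕ → A × A) : ℕ → B × B := fun k => (φ (c k).1, φ (c k).2)

theorem pev_mapc (m : ℕ) (c : ℕ → A × A) (s : I) : pev m (mapc φ c) s = φ (pev m c s) := by
  simp [pev, mapc, map_sum]

theorem mapc_mem {m : ℕ} {c : ℕ → A × A} (h : c ∈ D.PolySet m) :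
    mapc φ c ∈ (D.map φ).PolySet m :=
  ⟨by simp [mapc, map, h.1], fun k => ⟨map_mem_S φ (h.2.1 k).1, map_mem_S φ (h.2.1 k).2⟩,
    fun s => by rw [pev_mapc]; exact (h.2.2 s).map φ⟩

theorem mapc_stdc (b : A) : mapc φ (D.stdc b) = (D.map φ).stdc (φ b) := by
  ext1 k
  by_cases hk : k = 0 <;> simp [mapc, stdc, hk, map]

end map

end BDat

section flatten
variable {κ : Type} [Fintype κ] [DecidableEq κ]

/-- Flattening of block matrices. -/
def fl : M3 (Mat κ) ≃⋆ₐ[ℝ] Mat (Fin 3 × κ) :=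
  StarAlgEquiv.ofAlgEquiv (Matrix.compAlgEquiv (Fin 3) κ ℝ ℝ) fun x => by
    ext i j; rfl

theorem continuous_fl : Continuous (fl (κ := κ)) :=
  continuous_matrix fun i j => by
    change Continuous fun M : M3 (Mat κ) => M i.1 j.1 i.2 j.2
    exact (continuous_id.matrix_elem i.1 j.1).matrix_elem i.2 j.2

theorem isUnit_one_add_star_mul (a : Mat κ) : IsUnit (1 + star a * a) :=
  (Matrix.PosDef.one.add_posSemidef (Matrix.posSemidef_conjTranspose_mul_self a)).isUnit

end flatten

/-- Index types of the tower of block matrices. -/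
def TT (κ : Type) : ℕ → Type
  | 0 => κ
  | n + 1 => Fin 3 × TT κ n

section
variable (κ : Type) [Fintype κ] [DecidableEq κ]

instance instFintypeTT : ∀ n, Fintype (TT κ n)
  | 0 => inferInstanceAs (Fintype κ)
  | n + 1 => have := instFintypeTT n; inferInstanceAs (Fintype (Fin 3 × TT κ n))

instance instDecidableEqTT : ∀ n, DecidableEq (TT κ n)
  | 0 => inferInstanceAs (DecidableEq κ)
  | n + 1 => have := instDecidableEqTT n; inferInstanceAs (DecidableEq (Fin 3 × TT κ n))
end

namespace BDat
variable {ι : Type*} {κ : Type} [Fintype κ] [DecidableEq κ]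

/-- The next level of the tower. -/
def next (D : BDat ι (Mat κ)) : BDat ι (Mat (Fin 3 × κ)) := D.m3.map fl

/-- The tower over given data. -/
def tw (D : BDat ι (Mat κ)) : ∀ n, BDat ι (Mat (TT κ n))
  | 0 => D
  | n + 1 => (D.tw n).next

end BDat

/-- Sequences of pointed spaces. -/
structure Sys where
  W : ℕ → Type
  top : ∀ n, TopologicalSpace (W n)
  w : ∀ n, W n
  st : ∀ n, W n → W (n + 1)
  st_cont : ∀ n, Continuous (st n)
  st_w : ∀ n, st n (w n) = w (n + 1)

instance (S : Sys) (n : ℕ) : TopologicalSpace (S.W n) := S.top n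

/-- Stable homotopy relative to a subspace. -/
inductive SE (S : Sys) {X : Type} [TopologicalSpace X] (A : Set X) :
    (Σ n, X → S.W n) → (Σ n, X → S.W n) → Prop
  | htp {n : ℕ} {f g : X → S.W n} :
      Htp (fun f => ∀ a ∈ A, f a = S.w n) f g → SE S A ⟨n, f⟩ ⟨n, g⟩
  | st {n : ℕ} {f : X → S.W n} : Continuous f → (∀ a ∈ A, f a = S.w n) →
      SE S A ⟨n, f⟩ ⟨n + 1, S.st n ∘ f⟩
  | symm {p q : Σ n, X → S.W n} : SE S A p q → SE S A q p
  | trans {p q r : Σ n, X → S.W n} : SE S A p q → SE S A q r → SE S A p r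

/-- Strict morphisms of sequences of pointed spaces. -/
structure SysHom (S S' : Sys) where
  φ : ∀ n, S.W n → S'.W n
  cont : ∀ n, Continuous (φ n)
  map_w : ∀ n, φ n (S.w n) = S'.w n
  map_st : ∀ n a, φ (n + 1) (S.st n a) = S'.st n (φ n a)

namespace SE

variable {S S' : Sys} {X X' : Type} [TopologicalSpace X] [TopologicalSpace X'] {A : Set X}
  {A' : Set X'}

theorem map (Φ : SysHom S S') {p q : Σ n, X → S.W n} (h : SE S A p q) :
    SE S' A ⟨p.1, Φ.φ _ ∘ p.2⟩ ⟨q.1, Φ.φ _ ∘ q.2⟩ := by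
  induction h with
  | htp h => exact .htp (h.postcomp _ (Φ.cont _) fun f _ hf a ha => by simp [hf a ha, Φ.map_w])
  | @st n f hc hf =>
    have := SE.st (S := S') (A := A) ((Φ.cont n).comp hc) fun a ha => by simp [hf a ha, Φ.map_w]
    convert this using 3
    ext1 x
    exact Φ.map_st _ _
  | symm _ ih => exact ih.symm
  | trans _ _ ih ih2 => exact ih.trans ih2

/-- Stabilization on the total space. -/
def up (S : Sys) (X : Type) (p : Σ n, X → S.W n) : Σ n, X → S.W n := ⟨p.1 + 1, S.st _ ∘ p.2⟩

/-- Homotopy at the same level. -/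
inductive Hr (S : Sys) {X : Type} [TopologicalSpace X] (A : Set X) :
    (Σ n, X → S.W n) → (Σ n, X → S.W n) → Prop
  | mk {n : ℕ} {f g : X → S.W n} :
      Htp (fun f => ∀ a ∈ A, f a = S.w n) f g → Hr S A ⟨n, f⟩ ⟨n, g⟩

theorem Hr.symm {p q : Σ n, X → S.W n} (h : Hr S A p q) : Hr S A q p := by
  cases h with | mk h => exact .mk h.symm

theorem Hr.trans {p q r : Σ n, X → S.W n} (h : Hr S A p q) (h' : Hr S A q r) : Hr S A p r := by
  cases h with | mk h => cases h' with | mk h' => exact .mk (h.trans h')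

theorem Hr.up {p q : Σ n, X → S.W n} (h : Hr S A p q) : Hr S A (up S X p) (up S X q) := by
  cases h with
  | mk h => exact .mk (h.postcomp _ (S.st_cont _) fun f _ hf a ha => by simp [hf a ha, S.st_w])

theorem Hr.iter {p q : Σ n, X → S.W n} (h : Hr S A p q) (k : ℕ) :
    Hr S A ((SE.up S X)^[k] p) ((SE.up S X)^[k] q) := by
  induction k with
  | zero => exact h
  | succ k ih => rw [Function.iterate_succ_apply', Function.iterate_succ_apply']; exact ih.up

theorem exists_iter {p q : Σ n, X → S.W n} (h : SE S A p q) :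
    ∃ k l, Hr S A ((up S X)^[k] p) ((up S X)^[l] q) := by
  induction h with
  | htp h => exact ⟨0, 0, .mk h⟩
  | st hc hf => exact ⟨1, 0, .mk (.refl ((S.st_cont _).comp hc) fun a ha => by
      simp [hf a ha, S.st_w])⟩
  | symm _ ih => obtain ⟨k, l, h⟩ := ih; exact ⟨l, k, h.symm⟩
  | trans _ _ ih ih' =>
    obtain ⟨k, l, h⟩ := ih
    obtain ⟨k', l', h'⟩ := ih'
    refine ⟨k' + k, l + l', ?_⟩
    have h1 := h.iter k'
    have h2 := h'.iter l
    rw [← Function.iterate_add_apply, ← Function.iterate_add_apply] at h1 h2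
    rw [add_comm l k'] at h2
    exact h1.trans h2

end SE

namespace BDat
variable {ι : Type*} {κ : Type} [Fintype κ] [DecidableEq κ] (D : BDat ι (Mat κ))

variable {D} in
theorem next_mem_Y {a : M3 (Mat κ)} (h : a ∈ D.m3.Y) : fl a ∈ D.next.Y := by
  unfold next
  exact map_mem_Y (D := D.m3) (a := a) fl h

variable {D} in
theorem next_mem_Yp {a : M3 (Mat κ)} (h : a ∈ D.m3.Yp) : fl a ∈ D.next.Yp := by
  unfold next
  exact map_mem_Yp (D := D.m3) (a := a) fl h

variable {D} in
theorem next_mem_Zs {a : M3 (Mat κ)} (h : a ∈ D.m3.Zs) : fl a ∈ D.next.Zs := by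
  unfold next
  exact map_mem_Zs (D := D.m3) (a := a) fl h

/-- Stabilization of elements of `Y`. -/
def stY (a : D.Y) : D.next.Y := ⟨fl (dg a D.e D.e), next_mem_Y (D.dg_mem_Y a.2 D.e_Y D.e_Y)⟩

/-- Stabilization of elements of `Yp`. -/
def stYp (a : D.Yp) : D.next.Yp :=
  ⟨fl (dg a D.f D.f), next_mem_Yp (D.dg_mem_Yp a.2 D.f_Yp D.f_Yp)⟩

theorem f_Zs : D.f ∈ D.Zs := D.Yp_sub_Zs isUnit_one_add_star_mul D.f_Yp

theorem m3_pen (a b c : Mat κ) (s : I) :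
    D.m3.pen (dg a b c) s = dg (D.pen a s) (D.pen b s) (D.pen c s) := by
  simp [pen, m3, dg_smul, dg_add]

theorem dg_mem_Zs {a b c : Mat κ} (ha : a ∈ D.Zs) (hb : b ∈ D.Zs) (hc : c ∈ D.Zs) :
    dg a b c ∈ D.m3.Zs :=
  ⟨D.dg_mem_S ha.1 hb.1 hc.1, fun s => by
    rw [m3_pen]; exact isUnit_dg (ha.2 s) (hb.2 s) (hc.2 s)⟩

/-- Stabilization of elements of `Zs`. -/
def stZ (a : D.Zs) : D.next.Zs :=
  ⟨fl (dg a D.f D.f), next_mem_Zs (D.dg_mem_Zs a.2 D.f_Zs D.f_Zs)⟩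

/-- Paths in `Y` from `e` to `-e`. -/
def Pt : Set C(I, Mat κ) := {p | p 0 = D.e ∧ p 1 = -D.e ∧ ∀ s, p s ∈ D.Y}

/-- The pencil as a path. -/
def penC (b : Mat κ) : C(I, Mat κ) := ⟨D.pen b, by unfold pen; fun_prop⟩

theorem penC_mem {b : Mat κ} (hb : b ∈ D.Zs) : D.penC b ∈ D.Pt :=
  ⟨by simp [penC, pen], by simp [penC, pen], fun s => ⟨D.pen_mem _ hb.1 _, hb.2 s⟩⟩

theorem continuous_penC : Continuous D.penC := by
  refine ContinuousMap.continuous_of_continuous_uncurry _ ?_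
  change Continuous fun p : Mat κ × I => D.pen p.1 p.2
  unfold pen
  fun_prop

theorem continuous_fl_dg {Z : Type*} [TopologicalSpace Z] {a b c : Z → Mat κ} (ha : Continuous a)
    (hb : Continuous b) (hc : Continuous c) : Continuous fun z => fl (dg (a z) (b z) (c z)) := by
  refine continuous_fl.comp ?_
  unfold dg
  apply continuous_mat3 <;> fun_prop

/-- Stabilization of paths. -/
def stP (p : D.Pt) : D.next.Pt :=
  ⟨⟨fun s => fl (dg (p.1 s) (D.pen D.f s) (D.pen D.f s)),
      continuous_fl_dg p.1.continuous (D.penC D.f).continuous (D.penC D.f).continuous⟩,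
    by
      have hf := fun s : I => D.isUnit_pen isUnit_one_add_star_mul D.f_Yp s
      refine ⟨?_, ?_, fun s => next_mem_Y (D.dg_mem_Y (p.2.2.2 s) ⟨D.pen_mem _ D.f_mem _, hf s⟩
        ⟨D.pen_mem _ D.f_mem _, hf s⟩)⟩
      · simp [p.2.1, pen, next, map, m3]
      · simp [p.2.2.1, pen, next, map, m3, ← map_neg, dg_neg]⟩

/-- The sequence of spaces `Y`. -/
def YS : Sys where
  W n := (D.tw n).Y
  top _ := inferInstance
  w n := ⟨(D.tw n).e, (D.tw n).e_Y⟩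
  st n := (D.tw n).stY
  st_cont n := Continuous.subtype_mk (continuous_fl_dg continuous_subtype_val continuous_const
    continuous_const) _
  st_w _ := rfl

/-- The sequence of spaces `Yp`. -/
def YpS : Sys where
  W n := (D.tw n).Yp
  top _ := inferInstance
  w n := ⟨(D.tw n).f, (D.tw n).f_Yp⟩
  st n := (D.tw n).stYp
  st_cont n := Continuous.subtype_mk (continuous_fl_dg continuous_subtype_val continuous_const
    continuous_const) _
  st_w _ := rfl

/-- The sequence of spaces `Zs`. -/
def ZS : Sys where
  W n := (D.tw n).Zs
  top _ := inferInstance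
  w n := ⟨(D.tw n).f, (D.tw n).f_Zs⟩
  st n := (D.tw n).stZ
  st_cont n := Continuous.subtype_mk (continuous_fl_dg continuous_subtype_val continuous_const
    continuous_const) _
  st_w _ := rfl

theorem continuous_stP : Continuous D.stP := by
  refine Continuous.subtype_mk ?_ _
  refine ContinuousMap.continuous_of_continuous_uncurry _ ?_
  change Continuous fun p : D.Pt × I => fl (dg (p.1.1 p.2) (D.pen D.f p.2) (D.pen D.f p.2))
  have := (D.penC D.f).continuous
  exact continuous_fl_dg (by fun_prop) (this.comp continuous_snd) (this.comp continuous_snd)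

theorem penC_next (a b c : Mat κ) (s : I) : D.next.pen (fl (dg a b c)) s =
    fl (dg (D.pen a s) (D.pen b s) (D.pen c s)) := by
  rw [next, ← map_pen, m3_pen]

/-- The sequence of spaces of paths. -/
def PS : Sys where
  W n := (D.tw n).Pt
  top _ := inferInstance
  w n := ⟨(D.tw n).penC (D.tw n).f, (D.tw n).penC_mem (D.tw n).f_Zs⟩
  st n := (D.tw n).stP
  st_cont n := (D.tw n).continuous_stP
  st_w n := by
    refine Subtype.ext (ContinuousMap.ext fun s => ?_)
    exact ((D.tw n).penC_next _ _ _ s).symm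

/-- The inclusion of `Yp` in `Zs`. -/
def homYZ : SysHom D.YpS D.ZS where
  φ n a := ⟨a.1, (D.tw n).Yp_sub_Zs isUnit_one_add_star_mul a.2⟩
  cont n := Continuous.subtype_mk continuous_subtype_val _
  map_w _ := rfl
  map_st _ _ := rfl

/-- The pencil of an element of `Zs`. -/
def homZP : SysHom D.ZS D.PS where
  φ n a := ⟨(D.tw n).penC a.1, (D.tw n).penC_mem a.2⟩
  cont n := Continuous.subtype_mk ((D.tw n).continuous_penC.comp continuous_subtype_val) _
  map_w _ := rfl
  map_st n a := by
    refine Subtype.ext (ContinuousMap.ext fun s => ?_)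
    exact (D.tw n).penC_next _ _ _ s

variable {X : Type} [TopologicalSpace X]

/-- Homotopies of families of paths as homotopies of maps to path spaces. -/
theorem htp_Pt {f g : X → D.Pt} {F G : X × I → Mat κ} (h : Htp D.PathP F G)
    (hF : ∀ z, (f z.1).1 z.2 = F z) (hG : ∀ z, (g z.1).1 z.2 = G z) (P : (X → D.Pt) → Prop)
    (hP : ∀ f, P f) : Htp P f g := by
  obtain ⟨H, hc, h0, h1, hH⟩ := h
  have hs : ∀ t x, Continuous fun s => H t (x, s) := fun t x =>
    hc.comp (by fun_prop : Continuous fun s : I => (t, (x, s)))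
  refine ⟨fun t x => ⟨⟨fun s => H t (x, s), hs t x⟩, (hH t x).1, (hH t x).2.1, (hH t x).2.2⟩,
    ?_, ?_, ?_, fun _ => hP _⟩
  · refine Continuous.subtype_mk (ContinuousMap.continuous_of_continuous_uncurry _ ?_) _
    exact hc.comp (by fun_prop : Continuous fun p : (I × X) × I => (p.1.1, (p.1.2, p.2)))
  · ext1 x
    refine Subtype.ext (ContinuousMap.ext fun s => ?_)
    exact (congrFun h0 (x, s)).trans (hF (x, s)).symm
  · ext1 x
    refine Subtype.ext (ContinuousMap.ext fun s => ?_)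
    exact (congrFun h1 (x, s)).trans (hG (x, s)).symm

/-- Homotopies with values in a set as homotopies of maps to the subtype. -/
theorem htp_subtype {M : Type*} [TopologicalSpace M] {U : Set M} {f g : X → U} {F G : X → M}
    (h : FHtp U F G) (hF : ∀ x, (f x).1 = F x) (hG : ∀ x, (g x).1 = G x) (P : (X → U) → Prop)
    (hP : ∀ f, P f) : Htp P f g := by
  obtain ⟨H, hc, h0, h1, hH⟩ := h
  refine ⟨fun t x => ⟨H t x, hH t x⟩, hc.subtype_mk _, ?_, ?_, fun _ => hP _⟩
  · ext1 x; exact Subtype.ext ((congrFun h0 x).trans (hF x).symm)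
  · ext1 x; exact Subtype.ext ((congrFun h1 x).trans (hG x).symm)

theorem continuous_pev_apply (m : ℕ) (c : ℕ → Mat κ × Mat κ) :
    Continuous fun s : I => pev m c s := by
  unfold pev; fun_prop

variable {D} in
theorem next_mem_PolySet {m : ℕ} {c : ℕ → M3 (Mat κ) × M3 (Mat κ)} (hc : c ∈ D.m3.PolySet m) :
    mapc fl c ∈ D.next.PolySet m := by
  unfold next
  exact mapc_mem (D := D.m3) (c := c) fl hc

theorem mapc_stdc_next (b : M3 (Mat κ)) : mapc fl (D.m3.stdc b) = D.next.stdc (fl b) := by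
  unfold next
  exact mapc_stdc (D := D.m3) fl b

theorem continuous_stdc : Continuous D.stdc := by
  refine continuous_pi fun k => ?_
  unfold stdc
  by_cases hk : k = 0
  · simp only [hk, if_true]; fun_prop
  · simp only [hk, if_false]; fun_prop

variable {D} in
theorem pev_pathP {m : ℕ} {c : ℕ → Mat κ × Mat κ} (hc : c ∈ D.PolySet m) :
    pev m c 0 = D.e ∧ pev m c 1 = -D.e ∧ ∀ s, pev m c s ∈ D.Y := by
  refine ⟨?_, ?_, fun s => ⟨D.pev_mem hc.2.1 _, hc.2.2 s⟩⟩
  · rw [pev, Finset.sum_range_succ']; simp [hc.1]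
  · rw [pev, Finset.sum_range_succ']; simp [hc.1]

/-- The evaluation of coefficients as a path. -/
def evP {m : ℕ} (c : D.PolySet m) : D.Pt :=
  ⟨⟨fun s => pev m c.1 s, continuous_pev_apply m c.1⟩, pev_pathP c.2⟩

variable {D} in
theorem stdc_mem (m : ℕ) {b : Mat κ} (hb : b ∈ D.Zs) : D.stdc b ∈ D.PolySet m :=
  ⟨by simp [stdc], fun k => by
    by_cases hk : k = 0
    · simp only [stdc, hk, if_true]; exact ⟨D.e_mem, hb.1⟩
    · simp [stdc, hk, D.S.zero_mem], fun s => by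
      rw [pev_stdc]; exact hb.2 s⟩

/-- Coefficients of a pencil. -/
def stdP (m : ℕ) (b : D.Zs) : D.PolySet m := ⟨D.stdc b.1, stdc_mem m b.2⟩

/-- The inclusion of `Yp` in `Zs`. -/
def ypz (a : D.Yp) : D.Zs := ⟨a.1, D.Yp_sub_Zs isUnit_one_add_star_mul a.2⟩

theorem continuous_evP (m : ℕ) : Continuous (D.evP (m := m)) := by
  refine Continuous.subtype_mk (ContinuousMap.continuous_of_continuous_uncurry _ ?_) _
  exact continuous_pev m continuous_subtype_val

theorem continuous_mapc_fl :
    Continuous (mapc fl : (ℕ → M3 (Mat κ) × M3 (Mat κ)) → _) :=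
  continuous_pi fun k => Continuous.prodMk
    (continuous_fl.comp (continuous_fst.comp (continuous_apply k)))
    (continuous_fl.comp (continuous_snd.comp (continuous_apply k)))

/-- Degree reduction of polynomial paths. -/
def LamP (m : ℕ) (c : D.PolySet (m + 1)) : D.next.PolySet m :=
  ⟨mapc fl (D.Lam c.1), next_mem_PolySet (D.Lam_mem c.2)⟩

theorem continuous_LamP (m : ℕ) : Continuous (D.LamP m) :=
  (continuous_mapc_fl.comp (D.continuous_Lam.comp continuous_subtype_val)).subtype_mk _

theorem pathP_fl {F : X × I → M3 (Mat κ)} (h : D.m3.PathP F) :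
    D.next.PathP fun z => fl (F z) := by
  intro x
  obtain ⟨h0, h1, h2⟩ := h x
  refine ⟨?_, ?_, fun s => next_mem_Y (h2 s)⟩
  · simp only [h0]; rfl
  · simp only [h1, map_neg]; rfl

theorem evP_LamP {m : ℕ} (c : D.PolySet (m + 1)) (s : I) :
    (D.next.evP (D.LamP m c)).1 s = fl (pev m (D.Lam c.1) s) :=
  pev_mapc (A := M3 (Mat κ)) fl m (D.Lam c.1) s

theorem stP_apply (p : D.Pt) (s : I) :
    (D.stP p).1 s = fl (dg (p.1 s) (D.pen D.f s) (D.pen D.f s)) := rfl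

theorem htp_LamP {m : ℕ} {a : X → D.PolySet (m + 1)} (ha : Continuous a)
    (P : (X → D.next.Pt) → Prop) (hP : ∀ f, P f) :
    Htp P (fun x => D.next.evP (D.LamP m (a x))) (D.stP ∘ fun x => D.evP (a x)) := by
  have h := D.htp_pev_Lam (c := fun x => (a x).1) (continuous_subtype_val.comp ha)
    (fun x => (a x).2)
  have h' : Htp D.next.PathP (fun z : X × I => fl (pev m (D.Lam (a z.1).1) z.2))
      (fun z => fl (dg (pev (m + 1) (a z.1).1 z.2) (D.pen D.f z.2) (D.pen D.f z.2))) :=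
    h.postcomp (Q := D.next.PathP) (fun c => fl c) continuous_fl fun F _ hF => D.pathP_fl hF
  exact htp_Pt D.next h' (fun y => D.evP_LamP _ _) (fun y => rfl) P hP

theorem htp_LamP_stdP (m : ℕ) {b : X → D.Yp} (hb : Continuous b) :
    Htp (fun _ => True) (D.LamP m ∘ fun x => D.stdP (m + 1) (D.ypz (b x)))
      fun x => D.next.stdP m (D.next.ypz (D.stYp (b x))) := by
  have hlam := D.htp_lam isUnit_one_add_star_mul (continuous_subtype_val.comp hb)
    fun x => (b x).2
  have h1 : FHtp (D.next.PolySet m) (fun x => D.next.stdc (fl (D.lam (b x).1)))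
      (fun x => D.next.stdc (fl (dg (b x).1 D.f D.f))) :=
    hlam.postcomp (fun c => D.next.stdc (fl c)) (D.next.continuous_stdc.comp
      continuous_fl) fun F _ hF x => stdc_mem m (next_mem_Zs (hF x))
  refine htp_subtype (M := ℕ → Mat (Fin 3 × κ) × Mat (Fin 3 × κ)) (U := D.next.PolySet m)
    h1 ?_ ?_ _ (by simp)
  · intro x
    change mapc fl (D.Lam (D.stdc (b x).1)) = _
    rw [D.Lam_stdc, mapc_stdc_next]
  · intro x; rfl

/-- Every family of polynomial paths is stably homotopic to a linear one. -/
theorem exists_linear (m : ℕ) : ∀ (n : ℕ) (X : Type) [TopologicalSpace X]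
    (a : X → (D.tw n).PolySet m) (_ : Continuous a),
    ∃ (N : ℕ) (z : X → (D.tw N).Zs), Continuous z ∧
      SE D.PS ∅ ⟨N, D.homZP.φ N ∘ z⟩ ⟨n, fun x => (D.tw n).evP (a x)⟩ ∧
      ∀ (X' : Type) [TopologicalSpace X'] (j : X' → X) (_ : Continuous j) (b : X' → (D.tw n).Yp)
        (_ : Continuous b), Htp (fun _ => True) (a ∘ j) (fun x => (D.tw n).stdP m (D.homYZ.φ n (b x))) →
        SE D.ZS ∅ ⟨N, z ∘ j⟩ ⟨n, D.homYZ.φ n ∘ b⟩ := by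
  induction m with
  | zero =>
    intro n X _ a ha
    have hz : ∀ c : (D.tw n).PolySet 0, (c.1 0).2 ∈ (D.tw n).Zs := fun c =>
      ⟨(c.2.2.1 0).2, fun s => by
        have := c.2.2.2 s
        rwa [pev_zero, c.2.1] at this⟩
    have hzc : Continuous fun c : (D.tw n).PolySet 0 => (⟨(c.1 0).2, hz c⟩ : (D.tw n).Zs) :=
      Continuous.subtype_mk (continuous_snd.comp ((continuous_apply 0).comp continuous_subtype_val)) _
    refine ⟨n, fun x => ⟨((a x).1 0).2, hz _⟩, hzc.comp ha, ?_, ?_⟩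
    · have : D.homZP.φ n ∘ (fun x => ⟨((a x).1 0).2, hz (a x)⟩ : X → (D.tw n).Zs) =
          fun x => (D.tw n).evP (a x) := by
        ext1 x
        refine Subtype.ext (ContinuousMap.ext fun s => ?_)
        have : pev 0 (a x).1 s = (D.tw n).pen ((a x).1 0).2 s := by
          rw [pev_zero, (a x).2.1]; rfl
        exact this.symm
      rw [← this]
      exact .htp (.refl ((D.homZP.cont n).comp (hzc.comp ha)) (by simp))
    · intro X' _ j hj b hb h
      exact .htp (h.postcomp (Q := fun f => ∀ x ∈ (∅ : Set X'), f x = D.ZS.w n)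
        (fun c => (⟨(c.1 0).2, hz c⟩ : (D.tw n).Zs)) hzc (by simp))
  | succ m ih =>
    intro n X _ a ha
    obtain ⟨N, z, hz, h1, h2⟩ := ih (n + 1) X (fun x => (D.tw n).LamP m (a x))
      (((D.tw n).continuous_LamP m).comp ha)
    refine ⟨N, z, hz, h1.trans (.trans (.htp ((D.tw n).htp_LamP ha _ (by simp))) (SE.st ?_ ?_).symm), ?_⟩
    · exact ((D.tw n).continuous_evP (m + 1)).comp ha
    · simp
    · intro X' _ j hj b hb h
      refine (h2 X' j hj (fun x => (D.tw n).stYp (b x)) ((D.YpS.st_cont n).comp hb) ?_).trans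
        (SE.st ((D.homYZ.cont n).comp hb) (by simp)).symm
      exact (h.postcomp (Q := fun _ => True) _ ((D.tw n).continuous_LamP m) (by simp)).trans
        ((D.tw n).htp_LamP_stdP m hb)
end BDat

section quad
variable {κ : Type} [Fintype κ] [DecidableEq κ]

/-- Matrices without real eigenvalues. -/
def NR (κ : Type) [Fintype κ] [DecidableEq κ] : Set (Mat κ) :=
  {K | ∀ c s : ℝ, c ≠ 0 ∨ s ≠ 0 → IsUnit (c • (1 : Mat κ) + s • K)}

/-- Bounds for quadratic forms. -/
def Qf (r : ℝ) (M : Mat κ) : Prop := ∀ v : κ → ℝ, |v ⬝ᵥ M.mulVec v| ≤ r * (v ⬝ᵥ v)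

theorem Qf.add {r s : ℝ} {M N : Mat κ} (hM : Qf r M) (hN : Qf s N) : Qf (r + s) (M + N) := by
  intro v
  rw [Matrix.add_mulVec, dotProduct_add, add_mul]
  exact (abs_add_le _ _).trans (add_le_add (hM v) (hN v))

theorem Qf.smul {r t : ℝ} {M : Mat κ} (hM : Qf r M) (ht : 0 ≤ t) : Qf (t * r) (t • M) := by
  intro v
  rw [Matrix.smul_mulVec, dotProduct_smul, smul_eq_mul, abs_mul, abs_of_nonneg ht, mul_assoc]
  exact mul_le_mul_of_nonneg_left (hM v) ht

theorem Qf.mono {r s : ℝ} {M : Mat κ} (hM : Qf r M) (h : r ≤ s) : Qf s M := fun v =>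
  (hM v).trans (mul_le_mul_of_nonneg_right h (Finset.sum_nonneg fun i _ => mul_self_nonneg _))

theorem Qf_sum (M : Mat κ) : Qf (∑ i, ∑ j, |M i j|) M := by
  intro v
  have h0 : v ⬝ᵥ M.mulVec v = ∑ i, ∑ j, v i * (M i j * v j) := by
    simp [dotProduct, Matrix.mulVec, Finset.mul_sum]
  have h1 : ∀ i, v i * v i ≤ v ⬝ᵥ v := fun i =>
    Finset.single_le_sum (f := fun i => v i * v i) (fun i _ => mul_self_nonneg (v i))
      (Finset.mem_univ i)
  rw [h0, Finset.sum_mul]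
  refine (Finset.abs_sum_le_sum_abs _ _).trans (Finset.sum_le_sum fun i _ => ?_)
  rw [Finset.sum_mul]
  refine (Finset.abs_sum_le_sum_abs _ _).trans (Finset.sum_le_sum fun j _ => ?_)
  rw [show v i * (M i j * v j) = M i j * (v i * v j) by ring, abs_mul]
  refine mul_le_mul_of_nonneg_left ?_ (abs_nonneg _)
  rw [abs_le]
  constructor <;> nlinarith [h1 i, h1 j, sq_nonneg (v i + v j), sq_nonneg (v i - v j)]

theorem commute_lin (K : Mat κ) (a b c d : ℝ) :
    Commute (a • (1 : Mat κ) + b • K) (c • 1 + d • K) := by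
  simp only [Commute, SemiconjBy, add_mul, mul_add, smul_mul_assoc, mul_smul_comm, one_mul,
    mul_one]
  match_scalars <;> ring

theorem NR_isUnit {K : Mat κ} (h : K ∈ NR κ) : IsUnit K := by
  have := h 0 1 (by simp); simpa using this

theorem mat_mul_inv {K : Mat κ} (h : IsUnit K) : K * K⁻¹ = 1 :=
  Matrix.mul_nonsing_inv K ((Matrix.isUnit_iff_isUnit_det K).1 h)

theorem mat_inv_mul {K : Mat κ} (h : IsUnit K) : K⁻¹ * K = 1 :=
  Matrix.nonsing_inv_mul K ((Matrix.isUnit_iff_isUnit_det K).1 h)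

/-- Newton iteration for `K ^ 2 = -1`, with weights. -/
theorem NR_newton {K : Mat κ} (h : K ∈ NR κ) {α β : ℝ} (hα : 0 < α) (hβ : 0 ≤ β) :
    α • K - β • K⁻¹ ∈ NR κ := by
  intro c s hcs
  have hK : (c • (1 : Mat κ) + s • (α • K - β • K⁻¹)) * K =
      (s * α) • (K * K) + c • K - (s * β) • (1 : Mat κ) := by
    simp only [add_mul, sub_mul, smul_mul_assoc, one_mul, mat_inv_mul (NR_isUnit h), smul_sub, smul_smul]
    abel
  suffices IsUnit ((c • (1 : Mat κ) + s • (α • K - β • K⁻¹)) * K) by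
    have h2 := this.mul (⟨⟨K⁻¹, K, mat_inv_mul (NR_isUnit h), mat_mul_inv (NR_isUnit h)⟩, rfl⟩ : IsUnit K⁻¹)
    rwa [mul_assoc, mat_mul_inv (NR_isUnit h), mul_one] at h2
  rw [hK]
  by_cases hs : s = 0
  · have hc : c ≠ 0 := by tauto
    simp only [hs, zero_mul, zero_smul, zero_add, sub_zero]
    exact (NR_isUnit h).smul (Units.mk0 c hc)
  · have hd : 0 ≤ c ^ 2 + 4 * α * β * s ^ 2 := by positivity
    have hsq := Real.sq_sqrt hd
    set q := √(c ^ 2 + 4 * α * β * s ^ 2)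
    have hf : (s * α) • (K * K) + c • K - (s * β) • (1 : Mat κ) =
        ((((c + q) / 2)) • 1 + (s * α) • K) * (((c - q) / (2 * (s * α))) • 1 + (1 : ℝ) • K) := by
      simp only [add_mul, mul_add, smul_mul_assoc, mul_smul_comm, one_mul, mul_one]
      have : s * α ≠ 0 := mul_ne_zero hs hα.ne'
      match_scalars
      · ring
      · field_simp; ring
      · field_simp; linear_combination hsq
    rw [hf]
    exact (h _ _ (Or.inr (mul_ne_zero hs hα.ne'))).mul (h _ _ (Or.inr one_ne_zero))

/-- Quantitative control of the resolvent. -/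
def Dec (B : ℝ) (K : Mat κ) : Prop := ∀ c s : ℝ, c ^ 2 + s ^ 2 = 1 →
  Qf B ((K * K + 1) * ((c • (1 : Mat κ) + s • K)⁻¹ * (c • (1 : Mat κ) + s • K)⁻¹))

theorem inv_sq_mul {P R : Mat κ} (hP : IsUnit P) (h : Commute P R) :
    P⁻¹ * P⁻¹ * (P * R * (P * R)) = R * R := by
  calc P⁻¹ * P⁻¹ * (P * R * (P * R)) = P⁻¹ * (P⁻¹ * P) * (R * P) * R := by noncomm_ring
    _ = R * R := by
      rw [mat_inv_mul hP, mul_one, ← h.eq, ← mul_assoc, mat_inv_mul hP, one_mul]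

theorem Dec.newton {K : Mat κ} (h : K ∈ NR κ) {B : ℝ} (hB : Dec B K) :
    Dec (B / 2) ((1 / 2 : ℝ) • K - (1 / 2 : ℝ) • K⁻¹) := by
  intro c' s' hcs
  obtain ⟨θ, hc', hs'⟩ : ∃ θ : ℝ, c' = Real.cos θ ∧ s' = Real.sin θ := by
    have : ‖(⟨c', s'⟩ : ℂ)‖ = 1 := by
      rw [← sq_eq_sq₀ (norm_nonneg _) zero_le_one, ← Complex.normSq_eq_norm_sq, Complex.normSq_mk]
      linarith
    refine ⟨(⟨c', s'⟩ : ℂ).arg, ?_, ?_⟩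
    · rw [Complex.cos_arg (by intro h0; rw [h0] at this; simp at this), this]; simp
    · rw [Complex.sin_arg, this]; simp
  set c := Real.cos (θ / 2)
  set s := Real.sin (θ / 2)
  have h1 : c ^ 2 + s ^ 2 = 1 := by simp [c, s]
  have hc2 : c' = c ^ 2 - s ^ 2 := by
    rw [hc', show θ = 2 * (θ / 2) by ring, Real.cos_two_mul]; linarith
  have hs2 : s' = 2 * s * c := by rw [hs', show θ = 2 * (θ / 2) by ring, Real.sin_two_mul]
  have hne : c ≠ 0 ∨ s ≠ 0 := by
    by_contra! h0; rw [h0.1, h0.2] at h1; norm_num at h1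
  set N := (1 / 2 : ℝ) • K - (1 / 2 : ℝ) • K⁻¹ with hN
  set P := c • (1 : Mat κ) + s • K with hP
  set R := (-s) • (1 : Mat κ) + c • K with hR
  set W := c' • (1 : Mat κ) + s' • N with hW
  have hPu : IsUnit P := h _ _ hne
  have hRu : IsUnit R := h _ _ (by simpa using hne.symm)
  have hWu : IsUnit W := NR_newton h (by norm_num) (by norm_num) _ _ (by
    by_contra! h0; rw [h0.1, h0.2] at hcs; norm_num at hcs)
  have hPR : Commute P R := commute_lin K _ _ _ _
  have hi := mat_mul_inv (NR_isUnit h)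
  have hi' := mat_inv_mul (NR_isUnit h)
  have hKW : K * W = P * R := by
    simp only [hW, hP, hR, hN, add_mul, mul_add, mul_sub, smul_mul_assoc, mul_smul_comm, one_mul,
      mul_one, smul_smul, hi, smul_sub, hc2, hs2]
    match_scalars <;> ring
  have hWK : Commute W K := by
    simp only [Commute, SemiconjBy, hW, hN, add_mul, mul_add, mul_sub, sub_mul, smul_mul_assoc,
      mul_smul_comm, one_mul, mul_one, smul_sub, hi, hi']
  have hNN : (N * N + 1) * (K * K) = (1 / 4 : ℝ) • ((K * K + 1) * (K * K + 1)) := by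
    have e1 : K⁻¹ * K⁻¹ * (K * K) = 1 := by
      rw [mul_assoc, ← mul_assoc _ K K, hi', one_mul, hi']
    have e2 : K * K⁻¹ * (K * K) = K * K := by rw [hi, one_mul]
    have e3 : K⁻¹ * K * (K * K) = K * K := by rw [hi', one_mul]
    simp only [hN, add_mul, sub_mul, mul_sub, smul_mul_assoc, mul_smul_comm, smul_sub, e1, e2,
      e3, mul_add, one_mul, mul_one]
    match_scalars <;> ring
  have hPR2 : P * P + R * R = K * K + 1 := by
    simp only [hP, hR, add_mul, mul_add, smul_mul_assoc, mul_smul_comm, one_mul, mul_one]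
    match_scalars <;> first | ring1 | linear_combination h1
  have key : (N * N + 1) * (W⁻¹ * W⁻¹) =
      (1 / 4 : ℝ) • ((K * K + 1) * (P⁻¹ * P⁻¹) + (K * K + 1) * (R⁻¹ * R⁻¹)) := by
    have hu : IsUnit (P * R * (P * R)) := (hPu.mul hRu).mul (hPu.mul hRu)
    refine hu.mul_right_cancel ?_
    have a1 : (N * N + 1) * (W⁻¹ * W⁻¹) * (P * R * (P * R)) =
        (1 / 4 : ℝ) • ((K * K + 1) * (K * K + 1)) := by
      rw [← hKW, ← hWK.eq, mul_assoc, inv_sq_mul hWu hWK, hNN]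
    have a2 : (K * K + 1) * (P⁻¹ * P⁻¹) * (P * R * (P * R)) = (K * K + 1) * (R * R) := by
      rw [mul_assoc, inv_sq_mul hPu hPR]
    have a3 : (K * K + 1) * (R⁻¹ * R⁻¹) * (P * R * (P * R)) = (K * K + 1) * (P * P) := by
      rw [hPR.eq, mul_assoc, inv_sq_mul hRu hPR.symm]
    rw [a1, smul_mul_assoc, add_mul _ _ (P * R * (P * R)), a2, a3, ← mul_add, add_comm (R * R), hPR2]
  rw [key]
  have := ((hB c s h1).add (hB (-s) c (by linarith))).smul (t := 1 / 4) (by norm_num)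
  convert this using 1
  ring

/-- Deforming the symmetric part of a matrix to zero. -/
theorem isUnit_skew {A B : Mat κ} (hA : star A = A) (hB : star B = -B) {r : ℝ} (hr : r < 1)
    (h : Qf r ((A + B) * (A + B) + 1)) {t : ℝ} (ht : 0 ≤ t) (ht' : t ≤ 1) :
    t • A + B ∈ NR κ := by
  intro c s hcs
  by_contra hu
  rw [Matrix.isUnit_iff_isUnit_det, isUnit_iff_ne_zero, not_not,
    ← Matrix.exists_mulVec_eq_zero_iff] at hu
  obtain ⟨v, hv, h0⟩ := hu
  have hs : s ≠ 0 := by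
    rintro rfl
    have hc : c ≠ 0 := by tauto
    simp only [zero_smul, add_zero, Matrix.smul_mulVec, Matrix.one_mulVec] at h0
    exact hv ((smul_eq_zero.1 h0).resolve_left hc)
  have hAt : ∀ x y : κ → ℝ, x ⬝ᵥ A.mulVec y = A.mulVec x ⬝ᵥ y := fun x y => by
    rw [Matrix.dotProduct_mulVec, ← Matrix.mulVec_transpose]
    have : A.transpose = A := by rw [← Matrix.conjTranspose_eq_transpose_of_trivial]; exact hA
    rw [this]
  have hBt : ∀ x y : κ → ℝ, x ⬝ᵥ B.mulVec y = -(B.mulVec x ⬝ᵥ y) := fun x y => by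
    rw [Matrix.dotProduct_mulVec, ← Matrix.mulVec_transpose]
    have : B.transpose = -B := by rw [← Matrix.conjTranspose_eq_transpose_of_trivial]; exact hB
    rw [this, Matrix.neg_mulVec, neg_dotProduct]
  have hpos : 0 < v ⬝ᵥ v := by
    rcases (Finset.sum_nonneg fun i _ => mul_self_nonneg (v i) : 0 ≤ v ⬝ᵥ v).lt_or_eq with h | h
    · exact h
    · exact absurd (dotProduct_self_eq_zero.1 h.symm) hv
  set a := A.mulVec v with ha
  set b := B.mulVec v with hb
  have hb' : b = (-(c / s)) • v - t • a := by
    have : c • v + s • (t • a + b) = 0 := by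
      rw [← h0]; simp [Matrix.add_mulVec, Matrix.smul_mulVec, ha, hb]
    have h2 : s⁻¹ • (c • v + s • (t • a + b)) = 0 := by rw [this, smul_zero]
    rw [smul_add, smul_smul, smul_smul, inv_mul_cancel₀ hs, one_smul] at h2
    have h3 : b = -(s⁻¹ * c) • v - t • a := by
      rw [neg_smul]
      linear_combination (exp := 1) h2
    rw [h3]; ring_nf
  have hvb : v ⬝ᵥ b = 0 := by
    have := hBt v v
    rw [← hb, dotProduct_comm b v] at this
    linarith
  have hva : v ⬝ᵥ b = -(c / s) * (v ⬝ᵥ v) - t * (v ⬝ᵥ a) := by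
    conv_lhs => rw [hb']
    simp [dotProduct_sub]
  have hbb : b ⬝ᵥ b = (c / s) ^ 2 * (v ⬝ᵥ v) + 2 * (c / s) * t * (v ⬝ᵥ a) + t ^ 2 * (a ⬝ᵥ a) := by
    conv_lhs => rw [hb']
    simp only [sub_dotProduct, dotProduct_sub, smul_dotProduct, dotProduct_smul, smul_eq_mul,
      dotProduct_comm a v]
    ring
  have hq := abs_le.1 (h v)
  have hq' : v ⬝ᵥ ((A + B) * (A + B) + 1).mulVec v = a ⬝ᵥ a - b ⬝ᵥ b + v ⬝ᵥ v := by
    rw [Matrix.add_mulVec, ← Matrix.mulVec_mulVec, Matrix.add_mulVec, Matrix.add_mulVec,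
      Matrix.one_mulVec, ← ha, ← hb, dotProduct_add, dotProduct_add, hAt, hBt, ← ha, ← hb]
    simp only [dotProduct_add, dotProduct_comm b a]
    ring
  have haa : 0 ≤ a ⬝ᵥ a := Finset.sum_nonneg fun i _ => mul_self_nonneg (a i)
  rw [hq'] at hq
  have h1 : t * (v ⬝ᵥ a) = -(c / s) * (v ⬝ᵥ v) := by linarith
  have h2 : b ⬝ᵥ b = -((c / s) ^ 2 * (v ⬝ᵥ v)) + t ^ 2 * (a ⬝ᵥ a) := by
    linear_combination hbb + 2 * (c / s) * h1
  have h3 : 0 ≤ (1 - t ^ 2) * (a ⬝ᵥ a) := mul_nonneg (by nlinarith) haa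
  have h4 : 0 ≤ (c / s) ^ 2 * (v ⬝ᵥ v) := by positivity
  nlinarith [hq.2]

theorem Dec.qf {K : Mat κ} {B : ℝ} (h : Dec B K) : Qf B (K * K + 1) := by
  have := h 1 0 (by norm_num)
  simpa using this

variable {X : Type*} [TopologicalSpace X]

theorem continuous_inv_mat {M : X → Mat κ} (h : Continuous M) (hu : ∀ x, IsUnit (M x)) :
    Continuous fun x => (M x)⁻¹ := by
  simp only [Matrix.inv_def, Ring.inverse_eq_inv']
  exact (h.matrix_det.inv₀ fun x => ((Matrix.isUnit_iff_isUnit_det _).1 (hu x)).ne_zero).smul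
    h.matrix_adjugate

theorem exists_dec [CompactSpace X] {K : X → Mat κ} (h : Continuous K) (hK : ∀ x, K x ∈ NR κ) :
    ∃ B : ℝ, ∀ x, Dec B (K x) := by
  set C : Set (ℝ × ℝ) := {p | p.1 ^ 2 + p.2 ^ 2 = 1}
  have hC : IsCompact C := by
    refine Metric.isCompact_of_isClosed_isBounded (isClosed_eq (by fun_prop) (by fun_prop)) ?_
    refine (Metric.isBounded_closedBall (x := (0 : ℝ × ℝ)) (r := 1)).subset fun p hp => ?_
    have hp' : p.1 ^ 2 + p.2 ^ 2 = 1 := hp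
    rw [mem_closedBall_zero_iff, Prod.norm_def, sup_le_iff, Real.norm_eq_abs, Real.norm_eq_abs,
      ← sq_le_one_iff_abs_le_one, ← sq_le_one_iff_abs_le_one]
    constructor <;> nlinarith [sq_nonneg p.1, sq_nonneg p.2]
  have : CompactSpace C := isCompact_iff_compactSpace.1 hC
  have hP : Continuous fun p : X × C => (p.2.1.1 • (1 : Mat κ) + p.2.1.2 • K p.1) := by fun_prop
  have hPu : ∀ p : X × C, IsUnit (p.2.1.1 • (1 : Mat κ) + p.2.1.2 • K p.1) := fun p =>
    hK _ _ _ (by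
      have hp : p.2.1.1 ^ 2 + p.2.1.2 ^ 2 = 1 := p.2.2
      by_contra! h0; rw [h0.1, h0.2] at hp; norm_num at hp)
  have hPi := continuous_inv_mat hP hPu
  have hM : Continuous fun p : X × C => (K p.1 * K p.1 + 1) *
      ((p.2.1.1 • (1 : Mat κ) + p.2.1.2 • K p.1)⁻¹ * (p.2.1.1 • (1 : Mat κ) + p.2.1.2 • K p.1)⁻¹) := by
    have hk : Continuous fun p : X × C => K p.1 * K p.1 + 1 := by fun_prop
    exact hk.mul (hPi.mul hPi)
  set M := fun p : X × C => (K p.1 * K p.1 + 1) *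
      ((p.2.1.1 • (1 : Mat κ) + p.2.1.2 • K p.1)⁻¹ * (p.2.1.1 • (1 : Mat κ) + p.2.1.2 • K p.1)⁻¹)
  have hq : Continuous fun p => ∑ i, ∑ j, |M p i j| :=
    continuous_finsetSum _ fun i _ => continuous_finsetSum _ fun j _ =>
      (hM.matrix_elem i j).abs
  obtain ⟨B, hB⟩ := (isCompact_range hq).bddAbove
  exact ⟨B, fun x c s hcs => (Qf_sum (M (x, ⟨(c, s), hcs⟩))).mono
    (hB ⟨(x, ⟨(c, s), hcs⟩), rfl⟩)⟩

end quad

namespace BDat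
variable {ι : Type*} {κ : Type} [Fintype κ] [DecidableEq κ] (D : BDat ι (Mat κ))

variable {D} in
theorem mem_Zs_iff {b : Mat κ} (hb : b ∈ D.S) : b ∈ D.Zs ↔ -(D.e * b) ∈ NR κ := by
  have he : ∀ c s : ℝ, c • D.e + s • b = D.e * (c • (1 : Mat κ) + s • (-(D.e * b))) := fun c s => by
    rw [mul_add, mul_smul_comm, mul_smul_comm, mul_one, mul_neg, ← mul_assoc, D.e_sq, neg_one_mul,
      neg_neg]
  have hu : ∀ M : Mat κ, IsUnit (D.e * M) ↔ IsUnit M := fun M =>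
    ⟨fun h => by
      have h2 := D.e_unit.mul h
      rw [← mul_assoc, D.e_sq, neg_one_mul] at h2
      exact (IsUnit.neg_iff _).1 h2, fun h => D.e_unit.mul h⟩
  constructor
  · rintro ⟨-, h⟩ c s hcs
    rw [← hu, ← he]
    wlog hs : 0 ≤ s generalizing c s
    · have := this (-c) (-s) (by simpa using hcs) (by linarith)
      rw [← IsUnit.neg_iff]
      convert this using 1
      module
    have hr : 0 < c ^ 2 + s ^ 2 := by rcases hcs with h | h <;> positivity
    obtain ⟨r, hr0, hr⟩ : ∃ r : ℝ, 0 < r ∧ r ^ 2 = c ^ 2 + s ^ 2 :=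
      ⟨√(c ^ 2 + s ^ 2), Real.sqrt_pos.2 hr, Real.sq_sqrt hr.le⟩
    have hp := Real.pi_pos
    have h1 : (c / r) ^ 2 + (s / r) ^ 2 = 1 := by field_simp; linarith
    have hcr := abs_le.1 ((sq_le_one_iff_abs_le_one _).1 (by nlinarith [sq_nonneg (s / r)] :
      (c / r) ^ 2 ≤ 1))
    obtain ⟨t, ht⟩ : ∃ t : I, Real.pi * t = Real.arccos (c / r) :=
      ⟨⟨Real.arccos (c / r) / Real.pi, div_nonneg (Real.arccos_nonneg _) hp.le,
        (div_le_one hp).2 (Real.arccos_le_pi _)⟩, by field_simp⟩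
    have hc : cs t = c / r := by rw [cs, ht, Real.cos_arccos hcr.1 hcr.2]
    have hs' : sn t = s / r := by
      rw [sn, ht, Real.sin_arccos, Real.sqrt_eq_iff_mul_self_eq (by linarith [sq_nonneg (s / r)])
        (by positivity)]
      linarith
    have := (h t).smul (Units.mk0 r hr0.ne')
    rw [pen, hc, hs'] at this
    convert this using 1
    rw [Units.smul_mk0, smul_add, smul_smul, smul_smul, mul_div_cancel₀ _ hr0.ne',
      mul_div_cancel₀ _ hr0.ne']
  · intro h
    refine ⟨hb, fun s => ?_⟩
    rw [pen, he, hu]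
    refine h _ _ ?_
    by_contra! h0
    have := cs_sn s
    rw [h0.1, h0.2] at this
    norm_num at this

/-- Weighted Newton iteration. -/
def nw (t : ℝ) (b : Mat κ) : Mat κ := (1 - t / 2) • b - (t / 2) • (D.e * b⁻¹ * D.e)

variable {D} in
theorem nw_K {b : Mat κ} (t : ℝ) (hb : IsUnit b) :
    -(D.e * D.nw t b) = (1 - t / 2) • (-(D.e * b)) - (t / 2) • (-(D.e * b))⁻¹ := by
  have h1 : (-(D.e * b))⁻¹ = b⁻¹ * D.e := by
    refine Matrix.inv_eq_left_inv ?_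
    rw [mul_neg, mul_assoc, ← mul_assoc D.e, D.e_sq, neg_one_mul, mul_neg, neg_neg, mat_inv_mul hb]
  rw [h1, nw, mul_sub, mul_smul_comm, mul_smul_comm, mul_assoc, D.e_e]
  module

variable {D} in
theorem inv_mem {b : Mat κ} (hb : b ∈ D.S) (hu : IsUnit b) : D.e * b⁻¹ * D.e ∈ D.S := by
  have h1 := mat_mul_inv hu
  have h2 := mat_inv_mul hu
  have hs : star b⁻¹ = -b⁻¹ := by
    refine hu.star.mul_right_cancel ?_
    rw [← star_mul, h1, hb.1, neg_mul_neg, h2, star_one]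
  have hc : ∀ l, b⁻¹ * D.c l = D.ε l • (D.c l * b⁻¹) := fun l => by
    have h3 : b⁻¹ * (D.ε l • (b * D.c l)) * b⁻¹ = b⁻¹ * (D.c l * b) * b⁻¹ := by
      rw [hb.2, smul_smul, D.ε_sq, one_smul]
    rw [mul_smul_comm, smul_mul_assoc, ← mul_assoc, h2, one_mul, mul_assoc, mul_assoc, h1,
      mul_one] at h3
    exact h3.symm
  refine ⟨?_, fun l => ?_⟩
  · rw [star_mul, star_mul, D.e_star, hs]; noncomm_ring
  · rw [mul_assoc, D.e_c, mul_smul_comm, mul_assoc, ← mul_assoc _ (D.c l), hc, smul_mul_assoc,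
      mul_smul_comm, smul_smul, D.ε_sq, one_smul, mul_assoc, ← mul_assoc D.e (D.c l), D.e_c,
      smul_mul_assoc, mul_assoc, ← mul_assoc]
    simp only [mul_assoc]

variable {D} in
theorem isUnit_of_mem_Zs {b : Mat κ} (hb : b ∈ D.Zs) : IsUnit b := by
  have := D.e_unit.mul (NR_isUnit ((mem_Zs_iff hb.1).1 hb))
  rwa [mul_neg, D.e_e, neg_neg] at this

variable {D} in
theorem nw_mem {b : Mat κ} (hb : b ∈ D.Zs) (t : I) : D.nw t b ∈ D.Zs := by
  have hu := isUnit_of_mem_Zs hb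
  have hS : D.nw t b ∈ D.S := D.S.sub_mem (D.S.smul_mem _ hb.1) (D.S.smul_mem _ (inv_mem hb.1 hu))
  rw [mem_Zs_iff hS, nw_K _ hu]
  exact NR_newton ((mem_Zs_iff hb.1).1 hb) (by linarith [t.2.2]) (by linarith [t.2.1])

variable {D} in
theorem mem_Yp_of_Zs {b : Mat κ} (hb : b ∈ D.Zs) (h : b * D.e = -(D.e * b)) : b ∈ D.Yp :=
  ⟨⟨hb.1, isUnit_of_mem_Zs hb⟩, h⟩

variable {D} in
theorem nw_mem_Yp {b : Mat κ} (hb : b ∈ D.Yp) (t : I) : D.nw t b ∈ D.Yp := by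
  refine mem_Yp_of_Zs (nw_mem (D.Yp_sub_Zs isUnit_one_add_star_mul hb) t) ?_
  have h1 : b⁻¹ * D.e = -(D.e * b⁻¹) := by
    refine hb.1.2.mul_right_cancel ?_
    rw [neg_mul, mul_assoc, mul_assoc, mat_inv_mul hb.1.2, mul_one,
      show D.e * b = -(b * D.e) by rw [hb.2, neg_neg], mul_neg, ← mul_assoc, mat_inv_mul hb.1.2,
      one_mul]
  have h2 : D.e * b⁻¹ * D.e = b⁻¹ := by rw [mul_assoc, h1, mul_neg, D.e_e, neg_neg]
  rw [nw, h2, sub_mul, mul_sub, smul_mul_assoc, smul_mul_assoc, mul_smul_comm, mul_smul_comm, hb.2,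
    h1]
  module

variable {X : Type*} [TopologicalSpace X]

theorem continuous_nw {t : X → ℝ} {b : X → Mat κ} (ht : Continuous t) (hb : Continuous b)
    (hu : ∀ x, IsUnit (b x)) : Continuous fun x => D.nw (t x) (b x) := by
  have := continuous_inv_mat hb hu
  unfold nw
  fun_prop

theorem htp_nw {U : Set (Mat κ)} (hU : ∀ b ∈ U, IsUnit b) (h : ∀ b ∈ U, ∀ t : I, D.nw t b ∈ U)
    {b : X → Mat κ} (hb : Continuous b) (hbU : ∀ x, b x ∈ U) :
    FHtp U b fun x => D.nw 1 (b x) := by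
  refine ⟨fun t x => D.nw t (b x), D.continuous_nw (by fun_prop) (by fun_prop)
    fun p => hU _ (hbU _), ?_, ?_, fun t x => h _ (hbU x) t⟩
  · ext1 x; simp [nw]
  · ext1 x; simp

/-- Iterated Newton steps. -/
def nit (k : ℕ) : Mat κ → Mat κ := (D.nw 1)^[k]

theorem htp_nit {U : Set (Mat κ)} (hU : ∀ b ∈ U, IsUnit b) (h : ∀ b ∈ U, ∀ t : I, D.nw t b ∈ U)
    (k : ℕ) {b : X → Mat κ} (hb : Continuous b) (hbU : ∀ x, b x ∈ U) :
    FHtp U b fun x => D.nit k (b x) := by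
  induction k with
  | zero => exact .refl hb hbU
  | succ k ih =>
    simp only [nit, Function.iterate_succ_apply'] at ih ⊢
    exact ih.trans (D.htp_nw hU h ih.cont_right ih.prop_right)

variable {D} in
theorem dec_nit {b : Mat κ} (hb : b ∈ D.Zs) {B : ℝ} (hB : Dec B (-(D.e * b))) (k : ℕ) :
    D.nit k b ∈ D.Zs ∧ Dec (B / 2 ^ k) (-(D.e * D.nit k b)) := by
  induction k with
  | zero => exact ⟨hb, by simpa [nit] using hB⟩
  | succ k ih =>
    simp only [nit, Function.iterate_succ_apply'] at ih ⊢
    have h1 := nw_mem ih.1 1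
    refine ⟨h1, ?_⟩
    have := ih.2.newton ((mem_Zs_iff ih.1.1).1 ih.1)
    rw [nw_K _ (isUnit_of_mem_Zs ih.1), pow_succ, ← div_div]
    norm_num at this ⊢
    exact this

/-- Deformation of the part commuting with `e`. -/
def skw (t : ℝ) (b : Mat κ) : Mat κ := b - (t / 2) • (b - D.e * b * D.e)

variable {D} in
theorem skw_mem {b : Mat κ} (hb : b ∈ D.S) {r : ℝ} (hr : r < 1)
    (h : Qf r (-(D.e * b) * (-(D.e * b)) + 1)) (t : I) : D.skw t b ∈ D.Zs := by
  have heS : D.e * b * D.e ∈ D.S := by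
    refine ⟨?_, fun l => ?_⟩
    · rw [star_mul, star_mul, D.e_star, hb.1]; noncomm_ring
    · rw [mul_assoc, D.e_c, mul_smul_comm, mul_assoc, ← mul_assoc _ (D.c l), hb.2, smul_mul_assoc,
        mul_smul_comm, smul_smul, D.ε_sq, one_smul, mul_assoc, ← mul_assoc D.e (D.c l), D.e_c,
        smul_mul_assoc]
      simp only [mul_assoc]
  have hS : D.skw t b ∈ D.S := D.S.sub_mem hb (D.S.smul_mem _ (D.S.sub_mem hb heS))
  rw [mem_Zs_iff hS]
  set A := (1 / 2 : ℝ) • (-(D.e * b) - b * D.e) with hA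
  set B := (1 / 2 : ℝ) • (-(D.e * b) + b * D.e) with hB
  have hAB : A + B = -(D.e * b) := by rw [hA, hB]; module
  have hsA : star A = A := by
    simp only [hA, star_smul, star_sub, star_neg, star_mul, D.e_star, hb.1, star_trivial]
    congr 1; noncomm_ring
  have hsB : star B = -B := by
    simp only [hB, star_smul, star_add, star_neg, star_mul, D.e_star, hb.1, star_trivial]
    rw [← smul_neg]
    congr 1; noncomm_ring
  rw [← hAB] at h
  have := isUnit_skew hsA hsB hr h (t := 1 - t) (by linarith [t.2.2]) (by linarith [t.2.1])
  convert this using 1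
  rw [hA, hB, skw, mul_sub, mul_smul_comm, mul_sub, mul_assoc D.e b, D.e_e]
  module

variable {D} in
theorem skw_one_mem {b : Mat κ} (hb : b ∈ D.S) {r : ℝ} (hr : r < 1)
    (h : Qf r (-(D.e * b) * (-(D.e * b)) + 1)) : D.skw 1 b ∈ D.Yp := by
  refine mem_Yp_of_Zs (skw_mem hb hr h 1) ?_
  simp only [skw, sub_mul, mul_sub, smul_mul_assoc, mul_smul_comm, mul_assoc, D.e_sq, D.e_e]
  simp only [mul_neg, mul_one]
  module

variable {D} in
theorem skw_Yp {b : Mat κ} (hb : b ∈ D.Yp) (t : ℝ) : D.skw t b = b := by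
  rw [skw, mul_assoc, hb.2, mul_neg, D.e_e, neg_neg, sub_self, smul_zero, sub_zero]

/-- Deformation of `Zs` to `Yp`. -/
theorem exists_Yp {X X' : Type} [TopologicalSpace X] [TopologicalSpace X'] [CompactSpace X]
    [CompactSpace X'] {z : X → Mat κ} (hz : Continuous z) (hzZ : ∀ x, z x ∈ D.Zs) {j : X' → X}
    {b : X' → Mat κ} (hbY : ∀ x, b x ∈ D.Yp) (h : FHtp D.Zs (z ∘ j) b) :
    ∃ β : X → Mat κ, FHtp D.Zs β z ∧ (∀ x, β x ∈ D.Yp) ∧ FHtp D.Yp (β ∘ j) b := by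
  have hZn := fun c (hc : c ∈ D.Zs) t => nw_mem hc t
  have hZu := fun c (hc : c ∈ D.Zs) => isUnit_of_mem_Zs hc
  have hb := h.cont_right
  obtain ⟨H, hc, h0, h1, hH⟩ := h
  obtain ⟨B, hB⟩ := exists_dec (K := fun x => -(D.e * z x)) (by fun_prop)
    fun x => (mem_Zs_iff (hzZ x).1).1 (hzZ x)
  obtain ⟨B', hB'⟩ := exists_dec (K := fun p : I × X' => -(D.e * H p.1 p.2)) (by fun_prop)
    fun p => (mem_Zs_iff (hH p.1 p.2).1).1 (hH p.1 p.2)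
  obtain ⟨k, hk⟩ : ∃ k : ℕ, 2 * max B B' < 2 ^ k := pow_unbounded_of_one_lt _ one_lt_two
  have hle : ∀ C, C ≤ max B B' → C / 2 ^ k ≤ 1 / 2 := fun C hC => by
    rw [div_le_iff₀ (by positivity)]; linarith
  have q1 : ∀ x, Qf (1 / 2) (-(D.e * D.nit k (z x)) * (-(D.e * D.nit k (z x))) + 1) := fun x =>
    (dec_nit (hzZ x) (hB x) k).2.qf.mono (hle _ (le_max_left _ _))
  have q2 : ∀ t x, Qf (1 / 2) (-(D.e * D.nit k (H t x)) * (-(D.e * D.nit k (H t x))) + 1) :=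
    fun t x => (dec_nit (hH t x) (hB' (t, x)) k).2.qf.mono (hle _ (le_max_right _ _))
  have n1 := D.htp_nit hZu hZn k hz hzZ
  have n2 := D.htp_nit hZu hZn k (X := I × X') (b := fun p => H p.1 p.2) hc fun p => hH _ _
  refine ⟨fun x => D.skw 1 (D.nit k (z x)), ?_, fun x => skw_one_mem (n1.prop_right x).1
    (by norm_num) (q1 x), ?_⟩
  · refine Htp.symm (n1.trans ⟨fun t x => D.skw t (D.nit k (z x)), ?_, ?_, ?_, fun t x =>
      skw_mem (n1.prop_right x).1 (by norm_num) (q1 x) t⟩)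
    · have : Continuous fun p : I × X => D.nit k (z p.2) := n1.cont_right.comp continuous_snd
      unfold skw; fun_prop
    · ext1 x; simp [skw]
    · ext1 x; simp
  · refine Htp.trans (G := fun x => D.skw 1 (D.nit k (b x))) ⟨fun t x => D.skw 1 (D.nit k (H t x)),
      ?_, ?_, ?_, fun t x => skw_one_mem (n2.prop_right (t, x)).1 (by norm_num) (q2 t x)⟩ ?_
    · have := n2.cont_right
      unfold skw; fun_prop
    · ext1 x; simp [h0]
    · ext1 x; simp [h1]
    · have := (D.htp_nit (fun c hc => hc.1.2) (fun c hc t => nw_mem_Yp hc t) k hb hbY).symm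
      convert this using 2 with x
      exact skw_Yp (this.prop_left x) 1

end BDat

section approx

theorem exists_odd_part (q : Polynomial ℝ) :
    ∃ t : Polynomial ℝ, ∀ z : ℝ, (q.eval z - q.eval (-z)) / 2 = z * t.eval (z ^ 2) := by
  induction q using Polynomial.induction_on' with
  | add p q hp hq =>
    obtain ⟨s, hs⟩ := hp
    obtain ⟨t, ht⟩ := hq
    refine ⟨s + t, fun z => ?_⟩
    rw [Polynomial.eval_add, Polynomial.eval_add, Polynomial.eval_add, mul_add, ← hs, ← ht]
    ring
  | monomial n a =>
    rcases Nat.even_or_odd' n with ⟨k, rfl | rfl⟩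
    · exact ⟨0, fun z => by simp [pow_mul]⟩
    · refine ⟨Polynomial.monomial k a, fun z => ?_⟩
      simp only [Polynomial.eval_monomial, pow_succ, pow_mul]
      ring

variable {E : Type*} [NormedAddCommGroup E] [NormedSpace ℝ E] {X : Type*} [TopologicalSpace X]
  [CompactSpace X]

/-- Approximation of odd functions by odd polynomials. -/
theorem exists_odd_approx {h : X × I → E} (hc : Continuous h)
    (ho : ∀ x u, h (x, σ u) = -h (x, u)) {δ : ℝ} (hδ : 0 < δ) :
    ∃ (n : ℕ) (t : Fin n → Polynomial ℝ) (p : Fin n → I),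
      (∀ (x : X) (u : I), ‖∑ k, ((2 * (u : ℝ) - 1) * (t k).eval ((2 * (u : ℝ) - 1) ^ 2)) • h (x, p k) -
        h (x, u)‖ < δ) ∧ ∀ x, ∑ k, (t k).eval 1 • h (x, p k) = h (x, 1) := by
  set H : C(I, C(X, E)) := ⟨fun u => ⟨fun x => h (x, u), by fun_prop⟩,
    ContinuousMap.continuous_of_continuous_uncurry _ (by
      change Continuous fun q : I × X => h (q.2, q.1); fun_prop)⟩ with hH
  have hT := bernsteinApproximation_uniform H
  obtain ⟨n, hn⟩ := Filter.eventually_atTop.1 (Metric.tendsto_nhds.1 hT δ hδ)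
  have hn1 := hn (n + 1) (Nat.le_succ n)
  set N := n + 1
  have hB : ∀ (x : X) (u : I), ‖∑ k : Fin (N + 1), bernstein N k u •
      h (x, bernstein.z k) - h (x, u)‖ < δ := fun x u => by
    have h1 := ((bernsteinApproximation N H u - H u).norm_coe_le_norm x).trans
      ((bernsteinApproximation N H - H).norm_coe_le_norm u)
    rw [← dist_eq_norm] at h1
    rw [dist_eq_norm] at hn1
    refine lt_of_le_of_lt ?_ hn1
    refine le_trans (le_of_eq ?_) (((bernsteinApproximation N H u - H u).norm_coe_le_norm x).trans
      ((bernsteinApproximation N H - H).norm_coe_le_norm u))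
    rw [bernsteinApproximation.apply]
    simp [hH]
  choose t ht using fun k : Fin (N + 1) => exists_odd_part
    ((bernsteinPolynomial ℝ N k).comp (Polynomial.C (1 / 2) * (1 + Polynomial.X)))
  have he : ∀ (k : Fin (N + 1)) (u : I), (2 * (u : ℝ) - 1) * (t k).eval ((2 * (u : ℝ) - 1) ^ 2) =
      (bernstein N k u - bernstein N k (σ u)) / 2 := fun k u => by
    rw [← ht]
    simp only [Polynomial.eval_comp, Polynomial.eval_mul, Polynomial.eval_add, Polynomial.eval_one,
      Polynomial.eval_X, Polynomial.eval_C, bernstein, Polynomial.toContinuousMapOn_apply,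
      Polynomial.toContinuousMap_apply, unitInterval.coe_symm_eq]
    ring_nf
  refine ⟨N + 1, t, fun k => bernstein.z k, fun x u => ?_, fun x => ?_⟩
  · have h1 := hB x u
    have h2 := hB x (σ u)
    rw [ho] at h2
    have h3 : ∑ k, ((2 * (u : ℝ) - 1) * (t k).eval ((2 * (u : ℝ) - 1) ^ 2)) •
        h (x, bernstein.z k) - h (x, u) =
        (1 / 2 : ℝ) • ((∑ k : Fin (N + 1), bernstein N k u •
          h (x, bernstein.z k) - h (x, u)) - (∑ k : Fin (N + 1), bernstein N k (σ u) •
          h (x, bernstein.z k) - -h (x, u))) := by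
      simp only [he, sub_div, sub_smul, Finset.sum_sub_distrib]
      simp only [div_eq_inv_mul, mul_smul, ← Finset.smul_sum]
      module
    rw [h3, norm_smul]
    have := norm_sub_le (∑ k : Fin (N + 1), bernstein N k u •
          h (x, bernstein.z k) - h (x, u)) (∑ k : Fin (N + 1), bernstein N k (σ u) •
          h (x, bernstein.z k) - -h (x, u))
    rw [Real.norm_eq_abs, abs_of_pos (by norm_num)]
    linarith
  · have h1 : ∀ k, (t k).eval 1 = (bernstein N k 1 - bernstein N k 0) / 2 := fun k => by
      have := he k 1
      norm_num at this
      exact this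
    have h2 := congrArg (fun f : C(X, E) => f x) (bernsteinApproximation.apply_one
      (Nat.succ_ne_zero n) H)
    have h3 := congrArg (fun f : C(X, E) => f x) (bernsteinApproximation.apply_zero N H)
    rw [bernsteinApproximation.apply] at h2 h3
    simp [hH] at h2 h3
    have h4 : h (x, 0) = -h (x, 1) := by rw [← ho]; simp
    simp only [h1, sub_div, sub_smul, Finset.sum_sub_distrib]
    simp only [div_eq_inv_mul, mul_smul, ← Finset.smul_sum]
    rw [h2, h3, h4]
    module

/-- The angle with given normalized cosine. -/
def ac (u : I) : I := ⟨Real.arccos (2 * u - 1) / Real.pi, div_nonneg (Real.arccos_nonneg _)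
  Real.pi_pos.le, (div_le_one Real.pi_pos).2 (Real.arccos_le_pi _)⟩

/-- The smaller angle with given positive sine. -/
def as (y : ℝ) : I := Set.projIcc 0 1 zero_le_one (Real.arcsin y / Real.pi)

theorem ac_symm (u : I) : ac (σ u) = σ (ac u) := by
  refine Subtype.ext ?_
  have h : (2 * (σ u : ℝ) - 1) = -(2 * (u : ℝ) - 1) := by rw [unitInterval.coe_symm_eq]; ring
  rw [unitInterval.coe_symm_eq]
  simp only [ac]
  rw [h, Real.arccos_neg, sub_div, div_self Real.pi_ne_zero]

@[fun_prop] theorem continuous_ac : Continuous ac :=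
  Continuous.subtype_mk (by have := Real.continuous_arccos; fun_prop) _

@[fun_prop] theorem continuous_as : Continuous as := by
  have := Real.continuous_arcsin
  exact continuous_projIcc.comp (by fun_prop)

theorem cs_mem (s : I) : -1 ≤ cs s ∧ cs s ≤ 1 := ⟨Real.neg_one_le_cos _, Real.cos_le_one _⟩

theorem sn_le_one (s : I) : sn s ≤ 1 := Real.sin_le_one _

/-- The normalized cosine. -/
def uc (s : I) : I :=
  ⟨(1 + cs s) / 2, by linarith [(cs_mem s).1], by linarith [(cs_mem s).2]⟩

/-- The normalized sine. -/
def us (s : I) : I := ⟨(1 + sn s) / 2, by linarith [sn_nonneg s], by linarith [sn_le_one s]⟩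

theorem ac_uc (s : I) : ac (uc s) = s := by
  refine Subtype.ext ?_
  have h : 2 * ((1 + cs s) / 2) - 1 = Real.cos (Real.pi * s) := by rw [cs]; ring
  simp only [ac, uc]
  rw [h, Real.arccos_cos (mul_nonneg Real.pi_pos.le s.2.1)
    (mul_le_of_le_one_right Real.pi_pos.le s.2.2), mul_div_cancel_left₀ _ Real.pi_ne_zero]

theorem as_sn (s : I) : as (sn s) = s ∨ as (sn s) = σ s := by
  have hp := Real.pi_pos
  rcases le_total (s : ℝ) (1 / 2) with h | h
  · left
    have : Real.arcsin (sn s) / Real.pi = s := by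
      rw [sn, Real.arcsin_sin (by nlinarith [s.2.1]) (by nlinarith), mul_div_cancel_left₀ _ hp.ne']
    rw [as, this, Set.projIcc_val]
  · right
    have : Real.arcsin (sn s) / Real.pi = (σ s : I) := by
      rw [sn, ← Real.sin_pi_sub, Real.arcsin_sin (by nlinarith [s.2.2]) (by nlinarith [s.2.2]),
        unitInterval.coe_symm_eq]
      field_simp
    rw [as, this, Set.projIcc_val]

/-- Approximation of paths from `e` to `-e` by trigonometric polynomials. -/
theorem exists_path_approx {F : X × I → E} (hc : Continuous F) {e : E} (h0 : ∀ x, F (x, 0) = e)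
    (h1 : ∀ x, F (x, 1) = -e) (S : Submodule ℝ E) (hS : ∀ z, F z ∈ S) {δ : ℝ} (hδ : 0 < δ) :
    ∃ (m : ℕ) (c : X → ℕ → E × E), Continuous c ∧ (∀ x, (c x 0).1 = e) ∧
      (∀ x k, (c x k).1 ∈ S ∧ (c x k).2 ∈ S) ∧ ∀ (x : X) (s : I),
      ‖∑ k ∈ Finset.range (m + 1), sn s ^ (2 * k) • (cs s • (c x k).1 + sn s • (c x k).2) -
        F (x, s)‖ < δ := by
  obtain ⟨n, t, p, hA, hA1⟩ := exists_odd_approx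
    (h := fun z : X × I => (1 / 2 : ℝ) • (F (z.1, ac z.2) - F (z.1, σ (ac z.2))))
    (by fun_prop) (fun x u => by simp only [ac_symm, symm_symm]; module) (half_pos hδ)
  set g : X → I → E := fun x s => (1 / 2 : ℝ) • (F (x, s) + F (x, σ s)) with hg
  obtain ⟨n', t', p', hB, -⟩ := exists_odd_approx
    (h := fun z : X × I => g z.1 (as (max (2 * (z.2 : ℝ) - 1) 0)) -
      g z.1 (as (max (1 - 2 * (z.2 : ℝ)) 0)))
    (by simp only [hg]; fun_prop) (fun x u => by
      simp only [unitInterval.coe_symm_eq]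
      rw [show 2 * (1 - (u : ℝ)) - 1 = 1 - 2 * u by ring,
        show 1 - 2 * (1 - (u : ℝ)) = 2 * u - 1 by ring]; abel) (half_pos hδ)
  set hAf : X → Fin n → E := fun x k => (1 / 2 : ℝ) • (F (x, ac (p k)) - F (x, σ (ac (p k)))) with hAf_def
  set hBf : X → Fin n' → E := fun x k => g x (as (max (2 * (p' k : ℝ) - 1) 0)) -
      g x (as (max (1 - 2 * (p' k : ℝ)) 0)) with hBf_def
  set q : Fin n → Polynomial ℝ := fun k => (t k).comp (1 - Polynomial.X) with hq
  obtain ⟨m, hm⟩ : ∃ m, (∀ k, (q k).natDegree ≤ m) ∧ ∀ k, (t' k).natDegree ≤ m :=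
    ⟨(Finset.univ.sup fun k => (q k).natDegree) ⊔ Finset.univ.sup fun k => (t' k).natDegree,
      fun k => le_sup_of_le_left (Finset.le_sup (f := fun k => (q k).natDegree) (Finset.mem_univ k)),
      fun k => le_sup_of_le_right
        (Finset.le_sup (f := fun k => (t' k).natDegree) (Finset.mem_univ k))⟩
  have hgS : ∀ x s, g x s ∈ S := fun x s => S.smul_mem _ (S.add_mem (hS _) (hS _))
  refine ⟨m, fun x j => (∑ k, (q k).coeff j • hAf x k, ∑ k, (t' k).coeff j • hBf x k), ?_,
    fun x => ?_, fun x j => ⟨?_, ?_⟩, fun x s => ?_⟩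
  · refine continuous_pi fun j => ?_
    simp only [hAf_def, hBf_def, hg]
    fun_prop
  · change ∑ k, (q k).coeff 0 • hAf x k = e
    refine Eq.trans ?_ ((hA1 x).trans ?_)
    · refine Finset.sum_congr rfl fun k _ => ?_
      rw [hq, Polynomial.coeff_zero_eq_eval_zero, Polynomial.eval_comp]
      simp [hAf_def]
    · have : ac 1 = 0 := Subtype.ext (by simp [ac]; norm_num)
      simp only [this, unitInterval.symm_zero, h0, h1]
      module
  · change ∑ k, (q k).coeff j • hAf x k ∈ S
    exact S.sum_mem fun k _ => S.smul_mem _ (S.smul_mem _ (S.sub_mem (hS _) (hS _)))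
  · change ∑ k, (t' k).coeff j • hBf x k ∈ S
    exact S.sum_mem fun k _ => S.smul_mem _ (S.sub_mem (hgS _ _) (hgS _ _))
  · have h2 := hA x (uc s)
    have h3 := hB x (us s)
    have e1 : 2 * ((uc s : I) : ℝ) - 1 = cs s := by simp only [uc]; ring
    have e2 : 2 * ((us s : I) : ℝ) - 1 = sn s := by simp only [us]; ring
    have e3 : 1 - 2 * ((us s : I) : ℝ) = -sn s := by simp only [us]; ring
    have hs := sn_nonneg s
    have hg0 : g x (as 0) = 0 := by
      have : as 0 = 0 := by simp [as]
      rw [this]; simp [hg, h0, h1]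
    have hgs : g x (as (sn s)) = g x s := by
      rcases as_sn s with h | h <;> rw [h]
      simp only [hg, unitInterval.symm_symm]; rw [add_comm]
    simp only [e1, e2, e3, ac_uc, max_eq_left hs, max_eq_right (neg_nonpos.2 hs), hg0, hgs,
      sub_zero] at h2 h3
    have hs2 : cs s ^ 2 = 1 - sn s ^ 2 := by linarith [cs_sn s]
    have e4 : ∀ k, (t k).eval (cs s ^ 2) = ∑ j ∈ Finset.range (m + 1), (q k).coeff j * (sn s ^ 2) ^ j :=
      fun k => by
        rw [← Polynomial.eval_eq_sum_range' (Nat.lt_succ_of_le (hm.1 k)), hs2, hq,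
          Polynomial.eval_comp]; simp
    have e5 : ∀ k, (t' k).eval (sn s ^ 2) = ∑ j ∈ Finset.range (m + 1), (t' k).coeff j * (sn s ^ 2) ^ j :=
      fun k => by rw [← Polynomial.eval_eq_sum_range' (Nat.lt_succ_of_le (hm.2 k))]
    have e6 : ∑ j ∈ Finset.range (m + 1), sn s ^ (2 * j) • (cs s • (∑ k, (q k).coeff j • hAf x k) +
        sn s • ∑ k, (t' k).coeff j • hBf x k) =
        ∑ k, (cs s * (t k).eval (cs s ^ 2)) • hAf x k +
        ∑ k, (sn s * (t' k).eval (sn s ^ 2)) • hBf x k := by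
      simp only [e4, e5, Finset.mul_sum, Finset.sum_smul, smul_add, Finset.sum_add_distrib,
        Finset.smul_sum, smul_smul]
      congr 1
      · rw [Finset.sum_comm]
        refine Finset.sum_congr rfl fun k _ => Finset.sum_congr rfl fun j _ => ?_
        rw [pow_mul]; congr 1; ring
      · rw [Finset.sum_comm]
        refine Finset.sum_congr rfl fun k _ => Finset.sum_congr rfl fun j _ => ?_
        rw [pow_mul]; congr 1; ring
    rw [e6]
    have h4 : F (x, s) = (1 / 2 : ℝ) • (F (x, s) - F (x, σ s)) + g x s := by
      simp only [hg]; module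
    rw [h4, add_sub_add_comm]
    exact (norm_add_le _ _).trans_lt ((add_lt_add h2 h3).trans_eq (add_halves δ))

end approx

namespace SE
variable {S S' : Sys} {X X' : Type} [TopologicalSpace X] [TopologicalSpace X'] {A : Set X}

theorem refl {p : Σ n, X → S.W n} (hc : Continuous p.2) (hA : ∀ a ∈ A, p.2 a = S.w p.1) :
    SE S A p p := by
  obtain ⟨n, f⟩ := p
  exact .htp (.refl hc hA)

theorem iter (k : ℕ) {p : Σ n, X → S.W n} (hc : Continuous p.2)
    (hA : ∀ a ∈ A, p.2 a = S.w p.1) : Continuous ((up S X)^[k] p).2 ∧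
      (∀ a ∈ A, ((up S X)^[k] p).2 a = S.w _) ∧ SE S A p ((up S X)^[k] p) := by
  induction k with
  | zero => exact ⟨hc, hA, .refl hc hA⟩
  | succ k ih =>
    rw [Function.iterate_succ_apply']
    obtain ⟨h1, h2, h3⟩ := ih
    exact ⟨(S.st_cont _).comp h1, fun a ha => by simp [up, h2 a ha, S.st_w], h3.trans (.st h1 h2)⟩

theorem iter_comp (k : ℕ) (p : Σ n, X → S.W n) (j : X' → X) :
    (up S X')^[k] ⟨p.1, p.2 ∘ j⟩ = ⟨((up S X)^[k] p).1, ((up S X)^[k] p).2 ∘ j⟩ := by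
  induction k with
  | zero => rfl
  | succ k ih => rw [Function.iterate_succ_apply', Function.iterate_succ_apply', ih]; rfl

theorem iter_map (Φ : SysHom S S') (k : ℕ) (p : Σ n, X → S.W n) :
    (up S' X)^[k] ⟨p.1, Φ.φ _ ∘ p.2⟩ =
      ⟨((up S X)^[k] p).1, Φ.φ _ ∘ ((up S X)^[k] p).2⟩ := by
  induction k with
  | zero => rfl
  | succ k ih =>
    rw [Function.iterate_succ_apply', Function.iterate_succ_apply', ih]
    refine Sigma.ext rfl (heq_of_eq ?_)
    ext1 x
    exact (Φ.map_st _ _).symm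

end SE

namespace BDat
variable {ι : Type*} {κ : Type} [Fintype κ] [DecidableEq κ] (D : BDat ι (Mat κ))

section
attribute [local instance] Matrix.normedAddCommGroup Matrix.normedSpace

theorem isOpen_units_mat : IsOpen {a : Mat κ | IsUnit a} := by
  have : {a : Mat κ | IsUnit a} = {a : Mat κ | a.det ≠ 0} := by
    ext a; simp [Matrix.isUnit_iff_isUnit_det]
  rw [this]
  exact isOpen_ne_fun (continuous_id.matrix_det) continuous_const

theorem pev_lin (m : ℕ) (c c' : ℕ → Mat κ × Mat κ) (t : ℝ) (s : I) :
    pev m (fun k => ((1 - t) • (c k).1 + t • (c' k).1, (1 - t) • (c k).2 + t • (c' k).2)) s =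
      (1 - t) • pev m c s + t • pev m c' s := by
  simp only [pev, Finset.smul_sum, ← Finset.sum_add_distrib]
  exact Finset.sum_congr rfl fun k _ => by module

variable {X : Type} [TopologicalSpace X] [CompactSpace X]

/-- Approximation of families of paths by polynomial families. -/
theorem exists_poly {F : X → D.Pt} (hF : Continuous F) :
    ∃ (m : ℕ) (c : X → D.PolySet m), Continuous c ∧
      (∀ P : (X → D.Pt) → Prop, (∀ f, P f) → Htp P F fun x => D.evP (c x)) ∧
      ∀ (X' : Type) [TopologicalSpace X'] (j : X' → X) (_ : Continuous j) (b : X' → D.Yp)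
        (_ : Continuous b), (∀ x, (F (j x)).1 = D.penC (b x).1) →
        Htp (fun _ => True) (c ∘ j) fun x => D.stdP m (D.ypz (b x)) := by
  have hc : Continuous fun z : X × I => (F z.1).1 z.2 := by fun_prop
  obtain ⟨δ, hδ, hU⟩ := (isCompact_range hc).exists_thickening_subset_open
    (isOpen_units_mat (κ := κ)) (by rintro _ ⟨z, rfl⟩; exact ((F z.1).2.2.2 z.2).2)
  have hun : ∀ (x : X) (s : I) (a : Mat κ), ‖a - (F x).1 s‖ < δ → IsUnit a := fun x s a h =>
    hU (Metric.mem_thickening_iff.2 ⟨_, ⟨(x, s), rfl⟩, by rwa [dist_eq_norm]⟩)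
  obtain ⟨m, c, hcc, hc0, hcS, hcF⟩ := exists_path_approx hc (fun x => (F x).2.1)
    (fun x => (F x).2.2.1) D.S (fun z => ((F z.1).2.2.2 z.2).1) hδ
  have hcP : ∀ x, c x ∈ D.PolySet m := fun x => ⟨hc0 x, hcS x, fun s => hun x s _ (hcF x s)⟩
  have hconv : ∀ (x : X) (s t : I) (a : Mat κ), ‖a - (F x).1 s‖ < δ →
      ‖((1 - (t : ℝ)) • pev m (c x) s + (t : ℝ) • a) - (F x).1 s‖ < δ := fun x s t a ha => by
    have h1 : pev m (c x) s ∈ Metric.ball ((F x).1 s) δ := by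
      rw [mem_ball_iff_norm]; exact hcF x s
    have h2 : a ∈ Metric.ball ((F x).1 s) δ := by rwa [mem_ball_iff_norm]
    have := (convex_ball ((F x).1 s) δ) h1 h2 (sub_nonneg.2 t.2.2) t.2.1 (sub_add_cancel _ _)
    rwa [mem_ball_iff_norm] at this
  refine ⟨m, fun x => ⟨c x, hcP x⟩, hcc.subtype_mk _, fun P hP => Htp.symm ?_, ?_⟩
  · have hp : Htp D.PathP (fun z : X × I => pev m (c z.1) z.2) (fun z => (F z.1).1 z.2) := by
      refine ⟨fun t z => (1 - (t : ℝ)) • pev m (c z.1) z.2 + (t : ℝ) • (F z.1).1 z.2, ?_,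
        by ext1 z; simp, by ext1 z; simp, fun t x => ?_⟩
      · have h1 : Continuous fun z : X × I => pev m (c z.1) z.2 := continuous_pev m hcc
        have h2 : Continuous fun t : I => (t : ℝ) := continuous_subtype_val
        exact (((continuous_const.sub (h2.comp continuous_fst)).smul (h1.comp continuous_snd)).add
          ((h2.comp continuous_fst).smul (hc.comp continuous_snd)))
      · obtain ⟨h0, h1, h2⟩ := pev_pathP (hcP x)
        refine ⟨?_, ?_, fun s => ⟨?_, ?_⟩⟩
        · simp only [h0, (F x).2.1]; module
        · simp only [h1, (F x).2.2.1]; module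
        · exact D.S.add_mem (D.S.smul_mem _ (h2 s).1) (D.S.smul_mem _ ((F x).2.2.2 s).1)
        · exact hun x s _ (hconv x s t _ (by simpa using hδ))
    exact D.htp_Pt hp (fun _ => rfl) (fun _ => rfl) P hP
  · intro X' _ j hj b hb hFb
    refine htp_subtype (U := D.PolySet m) (F := fun x => c (j x)) (G := fun x => D.stdc (b x).1)
      ⟨fun t x k => ((1 - (t : ℝ)) • (c (j x) k).1 + (t : ℝ) • (D.stdc (b x).1 k).1,
        (1 - (t : ℝ)) • (c (j x) k).2 + (t : ℝ) • (D.stdc (b x).1 k).2), ?_, ?_, ?_, ?_⟩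
      (fun _ => rfl) (fun _ => rfl) _ (by simp)
    · refine continuous_pi fun k => ?_
      have h1 : Continuous fun p : I × X' => c (j p.2) k :=
        (continuous_apply k).comp (hcc.comp (hj.comp continuous_snd))
      have h2 : Continuous fun p : I × X' => D.stdc (b p.2).1 k :=
        (continuous_apply k).comp (D.continuous_stdc.comp
          (continuous_subtype_val.comp (hb.comp continuous_snd)))
      fun_prop
    · ext1 x; ext1 k; simp
    · ext1 x; ext1 k; simp
    · intro t x
      have hs := stdc_mem m (D.Yp_sub_Zs isUnit_one_add_star_mul (b x).2)
      refine ⟨?_, fun k => ⟨D.S.add_mem (D.S.smul_mem _ (hcS _ _).1) (D.S.smul_mem _ (hs.2.1 k).1),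
        D.S.add_mem (D.S.smul_mem _ (hcS _ _).2) (D.S.smul_mem _ (hs.2.1 k).2)⟩, fun s => ?_⟩
      · simp only [hc0, hs.1]; module
      · rw [pev_lin]
        refine hun (j x) s _ (hconv _ s t _ ?_)
        rw [hFb, pev_stdc]
        simpa [penC] using hδ
end

/-- Stable deformation of families of paths to pencils, relative to families of pencils. -/
theorem exists_free {X X' : Type} [TopologicalSpace X] [TopologicalSpace X'] [CompactSpace X]
    [CompactSpace X'] {n : ℕ} {F : X → (D.tw n).Pt} (hF : Continuous F) {j : X' → X}
    (hj : Continuous j) {b : X' → (D.tw n).Yp} (hb : Continuous b)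
    (h : ∀ x, (F (j x)).1 = (D.tw n).penC (b x).1) :
    ∃ (N : ℕ) (β : X → (D.tw N).Yp), Continuous β ∧
      SE D.PS ∅ ⟨N, D.homZP.φ N ∘ D.homYZ.φ N ∘ β⟩ ⟨n, F⟩ ∧ SE D.YpS ∅ ⟨N, β ∘ j⟩ ⟨n, b⟩ := by
  obtain ⟨m, c, hc, h1, h2⟩ := (D.tw n).exists_poly hF
  obtain ⟨N, z, hz, h3, h4⟩ := D.exists_linear m n X c hc
  obtain ⟨k, l, hkl⟩ := (h4 X' j hj b hb (h2 X' j hj b hb h)).exists_iter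
  have hP := SE.iter (S := D.ZS) (A := (∅ : Set X)) k (p := ⟨N, z⟩) hz (by simp)
  have hQ := SE.iter (S := D.YpS) (A := (∅ : Set X')) l (p := ⟨n, b⟩) hb (by simp)
  have e1 := SE.iter_comp (S := D.ZS) k ⟨N, z⟩ j
  have e2 := SE.iter_map D.homYZ l ⟨n, b⟩
  dsimp only at e1 e2
  rw [e1, e2] at hkl
  generalize (SE.up D.ZS X)^[k] ⟨N, z⟩ = P at hP hkl
  generalize (SE.up D.YpS X')^[l] ⟨n, b⟩ = Q at hQ hkl
  obtain ⟨N', z'⟩ := P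
  obtain ⟨N'', b'⟩ := Q
  cases hkl with
  | mk hh =>
  obtain ⟨hz', -, hP⟩ := hP
  obtain ⟨-, -, hQ⟩ := hQ
  obtain ⟨β, g1, g2, g3⟩ := (D.tw N').exists_Yp (z := fun x => (z' x).1)
    (continuous_subtype_val.comp hz') (fun x => (z' x).2) (b := fun x => (b' x).1)
    (fun x => (b' x).2) (by
      obtain ⟨H, H1, H2, H3, -⟩ := hh
      exact ⟨fun t x => (H t x).1, continuous_subtype_val.comp H1, funext fun x =>
        congrArg Subtype.val (congrFun H2 x), funext fun x => congrArg Subtype.val (congrFun H3 x),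
        fun t x => (H t x).2⟩)
  refine ⟨N', fun x => ⟨β x, g2 x⟩, g1.cont_left.subtype_mk _, ?_, ?_⟩
  · refine .trans (.map D.homZP (p := ⟨N', _⟩) (q := ⟨N, z⟩) (.trans (.htp ?_) hP.symm))
      (h3.trans (.htp (h1 _ (by simp)).symm))
    exact htp_subtype g1 (fun _ => rfl) (fun _ => rfl) _ (by simp)
  · refine .trans (.htp ?_) hQ.symm
    exact htp_subtype g3 (fun _ => rfl) (fun _ => rfl) _ (by simp)

end BDat

/-- A collar of a closed subset. -/
structure Collar {X : Type} [TopologicalSpace X] (A : Set X) where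
  κ : I → X → X
  κ_cont : Continuous fun p : I × X => κ p.1 p.2
  κ_zero : ∀ x, κ 0 x = x
  κ_mem : ∀ t, ∀ a ∈ A, κ t a ∈ A
  ψ : X → I
  ψ_cont : Continuous ψ
  ψ_eq : ∀ a ∈ A, ψ a = 1
  mem_of_ne : ∀ x, ψ x ≠ 0 → κ 1 x ∈ A
  closed : IsClosed A

namespace Collar
variable {X : Type} [TopologicalSpace X] {A : Set X} (C : Collar A)
  {W W' : Type*} [TopologicalSpace W] [TopologicalSpace W']

open Classical in
/-- Extension of a map on the interior along a path on the collar. -/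
def push (γ : I → W) (g : X → W) (x : X) : W := if C.ψ x = 0 then g (C.κ 1 x) else γ (σ (C.ψ x))

theorem push_mem (γ : I → W) (g : X → W) {a : X} (ha : a ∈ A) : C.push γ g a = γ 0 := by
  simp [push, C.ψ_eq a ha]

theorem map_push (h : W → W') (γ : I → W) (g : X → W) (x : X) :
    h (C.push γ g x) = C.push (h ∘ γ) (h ∘ g) x := apply_ite _ _ _ _

theorem push_const {w : W} {g : X → W} (hg : ∀ a ∈ A, g a = w) :
    C.push (fun _ => w) g = g ∘ C.κ 1 := by
  ext1 x
  unfold push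
  split_ifs with h
  · rfl
  · exact (hg _ (C.mem_of_ne x h)).symm

theorem continuous_push {T : Type*} [TopologicalSpace T] {γ : T → I → W} {g : T → X → W}
    (hγ : Continuous fun p : T × I => γ p.1 p.2) (hg : Continuous fun p : T × X => g p.1 p.2)
    (h : ∀ t, ∀ a ∈ A, g t a = γ t 1) :
    Continuous fun p : T × X => C.push (γ p.1) (g p.1) p.2 := by
  have hκ : Continuous fun p : T × X => C.κ 1 p.2 :=
    C.κ_cont.comp (continuous_const.prodMk continuous_snd)
  have hψ := C.ψ_cont
  have h1 : ContinuousOn (fun p : T × X => C.push (γ p.1) (g p.1) p.2) {p | C.ψ p.2 = 0} :=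
    (hg.comp (continuous_fst.prodMk hκ)).continuousOn.congr fun p hp => if_pos hp
  have h2 : ContinuousOn (fun p : T × X => C.push (γ p.1) (g p.1) p.2) {p | C.κ 1 p.2 ∈ A} := by
    refine (hγ.comp (by fun_prop : Continuous fun p : T × X => (p.1, σ (C.ψ p.2)))).continuousOn.congr
      fun p hp => ?_
    change C.push (γ p.1) (g p.1) p.2 = γ p.1 (σ (C.ψ p.2))
    unfold push
    split_ifs with h0
    · rw [h0, unitInterval.symm_zero, h _ _ hp]
    · rfl
  have h3 := h1.union_of_isClosed h2 (isClosed_eq (by fun_prop) continuous_const)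
    (C.closed.preimage hκ)
  rw [← continuousOn_univ]
  refine h3.mono fun p _ => ?_
  by_cases hp : C.ψ p.2 = 0
  · exact Or.inl hp
  · exact Or.inr (C.mem_of_ne _ hp)

theorem htp_push_family {w : W} {L : I → I → W} {G : I → X → W}
    (hL : Continuous fun p : I × I => L p.1 p.2) (hG : Continuous fun p : I × X => G p.1 p.2)
    (h : ∀ t, ∀ a ∈ A, G t a = L t 1) (h0 : ∀ t, L t 0 = w) :
    Htp (fun f => ∀ a ∈ A, f a = w) (C.push (L 0) (G 0)) (C.push (L 1) (G 1)) :=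
  ⟨fun t => C.push (L t) (G t), C.continuous_push hL hG h, rfl, rfl, fun t _ ha =>
    (C.push_mem _ _ ha).trans (h0 t)⟩

theorem htp_push {w : W} {γ : I → W} {K : I → X → W} (hK : Continuous fun p : I × X => K p.1 p.2)
    (hγ : Continuous γ) (h : ∀ t, ∀ a ∈ A, K t a = γ t) (h0 : γ 0 = w) :
    Htp (fun f => ∀ a ∈ A, f a = w) (K 0) (C.push γ (K 1)) := by
  have h1 := C.htp_push_family (w := w) (L := fun t s => γ (t * s)) (G := K) (by fun_prop) hK
    (fun t a ha => by rw [mul_one, h t a ha]) fun t => by rw [mul_zero, h0]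
  simp only [zero_mul, one_mul, h0] at h1
  rw [C.push_const fun a ha => by rw [h 0 a ha, h0]] at h1
  refine .trans ⟨fun t => K 0 ∘ C.κ t, hK.comp (continuous_const.prodMk C.κ_cont), ?_, rfl,
    fun t a ha => ?_⟩ h1
  · ext1 x; simp [C.κ_zero]
  · exact (h 0 _ (C.κ_mem t a ha)).trans h0

end Collar

namespace SE
variable {S S' : Sys} {X X' : Type} [TopologicalSpace X] [TopologicalSpace X'] {A : Set X}

/-- `q` is a stabilization of `p`, naturally for maps into the domain. -/
def Stab (S : Sys) (p q : Σ n, X → S.W n) : Prop :=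
  Continuous q.2 ∧ ∀ (Z : Type) [TopologicalSpace Z] (A : Set Z) (g : Z → X), Continuous g →
    (∀ a ∈ A, p.2 (g a) = S.w p.1) → (∀ a ∈ A, q.2 (g a) = S.w q.1) ∧
      SE S A ⟨p.1, p.2 ∘ g⟩ ⟨q.1, q.2 ∘ g⟩

theorem stab_iter (k : ℕ) {p : Σ n, X → S.W n} (hc : Continuous p.2) :
    Stab S p ((up S X)^[k] p) := by
  refine ⟨(iter (A := ∅) k hc (by simp)).1, fun Z _ A g hg hA => ?_⟩
  have := iter (A := A) k (p := ⟨p.1, p.2 ∘ g⟩) (hc.comp hg) hA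
  rw [iter_comp] at this
  exact this.2

end SE

namespace BDat
variable {ι : Type*} {κ : Type} [Fintype κ] [DecidableEq κ] (D : BDat ι (Mat κ))

/-- Pencils. -/
def pc (n : ℕ) (b : (D.tw n).Yp) : (D.tw n).Pt := D.homZP.φ n (D.homYZ.φ n b)

theorem continuous_pc (n : ℕ) : Continuous (D.pc n) := (D.homZP.cont n).comp (D.homYZ.cont n)

/-- The morphism given by pencils. -/
def homYP : SysHom D.YpS D.PS where
  φ := D.pc
  cont := D.continuous_pc
  map_w _ := rfl
  map_st n b := by
    have := D.homZP.map_st n (D.homYZ.φ n b)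
    rw [← D.homYZ.map_st] at this
    exact this

variable {X X' : Type} [TopologicalSpace X] [TopologicalSpace X'] [CompactSpace X]

theorem exists_free_level [CompactSpace X'] {n : ℕ} {F : X → (D.tw n).Pt} (hF : Continuous F)
    {j : X' → X} (hj : Continuous j) {b : X' → (D.tw n).Yp} (hb : Continuous b)
    (h : ∀ x, F (j x) = D.pc n (b x)) :
    ∃ (N : ℕ) (β : X → (D.tw N).Yp) (F' : X → (D.tw N).Pt) (b' : X' → (D.tw N).Yp),
      Continuous β ∧ Htp (fun _ => True) F' (D.pc N ∘ β) ∧ Htp (fun _ => True) b' (β ∘ j) ∧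
      SE.Stab D.PS ⟨n, F⟩ ⟨N, F'⟩ ∧ SE.Stab D.YpS ⟨n, b⟩ ⟨N, b'⟩ := by
  obtain ⟨N, β, hβ, h1, h2⟩ := D.exists_free hF hj hb fun x => congrArg Subtype.val (h x)
  obtain ⟨k₁, l₁, h1⟩ := h1.exists_iter
  obtain ⟨k₂, l₂, h2⟩ := h2.exists_iter
  have h1 := h1.iter k₂
  have h2 := h2.iter k₁
  rw [← Function.iterate_add_apply, ← Function.iterate_add_apply] at h1 h2
  rw [add_comm] at h1
  have e1 := SE.iter_map D.homYP (k₁ + k₂) ⟨N, β⟩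
  have e2 := SE.iter_comp (k₁ + k₂) (S := D.YpS) ⟨N, β⟩ j
  dsimp only at e1 e2
  erw [e1] at h1
  rw [e2] at h2
  have s1 := SE.stab_iter (S := D.PS) (k₂ + l₁) (p := ⟨n, F⟩) hF
  have s2 := SE.stab_iter (S := D.YpS) (k₁ + l₂) (p := ⟨n, b⟩) hb
  have s3 := (SE.stab_iter (S := D.YpS) (k₁ + k₂) (p := ⟨N, β⟩) hβ).1
  generalize (SE.up D.YpS X)^[k₁ + k₂] ⟨N, β⟩ = B at *
  generalize (SE.up D.PS X)^[k₂ + l₁] ⟨n, F⟩ = P at *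
  generalize (SE.up D.YpS X')^[k₁ + l₂] ⟨n, b⟩ = Q at *
  obtain ⟨M, β'⟩ := B
  obtain ⟨M₁, F'⟩ := P
  obtain ⟨M₂, b'⟩ := Q
  cases h1 with
  | mk h1 =>
  cases h2 with
  | mk h2 =>
  exact ⟨M, β', _, _, s3, h1.symm.mono fun _ _ _ => trivial, h2.symm.mono fun _ _ _ => trivial, s1, s2⟩

variable {A : Set X}

/-- Injectivity of the stable map given by pencils. -/
theorem pc_inj (C : Collar A) {p q : Σ n, X → D.YpS.W n} (hp : Continuous p.2)
    (hq : Continuous q.2) (hpA : ∀ a ∈ A, p.2 a = D.YpS.w _) (hqA : ∀ a ∈ A, q.2 a = D.YpS.w _)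
    (h : SE D.PS A ⟨p.1, D.pc _ ∘ p.2⟩ ⟨q.1, D.pc _ ∘ q.2⟩) : SE D.YpS A p q := by
  obtain ⟨k, l, h⟩ := h.exists_iter
  erw [SE.iter_map D.homYP k p, SE.iter_map D.homYP l q] at h
  obtain ⟨hp, hpA, h1⟩ := SE.iter k hp hpA
  obtain ⟨hq, hqA, h2⟩ := SE.iter l hq hqA
  refine h1.trans (.trans ?_ h2.symm)
  generalize (SE.up D.YpS X)^[k] p = p at *
  generalize (SE.up D.YpS X)^[l] q = q at *
  obtain ⟨n, b₀⟩ := p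
  obtain ⟨m, b₁⟩ := q
  cases h with
  | mk h =>
  obtain ⟨H, Hc, H0, H1, HA⟩ := h
  dsimp only at *
  let K : Set (D.tw n).Pt := Set.range (fun p : I × X => H p.1 p.2) ∪ {D.PS.w n}
  let K' : Set (D.tw n).Yp := (Set.range b₀ ∪ Set.range b₁) ∪ {D.YpS.w n}
  have hK : CompactSpace K := isCompact_iff_compactSpace.1
    ((isCompact_range Hc).union isCompact_singleton)
  have hK' : CompactSpace K' := isCompact_iff_compactSpace.1
    (((isCompact_range hp).union (isCompact_range hq)).union isCompact_singleton)
  have hj : ∀ b ∈ K', D.pc n b ∈ K := by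
    rintro _ ((⟨x, rfl⟩ | ⟨x, rfl⟩) | rfl)
    · exact Or.inl ⟨(0, x), congrFun H0 x⟩
    · exact Or.inl ⟨(1, x), congrFun H1 x⟩
    · exact Or.inr rfl
  let j : K' → K := fun b => ⟨D.pc n b.1, hj b.1 b.2⟩
  have hjc : Continuous j := ((D.continuous_pc n).comp continuous_subtype_val).subtype_mk _
  obtain ⟨N, β, F', b', hβ, -, hb, -, hS⟩ := D.exists_free_level (n := n) (X := K) (X' := K')
    (F := Subtype.val) continuous_subtype_val hjc (b := Subtype.val) continuous_subtype_val
    fun _ => rfl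
  obtain ⟨L, Lc, L0, L1, -⟩ := hb
  let w : K' := ⟨D.YpS.w n, Or.inr rfl⟩
  have hw : b' w = D.YpS.w N := (hS.2 Unit Set.univ (fun _ => w) continuous_const
    fun _ _ => rfl).1 () trivial
  have key : ∀ (b : X → (D.tw n).Yp) (hbc : Continuous b) (hbK : ∀ x, b x ∈ K')
      (hbA : ∀ a ∈ A, b a = D.YpS.w n), SE D.YpS A ⟨n, b⟩
        ⟨N, C.push (fun t => L t w) fun x => β (j ⟨b x, hbK x⟩)⟩ := fun b hbc hbK hbA => by
    have hg : Continuous fun x => (⟨b x, hbK x⟩ : K') := hbc.subtype_mk _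
    have h1 := (hS.2 X A _ hg hbA).2
    refine h1.trans (.htp ?_)
    have h2 := C.htp_push (w := D.YpS.w N) (γ := fun t => L t w) (K := fun t x => L t ⟨b x, hbK x⟩)
      (by exact Lc.comp (continuous_fst.prodMk (hg.comp continuous_snd)))
      (by exact Lc.comp (Continuous.prodMk_left w))
      (fun t a ha => by
        have : (⟨b a, hbK a⟩ : K') = w := Subtype.ext (hbA a ha)
        rw [this]) (by rw [L0, hw])
    rw [L0, L1] at h2
    exact h2
  refine (key b₀ hp (fun x => Or.inl (Or.inl ⟨x, rfl⟩)) hpA).trans (.trans (.htp ?_)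
    (key b₁ hq (fun x => Or.inl (Or.inr ⟨x, rfl⟩)) hqA).symm)
  have h3 := C.htp_push_family (w := D.YpS.w N) (L := fun _ t => L t w)
    (G := fun t x => β ⟨H t x, Or.inl ⟨(t, x), rfl⟩⟩)
    (by exact Lc.comp ((continuous_snd).prodMk continuous_const))
    (by exact hβ.comp (Hc.subtype_mk _))
    (fun t a ha => by
      have : (⟨H t a, Or.inl ⟨(t, a), rfl⟩⟩ : K) = j w := Subtype.ext (HA t a ha)
      rw [this, L1]; rfl) (fun t => by rw [L0, hw])
  simp only [H0, H1] at h3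
  exact h3

end BDat

section
variable {A : Type*} [Ring A] [Algebra ℝ A]

/-- Conjugation of `diag(p, q, r)` by a rotation of the first two coordinates. -/
def rt (c s : ℝ) (p q r : A) : M3 A :=
  !![(c * c) • p + (s * s) • q, (c * s) • (p - q), 0;
    (c * s) • (p - q), (s * s) • p + (c * c) • q, 0; 0, 0, r]

theorem rt_self {c s : ℝ} (h : c * c + s * s = 1) (p r : A) : rt c s p p r = dg p p r := by
  simp only [rt, dg, ← add_smul, h, add_comm (s * s), sub_self, smul_zero, one_smul]

theorem rt_zero (p q r : A) : rt 1 0 p q r = dg p q r := by simp [rt, dg]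

theorem rt_one (p q r : A) : rt 0 1 p q r = dg q p r := by simp [rt, dg]

theorem isUnit_rt {c s : ℝ} (h : c * c + s * s = 1) {p q r : A} (hp : IsUnit p) (hq : IsUnit q)
    (hr : IsUnit r) : IsUnit (rt c s p q r) := by
  have e1 : (!![c • 1, -s • 1, 0; s • 1, c • 1, 0; 0, 0, 1] : M3 A) *
      !![c • 1, s • 1, 0; -s • 1, c • 1, 0; 0, 0, 1] = 1 := by
    have h' : s * s + c * c = 1 := by rw [add_comm, h]
    simp [Matrix.one_fin_three, smul_smul, ← add_smul, h, h', mul_comm s c]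
  have e2 : (!![c • 1, s • 1, 0; -s • 1, c • 1, 0; 0, 0, 1] : M3 A) *
      !![c • 1, -s • 1, 0; s • 1, c • 1, 0; 0, 0, 1] = 1 := by
    have h' : s * s + c * c = 1 := by rw [add_comm, h]
    simp [Matrix.one_fin_three, smul_smul, ← add_smul, h, h', mul_comm s c]
  have e3 : rt c s p q r = (!![c • 1, -s • 1, 0; s • 1, c • 1, 0; 0, 0, 1] : M3 A) * dg p q r *
      !![c • 1, s • 1, 0; -s • 1, c • 1, 0; 0, 0, 1] := by
    simp only [dg, rt, Matrix.mul_fin_three, mul_zero, zero_mul, add_zero, zero_add, smul_mul_assoc,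
      mul_smul_comm, one_mul, mul_one, smul_smul, neg_smul, neg_mul, mul_neg]
    congr <;> module
  rw [e3]
  exact (IsUnit.mul ⟨⟨_, _, e1, e2⟩, rfl⟩ (isUnit_dg hp hq hr)).mul ⟨⟨_, _, e2, e1⟩, rfl⟩
end

namespace Collar
variable {X : Type} [TopologicalSpace X] {A : Set X} (C : Collar A)
  {W W' : Type*} [TopologicalSpace W] [TopologicalSpace W'] {R : ℝ → W → W → W'}
  {η ν : I → W} {G : X → W} {w q : W}

theorem push_op (hR : Continuous fun x : ℝ × W × W => R x.1 x.2.1 x.2.2) (hη : Continuous η)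
    (hν : Continuous ν) (hG : Continuous G) (η0 : η 0 = w) (ν0 : ν 0 = w)
    (η1 : η 1 = q) (ν1 : ν 1 = q) (hA : ∀ a ∈ A, G a = q) :
    Htp (fun f => ∀ a ∈ A, f a = R 0 w w) (fun x => R 0 (C.push η G x) w)
      (C.push (fun t => R 0 (η t) (ν t)) fun x => R 0 (G x) q) := by
  have h1 := C.htp_push (w := w) (γ := ν) (K := fun t _ => ν t) (by fun_prop) hν
    (fun _ _ _ => rfl) ν0
  have hp : Continuous (C.push η G) :=
    (C.continuous_push (T := Unit) (γ := fun _ => η) (g := fun _ => G) (by fun_prop)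
      (by fun_prop) fun _ a ha => (hA a ha).trans η1.symm).comp (Continuous.prodMk_right ())
  have h2 := h1.map (Q := fun f => ∀ a ∈ A, f a = R 0 w w)
    (fun f x => R 0 (C.push η G x) (f x)) (fun H hH => hR.comp
      (by fun_prop : Continuous fun p : I × X => ((0 : ℝ), C.push η G p.2, H p.1 p.2)))
    fun f _ hf a ha => by rw [hf a ha, C.push_mem _ _ ha, η0]
  convert h2 using 1
  · ext1 x
    rw [ν0]
  · ext1 x
    unfold Collar.push
    split_ifs <;> simp [ν1]

theorem push_swap (hR : Continuous fun x : ℝ × W × W => R x.1 x.2.1 x.2.2)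
    (self : ∀ θ p, R θ p p = R 0 p p) (swap : ∀ p q, R 1 p q = R 0 q p) (hη : Continuous η)
    (hν : Continuous ν) (hG : Continuous G) (η0 : η 0 = w) (ν0 : ν 0 = w)
    (η1 : η 1 = q) (ν1 : ν 1 = q) (hA : ∀ a ∈ A, G a = q) :
    Htp (fun f => ∀ a ∈ A, f a = R 0 w w) (fun x => R 0 (C.push η G x) w)
      (fun x => R 0 (C.push ν G x) w) := by
  refine (C.push_op hR hη hν hG η0 ν0 η1 ν1 hA).trans (.trans ?_
    (C.push_op hR hν hη hG ν0 η0 ν1 η1 hA).symm)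
  have := C.htp_push_family (w := R 0 w w)
    (L := fun θ t => R θ (η t) (ν t)) (G := fun _ x => R 0 (G x) q)
    (hR.comp (by fun_prop : Continuous fun p : I × I => ((p.1 : ℝ), η p.2, ν p.2)))
    (hR.comp (by fun_prop : Continuous fun p : I × X => ((0 : ℝ), G p.2, q)))
    (fun t a ha => by rw [hA a ha, η1, ν1, self t])
    (fun t => by rw [η0, ν0, self])
  simpa [swap] using this

end Collar

namespace BDat
variable {ι : Type*} {κ : Type} [Fintype κ] [DecidableEq κ] (D : BDat ι (Mat κ))

/-- The base point of the path space. -/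
def wP : D.Pt := ⟨D.penC D.f, D.penC_mem D.f_Zs⟩

theorem cos_sin_sq (θ : ℝ) : Real.cos θ * Real.cos θ + Real.sin θ * Real.sin θ = 1 := by
  have := Real.cos_sq_add_sin_sq θ; nlinarith

theorem rt_mem_Y {θ : ℝ} {p q r : Mat κ} (hp : p ∈ D.Y) (hq : q ∈ D.Y) (hr : r ∈ D.Y) :
    rt (Real.cos θ) (Real.sin θ) p q r ∈ D.m3.Y :=
  ⟨D.mem_m3_S (D.S.add_mem (D.S.smul_mem _ hp.1) (D.S.smul_mem _ hq.1))
    (D.S.smul_mem _ (D.S.sub_mem hp.1 hq.1)) D.S.zero_mem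
    (D.S.add_mem (D.S.smul_mem _ hp.1) (D.S.smul_mem _ hq.1)) D.S.zero_mem hr.1,
    isUnit_rt (cos_sin_sq θ) hp.2 hq.2 hr.2⟩

theorem continuous_fl_rt {Z : Type*} [TopologicalSpace Z] {θ : Z → ℝ} {a b c : Z → Mat κ}
    (hθ : Continuous θ) (ha : Continuous a) (hb : Continuous b) (hc : Continuous c) :
    Continuous fun z => fl (rt (Real.cos (θ z)) (Real.sin (θ z)) (a z) (b z) (c z)) := by
  refine continuous_fl.comp ?_
  unfold rt
  apply continuous_mat3 <;> fun_prop

/-- Rotation of block sums of paths. -/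
def rotP (θ : ℝ) (p q : D.Pt) : D.next.Pt :=
  ⟨⟨fun s => fl (rt (Real.cos θ) (Real.sin θ) (p.1 s) (q.1 s) (D.wP.1 s)),
      continuous_fl_rt continuous_const p.1.continuous q.1.continuous D.wP.1.continuous⟩,
    by
      refine ⟨?_, ?_, fun s => next_mem_Y (D.rt_mem_Y (p.2.2.2 s) (q.2.2.2 s) (D.wP.2.2.2 s))⟩
      · change fl (rt _ _ (p.1 0) (q.1 0) (D.wP.1 0)) = _
        rw [p.2.1, q.2.1, D.wP.2.1, rt_self (cos_sin_sq θ)]; rfl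
      · change fl (rt _ _ (p.1 1) (q.1 1) (D.wP.1 1)) = _
        rw [p.2.2.1, q.2.2.1, D.wP.2.2.1, rt_self (cos_sin_sq θ), ← dg_neg, map_neg]; rfl⟩

theorem rotP_self (θ : ℝ) (p : D.Pt) : D.rotP θ p p = D.rotP 0 p p := by
  refine Subtype.ext (ContinuousMap.ext fun s => ?_)
  change fl (rt _ _ (p.1 s) (p.1 s) (D.wP.1 s)) = fl (rt _ _ (p.1 s) (p.1 s) (D.wP.1 s))
  rw [rt_self (cos_sin_sq θ), rt_self (cos_sin_sq 0)]

theorem rotP_w (p : D.Pt) : D.rotP 0 p D.wP = D.stP p := by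
  refine Subtype.ext (ContinuousMap.ext fun s => ?_)
  change fl (rt _ _ (p.1 s) (D.wP.1 s) (D.wP.1 s)) = _
  rw [Real.cos_zero, Real.sin_zero, rt_zero]; rfl

theorem rotP_swap (p q : D.Pt) : D.rotP (Real.pi / 2) p q = D.rotP 0 q p := by
  refine Subtype.ext (ContinuousMap.ext fun s => ?_)
  change fl (rt _ _ (p.1 s) (q.1 s) (D.wP.1 s)) = fl (rt _ _ (q.1 s) (p.1 s) (D.wP.1 s))
  rw [Real.cos_pi_div_two, Real.sin_pi_div_two, Real.cos_zero, Real.sin_zero, rt_zero, rt_one]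

theorem continuous_rotP : Continuous fun x : ℝ × D.Pt × D.Pt => D.rotP x.1 x.2.1 x.2.2 := by
  refine Continuous.subtype_mk ?_ _
  refine ContinuousMap.continuous_of_continuous_uncurry _ ?_
  change Continuous fun x : (ℝ × D.Pt × D.Pt) × I => fl (rt (Real.cos x.1.1) (Real.sin x.1.1)
    (x.1.2.1.1 x.2) (x.1.2.2.1 x.2) (D.wP.1 x.2))
  have := D.wP.1.continuous
  exact continuous_fl_rt (by fun_prop) (by fun_prop) (by fun_prop) (by fun_prop)

variable {X : Type} [TopologicalSpace X] {A : Set X}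

theorem push_swap (C : Collar A) {η ν : I → D.Pt} {G : X → D.Pt} (hη : Continuous η)
    (hν : Continuous ν) (hG : Continuous G) (η0 : η 0 = D.wP) (ν0 : ν 0 = D.wP) {q : D.Pt}
    (η1 : η 1 = q) (ν1 : ν 1 = q) (hA : ∀ a ∈ A, G a = q) :
    Htp (fun f => ∀ a ∈ A, f a = D.stP D.wP) (fun x => D.stP (C.push η G x))
      (fun x => D.stP (C.push ν G x)) := by
  have hR : Continuous fun x : ℝ × D.Pt × D.Pt => D.rotP (x.1 * (Real.pi / 2)) x.2.1 x.2.2 :=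
    Continuous.comp (g := fun x : ℝ × D.Pt × D.Pt => D.rotP x.1 x.2.1 x.2.2)
      (f := fun x : ℝ × D.Pt × D.Pt => (x.1 * (Real.pi / 2), x.2.1, x.2.2))
      D.continuous_rotP ((continuous_fst.mul continuous_const).prodMk continuous_snd)
  have h1 : ∀ (θ : ℝ) p, D.rotP (θ * (Real.pi / 2)) p p = D.rotP (0 * (Real.pi / 2)) p p :=
    fun θ p => by rw [rotP_self, D.rotP_self (0 * _)]
  have h2 : ∀ p q, D.rotP (1 * (Real.pi / 2)) p q = D.rotP (0 * (Real.pi / 2)) q p :=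
    fun p q => by rw [one_mul, zero_mul, rotP_swap]
  have := Collar.push_swap (W := D.Pt) (W' := D.next.Pt) C
    (R := fun θ p q => D.rotP (θ * (Real.pi / 2)) p q) (w := D.wP) hR h1 h2
    hη hν hG η0 ν0 η1 ν1 hA
  simpa only [zero_mul, rotP_w] using this

/-- Surjectivity of the stable map given by pencils. -/
theorem pc_surj [CompactSpace X] (C : Collar A) {n : ℕ} {F : X → (D.tw n).Pt} (hF : Continuous F)
    (hA : ∀ a ∈ A, F a = D.PS.w n) : ∃ (N : ℕ) (β : X → (D.tw N).Yp), Continuous β ∧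
      (∀ a ∈ A, β a = D.YpS.w N) ∧ SE D.PS A ⟨N, D.pc N ∘ β⟩ ⟨n, F⟩ := by
  let K : Set (D.tw n).Pt := Set.range F ∪ {D.PS.w n}
  have hK : CompactSpace K := isCompact_iff_compactSpace.1
    ((isCompact_range hF).union isCompact_singleton)
  let w : K := ⟨D.PS.w n, Or.inr rfl⟩
  obtain ⟨N, β, F', b', hβ, hJ, hb, hS, hS'⟩ := D.exists_free_level (n := n) (X := K) (X' := Unit)
    (F := Subtype.val) continuous_subtype_val (j := fun _ => w) continuous_const
    (b := fun _ => D.YpS.w n) continuous_const fun _ => rfl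
  obtain ⟨J, Jc, J0, J1, -⟩ := hJ
  obtain ⟨L, Lc, L0, L1, -⟩ := hb
  have hb' : b' () = D.YpS.w N :=
    (hS'.2 Unit Set.univ id continuous_id fun _ _ => rfl).1 () trivial
  let F₀ : X → K := fun x => ⟨F x, Or.inl ⟨x, rfl⟩⟩
  have hF₀ : Continuous F₀ := hF.subtype_mk _
  have hA₀ : ∀ a ∈ A, F₀ a = w := fun a ha => Subtype.ext (hA a ha)
  obtain ⟨hw, hS₁⟩ := hS.2 X A F₀ hF₀ hA
  have hw' : F' w = D.PS.w N :=
    (hS.2 Unit Set.univ (fun _ => w) continuous_const fun _ _ => rfl).1 () trivial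
  have hγ : Continuous fun t => L t () := Lc.comp (Continuous.prodMk_left ())
  have hη : Continuous fun t => J t w := Jc.comp (Continuous.prodMk_left w)
  have hγ1 : L 1 () = β w := congrFun L1 ()
  have hβ' : Continuous (C.push (fun t => L t ()) (β ∘ F₀)) :=
    (C.continuous_push (T := Unit) (γ := fun _ t => L t ()) (g := fun _ => β ∘ F₀) (by fun_prop)
      (by fun_prop) fun _ a ha => by rw [hγ1, Function.comp, hA₀ a ha]).comp
        (Continuous.prodMk_right ())
  have hβA : ∀ a ∈ A, C.push (fun t => L t ()) (β ∘ F₀) a = D.YpS.w N := fun a ha => by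
    rw [C.push_mem _ _ ha, L0, hb']
  refine ⟨N, C.push (fun t => L t ()) (β ∘ F₀), hβ', hβA, ?_⟩
  have h1 := C.htp_push (w := D.PS.w N) (γ := fun t => J t w) (K := fun t x => J t (F₀ x))
    (Jc.comp (continuous_fst.prodMk (hF₀.comp continuous_snd))) hη
    (fun t a ha => by rw [hA₀ a ha]) (by rw [J0, hw'])
  rw [J0, J1] at h1
  have h2 := (D.tw N).push_swap C (η := fun t => J t w) (ν := fun t => D.pc N (L t ()))
    (G := fun x => D.pc N (β (F₀ x))) (q := D.pc N (β w)) hη ((D.continuous_pc N).comp hγ)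
    ((D.continuous_pc N).comp (hβ.comp hF₀)) (by simp only [J0]; exact hw')
    (by simp only [L0, hb']; rfl) (by simp only [J1]; rfl) (by simp only [hγ1])
    fun a ha => by rw [hA₀ a ha]
  have e : (fun x => (D.tw N).stP (C.push (fun t => D.pc N (L t ()))
      (fun x => D.pc N (β (F₀ x))) x)) =
      D.PS.st N ∘ D.pc N ∘ C.push (fun t => L t ()) (β ∘ F₀) :=
    funext fun x => congrArg (D.tw N).stP (C.map_push (D.pc N) _ _ x).symm
  have h3 : Htp (fun f : X → D.PS.W (N + 1) => ∀ a ∈ A, f a = D.PS.w (N + 1))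
      (D.PS.st N ∘ D.pc N ∘ C.push (fun t => L t ()) (β ∘ F₀))
      (D.PS.st N ∘ C.push (fun t => J t w) fun x => D.pc N (β (F₀ x))) :=
    (e ▸ h2.symm).mono fun f _ hf a ha => (hf a ha).trans (D.PS.st_w N)
  refine .trans ?_ (hS₁.trans (.htp h1)).symm
  refine (SE.st ((D.continuous_pc N).comp hβ') fun a ha => by
    simp only [Function.comp, hβA a ha]; rfl).trans ?_
  refine .trans (.htp h3)
    (SE.st h1.cont_right h1.prop_right).symm

end BDat

namespace SE
variable {S S' : Sys} {X : Type} [TopologicalSpace X] {A : Set X}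

theorem const_aux (n : ℕ) : SE S A ⟨n, fun _ : X => S.w n⟩ ⟨0, fun _ => S.w 0⟩ := by
  induction n with
  | zero => exact .refl continuous_const fun _ _ => rfl
  | succ n ih =>
    refine .trans ?_ ih
    have := (SE.st (S := S) (A := A) (n := n) (f := fun _ => S.w n) continuous_const
      fun _ _ => rfl).symm
    rwa [show S.st n ∘ (fun _ : X => S.w n) = fun _ => S.w (n + 1) from
      funext fun _ => S.st_w n] at this

/-- There are exactly two stable homotopy classes. -/
def Two (S : Sys) {X : Type} [TopologicalSpace X] (A : Set X) : Prop :=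
  ∃ p : Σ n, X → S.W n, Continuous p.2 ∧ (∀ a ∈ A, p.2 a = S.w p.1) ∧
    ¬ SE S A p ⟨0, fun _ => S.w 0⟩ ∧
    ∀ q : Σ n, X → S.W n, Continuous q.2 → (∀ a ∈ A, q.2 a = S.w q.1) →
      SE S A q ⟨0, fun _ => S.w 0⟩ ∨ SE S A q p

theorem Two.of_hom (Φ : SysHom S S') (Ψ : SysHom S' S) (h : ∀ n a, Ψ.φ n (Φ.φ n a) = a)
    (h' : ∀ n a, Φ.φ n (Ψ.φ n a) = a) (H : Two S A) : Two S' A := by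
  obtain ⟨⟨n, p⟩, hp, hA, h0, h1⟩ := H
  have hc : ∀ n, Φ.φ n ∘ (fun _ : X => S.w n) = fun _ => S'.w n := fun n =>
    funext fun _ => Φ.map_w n
  have hc' : ∀ n, Ψ.φ n ∘ (fun _ : X => S'.w n) = fun _ => S.w n := fun n =>
    funext fun _ => Ψ.map_w n
  have e : ∀ n (f : X → S.W n), Ψ.φ n ∘ Φ.φ n ∘ f = f := fun n f => funext fun _ => h n _
  have e' : ∀ n (f : X → S'.W n), Φ.φ n ∘ Ψ.φ n ∘ f = f := fun n f => funext fun _ => h' n _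
  refine ⟨⟨n, Φ.φ n ∘ p⟩, (Φ.cont n).comp hp, fun a ha =>
    (congrArg (Φ.φ n) (hA a ha)).trans (Φ.map_w n), fun H => h0 ?_, ?_⟩
  · have := H.map Ψ
    dsimp only at this
    rwa [e, hc'] at this
  · rintro ⟨m, q⟩ hq hqA
    have := h1 ⟨m, Ψ.φ m ∘ q⟩ ((Ψ.cont m).comp hq) fun a ha =>
      (congrArg (Ψ.φ m) (hqA a ha)).trans (Ψ.map_w m)
    refine this.imp (fun H => ?_) fun H => ?_
    · have := H.map Φ
      dsimp only at this
      rwa [e', hc] at this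
    · have := H.map Φ
      dsimp only at this
      rwa [e'] at this

end SE

namespace BDat
open SE
variable {ι : Type*} {κ : Type} [Fintype κ] [DecidableEq κ] (D : BDat ι (Mat κ))
variable {X : Type} [TopologicalSpace X] {A : Set X}

theorem two_PS [CompactSpace X] (C : Collar A) (H : Two D.YpS A) : Two D.PS A := by
  obtain ⟨⟨n, p⟩, hp, hA, h0, h1⟩ := H
  refine ⟨⟨n, D.pc n ∘ p⟩, (D.continuous_pc n).comp hp, fun a ha => ?_, fun H => h0 ?_, ?_⟩
  · exact congrArg (D.pc n) (hA a ha)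
  · exact D.pc_inj C hp continuous_const hA (fun _ _ => rfl) H
  · rintro ⟨m, q⟩ hq hqA
    obtain ⟨N, β, hβ, hβA, h⟩ := D.pc_surj C hq hqA
    exact (h1 ⟨N, β⟩ hβ hβA).imp (fun H => h.symm.trans (H.map D.homYP))
      fun H => h.symm.trans (H.map D.homYP)

/-- Rotation from the pencil of `f` to the constant path. -/
def uu (s : I) : Mat κ :=
  Real.cos (Real.pi * s / 2) • 1 + Real.sin (Real.pi * s / 2) • (D.f * D.e)

theorem star_uu (s : I) : star (D.uu s) =
    Real.cos (Real.pi * s / 2) • 1 - Real.sin (Real.pi * s / 2) • (D.f * D.e) := by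
  have : star (D.f * D.e) = -(D.f * D.e) := by
    rw [star_mul, D.e_star, D.f_star, neg_mul_neg, D.f_e, neg_neg]
  rw [uu, star_add, star_smul, star_smul, this, star_one, smul_neg, sub_eq_add_neg]
  rfl

theorem fe_sq : D.f * D.e * (D.f * D.e) = -1 := by
  calc D.f * D.e * (D.f * D.e) = D.f * (D.e * D.f) * D.e := by noncomm_ring
    _ = D.f * (-(D.f * D.e)) * D.e := by rw [D.f_e, neg_neg]
    _ = -((D.f * D.f) * (D.e * D.e)) := by noncomm_ring
    _ = -1 := by rw [D.f_sq, D.e_sq]; simp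

theorem cs_aux (a b : Mat κ) (h : a * a = -1) {c s : ℝ} (hcs : c * c + s * s = 1) :
    (c • 1 + s • a) * (c • 1 - s • a) = 1 := by
  have : (c • (1 : Mat κ) + s • a) * (c • 1 - s • a) = (c * c) • 1 - (s * s) • (a * a) := by
    simp only [add_mul, mul_sub, smul_mul_assoc, mul_smul_comm, one_mul, mul_one]
    module
  rw [this, h, smul_neg, sub_neg_eq_add, ← add_smul, hcs, one_smul]

theorem uu_star (s : I) : D.uu s * star (D.uu s) = 1 := by
  rw [star_uu, uu]
  exact cs_aux _ 0 D.fe_sq (cos_sin_sq _)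

theorem star_uu_mul (s : I) : star (D.uu s) * D.uu s = 1 := mul_eq_one_comm.1 (D.uu_star s)

theorem continuous_uu : Continuous D.uu := by unfold uu; fun_prop

theorem uu_c (s : I) (l : ι) : D.uu s * D.c l = D.c l * D.uu s := by
  have := D.mul_comm_c D.f_mem D.e_mem l
  simp only [uu, add_mul, mul_add, smul_mul_assoc, mul_smul_comm, one_mul, mul_one, this]

theorem star_uu_c (s : I) (l : ι) : star (D.uu s) * D.c l = D.c l * star (D.uu s) := by
  have := D.mul_comm_c D.f_mem D.e_mem l
  simp only [star_uu, sub_mul, mul_sub, smul_mul_assoc, mul_smul_comm, one_mul, mul_one, this]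

theorem uu_mem {a : Mat κ} (ha : a ∈ D.Y) (s : I) : D.uu s * a * star (D.uu s) ∈ D.Y :=
  D.conj_Y ha (D.uu_c s) (D.star_uu_c s) ⟨⟨_, _, D.uu_star s, D.star_uu_mul s⟩, rfl⟩

theorem uu_mem' {a : Mat κ} (ha : a ∈ D.Y) (s : I) : star (D.uu s) * a * D.uu s ∈ D.Y := by
  have := D.conj_Y ha (D.star_uu_c s) (by rw [star_star]; exact D.uu_c s)
    ⟨⟨_, _, D.star_uu_mul s, D.uu_star s⟩, rfl⟩
  rwa [star_star] at this

theorem uu_zero : D.uu 0 = 1 := by simp [uu]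
theorem uu_one : D.uu 1 = D.f * D.e := by simp [uu]

theorem uu_pen (s : I) : D.uu s * D.pen D.f s * star (D.uu s) = D.e := by
  have h1 : D.f * D.e * D.e = -D.f := by rw [mul_assoc, D.e_sq, mul_neg, mul_one]
  have h2 : D.e * (D.f * D.e) = D.f := by
    rw [D.f_e, mul_neg, ← mul_assoc, D.e_sq, neg_mul, neg_neg, one_mul]
  have h3 : D.f * D.e * D.f = D.e := by
    rw [D.f_e, neg_mul, mul_assoc, D.f_sq, mul_neg, neg_neg, mul_one]
  have h4 : D.f * (D.f * D.e) = -D.e := by rw [← mul_assoc, D.f_sq, neg_mul, one_mul]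
  have hp : D.pen D.f s = Real.cos (Real.pi * s) • D.e + Real.sin (Real.pi * s) • D.f := by
    rfl
  have hk : star (D.uu s) * D.e = D.pen D.f s * star (D.uu s) := by
    have e1 : Real.cos (Real.pi * s) = Real.cos (Real.pi * s / 2) * Real.cos (Real.pi * s / 2) -
        Real.sin (Real.pi * s / 2) * Real.sin (Real.pi * s / 2) := by
      rw [← Real.cos_add]; ring_nf
    have e2 : Real.sin (Real.pi * s) = Real.sin (Real.pi * s / 2) * Real.cos (Real.pi * s / 2) +
        Real.cos (Real.pi * s / 2) * Real.sin (Real.pi * s / 2) := by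
      rw [← Real.sin_add]; ring_nf
    have e3 := cos_sin_sq (Real.pi * s / 2)
    rw [hp, star_uu, e1, e2]
    generalize Real.cos (Real.pi * s / 2) = c at *
    generalize Real.sin (Real.pi * s / 2) = d at *
    simp only [add_mul, sub_mul, mul_sub, smul_mul_assoc, mul_smul_comm, one_mul, mul_one,
      h1, h2, h4]
    match_scalars
    · linear_combination -c * e3
    · linear_combination (-d) * e3
  rw [mul_assoc, ← hk, ← mul_assoc, D.uu_star, one_mul]

/-- A path as a map to `Y`. -/
def tr (p : D.Pt) (s : I) : D.Y := ⟨D.uu s * p.1 s * star (D.uu s), D.uu_mem (p.2.2.2 s) s⟩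

theorem continuous_tr : Continuous fun x : D.Pt × I => D.tr x.1 x.2 := by
  refine Continuous.subtype_mk ?_ _
  have h := D.continuous_uu.comp (continuous_snd (X := D.Pt))
  have h' : Continuous fun x : D.Pt × I => x.1.1 x.2 := by fun_prop
  exact (h.mul h').mul h.star

theorem continuous_tr_comp {f : X → D.Pt} {s : X → I} (hf : Continuous f) (hs : Continuous s) :
    Continuous fun z => D.tr (f z) (s z) :=
  Continuous.comp (g := fun x : D.Pt × I => D.tr x.1 x.2) (f := fun z => (f z, s z))
    D.continuous_tr (hf.prodMk hs)

theorem tr_zero (p : D.Pt) : (D.tr p 0).1 = D.e := by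
  simp [tr, uu_zero, p.2.1]

theorem tr_one (p : D.Pt) : (D.tr p 1).1 = D.e := by
  have h : star (D.f * D.e) = -(D.f * D.e) := by
    rw [star_mul, D.e_star, D.f_star, neg_mul_neg, D.f_e, neg_neg]
  have h1 : D.f * D.e * D.e = -D.f := by rw [mul_assoc, D.e_sq, mul_neg, mul_one]
  simp only [tr, uu_one, p.2.2.1, h, mul_neg, neg_neg, h1]
  rw [← mul_assoc, D.f_sq]; simp

theorem tr_wP (s : I) : (D.tr D.wP s).1 = D.e := D.uu_pen s

theorem uu_next (s : I) : D.next.uu s = fl (dg (D.uu s) (D.uu s) (D.uu s)) := by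
  have h1 : D.next.f = fl (dg D.f D.f D.f) := rfl
  have h2 : D.next.e = fl (dg D.e D.e D.e) := rfl
  rw [uu, h1, h2, ← map_mul, ← map_one fl, ← map_smul, ← map_smul, ← map_add, dg_mul, ← dg_one,
    dg_smul, dg_smul, dg_add]
  rfl

theorem tr_stP (p : D.Pt) (s : I) : D.next.tr (D.stP p) s = D.stY (D.tr p s) := by
  refine Subtype.ext ?_
  change D.next.uu s * (D.stP p).1 s * star (D.next.uu s) =
    fl (dg (D.uu s * p.1 s * star (D.uu s)) D.e D.e)
  rw [uu_next, stP_apply, ← map_star, star_dg, ← map_mul, ← map_mul, dg_mul, dg_mul, uu_pen]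

theorem tr_inj {p q : D.Pt} {s : I} (h : D.tr p s = D.tr q s) : p.1 s = q.1 s := by
  have h := congrArg Subtype.val h
  change D.uu s * p.1 s * star (D.uu s) = D.uu s * q.1 s * star (D.uu s) at h
  have hk : ∀ a : Mat κ, star (D.uu s) * (D.uu s * a * star (D.uu s)) * D.uu s = a := fun a => by
    calc _ = (star (D.uu s) * D.uu s) * a * (star (D.uu s) * D.uu s) := by
          simp only [mul_assoc]
      _ = a := by rw [star_uu_mul]; simp
  rw [← hk (p.1 s), h, hk]

/-- The path given by a loop. -/
def unt (g : I → D.Y) (hg : Continuous g) (h0 : (g 0).1 = D.e) (h1 : (g 1).1 = D.e) : D.Pt :=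
  ⟨⟨fun s => star (D.uu s) * (g s).1 * D.uu s, (D.continuous_uu.star.mul
    (continuous_subtype_val.comp hg)).mul D.continuous_uu⟩, by
    refine ⟨?_, ?_, fun s => D.uu_mem' (g s).2 s⟩
    · change star (D.uu 0) * (g 0).1 * D.uu 0 = _
      rw [h0, uu_zero]; simp
    · change star (D.uu 1) * (g 1).1 * D.uu 1 = _
      have h : star (D.f * D.e) = -(D.f * D.e) := by
        rw [star_mul, D.e_star, D.f_star, neg_mul_neg, D.f_e, neg_neg]
      have h2 : D.f * D.e * D.e = -D.f := by rw [mul_assoc, D.e_sq, mul_neg, mul_one]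
      rw [h1, uu_one, h, neg_mul, h2, neg_neg, ← mul_assoc, D.f_sq]; simp⟩

theorem tr_unt (g : I → D.Y) (hg : Continuous g) (h0 : (g 0).1 = D.e) (h1 : (g 1).1 = D.e)
    (s : I) : D.tr (D.unt g hg h0 h1) s = g s := by
  refine Subtype.ext ?_
  change D.uu s * (star (D.uu s) * (g s).1 * D.uu s) * star (D.uu s) = _
  calc _ = (D.uu s * star (D.uu s)) * (g s).1 * (D.uu s * star (D.uu s)) := by
        simp only [mul_assoc]
    _ = _ := by rw [uu_star]; simp

theorem continuous_unt {g : X → I → D.Y} (hg : Continuous fun p : X × I => g p.1 p.2)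
    (hg' : ∀ x, Continuous (g x)) (h0 : ∀ x, (g x 0).1 = D.e) (h1 : ∀ x, (g x 1).1 = D.e) :
    Continuous fun x => D.unt (g x) (hg' x) (h0 x) (h1 x) := by
  refine Continuous.subtype_mk (ContinuousMap.continuous_of_continuous_uncurry _ ?_) _
  have h := D.continuous_uu.comp (continuous_snd (X := X))
  exact (h.star.mul (continuous_subtype_val.comp hg)).mul h

/-- The subset of a product with the interval generated by a subset and the boundary. -/
def cyl (A : Set X) : Set (X × I) := {z | z.1 ∈ A ∨ z.2 = 0 ∨ z.2 = 1}

/-- Families of paths as families of loops. -/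
def lp (p : Σ n, X → D.PS.W n) : Σ n, X × I → D.YS.W n :=
  ⟨p.1, fun z => (D.tw p.1).tr (p.2 z.1) z.2⟩

theorem lp_cont {n : ℕ} {f : X → D.PS.W n} (hf : Continuous f) :
    Continuous fun z : X × I => (D.tw n).tr (f z.1) z.2 :=
  (D.tw n).continuous_tr_comp (f := fun z : X × I => f z.1) (hf.comp continuous_fst)
    continuous_snd

theorem lp_mem {n : ℕ} {f : X → D.PS.W n} (hA : ∀ a ∈ A, f a = D.PS.w n) :
    ∀ z ∈ cyl A, (D.tw n).tr (f z.1) z.2 = D.YS.w n := by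
  rintro ⟨x, s⟩ (h | h | h)
  · exact Subtype.ext ((congrArg (fun p => ((D.tw n).tr p s).1) (hA x h)).trans
      ((D.tw n).tr_wP s))
  · exact Subtype.ext ((congrArg (fun s => ((D.tw n).tr (f x) s).1) h).trans
      ((D.tw n).tr_zero (f x)))
  · exact Subtype.ext ((congrArg (fun s => ((D.tw n).tr (f x) s).1) h).trans
      ((D.tw n).tr_one (f x)))

theorem lp_up (p : Σ n, X → D.PS.W n) : up D.YS (X × I) (D.lp p) = D.lp (up D.PS X p) :=
  Sigma.ext rfl (heq_of_eq (funext fun z => ((D.tw p.1).tr_stP (p.2 z.1) z.2).symm))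

theorem lp_iter (k : ℕ) (p : Σ n, X → D.PS.W n) :
    (up D.YS (X × I))^[k] (D.lp p) = D.lp ((up D.PS X)^[k] p) := by
  induction k with
  | zero => rfl
  | succ k ih => rw [Function.iterate_succ_apply', Function.iterate_succ_apply', ih, lp_up]

theorem lp_map {p q : Σ n, X → D.PS.W n} (h : SE D.PS A p q) :
    SE D.YS (cyl A) (D.lp p) (D.lp q) := by
  induction h with
  | @htp n f g h =>
    exact .htp (h.map (fun f (z : X × I) => (D.tw n).tr (f z.1) z.2) (fun H hH =>
      (D.tw n).continuous_tr_comp (f := fun z : I × X × I => H z.1 z.2.1)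
        (hH.comp (continuous_fst.prodMk (continuous_fst.comp continuous_snd)))
        (continuous_snd.comp continuous_snd))
      fun f _ hf => D.lp_mem hf)
  | @st n f hc hf =>
    have := SE.st (S := D.YS) (f := fun z : X × I => (D.tw n).tr (f z.1) z.2) (D.lp_cont hc)
      (D.lp_mem hf)
    exact this.trans (by
      rw [show (⟨n + 1, D.PS.st n ∘ f⟩ : Σ n, X → D.PS.W n) = up D.PS X ⟨n, f⟩ from rfl, ← lp_up]
      exact .refl ((D.YS.st_cont n).comp (D.lp_cont hc)) fun a ha =>
        (congrArg (D.YS.st n) (D.lp_mem hf a ha)).trans (D.YS.st_w n))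
  | symm _ ih => exact ih.symm
  | trans _ _ ih ih' => exact ih.trans ih'

theorem lp_surj {n : ℕ} {g : X × I → D.YS.W n} (hg : Continuous g)
    (hA : ∀ z ∈ cyl A, g z = D.YS.w n) : ∃ f : X → D.PS.W n, Continuous f ∧
      (∀ a ∈ A, f a = D.PS.w n) ∧ ∀ x s, (D.tw n).tr (f x) s = g (x, s) := by
  have hg' : ∀ x, Continuous fun s => g (x, s) := fun x => hg.comp (Continuous.prodMk_right x)
  have h0 : ∀ x, (g (x, 0)).1 = (D.tw n).e := fun x =>
    congrArg Subtype.val (hA (x, 0) (Or.inr (Or.inl rfl)))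
  have h1 : ∀ x, (g (x, 1)).1 = (D.tw n).e := fun x =>
    congrArg Subtype.val (hA (x, 1) (Or.inr (Or.inr rfl)))
  have h2 : ∀ x s, (D.tw n).tr ((D.tw n).unt (fun s => g (x, s)) (hg' x) (h0 x) (h1 x)) s =
    g (x, s) := fun x s => (D.tw n).tr_unt _ _ _ _ s
  refine ⟨_, (D.tw n).continuous_unt (g := fun x s => g (x, s)) hg hg' h0 h1, fun a ha => ?_, h2⟩
  refine Subtype.ext (ContinuousMap.ext fun s => (D.tw n).tr_inj (s := s) ?_)
  refine (h2 a s).trans ((hA (a, s) (Or.inl ha)).trans ?_)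
  exact Subtype.ext ((D.tw n).tr_wP s).symm

theorem lp_htp {n : ℕ} {f g : X → D.PS.W n}
    (h : Htp (fun f => ∀ a ∈ cyl A, f a = D.YS.w n) (fun z : X × I => (D.tw n).tr (f z.1) z.2)
      (fun z : X × I => (D.tw n).tr (g z.1) z.2)) :
    Htp (fun f => ∀ a ∈ A, f a = D.PS.w n) f g := by
  obtain ⟨H, hc, h0, h1, hA⟩ := h
  obtain ⟨K, hK, hKA, hKt⟩ := D.lp_surj (X := I × X) (A := {z | z.2 ∈ A}) (n := n)
    (g := fun z => H z.1.1 (z.1.2, z.2)) (hc.comp (by fun_prop :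
      Continuous fun z : (I × X) × I => (z.1.1, (z.1.2, z.2)))) (by
      rintro ⟨⟨t, x⟩, s⟩ h
      exact hA t (x, s) h)
  refine ⟨fun t x => K (t, x), hK, ?_, ?_, fun t a ha => hKA (t, a) ha⟩
  · refine funext fun x => Subtype.ext (ContinuousMap.ext fun s => (D.tw n).tr_inj (s := s) ?_)
    exact (hKt (0, x) s).trans (congrFun h0 (x, s))
  · refine funext fun x => Subtype.ext (ContinuousMap.ext fun s => (D.tw n).tr_inj (s := s) ?_)
    exact (hKt (1, x) s).trans (congrFun h1 (x, s))

theorem lp_inj {p q : Σ n, X → D.PS.W n} (hp : Continuous p.2) (hq : Continuous q.2)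
    (hpA : ∀ a ∈ A, p.2 a = D.PS.w _) (hqA : ∀ a ∈ A, q.2 a = D.PS.w _)
    (h : SE D.YS (cyl A) (D.lp p) (D.lp q)) : SE D.PS A p q := by
  obtain ⟨k, l, h⟩ := h.exists_iter
  rw [lp_iter, lp_iter] at h
  obtain ⟨hp, hpA, h1⟩ := SE.iter k hp hpA
  obtain ⟨hq, hqA, h2⟩ := SE.iter l hq hqA
  refine h1.trans (.trans ?_ h2.symm)
  generalize (up D.PS X)^[k] p = p at *
  generalize (up D.PS X)^[l] q = q at *
  obtain ⟨n, f⟩ := p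
  obtain ⟨m, g⟩ := q
  unfold lp at h
  cases h with
  | mk h => exact .htp (D.lp_htp h)

theorem lp_const : D.lp ⟨0, fun _ : X => D.PS.w 0⟩ = ⟨0, fun _ => D.YS.w 0⟩ :=
  Sigma.ext rfl (heq_of_eq (funext fun z => Subtype.ext (D.tr_wP z.2)))

theorem two_YS (H : Two D.PS A) : Two D.YS (cyl A) := by
  obtain ⟨⟨n, p⟩, hp, hA, h0, h1⟩ := H
  refine ⟨D.lp ⟨n, p⟩, D.lp_cont hp, D.lp_mem hA, fun H => h0 ?_, ?_⟩
  · rw [← lp_const] at H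
    exact D.lp_inj hp continuous_const hA (fun _ _ => rfl) H
  · rintro ⟨m, q⟩ hq hqA
    obtain ⟨f, hf, hfA, h⟩ := D.lp_surj hq hqA
    have e : (⟨m, q⟩ : Σ n, X × I → D.YS.W n) = D.lp ⟨m, f⟩ :=
      Sigma.ext rfl (heq_of_eq (funext fun z => (h z.1 z.2).symm))
    rw [e, ← lp_const]
    exact (h1 ⟨m, f⟩ hf hfA).imp D.lp_map D.lp_map

/-- One step of Bott periodicity. -/
theorem two_bott [CompactSpace X] (C : Collar A) (H : Two D.YpS A) : Two D.YS (cyl A) :=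
  D.two_YS (D.two_PS C H)

end BDat

/-- Constants cutting out a space of invertible skew matrices, and a base point of it. -/
structure CDat (ι : Type*) (κ : Type) [Fintype κ] [DecidableEq κ] where
  c : ι → Mat κ
  ε : ι → ℝ
  e : Mat κ
  e_star : star e = -e
  e_unit : IsUnit e
  e_c : ∀ l, e * c l = ε l • (c l * e)

namespace CDat
variable {ι : Type*} {κ : Type} [Fintype κ] [DecidableEq κ] (D : CDat ι κ)

/-- The data at the next level. -/
def next : CDat ι (Fin 3 × κ) where
  c l := fl (dg (D.c l) (D.c l) (D.c l))
  ε := D.ε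
  e := fl (dg D.e D.e D.e)
  e_star := by rw [← map_star, star_dg, D.e_star, ← dg_neg, map_neg]
  e_unit := (isUnit_dg D.e_unit D.e_unit D.e_unit).map fl
  e_c l := by rw [← map_mul, ← map_mul, dg_mul, dg_mul, D.e_c, ← dg_smul, map_smul]

/-- The tower over given data. -/
def tw (D : CDat ι κ) : ∀ n, CDat ι (TT κ n)
  | 0 => D
  | n + 1 => (D.tw n).next

/-- Invertible skew matrices with the prescribed commutation relations. -/
def U : Set (Mat κ) := {a | star a = -a ∧ IsUnit a ∧ ∀ l, a * D.c l = D.ε l • (D.c l * a)}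

theorem e_U : D.e ∈ D.U := ⟨D.e_star, D.e_unit, D.e_c⟩

theorem next_U {a b c : Mat κ} (ha : a ∈ D.U) (hb : b ∈ D.U) (hc : c ∈ D.U) :
    fl (dg a b c) ∈ D.next.U := by
  refine ⟨?_, (isUnit_dg ha.2.1 hb.2.1 hc.2.1).map fl, fun l => ?_⟩
  · rw [← map_star, star_dg, ha.1, hb.1, hc.1, ← dg_neg, map_neg]
  · change fl _ * fl _ = D.ε l • (fl _ * fl _)
    rw [← map_mul, ← map_mul, dg_mul, dg_mul, ha.2.2, hb.2.2, hc.2.2, ← dg_smul, map_smul]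

/-- The associated sequence of spaces. -/
def Y : Sys where
  W n := (D.tw n).U
  top _ := inferInstance
  w n := ⟨(D.tw n).e, (D.tw n).e_U⟩
  st n a := ⟨fl (dg a.1 (D.tw n).e (D.tw n).e), (D.tw n).next_U a.2 (D.tw n).e_U (D.tw n).e_U⟩
  st_cont n := Continuous.subtype_mk (BDat.continuous_fl_dg continuous_subtype_val
    continuous_const continuous_const) _
  st_w _ := rfl

end CDat

namespace BDat
open SE
variable {ι : Type*} {κ : Type} [Fintype κ] [DecidableEq κ] (D : BDat ι (Mat κ))

/-- The constants defining `Y`. -/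
def cd : CDat ι κ := ⟨D.c, D.ε, D.e, D.e_star, D.e_unit, D.e_c⟩

/-- The constants defining `Yp`. -/
def cdp : CDat (Option ι) κ where
  c l := l.elim D.e D.c
  ε l := l.elim (-1) D.ε
  e := D.f
  e_star := D.f_star
  e_unit := D.f_unit
  e_c l := by cases l <;> simp [D.f_c, D.f_e]

theorem cd_tw (n : ℕ) : (D.tw n).cd = D.cd.tw n := by
  induction n with
  | zero => rfl
  | succ n ih => exact congrArg CDat.next ih

theorem cdp_next : D.next.cdp = D.cdp.next := by
  unfold cdp CDat.next
  congr
  funext l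
  cases l <;> rfl

theorem cdp_tw (n : ℕ) : (D.tw n).cdp = D.cdp.tw n := by
  induction n with
  | zero => rfl
  | succ n ih => exact (cdp_next _).trans (congrArg CDat.next ih)

theorem cd_U : D.cd.U = D.Y := by
  ext a; exact ⟨fun h => ⟨⟨h.1, h.2.2⟩, h.2.1⟩, fun h => ⟨h.1.1, h.2, h.1.2⟩⟩

theorem cdp_U : D.cdp.U = D.Yp := by
  ext a
  refine ⟨fun h => ⟨⟨⟨h.1, fun l => h.2.2 (some l)⟩, h.2.1⟩, ?_⟩, fun h => ⟨h.1.1.1, h.1.2, ?_⟩⟩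
  · have := h.2.2 none
    simpa [cdp] using this
  · rintro (_ | l)
    · simpa [cdp] using h.2
    · exact h.1.1.2 l

theorem cd_mem {n : ℕ} {a : Mat (TT κ n)} : a ∈ (D.cd.tw n).U ↔ a ∈ (D.tw n).Y := by
  rw [← cd_tw, cd_U]

theorem cdp_mem {n : ℕ} {a : Mat (TT κ n)} : a ∈ (D.cdp.tw n).U ↔ a ∈ (D.tw n).Yp := by
  rw [← cdp_tw, cdp_U]

theorem cd_e (n : ℕ) : (D.cd.tw n).e = (D.tw n).e := by rw [← cd_tw]; rfl
theorem cdp_e (n : ℕ) : (D.cdp.tw n).e = (D.tw n).f := by rw [← cdp_tw]; rfl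

variable {X : Type} [TopologicalSpace X] {A : Set X}

theorem two_cd : Two D.YS A ↔ Two D.cd.Y A := by
  let Φ : SysHom D.YS D.cd.Y :=
    { φ := fun n a => ⟨a.1, D.cd_mem.2 a.2⟩
      cont := fun n => Continuous.subtype_mk continuous_subtype_val _
      map_w := fun n => Subtype.ext (D.cd_e n).symm
      map_st := fun n a => Subtype.ext (by
        change fl (dg a.1 (D.tw n).e (D.tw n).e) = fl (dg a.1 (D.cd.tw n).e (D.cd.tw n).e)
        rw [cd_e]) }
  let Ψ : SysHom D.cd.Y D.YS :=
    { φ := fun n a => ⟨a.1, D.cd_mem.1 a.2⟩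
      cont := fun n => Continuous.subtype_mk continuous_subtype_val _
      map_w := fun n => Subtype.ext (D.cd_e n)
      map_st := fun n a => Subtype.ext (by
        change fl (dg a.1 (D.cd.tw n).e (D.cd.tw n).e) = fl (dg a.1 (D.tw n).e (D.tw n).e)
        rw [cd_e]) }
  exact ⟨.of_hom Φ Ψ (fun _ _ => rfl) fun _ _ => rfl, .of_hom Ψ Φ (fun _ _ => rfl) fun _ _ => rfl⟩

theorem two_cdp : Two D.YpS A ↔ Two D.cdp.Y A := by
  let Φ : SysHom D.YpS D.cdp.Y :=
    { φ := fun n a => ⟨a.1, D.cdp_mem.2 a.2⟩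
      cont := fun n => Continuous.subtype_mk continuous_subtype_val _
      map_w := fun n => Subtype.ext (D.cdp_e n).symm
      map_st := fun n a => Subtype.ext (by
        change fl (dg a.1 (D.tw n).f (D.tw n).f) = fl (dg a.1 (D.cdp.tw n).e (D.cdp.tw n).e)
        rw [cdp_e]) }
  let Ψ : SysHom D.cdp.Y D.YpS :=
    { φ := fun n a => ⟨a.1, D.cdp_mem.1 a.2⟩
      cont := fun n => Continuous.subtype_mk continuous_subtype_val _
      map_w := fun n => Subtype.ext (D.cdp_e n)
      map_st := fun n a => Subtype.ext (by
        change fl (dg a.1 (D.cdp.tw n).e (D.cdp.tw n).e) = fl (dg a.1 (D.tw n).f (D.tw n).f)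
        rw [cdp_e]) }
  exact ⟨.of_hom Φ Ψ (fun _ _ => rfl) fun _ _ => rfl, .of_hom Ψ Φ (fun _ _ => rfl) fun _ _ => rfl⟩

/-- Bott periodicity in terms of the constants. -/
theorem two_step [CompactSpace X] (C : Collar A) (H : Two D.cdp.Y A) : Two D.cd.Y (cyl A) :=
  D.two_cd.1 (D.two_bott C (D.two_cdp.2 H))

/-- Extension of the data by a further anticommuting element. -/
def ext (f τ : Mat κ) (f_star : star f = -f) (f_sq : f * f = -1)
    (f_c : ∀ l, f * D.c l = D.ε l • (D.c l * f)) (f_e : f * D.e = -(D.e * f))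
    (f_f : f * D.f = -(D.f * f)) (τ_left : star τ * τ = 1) (τ_c : ∀ l, τ * D.c l = D.c l * τ)
    (τ_e : τ * D.e = D.e * τ) (τ_f : τ * D.f = D.f * τ) (τ_f' : τ * f = -(f * τ)) :
    BDat (Option ι) (Mat κ) where
  c := D.cdp.c
  ε := D.cdp.ε
  e := D.f
  f := f
  τ := τ
  e_star := D.f_star
  e_sq := D.f_sq
  e_c := D.cdp.e_c
  f_star := f_star
  f_sq := f_sq
  f_c l := by cases l <;> simp [f_c, f_e, cdp]
  f_e := f_f
  τ_left := τ_left
  τ_right := mul_eq_one_comm.1 τ_left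
  τ_c l := by cases l <;> simp [τ_c, τ_e, cdp]
  τ_e := τ_f
  τ_f := τ_f'
  ε_sq l := by cases l <;> simp [D.ε_sq, cdp]

end BDat

open BDat (cyl)

/-- Truncation to the unit interval. -/
abbrev pj (x : ℝ) : I := Set.projIcc (0 : ℝ) 1 zero_le_one x

theorem continuous_pj : Continuous pj := continuous_projIcc

theorem pj_of_nonpos {x : ℝ} (h : x ≤ 0) : pj x = 0 := Set.projIcc_of_le_left _ h
theorem pj_of_one_le {x : ℝ} (h : 1 ≤ x) : pj x = 1 := Set.projIcc_of_right_le _ h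
theorem pj_coe (t : I) : pj t = t := Set.projIcc_val _ t

namespace Collar
variable {X : Type} [TopologicalSpace X] {A : Set X}

/-- The collar of the boundary of a cylinder. -/
def cyl (C : Collar A) : Collar (BDat.cyl A) where
  κ t z := (C.κ t z.1, pj ((1 + 2 * t) * z.2 - t))
  κ_cont := (C.κ_cont.comp (f := fun p : I × X × I => (p.1, p.2.1)) (by fun_prop)).prodMk
    (continuous_pj.comp (by fun_prop))
  κ_zero z := by simp [C.κ_zero]
  κ_mem t z hz := by
    rcases hz with h | h | h
    · exact .inl (C.κ_mem t _ h)
    · exact .inr (.inl (pj_of_nonpos (by simp [h, t.2.1])))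
    · exact .inr (.inr (pj_of_one_le (by simp [h]; linarith [t.2.1])))
  ψ z := max (C.ψ z.1) (pj (max (1 - 3 * z.2) (3 * z.2 - 2)))
  ψ_cont := (C.ψ_cont.comp continuous_fst).max (continuous_pj.comp (by fun_prop))
  ψ_eq z hz := by
    rcases hz with h | h | h
    · rw [C.ψ_eq _ h]; exact max_eq_left le_one'
    · rw [pj_of_one_le (by simp [h])]; exact max_eq_right le_one'
    · rw [pj_of_one_le (by simp [h]; norm_num)]; exact max_eq_right le_one'
  mem_of_ne z hz := by
    by_cases h : C.ψ z.1 = 0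
    · right
      by_contra! h2
      apply hz
      rw [h, pj_of_nonpos]
      · simp
      · refine max_le ?_ ?_
        · by_contra! h3
          exact h2.1 (pj_of_nonpos (by push_cast; linarith))
        · by_contra! h3
          exact h2.2 (pj_of_one_le (by push_cast; linarith))
    · exact .inl (C.mem_of_ne _ h)
  closed := (C.closed.preimage continuous_fst).union
    ((isClosed_singleton.preimage continuous_snd).union
      (isClosed_singleton.preimage continuous_snd))

end Collar

/-- Cubes. -/
def Cb : ℕ → Type
  | 0 => Unit
  | k + 1 => Cb k × I

instance instMetricSpaceCb : ∀ k, MetricSpace (Cb k)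
  | 0 => inferInstanceAs (MetricSpace Unit)
  | k + 1 => have := instMetricSpaceCb k; inferInstanceAs (MetricSpace (Cb k × I))

instance instCompactSpaceCb : ∀ k, CompactSpace (Cb k)
  | 0 => inferInstanceAs (CompactSpace Unit)
  | k + 1 => have := instCompactSpaceCb k; inferInstanceAs (CompactSpace (Cb k × I))

/-- The boundary of a cube. -/
def bd : ∀ k, Set (Cb k)
  | 0 => ∅
  | k + 1 => cyl (bd k)

/-- The collar of the boundary of a cube. -/
def bdCollar : ∀ k, Collar (bd k)
  | 0 =>
    { κ := fun _ x => x
      κ_cont := continuous_snd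
      κ_zero := fun _ => rfl
      κ_mem := fun _ _ h => h
      ψ := fun _ => 0
      ψ_cont := continuous_const
      ψ_eq := fun _ h => h.elim
      mem_of_ne := fun _ h => (h rfl).elim
      closed := isClosed_empty }
  | k + 1 => (bdCollar k).cyl

/-- Lifting of homotopies through orbit maps. -/
theorem hlp {M B X : Type*} [Monoid M] [TopologicalSpace M] [ContinuousMul M]
    [TopologicalSpace B] [PseudoMetricSpace X] [CompactSpace X] (act : M → B → B)
    (act_one : ∀ b, act 1 b = b) (act_mul : ∀ m n b, act (m * n) b = act m (act n b))
    (T : B × B → M) (O : Set (B × B)) (hO : IsOpen O)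
    (T_cont : ContinuousOn T O) (T_self : ∀ b, (b, b) ∈ O → T (b, b) = 1)
    (T_act : ∀ z ∈ O, act (T z) z.1 = z.2) (P : Submonoid M)
    (h : I → X → B) (hc : Continuous fun p : I × X => h p.1 p.2)
    (hd : ∀ t x, (h t x, h t x) ∈ O)
    (hP : ∀ t t' x, (h t x, h t' x) ∈ O → T (h t x, h t' x) ∈ P) :
    ∃ G : I → X → M, Continuous (fun p : I × X => G p.1 p.2) ∧ (∀ x, G 0 x = 1) ∧
      (∀ t x, act (G t x) (h 0 x) = h t x) ∧
      (∀ x, (∀ t, h t x = h 0 x) → ∀ t, G t x = 1) ∧ ∀ t x, G t x ∈ P := by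
  obtain ⟨n, hn, hnO⟩ : ∃ n : ℕ, 0 < n ∧ ∀ (t t' : I) (x : X), dist t t' ≤ 1 / n →
      (h t x, h t' x) ∈ O := by
    have hf : Continuous fun z : (I × I) × X => (h z.1.1 z.2, h z.1.2 z.2) :=
      (hc.comp (f := fun z : (I × I) × X => (z.1.1, z.2)) (by fun_prop)).prodMk
        (hc.comp (f := fun z : (I × I) × X => (z.1.2, z.2)) (by fun_prop))
    have hK : IsCompact {z : (I × I) × X | z.1.1 = z.1.2} :=
      (isClosed_eq (by fun_prop) (by fun_prop)).isCompact
    obtain ⟨δ, hδ, hδO⟩ := hK.exists_thickening_subset_open (hO.preimage hf) (by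
      rintro ⟨⟨t, t'⟩, x⟩ (rfl : t = t')
      exact hd _ _)
    obtain ⟨n, hn⟩ := exists_nat_one_div_lt hδ
    refine ⟨n + 1, n.succ_pos, fun t t' x hx => ?_⟩
    apply hδO (a := ((t, t'), x))
    rw [Metric.mem_thickening_iff]
    refine ⟨((t, t), x), rfl, ?_⟩
    simp only [Prod.dist_eq, dist_self, max_eq_left dist_nonneg, max_eq_right dist_nonneg]
    rw [dist_comm]
    push_cast at hx
    exact hx.trans_lt hn
  let s : ℕ → I → I := fun i t => min t (pj (i / n))
  have hs : ∀ i, Continuous (s i) := fun i => by fun_prop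
  have hsd : ∀ i t, dist (s i t) (s (i + 1) t) ≤ 1 / n := fun i t => by
    have h1 : dist (s i t) (s (i + 1) t) ≤ dist (pj (i / n)) (pj ((i + 1 : ℕ) / n)) := by
      rw [Subtype.dist_eq, Subtype.dist_eq, Real.dist_eq, Real.dist_eq]
      exact (abs_min_sub_min_le_max (t : ℝ) (pj (i / n) : ℝ) t (pj ((i + 1 : ℕ) / n) : ℝ)).trans
        (by simp)
    refine h1.trans ?_
    have h2 := LipschitzWith.projIcc (zero_le_one (α := ℝ)) |>.dist_le_mul (i / n : ℝ)
      ((i + 1 : ℕ) / n)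
    refine h2.trans (le_of_eq ?_)
    rw [Real.dist_eq, ← sub_div, abs_div]
    simp
  have hsO : ∀ i t x, (h (s i t) x, h (s (i + 1) t) x) ∈ O := fun i t x => hnO _ _ _ (hsd i t)
  have key : ∀ m : ℕ, ∃ G : I → X → M, Continuous (fun p : I × X => G p.1 p.2) ∧
      (∀ x, G 0 x = 1) ∧ (∀ t x, act (G t x) (h 0 x) = h (s m t) x) ∧
      (∀ x, (∀ t, h t x = h 0 x) → ∀ t, G t x = 1) ∧ ∀ t x, G t x ∈ P := by
    intro m
    induction m with
    | zero =>
      refine ⟨fun _ _ => 1, continuous_const, fun _ => rfl, fun t x => ?_, fun _ _ _ => rfl,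
        fun _ _ => P.one_mem⟩
      rw [act_one, show s 0 t = 0 by simp [s]]
    | succ m ih =>
      obtain ⟨G, h1, h2, h3, h4, h5⟩ := ih
      refine ⟨fun t x => T (h (s m t) x, h (s (m + 1) t) x) * G t x, ?_, fun x => ?_,
        fun t x => ?_, fun x hx t => ?_, fun t x => P.mul_mem (hP _ _ _ (hsO m t x)) (h5 t x)⟩
      · refine Continuous.mul (T_cont.comp_continuous (f := fun p : I × X =>
          (h (s m p.1) p.2, h (s (m + 1) p.1) p.2)) ?_ fun p => hsO m p.1 p.2) h1
        exact (hc.comp (f := fun p : I × X => (s m p.1, p.2)) (by fun_prop)).prodMk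
          (hc.comp (f := fun p : I × X => (s (m + 1) p.1, p.2)) (by fun_prop))
      · simp [s, T_self _ (hd 0 x), h2]
      · rw [act_mul, h3, T_act _ (hsO m t x)]
      · simp only [hx, T_self _ (hd 0 x), h4 x hx, one_mul]
  obtain ⟨G, h1, h2, h3, h4, h5⟩ := key n
  refine ⟨G, h1, h2, fun t x => ?_, h4, h5⟩
  rw [h3, show s n t = t by
    simp only [s]; rw [div_self (by positivity), pj_of_one_le le_rfl]; exact min_eq_left le_one']

/-- Coordinates of a cube. -/
def cbι : ∀ k, Cb k → Fin k → ℝ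
  | 0, _ => Fin.elim0
  | k + 1, z => Fin.snoc (cbι k z.1) (z.2 : ℝ)

/-- The point of the cube with given truncated coordinates. -/
def cbr : ∀ k, (Fin k → ℝ) → Cb k
  | 0, _ => ()
  | k + 1, v => (cbr k (Fin.init v), pj (v (Fin.last k)))

theorem continuous_cbι : ∀ k, Continuous (cbι k)
  | 0 => continuous_of_const fun _ _ => rfl
  | k + 1 => ((continuous_cbι k).comp (continuous_fst (X := Cb k) (Y := I))).finSnoc
      (continuous_subtype_val.comp (continuous_snd (X := Cb k) (Y := I)))

theorem continuous_cbr : ∀ k, Continuous (cbr k)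
  | 0 => continuous_const
  | k + 1 => ((continuous_cbr k).comp (Continuous.finInit continuous_id)).prodMk
      (continuous_pj.comp (continuous_apply _))

theorem cbr_cbι : ∀ k x, cbr k (cbι k x) = x
  | 0, _ => rfl
  | k + 1, x => Prod.ext ((congrArg (cbr k) (Fin.init_snoc _ _)).trans (cbr_cbι k x.1))
      ((congrArg pj (Fin.snoc_last _ _)).trans (pj_coe x.2))

theorem Htp.line {X E : Type*} [TopologicalSpace X] [NormedAddCommGroup E] [NormedSpace ℝ E]
    {P : (X → E) → Prop} {f g : X → E} (hf : Continuous f) (hg : Continuous g)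
    (h : ∀ t : I, P fun x => f x + (t : ℝ) • (g x - f x)) : Htp P f g :=
  ⟨fun t x => f x + (t : ℝ) • (g x - f x), by fun_prop, by simp, by simp, h⟩

/-- Low-dimensional homotopy groups of a punctured vector space vanish. -/
theorem htp_const {k : ℕ} {E : Type*} [NormedAddCommGroup E] [NormedSpace ℝ E]
    [FiniteDimensional ℝ E] (hk : k + 1 < Module.finrank ℝ E) {F : Cb k → E} (hF : Continuous F)
    (h0 : ∀ x, F x ≠ 0) {v : E} (hv : v ≠ 0) (hb : ∀ x ∈ bd k, F x = v) :
    Htp (fun f => (∀ x, f x ≠ 0) ∧ ∀ x ∈ bd k, f x = v) F fun _ => v := by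
  obtain ⟨δ, hδ, hδF, hδv⟩ : ∃ δ > 0, (∀ x, δ ≤ ‖F x‖) ∧ δ ≤ ‖v‖ := by
    rcases isEmpty_or_nonempty (Cb k) with hX | hX
    · exact ⟨‖v‖, norm_pos_iff.2 hv, fun x => isEmptyElim x, le_rfl⟩
    · obtain ⟨x, -, hx⟩ := isCompact_univ.exists_isMinOn Set.univ_nonempty hF.norm.continuousOn
      exact ⟨min ‖F x‖ ‖v‖, lt_min (norm_pos_iff.2 (h0 x)) (norm_pos_iff.2 hv),
        fun y => (min_le_left _ _).trans (hx (Set.mem_univ y)), min_le_right _ _⟩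
  obtain ⟨g', hg', hgF', -⟩ := (hF.comp (continuous_cbr k)).exists_contDiff_approx 1
    (ε := fun _ => δ / 4) continuous_const (fun _ => by positivity)
  have hd := ContDiff.dense_compl_range_of_finrank_lt_finrank
    (f := fun z : (Fin k → ℝ) × ℝ => z.2 • g' z.1) (by fun_prop) (by simpa using hk)
  obtain ⟨w, hwv, hw⟩ := hd.exists_dist_lt v (ε := δ / 4) (by positivity)
  obtain ⟨g, hg, hgF, hgw⟩ : ∃ g : Cb k → E, Continuous g ∧ (∀ x, dist (g x) (F x) < δ / 4) ∧
      ∀ x (s : ℝ), s • g x ≠ w := by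
    refine ⟨fun x => g' (cbι k x), hg'.continuous.comp (continuous_cbι k), fun x => ?_,
      fun x s h => hwv ⟨(_, s), h⟩⟩
    simpa [cbr_cbι] using hgF' (cbι k x)
  obtain ⟨ψ, hψ0, hψ1, hψI⟩ := exists_continuous_zero_one_of_isClosed
    (s := {x | δ / 4 ≤ dist (F x) v}) (t := bd k)
    (isClosed_le continuous_const (by fun_prop)) (bdCollar k).closed (by
      rw [Set.disjoint_left]
      intro x hx hx'
      simp only [Set.mem_ofPred_eq, hb x hx', dist_self] at hx
      linarith)
  let c : (Cb k → E) → Cb k → E := fun f x => f x + ψ x • (v - f x)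
  have hc : ∀ f, Continuous f → Continuous (c f) := fun f hf => by fun_prop
  have hcb : ∀ f, ∀ x ∈ bd k, c f x = v := fun f x hx => by simp [c, hψ1 hx]
  have hball : ∀ x, ψ x ≠ 0 → dist (F x) v < δ / 4 := fun x hx => by
    by_contra! h
    exact hx (hψ0 h)
  have hB : ∀ x, ψ x ≠ 0 → ∀ f : Cb k → E, f x ∈ Metric.ball v δ → c f x ∈ Metric.ball v δ :=
    fun x hx f hf => (convex_ball v δ).add_smul_sub_mem hf (Metric.mem_ball_self hδ) (hψI x)
  have hBF : ∀ x, ψ x ≠ 0 → F x ∈ Metric.ball v δ := fun x hx => by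
    have := hball x hx; rw [Metric.mem_ball]; linarith
  have hBg : ∀ x, ψ x ≠ 0 → g x ∈ Metric.ball v δ := fun x hx => by
    have := hball x hx; have := hgF x; have := dist_triangle (g x) (F x) v
    rw [Metric.mem_ball]; linarith
  have hBw : w ∈ Metric.ball v δ := by
    rw [Metric.mem_ball, dist_comm]; linarith
  have h0B : ∀ y ∈ Metric.ball v δ, y ≠ 0 := by
    rintro y hy rfl
    rw [Metric.mem_ball, dist_zero_left] at hy
    linarith
  have hBl : ∀ (t : I) {y z : E}, y ∈ Metric.ball v δ → z ∈ Metric.ball v δ →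
      y + (t : ℝ) • (z - y) ≠ 0 := fun t y z hy hz =>
    h0B _ ((convex_ball v δ).add_smul_sub_mem hy hz t.2)
  have hc0 : ∀ x f, ψ x = 0 → c f x = f x := fun x f hx => by simp [c, hx]
  have near : ∀ (t : I) {y z : E}, dist y z < δ / 4 → δ ≤ ‖y‖ → y + (t : ℝ) • (z - y) ≠ 0 := by
    intro t y z h1 h2 h3
    have h4 : ‖y‖ ≤ dist y z := by
      rw [eq_neg_of_add_eq_zero_left h3, norm_neg, norm_smul, dist_comm, ← dist_eq_norm,
        Real.norm_of_nonneg t.2.1]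
      exact mul_le_of_le_one_left dist_nonneg t.2.2 |>.trans_eq (by
        rw [← eq_neg_of_add_eq_zero_left h3])
    linarith
  refine .trans (.line hF (hc F hF) fun t => ⟨fun x => ?_, fun x hx => ?_⟩)
    (.trans (.line (hc F hF) (hc g hg) fun t => ⟨fun x => ?_, fun x hx => ?_⟩)
    (.trans (.line (hc g hg) (hc (fun _ => w) continuous_const) fun t =>
      ⟨fun x => ?_, fun x hx => ?_⟩)
    (.line (hc (fun _ => w) continuous_const) continuous_const fun t =>
      ⟨fun x => ?_, fun x hx => ?_⟩)))
  · by_cases hx : ψ x = 0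
    · simpa [hc0 _ _ hx] using h0 x
    · exact hBl t (hBF x hx) (hB x hx F (hBF x hx))
  · simp [hcb _ x hx, hb x hx]
  · by_cases hx : ψ x = 0
    · beta_reduce
      rw [hc0 x _ hx, hc0 x _ hx]
      exact near t (by rw [dist_comm]; exact hgF x) (hδF x)
    · exact hBl t (hB x hx _ (hBF x hx)) (hB x hx _ (hBg x hx))
  · simp [hcb _ x hx]
  · by_cases hx : ψ x = 0
    · beta_reduce
      rw [hc0 x g hx, hc0 x (fun _ => w) hx]
      intro h
      by_cases ht : (t : ℝ) = 0
      · have h1 : g x = 0 := by simpa [ht] using h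
        have h2 := hgF x
        rw [h1, dist_zero_left] at h2
        linarith [hδF x]
      · refine hgw x (-((1 - t) / t)) ?_
        have h3 : (t : ℝ) • w = (-(1 - t : ℝ)) • g x := by
          rw [← sub_eq_zero, ← h]; module
        rw [← inv_smul_smul₀ ht w, h3, smul_smul]
        congr 1
        ring
    · exact hBl t (hB x hx _ (hBg x hx)) (hB x hx (fun _ => w) hBw)
  · simp [hcb _ x hx]
  · by_cases hx : ψ x = 0
    · beta_reduce
      rw [hc0 x (fun _ => w) hx]
      intro h
      refine near (σ t) hw hδv ?_
      rw [← h, coe_symm_eq]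
      module
    · exact hBl t (hB x hx (fun _ => w) hBw) (Metric.mem_ball_self hδ)
  · simp [hcb _ x hx]

section
variable {K : Type} [NormedDivisionRing K] [NormedAlgebra ℝ K] [StarRing K] [ContinuousStar K]
  [FiniteDimensional ℝ K] {κ : Type} [Fintype κ] [DecidableEq κ]

/-- Invertible matrices differing from the identity only in the given rows and columns. -/
def SG (K : Type) [NormedDivisionRing K] {κ : Type} [Fintype κ] [DecidableEq κ] (s : Finset κ) :
    Submonoid (Matrix κ κ K) where
  carrier := {M | IsUnit M ∧ ∀ i j, i ∉ s ∨ j ∉ s → M i j = (1 : Matrix κ κ K) i j}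
  one_mem' := ⟨isUnit_one, fun _ _ _ => rfl⟩
  mul_mem' {M N} hM hN := by
    refine ⟨hM.1.mul hN.1, ?_⟩
    rintro i j (h | h)
    · rw [Matrix.mul_apply, Finset.sum_congr rfl fun k _ => by rw [hM.2 i k (.inl h)],
        ← Matrix.mul_apply, one_mul, hN.2 i j (.inl h)]
    · rw [Matrix.mul_apply, Finset.sum_congr rfl fun k _ => by rw [hN.2 k j (.inr h)],
        ← Matrix.mul_apply, mul_one, hM.2 i j (.inr h)]

theorem SG_mono {s t : Finset κ} (h : t ⊆ s) : SG K t ≤ SG K s := fun _ hM =>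
  ⟨hM.1, fun i j hij => hM.2 i j (hij.imp (fun h' h'' => h' (h h'')) fun h' h'' => h' (h h''))⟩

attribute [local instance] Matrix.linftyOpNormedRing in
theorem isOpen_isUnit_matrix : IsOpen {M : Matrix κ κ K | IsUnit M} := by
  have : CompleteSpace K := FiniteDimensional.complete ℝ K
  have : @CompleteSpace (Matrix κ κ K) PseudoMetricSpace.toUniformSpace :=
    inferInstanceAs (CompleteSpace (κ → κ → K))
  have : HasSummableGeomSeries (Matrix κ κ K) := inferInstance
  exact Units.isOpen (R := Matrix κ κ K)

/-- A matrix moving one vector to another. -/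
def mvT (z : (κ → K) × (κ → K)) : Matrix κ κ K := fun i j =>
  (1 : Matrix κ κ K) i j + (∑ k, ‖z.1 k‖ ^ 2 : ℝ)⁻¹ • ((z.2 i - z.1 i) * star (z.1 j))

theorem sum_norm_sq_ne {p : κ → K} (hp : p ≠ 0) : (∑ k, ‖p k‖ ^ 2 : ℝ) ≠ 0 := by
  intro h
  apply hp
  funext i
  have := (Finset.sum_eq_zero_iff_of_nonneg fun k _ => by positivity).1 h i (Finset.mem_univ i)
  simpa using this

theorem mvT_mulVec (hK : ∀ a : K, star a * a = algebraMap ℝ K (‖a‖ ^ 2)) {p q : κ → K}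
    (hp : p ≠ 0) : (mvT (p, q)).mulVec p = q := by
  funext i
  simp only [Matrix.mulVec, dotProduct, mvT, add_mul, Finset.sum_add_distrib]
  have h1 : ∑ j, (1 : Matrix κ κ K) i j * p j = p i := by simp [Matrix.one_apply]
  rw [h1, Finset.sum_congr rfl fun j _ => by rw [smul_mul_assoc, mul_assoc, hK],
    ← Finset.smul_sum, ← Finset.mul_sum, ← map_sum, ← Algebra.commutes, ← Algebra.smul_def,
    smul_smul, inv_mul_cancel₀ (sum_norm_sq_ne hp), one_smul, add_sub_cancel]

theorem mvT_self (p : κ → K) : mvT (p, p) = 1 := by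
  ext i j; simp [mvT]

theorem continuousOn_mvT : ContinuousOn mvT {z : (κ → K) × (κ → K) | z.1 ≠ 0} := by
  refine continuousOn_pi.2 fun i => continuousOn_pi.2 fun j => ?_
  unfold mvT
  refine continuousOn_const.add (ContinuousOn.smul (ContinuousOn.inv₀ ?_ fun z hz =>
    sum_norm_sq_ne hz) ?_)
  · fun_prop
  · fun_prop

theorem col_ne_zero {M : Matrix κ κ K} (hM : IsUnit M) (p : κ) : ∃ i, M i p ≠ 0 := by
  by_contra! h
  obtain ⟨N, hN⟩ := hM.exists_left_inv
  have := congrFun (congrFun hN p) p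
  simp [Matrix.mul_apply, h] at this

/-- Stability for families of invertible matrices: removal of one index. -/
theorem stab_step (hK : ∀ a : K, star a * a = algebraMap ℝ K (‖a‖ ^ 2)) {k : ℕ} {s : Finset κ}
    {p : κ} (hp : p ∈ s) (hk : k + 1 < s.card * Module.finrank ℝ K) {F : Cb k → Matrix κ κ K}
    (hF : Continuous F) (hs : ∀ x, F x ∈ SG K s) (hb : ∀ x ∈ bd k, F x ∈ SG K (s.erase p)) :
    ∃ F', Htp (fun f => (∀ x, f x ∈ SG K s) ∧ ∀ x ∈ bd k, f x = F x) F F' ∧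
      ∀ x, F' x ∈ SG K (s.erase p) := by
  have hps : p ∉ s.erase p := Finset.notMem_erase p s
  obtain ⟨H, hHc, hH0, hH1, hH⟩ := htp_const (k := k) (E := s → K)
    (F := fun x i => F x i p) (v := Pi.single ⟨p, hp⟩ 1)
    (by rwa [Module.finrank_pi_fintype, Finset.sum_const, Finset.card_univ, Fintype.card_coe,
      smul_eq_mul])
    (by fun_prop) (fun x h0 => by
      obtain ⟨i, hi⟩ := col_ne_zero (hs x).1 p
      by_cases his : i ∈ s
      · exact hi (congrFun h0 ⟨i, his⟩)
      · rw [(hs x).2 i p (.inl his), Matrix.one_apply_ne (by rintro rfl; exact his hp)] at hi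
        exact hi rfl)
    (by simp) (fun x hx => by
      funext i
      rw [(hb x hx).2 _ _ (.inr hps)]
      by_cases hi : i = ⟨p, hp⟩
      · subst hi; simp
      · rw [Pi.single_eq_of_ne hi, Matrix.one_apply_ne fun h => hi (Subtype.ext h)])
  let h : I → Cb k → κ → K := fun t x i => if hi : i ∈ s then H t x ⟨i, hi⟩ else 0
  have hhc : Continuous fun z : I × Cb k => h z.1 z.2 := by
    refine continuous_pi fun i => ?_
    by_cases hi : i ∈ s
    · simp only [h, hi, dite_true]; exact (continuous_apply _).comp hHc
    · simp only [h, hi, dite_false]; exact continuous_const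
  have hh0 : ∀ t x, h t x ≠ 0 := fun t x h0 => (hH t).1 x (by
    funext i
    have := congrFun h0 i
    simpa [h] using this)
  have hhs : ∀ t x i, i ∉ s → h t x i = 0 := fun t x i hi => by simp [h, hi]
  have hhF : ∀ x i, h 0 x i = F x i p := fun x i => by
    by_cases hi : i ∈ s
    · simp [h, hi, hH0]
    · rw [hhs _ _ _ hi, (hs x).2 i p (.inl hi), Matrix.one_apply_ne (by rintro rfl; exact hi hp)]
  have hh1 : ∀ x i, h 1 x i = (1 : Matrix κ κ K) i p := fun x i => by
    by_cases hi : i = p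
    · subst hi; simp [h, hp, hH1]
    · rw [Matrix.one_apply_ne hi]
      by_cases his : i ∈ s
      · simp only [h, his, dite_true, hH1]
        exact Pi.single_eq_of_ne (fun h => hi (congrArg Subtype.val h)) _
      · exact hhs _ _ _ his
  have hhb : ∀ x ∈ bd k, ∀ t, h t x = h 0 x := fun x hx t => by
    funext i
    by_cases hi : i ∈ s
    · simp only [h, hi, dite_true]; rw [(hH t).2 x hx, (hH 0).2 x hx]
    · simp [h, hi]
  obtain ⟨G, hGc, hG0, hGa, hGb, hGs⟩ := hlp (X := Cb k) (fun (M : Matrix κ κ K) v => M.mulVec v)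
    (fun v => Matrix.one_mulVec v) (fun M N v => (Matrix.mulVec_mulVec v M N).symm) mvT
    ({z | z.1 ≠ 0} ∩ mvT ⁻¹' {M | IsUnit M})
    (continuousOn_mvT.isOpen_inter_preimage (isOpen_ne_fun continuous_fst continuous_const)
      isOpen_isUnit_matrix)
    (continuousOn_mvT.mono Set.inter_subset_left) (fun v _ => mvT_self v)
    (fun z hz => mvT_mulVec hK hz.1) (SG K s) h hhc
    (fun t x => ⟨hh0 t x, by simp [mvT_self]⟩) (fun t t' x hx => ⟨hx.2, fun i j hij => by
      rcases hij with hi | hi <;> simp [mvT, hhs _ _ _ hi]⟩)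
  let M : Cb k → Matrix κ κ K := fun x => G 1 x * F x
  have hG1 : Continuous (G 1) := hGc.comp (f := fun x => ((1 : I), x)) (by fun_prop)
  have hMc : Continuous M := hG1.mul hF
  have hM1 : ∀ x i, M x i p = (1 : Matrix κ κ K) i p := fun x i => by
    have := congrFun (hGa 1 x) i
    rw [hh1] at this
    rw [← this]
    simp only [M, Matrix.mul_apply, Matrix.mulVec, dotProduct, hhF]
  have hMb : ∀ x ∈ bd k, M x = F x := fun x hx => by
    simp only [M]; rw [hGb x (hhb x hx), one_mul]
  have hMs : ∀ x, M x ∈ SG K s := fun x => (SG K s).mul_mem (hGs 1 x) (hs x)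
  let E : Cb k → Matrix κ κ K := fun x i j => if i = p ∧ j ≠ p then M x p j else 0
  have hEc : Continuous E := continuous_matrix fun i j => by
    by_cases hij : i = p ∧ j ≠ p
    · simp only [E, if_pos hij]; exact hMc.matrix_elem p j
    · simp only [E, if_neg hij]; exact continuous_const
  have hEE : ∀ x, E x * E x = 0 := fun x => by
    ext i j
    rw [Matrix.mul_apply]
    refine Finset.sum_eq_zero fun l _ => ?_
    by_cases hl : l = p <;> simp [E, hl]
  have hME : ∀ x, M x * E x = E x := fun x => by
    ext i j
    rw [Matrix.mul_apply, Finset.sum_eq_single p]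
    · rw [hM1]
      by_cases hi : i = p
      · subst hi; simp [E]
      · simp [E, hi]
    · intro l _ hl; simp [E, hl]
    · simp
  have hU : ∀ x (t : ℝ), 1 - t • E x ∈ SG K s := fun x t => by
    refine ⟨⟨⟨1 - t • E x, 1 + t • E x, ?_, ?_⟩, rfl⟩, fun i j hij => ?_⟩
    · simp [sub_mul, mul_add, hEE]
    · simp [add_mul, mul_sub, hEE]
    · have : E x i j = 0 := by
        by_cases h1 : i = p ∧ j ≠ p
        · have hj : j ∉ s := hij.resolve_left fun h => h (h1.1 ▸ hp)
          simp only [E, h1]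
          simp [(hMs x).2 p j (.inr hj), Ne.symm h1.2]
        · simp [E, h1]
      simp [this]
  have hEb : ∀ x ∈ bd k, E x = 0 := fun x hx => by
    ext i j
    by_cases h1 : i = p ∧ j ≠ p
    · simp only [E, h1]
      simp [hMb x hx, (hb x hx).2 p j (.inl hps), Ne.symm h1.2]
    · simp [E, h1]
  refine ⟨fun x => M x * (1 - (1 : ℝ) • E x), .trans (G := M) ?_ ?_, fun x => ?_⟩
  · refine ⟨fun t x => G t x * F x, hGc.mul (hF.comp continuous_snd), ?_, rfl, fun t =>
      ⟨fun x => (SG K s).mul_mem (hGs t x) (hs x), fun x hx => ?_⟩⟩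
    · funext x; beta_reduce; rw [hG0, one_mul]
    · simp only []; rw [hGb x (hhb x hx), one_mul]
  · refine ⟨fun t x => M x * (1 - (t : ℝ) • E x), ?_, ?_, ?_, fun t =>
      ⟨fun x => (SG K s).mul_mem (hMs x) (hU x t), fun x hx => ?_⟩⟩
    · exact (hMc.comp continuous_snd).mul (continuous_const.sub
        ((continuous_subtype_val.comp continuous_fst).smul (hEc.comp continuous_snd)))
    · funext x; simp
    · funext x; simp
    · simp [hEb x hx, hMb x hx]
  · have hx := (SG K s).mul_mem (hMs x) (hU x 1)
    beta_reduce
    refine ⟨hx.1, fun i j hij => ?_⟩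
    by_cases hi : i = p
    · subst hi
      rw [one_smul, mul_sub, mul_one, hME, Matrix.sub_apply]
      by_cases hj : j = i
      · subst hj; simp [E, hM1]
      · simp [E, hj, Ne.symm hj]
    by_cases hj : j = p
    · subst hj
      rw [one_smul, mul_sub, mul_one, hME, Matrix.sub_apply]
      simp [E, hM1]
    · exact hx.2 i j (by simpa [hi, hj] using hij)

/-- Stability for families of invertible matrices. -/
theorem stab (hK : ∀ a : K, star a * a = algebraMap ℝ K (‖a‖ ^ 2)) {k : ℕ} {s t : Finset κ}
    (hts : t ⊆ s) (hk : k + 1 < (t.card + 1) * Module.finrank ℝ K) {F : Cb k → Matrix κ κ K}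
    (hF : Continuous F) (hs : ∀ x, F x ∈ SG K s) (hb : ∀ x ∈ bd k, F x ∈ SG K t) :
    ∃ F', Htp (fun f => (∀ x, f x ∈ SG K s) ∧ ∀ x ∈ bd k, f x = F x) F F' ∧
      ∀ x, F' x ∈ SG K t := by
  induction hn : (s \ t).card generalizing s F with
  | zero =>
    have : s ⊆ t := by simpa using hn
    exact ⟨F, .refl hF ⟨hs, fun _ _ => rfl⟩, fun x => SG_mono this (hs x)⟩
  | succ n ih =>
    obtain ⟨p, hp⟩ := Finset.card_pos.1 (by rw [hn]; exact n.succ_pos)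
    obtain ⟨hps, hpt⟩ := Finset.mem_sdiff.1 hp
    have hte : t ⊆ s.erase p := Finset.subset_erase.2 ⟨hts, hpt⟩
    have hlt : t.card + 1 ≤ s.card := Finset.card_lt_card
      (hts.ssubset_of_ne (by rintro rfl; exact hpt hps))
    obtain ⟨F', h1, h2⟩ := stab_step hK hps (hk.trans_le (Nat.mul_le_mul_right _ hlt)) hF hs
      fun x hx => SG_mono hte (hb x hx)
    have h3 := h1.prop_right.2
    obtain ⟨F'', h4, h5⟩ := ih hte h1.cont_right h2 (fun x hx => by rw [h3 x hx]; exact hb x hx)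
      (by
        have : s.erase p \ t = (s \ t).erase p := by ext; simp; tauto
        rw [this, Finset.card_erase_of_mem hp, hn]; rfl)
    exact ⟨F'', h1.trans (h4.mono fun f _ hf => ⟨fun x => SG_mono (Finset.erase_subset _ _)
      (hf.1 x), fun x hx => (hf.2 x hx).trans (h3 x hx)⟩), h5⟩

end

/-- Left multiplication by a quaternion. -/
def qL (h : ℍ[ℝ]) : Mat (Fin 4) :=
  !![h.re, -h.imI, -h.imJ, -h.imK; h.imI, h.re, -h.imK, h.imJ; h.imJ, h.imK, h.re, -h.imI;
    h.imK, -h.imJ, h.imI, h.re]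

/-- Right multiplication by a quaternion. -/
def qR (h : ℍ[ℝ]) : Mat (Fin 4) :=
  !![h.re, -h.imI, -h.imJ, -h.imK; h.imI, h.re, h.imK, -h.imJ; h.imJ, -h.imK, h.re, h.imI;
    h.imK, h.imJ, -h.imI, h.re]

theorem qL_mul (a b : ℍ[ℝ]) : qL (a * b) = qL a * qL b := by
  ext i j
  fin_cases i <;> fin_cases j <;> simp [qL, Matrix.mul_apply, Fin.sum_univ_four] <;> ring

theorem qL_one : qL 1 = 1 := by
  ext i j; fin_cases i <;> fin_cases j <;> simp [qL]

theorem qL_neg (a : ℍ[ℝ]) : qL (-a) = -qL a := by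
  ext i j; fin_cases i <;> fin_cases j <;> simp [qL]

theorem qL_add (a b : ℍ[ℝ]) : qL (a + b) = qL a + qL b := by
  ext i j; fin_cases i <;> fin_cases j <;> simp [qL] <;> ring

theorem qL_star (a : ℍ[ℝ]) : star (qL a) = qL (star a) := by
  ext i j; fin_cases i <;> fin_cases j <;> simp [qL, Matrix.star_apply]

theorem qL_comm_qR (a b : ℍ[ℝ]) : qL a * qR b = qR b * qL a := by
  ext i j
  fin_cases i <;> fin_cases j <;> simp [qL, qR, Matrix.mul_apply, Fin.sum_univ_four] <;> ring

@[simps] def qi : ℍ[ℝ] := ⟨0, 1, 0, 0⟩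
@[simps] def qj : ℍ[ℝ] := ⟨0, 0, 1, 0⟩
@[simps] def qk : ℍ[ℝ] := ⟨0, 0, 0, 1⟩

theorem qi_qi : qi * qi = -1 := by ext <;> simp
theorem qj_qj : qj * qj = -1 := by ext <;> simp
theorem qk_qk : qk * qk = -1 := by ext <;> simp
theorem qi_qj : qi * qj = qk := by ext <;> simp
theorem qj_qi : qj * qi = -qk := by ext <;> simp
theorem qj_qk : qj * qk = qi := by ext <;> simp
theorem qk_qj : qk * qj = -qi := by ext <;> simp
theorem qk_qi : qk * qi = qj := by ext <;> simp
theorem qi_qk : qi * qk = -qj := by ext <;> simp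
theorem star_qi : star qi = -qi := by ext <;> simp
theorem star_qj : star qj = -qj := by ext <;> simp
theorem star_qk : star qk = -qk := by ext <;> simp

/-- Matrices commuting with right multiplications are left multiplications. -/
theorem eq_qL {N : Mat (Fin 4)} (h1 : N * qR qi = qR qi * N) (h2 : N * qR qj = qR qj * N) :
    N = qL ⟨N 0 0, N 1 0, N 2 0, N 3 0⟩ := by
  have e1 := fun i j => congrFun (congrFun h1 i) j
  have e2 := fun i j => congrFun (congrFun h2 i) j
  simp [qR, Matrix.mul_apply, Fin.sum_univ_four] at e1 e2
  simp [Fin.forall_fin_succ] at e1 e2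
  ext i j
  fin_cases i <;> fin_cases j <;> simp [qL] <;> linarith

def mJ : Mat (Fin 2) := !![0, 1; -1, 0]
def mX : Mat (Fin 2) := !![0, 1; 1, 0]
def mZ : Mat (Fin 2) := !![1, 0; 0, -1]

theorem mJ_mJ : mJ * mJ = -1 := by simp [mJ, Matrix.one_fin_two]
theorem mX_mX : mX * mX = 1 := by simp [mX, Matrix.one_fin_two]
theorem mZ_mZ : mZ * mZ = 1 := by simp [mZ, Matrix.one_fin_two]
theorem mJ_mX : mJ * mX = mZ := by simp [mJ, mX, mZ]
theorem mX_mJ : mX * mJ = -mZ := by simp [mJ, mX, mZ]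
theorem mJ_mZ : mJ * mZ = -mX := by simp [mJ, mX, mZ]
theorem mZ_mJ : mZ * mJ = mX := by simp [mJ, mX, mZ]
theorem mX_mZ : mX * mZ = -mJ := by simp [mJ, mX, mZ]
theorem mZ_mX : mZ * mX = mJ := by simp [mJ, mX, mZ]
theorem star_mJ : star mJ = -mJ := by ext i j; fin_cases i <;> fin_cases j <;> simp [mJ, Matrix.star_apply]
theorem star_mX : star mX = mX := by ext i j; fin_cases i <;> fin_cases j <;> simp [mX, Matrix.star_apply]
theorem star_mZ : star mZ = mZ := by ext i j; fin_cases i <;> fin_cases j <;> simp [mZ, Matrix.star_apply]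

section
variable {κ κ' : Type} [Fintype κ] [Fintype κ']

theorem kr_neg_left (a : Mat κ) (b : Mat κ') : (-a) ⊗ₖ b = -(a ⊗ₖ b) := by
  ext; simp
theorem kr_neg_right (a : Mat κ) (b : Mat κ') : a ⊗ₖ (-b) = -(a ⊗ₖ b) := by
  ext; simp
theorem kr_star (a : Mat κ) (b : Mat κ') : star (a ⊗ₖ b) = star a ⊗ₖ star b :=
  Matrix.conjTranspose_kronecker a b
theorem kr_mul (a a' : Mat κ) (b b' : Mat κ') : (a ⊗ₖ b) * (a' ⊗ₖ b') = (a * a') ⊗ₖ (b * b') :=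
  (Matrix.mul_kronecker_mul _ _ _ _).symm
end

abbrev Mx := Fin 2 × Fin 4
abbrev Dx := Fin 2 × Mx

/-- Constants of the quaternionic structure. -/
def c1 : Fin 3 → Mat Mx := ![mZ ⊗ₖ 1, 1 ⊗ₖ qR qi, 1 ⊗ₖ qR qj]
def c3 (l : Fin 3) : Mat Dx := (1 : Mat (Fin 2)) ⊗ₖ c1 l
def ε3 : Fin 3 → ℝ := ![-1, 1, 1]
def e1 : Mat Dx := 1 ⊗ₖ (mJ ⊗ₖ 1)
def e2 : Mat Dx := 1 ⊗ₖ (mX ⊗ₖ qL qi)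
def e3 : Mat Dx := 1 ⊗ₖ (mX ⊗ₖ qL qj)
def e4 : Mat Dx := mZ ⊗ₖ (mX ⊗ₖ qL qk)
def e5 : Mat Dx := mX ⊗ₖ (mX ⊗ₖ qL qk)
def τ1 : Mat Dx := 1 ⊗ₖ (1 ⊗ₖ qL qk)
def τ2 : Mat Dx := mZ ⊗ₖ (1 ⊗ₖ qL qi)
def τ3 : Mat Dx := mJ ⊗ₖ (1 ⊗ₖ 1)
def τ4 : Mat Dx := mZ ⊗ₖ (1 ⊗ₖ 1)

theorem e_c3 {u v : Mat (Fin 2)} {h : ℍ[ℝ]} (hv : v * mZ = -(mZ * v)) (l : Fin 3) :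
    (u ⊗ₖ (v ⊗ₖ qL h) : Mat Dx) * c3 l = ε3 l • (c3 l * (u ⊗ₖ (v ⊗ₖ qL h) : Mat Dx)) := by
  fin_cases l <;> simp [c3, c1, ε3, kr_mul, hv, qL_comm_qR, kr_neg_left, kr_neg_right]

theorem τ_c3 {u : Mat (Fin 2)} {h : ℍ[ℝ]} (l : Fin 3) :
    (u ⊗ₖ (1 ⊗ₖ qL h) : Mat Dx) * c3 l = c3 l * (u ⊗ₖ (1 ⊗ₖ qL h) : Mat Dx) := by
  fin_cases l <;> simp [c3, c1, kr_mul, qL_comm_qR]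

theorem mJ_anti : mJ * mZ = -(mZ * mJ) := by rw [mJ_mZ, mZ_mJ]
theorem mX_anti : mX * mZ = -(mZ * mX) := by rw [mX_mZ, mZ_mX]

theorem e1_c3 (l : Fin 3) : e1 * c3 l = ε3 l • (c3 l * e1) := by
  unfold e1; rw [← qL_one]; exact e_c3 mJ_anti l
theorem τ3_c3 (l : Fin 3) : τ3 * c3 l = c3 l * τ3 := by
  unfold τ3; rw [← qL_one]; exact τ_c3 l
theorem τ4_c3 (l : Fin 3) : τ4 * c3 l = c3 l * τ4 := by
  unfold τ4; rw [← qL_one]; exact τ_c3 l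

section
attribute [local simp] e1 e2 e3 e4 e5 τ1 τ2 τ3 τ4 kr_mul kr_star kr_neg_left kr_neg_right qL_neg
  qL_one qL_star mJ_mJ mX_mX mZ_mZ mJ_mX mX_mJ mJ_mZ mZ_mJ mX_mZ mZ_mX
  star_mJ star_mX star_mZ qi_qi qj_qj qk_qk qi_qj qj_qi qj_qk qk_qj qk_qi
  qi_qk star_qi star_qj star_qk

theorem star_e1 : star e1 = -e1 := by simp
theorem e1_sq : e1 * e1 = -1 := by simp
theorem star_e2 : star e2 = -e2 := by simp
theorem e2_sq : e2 * e2 = -1 := by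
  simp [← qL_mul]
theorem star_e3 : star e3 = -e3 := by simp
theorem e3_sq : e3 * e3 = -1 := by
  simp [← qL_mul]
theorem star_e4 : star e4 = -e4 := by simp
theorem e4_sq : e4 * e4 = -1 := by
  simp [← qL_mul]
theorem star_e5 : star e5 = -e5 := by simp
theorem e5_sq : e5 * e5 = -1 := by
  simp [← qL_mul]
theorem e2_e1 : e2 * e1 = -(e1 * e2) := by simp
theorem e3_e1 : e3 * e1 = -(e1 * e3) := by simp
theorem e3_e2 : e3 * e2 = -(e2 * e3) := by
  simp [← qL_mul]
theorem e4_e1 : e4 * e1 = -(e1 * e4) := by simp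
theorem e4_e2 : e4 * e2 = -(e2 * e4) := by
  simp [← qL_mul]
theorem e4_e3 : e4 * e3 = -(e3 * e4) := by
  simp [← qL_mul]
theorem e5_e1 : e5 * e1 = -(e1 * e5) := by simp
theorem e5_e2 : e5 * e2 = -(e2 * e5) := by
  simp [← qL_mul]
theorem e5_e3 : e5 * e3 = -(e3 * e5) := by
  simp [← qL_mul]
theorem e5_e4 : e5 * e4 = -(e4 * e5) := by
  simp [← qL_mul]
theorem τ1_left : star τ1 * τ1 = 1 := by
  simp [← qL_mul]
theorem τ1_e1 : τ1 * e1 = e1 * τ1 := by simp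
theorem τ1_e2 : τ1 * e2 = -(e2 * τ1) := by
  simp [← qL_mul]
theorem τ2_left : star τ2 * τ2 = 1 := by
  simp [← qL_mul]
theorem τ2_e1 : τ2 * e1 = e1 * τ2 := by simp
theorem τ2_e2 : τ2 * e2 = e2 * τ2 := by
  simp [← qL_mul]
theorem τ2_e3 : τ2 * e3 = -(e3 * τ2) := by
  simp [← qL_mul]
theorem τ3_left : star τ3 * τ3 = 1 := by simp
theorem τ3_e1 : τ3 * e1 = e1 * τ3 := by simp
theorem τ3_e2 : τ3 * e2 = e2 * τ3 := by simp
theorem τ3_e3 : τ3 * e3 = e3 * τ3 := by simp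
theorem τ3_e4 : τ3 * e4 = -(e4 * τ3) := by simp
theorem τ4_left : star τ4 * τ4 = 1 := by simp
theorem τ4_e1 : τ4 * e1 = e1 * τ4 := by simp
theorem τ4_e2 : τ4 * e2 = e2 * τ4 := by simp
theorem τ4_e3 : τ4 * e3 = e3 * τ4 := by simp
theorem τ4_e4 : τ4 * e4 = e4 * τ4 := by simp
theorem τ4_e5 : τ4 * e5 = -(e5 * τ4) := by simp
end

/-- The four steps of the periodicity. -/
def BD1 : BDat (Fin 3) (Mat Dx) where
  c := c3
  ε := ε3
  e := e1
  f := e2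
  τ := τ1
  e_star := star_e1
  e_sq := e1_sq
  e_c := e1_c3
  f_star := star_e2
  f_sq := e2_sq
  f_c := e_c3 mX_anti
  f_e := e2_e1
  τ_left := τ1_left
  τ_right := mul_eq_one_comm.1 τ1_left
  τ_c := τ_c3
  τ_e := τ1_e1
  τ_f := τ1_e2
  ε_sq l := by fin_cases l <;> simp [ε3]

def BD2 : BDat (Option (Fin 3)) (Mat Dx) :=
  BD1.ext e3 τ2 star_e3 e3_sq (e_c3 mX_anti) e3_e1 e3_e2 τ2_left τ_c3 τ2_e1 τ2_e2 τ2_e3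

def BD3 : BDat (Option (Option (Fin 3))) (Mat Dx) :=
  BD2.ext e4 τ3 star_e4 e4_sq (by
      rintro (_ | l)
      · exact e4_e1.trans (neg_one_smul ℝ _).symm
      · exact e_c3 mX_anti l)
    e4_e2 e4_e3 τ3_left (by
      rintro (_ | l)
      · exact τ3_e1
      · exact τ3_c3 l)
    τ3_e2 τ3_e3 τ3_e4

def BD4 : BDat (Option (Option (Option (Fin 3)))) (Mat Dx) :=
  BD3.ext e5 τ4 star_e5 e5_sq (by
      rintro (_ | _ | l)
      · exact e5_e2.trans (neg_one_smul ℝ _).symm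
      · exact e5_e1.trans (neg_one_smul ℝ _).symm
      · exact e_c3 mX_anti l)
    e5_e3 e5_e4 τ4_left (by
      rintro (_ | _ | l)
      · exact τ4_e2
      · exact τ4_e1
      · exact τ4_c3 l)
    τ4_e3 τ4_e4 τ4_e5

theorem bott_four (H : SE.Two BD4.cdp.Y (bd 1)) : SE.Two BD1.cd.Y (bd 5) :=
  BD1.two_step (bdCollar 4) (BD2.two_step (bdCollar 3) (BD3.two_step (bdCollar 2)
    (BD4.two_step (bdCollar 1) H)))

/-- Off-diagonal parametrization of a linear space in a star ring by pairs of elements of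
another star ring. -/
structure KD (R A : Type) [Ring R] [StarRing R] [TopologicalSpace R] [Ring A] [StarRing A]
    [TopologicalSpace A] where
  P : R →+ A
  Q : R →+ A
  p : A → R
  q : A → R
  S : Set A
  P_cont : Continuous P
  Q_cont : Continuous Q
  p_cont : Continuous p
  p_PQ : ∀ a b, p (P a + Q b) = a
  q_PQ : ∀ a b, q (P a + Q b) = b
  star_P : ∀ h, star (P h) = -Q (star h)
  PP : ∀ h h', P h * P h' = 0
  QQ : ∀ h h', Q h * Q h' = 0
  PQ : ∀ h h', P h * Q h' = P 1 * Q (h * h')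
  QP : ∀ h h', Q h * P h' = Q 1 * P (h * h')
  one : P 1 * Q 1 + Q 1 * P 1 = -1
  mem_S : ∀ a, a ∈ S → P (p a) + Q (q a) = a
  PQ_S : ∀ a b, P a + Q b ∈ S

namespace KD
variable {R A : Type} [Ring R] [StarRing R] [TopologicalSpace R] [Ring A] [StarRing A]
  [TopologicalSpace A] (k : KD R A)

theorem star_Q (h : R) : star (k.Q h) = -k.P (star h) := by
  rw [← star_star h, ← neg_neg (k.Q _), ← k.star_P, star_neg, star_star, star_star]

theorem P_add_Q_inj {a b a' b' : R} (h : k.P a + k.Q b = k.P a' + k.Q b') : a = a' ∧ b = b' :=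
  ⟨by rw [← k.p_PQ a b, h, k.p_PQ], by rw [← k.q_PQ a b, h, k.q_PQ]⟩

theorem PQP (h : R) : k.P 1 * (k.Q 1 * k.P h) = -k.P h := by
  have := congrArg (· * k.P h) k.one
  simpa [add_mul, mul_assoc, k.PP] using this

theorem QPQ (h : R) : k.Q 1 * (k.P 1 * k.Q h) = -k.Q h := by
  have := congrArg (· * k.Q h) k.one
  simpa [add_mul, mul_assoc, k.QQ] using this

theorem mul_eq (a b a' b' : R) : (k.P a + k.Q b) * (k.P a' + k.Q b') =
    k.P 1 * k.Q (a * b') + k.Q 1 * k.P (b * a') := by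
  rw [mul_add, add_mul, add_mul, k.PP, k.QQ, k.PQ, k.QP, zero_add, add_zero, add_comm]

/-- The parametrization of skew elements. -/
def Φ (b : R) : A := k.P b + k.Q (star b)

theorem star_Φ (b : R) : star (k.Φ b) = -k.Φ b := by
  rw [Φ, star_add, k.star_P, k.star_Q, star_star, neg_add, add_comm]

theorem isUnit_Φ {b : R} (hb : IsUnit b) : IsUnit (k.Φ b) := by
  obtain ⟨c, h1⟩ := hb.exists_right_inv
  obtain ⟨c', h2⟩ := hb.exists_left_inv
  have h3 : c' = c := left_inv_eq_right_inv h2 h1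
  subst h3
  have h1' : star c' * star b = 1 := by rw [← star_mul, h1, star_one]
  have h2' : star b * star c' = 1 := by rw [← star_mul, h2, star_one]
  have e : -(k.P 1 * k.Q 1) + -(k.Q 1 * k.P 1) = 1 := by rw [← neg_add, k.one, neg_neg]
  refine ⟨⟨k.Φ b, k.Φ (-star c'), ?_, ?_⟩, rfl⟩ <;>
  · rw [Φ, Φ, mul_eq]
    simp [h1, h2, h1', h2', e]

theorem isUnit_of_mul {b h h' : R} (e : k.Φ b * (k.P h + k.Q h') = 1) : IsUnit b := by
  rw [Φ, mul_eq] at e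
  have e1 := congrArg (k.P 1 * ·) e
  have e2 := congrArg (k.Q 1 * ·) e
  simp only [mul_add, ← mul_assoc (k.P 1) (k.P 1), ← mul_assoc (k.Q 1) (k.Q 1), k.PP, k.QQ,
    zero_mul, zero_add, add_zero, k.PQP, k.QPQ, mul_one] at e1 e2
  have h1 : star b * h = -1 := (k.P_add_Q_inj (b := 0) (b' := 0)
    (by rw [map_neg, ← e1, neg_neg])).1
  have h2 : b * h' = -1 := (k.P_add_Q_inj (a := 0) (a' := 0) (by rw [map_neg, ← e2, neg_neg])).2
  have h3 : star h * b = -1 := by rw [← star_star b, ← star_mul, h1, star_neg, star_one]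
  have h4 : b * (-h') = 1 := by rw [mul_neg, h2, neg_neg]
  have h5 : (-star h) * b = 1 := by rw [neg_mul, h3, neg_neg]
  exact ⟨⟨b, -h', h4, by rwa [← left_inv_eq_right_inv h5 h4]⟩, rfl⟩

theorem Φ_p {a : A} (ha : a ∈ k.S) (hs : star a = -a) : k.Φ (k.p a) = a := by
  have h := k.mem_S a ha
  rw [← h, star_add, k.star_P, k.star_Q, ← neg_add, neg_inj, add_comm] at hs
  rw [Φ, (k.P_add_Q_inj hs).2, h]

theorem p_Φ (b : R) : k.p (k.Φ b) = b := k.p_PQ _ _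

theorem continuous_Φ [ContinuousStar R] [ContinuousAdd A] : Continuous k.Φ :=
  k.P_cont.add (k.Q_cont.comp continuous_star)

variable {ν : Type} [Fintype ν] [DecidableEq ν]

/-- Passage to matrices. -/
def mat (ν : Type) [Fintype ν] [DecidableEq ν] : KD (Matrix ν ν R) (Matrix ν ν A) :=
  have hd : ∀ f : R →+ A, (1 : Matrix ν ν R).map f = Matrix.diagonal fun _ => f 1 := fun f => by
    rw [← Matrix.diagonal_one, Matrix.diagonal_map (map_zero f)]
  { P := k.P.mapMatrix
    Q := k.Q.mapMatrix
    p := fun M => M.map k.p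
    q := fun M => M.map k.q
    S := {M | ∀ i j, M i j ∈ k.S}
    P_cont := continuous_id.matrix_map k.P_cont
    Q_cont := continuous_id.matrix_map k.Q_cont
    p_cont := continuous_id.matrix_map k.p_cont
    p_PQ := fun a b => by ext i j; exact k.p_PQ _ _
    q_PQ := fun a b => by ext i j; exact k.q_PQ _ _
    star_P := fun h => by ext i j; exact k.star_P _
    PP := fun h h' => by ext i j; simp [Matrix.mul_apply, k.PP]
    QQ := fun h h' => by ext i j; simp [Matrix.mul_apply, k.QQ]
    PQ := fun h h' => by
      ext i j
      change (h.map k.P * h'.map k.Q : Matrix ν ν A) i j =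
        (Matrix.map 1 k.P * (h * h').map k.Q : Matrix ν ν A) i j
      rw [hd, Matrix.diagonal_mul]
      simp only [Matrix.mul_apply, Matrix.map_apply, map_sum, Finset.mul_sum, k.PQ (h _ _)]
    QP := fun h h' => by
      ext i j
      change (h.map k.Q * h'.map k.P : Matrix ν ν A) i j =
        (Matrix.map 1 k.Q * (h * h').map k.P : Matrix ν ν A) i j
      rw [hd, Matrix.diagonal_mul]
      simp only [Matrix.mul_apply, Matrix.map_apply, map_sum, Finset.mul_sum, k.QP (h _ _)]
    one := by
      simp only [AddMonoidHom.mapMatrix_apply, hd, Matrix.diagonal_mul_diagonal,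
        Matrix.diagonal_add, k.one]
      rw [← Matrix.diagonal_one, ← Matrix.diagonal_neg]
    mem_S := fun M hM => by ext i j; exact k.mem_S _ (hM i j)
    PQ_S := fun M N i j => k.PQ_S _ _ }

theorem mat_Φ_apply (b : Matrix ν ν R) (i j : ν) :
    (k.mat ν).Φ b i j = k.P (b i j) + k.Q (star (b j i)) := rfl

end KD

theorem dg_map {A B : Type*} [Ring A] [Ring B] (f : A → B) (hf : f 0 = 0) (x y z : A)
    (i j : Fin 3) : dg (f x) (f y) (f z) i j = f (dg x y z i j) := by
  fin_cases i <;> fin_cases j <;> first | rfl | exact hf.symm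

theorem dg_symm {A : Type*} [Ring A] (x y z : A) (i j : Fin 3) : dg x y z i j = dg x y z j i := by
  fin_cases i <;> fin_cases j <;> rfl

theorem dg_same {A : Type*} [Ring A] (x : A) (i j : Fin 3) :
    dg x x x i j = if i = j then x else 0 := by
  fin_cases i <;> fin_cases j <;> rfl

section tower
variable {κ μ : Type} [Fintype κ] [DecidableEq κ] [Fintype μ] [DecidableEq μ]

/-- Block matrices as matrices. -/
def thE {ν : Type} [Fintype ν] [DecidableEq ν] (e : ν × μ ≃ κ) :
    Matrix ν ν (Mat μ) ≃ₐ[ℝ] Mat κ :=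
  (Matrix.compAlgEquiv ν μ ℝ ℝ).trans (Matrix.reindexAlgEquiv ℝ ℝ e)

variable {ν : Type} [Fintype ν] [DecidableEq ν]

theorem thE_apply (e : ν × μ ≃ κ) (M : Matrix ν ν (Mat μ)) (p q : ν) (x y : μ) :
    thE e M (e (p, x)) (e (q, y)) = M p q x y := by
  change M (e.symm (e (p, x))).1 (e.symm (e (q, y))).1 (e.symm (e (p, x))).2
    (e.symm (e (q, y))).2 = _
  simp

theorem thE_ext (e : ν × μ ≃ κ) {a b : Mat κ}
    (h : ∀ p q x y, a (e (p, x)) (e (q, y)) = b (e (p, x)) (e (q, y))) : a = b := by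
  ext i j
  have := h (e.symm i).1 (e.symm j).1 (e.symm i).2 (e.symm j).2
  simpa using this

theorem thE_star (e : ν × μ ≃ κ) (M : Matrix ν ν (Mat μ)) : star (thE e M) = thE e (star M) :=
  thE_ext e fun p q x y => by
    rw [Matrix.star_apply, thE_apply, thE_apply]; rfl

theorem continuous_thE (e : ν × μ ≃ κ) : Continuous (thE e) :=
  continuous_matrix fun i j => ((continuous_id.matrix_elem (e.symm i).1 (e.symm j).1).matrix_elem
    (e.symm i).2 (e.symm j).2)

theorem continuous_thE_symm (e : ν × μ ≃ κ) : Continuous (thE e).symm :=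
  continuous_matrix fun i j => continuous_matrix fun x y =>
    (continuous_id.matrix_elem (e (i, x)) (e (j, y)))

/-- Index equivalences along the tower. -/
def eT {lam : Type} (e : lam × μ ≃ κ) : ∀ n, TT lam n × μ ≃ TT κ n
  | 0 => e
  | n + 1 => (Equiv.prodAssoc _ _ _).trans (Equiv.prodCongr (Equiv.refl (Fin 3)) (eT e n))

/-- Flattening of block matrices over any ring. -/
def cmpE {R : Type} [Ring R] : M3 (Matrix ν ν R) ≃+* Matrix (Fin 3 × ν) (Fin 3 × ν) R :=
  Matrix.compRingEquiv (Fin 3) ν R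

theorem cmpE_dg_diagonal {R : Type} [Ring R] (a : R) :
    cmpE (dg (Matrix.diagonal fun _ : ν => a) (Matrix.diagonal fun _ : ν => a)
      (Matrix.diagonal fun _ : ν => a)) = Matrix.diagonal fun _ => a := by
  ext ⟨i, p⟩ ⟨j, q⟩
  change (dg (Matrix.diagonal fun _ : ν => a) (Matrix.diagonal fun _ : ν => a)
      (Matrix.diagonal fun _ : ν => a) : M3 (Matrix ν ν R)) i j p q = _
  rw [dg_same]
  by_cases h : i = j <;> simp [h, Matrix.diagonal_apply]

variable {lam : Type} [Fintype lam] [DecidableEq lam] (e : lam × μ ≃ κ)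

theorem thE_cmpE (n : ℕ) (M N L : Matrix (TT lam n) (TT lam n) (Mat μ)) :
    thE (eT e (n + 1)) (cmpE (dg M N L)) =
      fl (dg (thE (eT e n) M) (thE (eT e n) N) (thE (eT e n) L)) := by
  refine thE_ext (eT e (n + 1)) ?_
  rintro ⟨i, p⟩ ⟨j, q⟩ x y
  refine (thE_apply (eT e (n + 1)) (cmpE (dg M N L)) (i, p) (j, q) x y).trans ?_
  change (dg M N L : M3 (Matrix (TT lam n) (TT lam n) (Mat μ))) i j p q x y =
    (dg (thE (eT e n) M) (thE (eT e n) N) (thE (eT e n) L) : M3 (Mat (TT κ n))) i j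
    (eT e n (p, x)) (eT e n (q, y))
  rw [dg_map _ (map_zero (thE (eT e n))), thE_apply]

/-- Invertible matrices indexed by the tower. -/
abbrev GLu (K lam : Type) [Ring K] [Fintype lam] [DecidableEq lam] (n : ℕ) : Type :=
  {b : Matrix (TT lam n) (TT lam n) K // IsUnit b}

/-- Towers of general linear groups. -/
def GLS (K lam : Type) [Ring K] [TopologicalSpace K] [Fintype lam] [DecidableEq lam] : Sys where
  W n := GLu K lam n
  top _ := inferInstance
  w _ := ⟨1, isUnit_one⟩
  st n b := ⟨cmpE (dg b.1 1 1), (isUnit_dg b.2 isUnit_one isUnit_one).map cmpE⟩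
  st_cont n := by
    refine Continuous.subtype_mk (continuous_matrix fun i j => ?_) _
    change Continuous fun b : GLu K lam n =>
      dg b.1 1 1 i.1 j.1 i.2 j.2
    have : Continuous fun b : GLu K lam n => dg b.1 1 1 :=
      continuous_mat3 continuous_subtype_val continuous_const continuous_const continuous_const
        continuous_const continuous_const continuous_const continuous_const continuous_const
    exact (this.matrix_elem _ _).matrix_elem _ _
  st_w n := Subtype.ext ((congrArg cmpE dg_one).trans (map_one cmpE))

variable {ι : Type} {C : CDat ι κ} {K : Type} [Ring K] [StarRing K] [TopologicalSpace K]
  {k : KD K (Mat μ)} {c0 : ι → Mat μ} {e}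

theorem tw_eps (n : ℕ) : (C.tw n).ε = C.ε := by
  induction n with
  | zero => rfl
  | succ n ih => exact ih

theorem tw_c (hc : ∀ l, C.c l = thE e (Matrix.diagonal fun _ => c0 l)) (n : ℕ) (l : ι) :
    (C.tw n).c l = thE (eT e n) (Matrix.diagonal fun _ => c0 l) := by
  induction n with
  | zero => exact hc l
  | succ n ih =>
    refine Eq.trans ?_ (congrArg _ (cmpE_dg_diagonal (c0 l)))
    rw [thE_cmpE, ← ih]; rfl

theorem mat_Φ_one {ν : Type} [Fintype ν] [DecidableEq ν] :
    (k.mat ν).Φ 1 = Matrix.diagonal fun _ => k.Φ 1 := by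
  ext1 i j
  rw [KD.mat_Φ_apply, Matrix.diagonal_apply]
  by_cases h : i = j
  · subst h; simp [KD.Φ]
  · simp [h, Ne.symm h]

theorem tw_e (he : C.e = thE e (Matrix.diagonal fun _ => k.Φ 1)) (n : ℕ) :
    (C.tw n).e = thE (eT e n) ((k.mat _).Φ 1) := by
  rw [mat_Φ_one]
  induction n with
  | zero => exact he
  | succ n ih =>
    refine Eq.trans ?_ (congrArg _ (cmpE_dg_diagonal (k.Φ 1)))
    rw [thE_cmpE, ← ih]; rfl

theorem mat_Φ_dg {ν : Type} [Fintype ν] [DecidableEq ν] (b : Matrix ν ν K) :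
    (k.mat _).Φ (cmpE (dg b 1 1)) = cmpE (dg ((k.mat ν).Φ b) ((k.mat ν).Φ 1) ((k.mat ν).Φ 1)) := by
  ext1 ⟨i, p⟩ ⟨j, q⟩
  rw [KD.mat_Φ_apply]
  change k.P (dg b 1 1 i j p q) + k.Q (star (dg b 1 1 j i q p)) =
    (dg ((k.mat ν).Φ b) ((k.mat ν).Φ 1) ((k.mat ν).Φ 1) : M3 (Matrix ν ν (Mat μ))) i j p q
  rw [dg_map (k.mat ν).Φ (by rw [KD.Φ, star_zero, map_zero, map_zero, add_zero]),
    KD.mat_Φ_apply, dg_symm b 1 1 j i]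

theorem mem_tw {n : ℕ} (hc : ∀ l, C.c l = thE e (Matrix.diagonal fun _ => c0 l))
    (hS : k.S = {a | ∀ l, a * c0 l = C.ε l • (c0 l * a)})
    {M : Matrix (TT lam n) (TT lam n) (Mat μ)} :
    (∀ l, thE (eT e n) M * (C.tw n).c l = (C.tw n).ε l • ((C.tw n).c l * thE (eT e n) M)) ↔
      M ∈ (k.mat _).S := by
  change _ ↔ ∀ i j, M i j ∈ k.S
  simp only [tw_c hc, tw_eps, ← map_mul, ← map_smul, EmbeddingLike.apply_eq_iff_eq, hS,
    Set.mem_ofPred_eq]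
  refine ⟨fun h i j l => ?_, fun h l => ?_⟩
  · have := congrFun (congrFun (h l) i) j
    rwa [Matrix.mul_diagonal, Matrix.smul_apply, Matrix.diagonal_mul] at this
  · ext1 i j
    rw [Matrix.mul_diagonal, Matrix.smul_apply, Matrix.diagonal_mul, h]

variable {X : Type} [TopologicalSpace X] {A : Set X}

/-- Identification of the spaces in the periodicity with general linear groups. -/
theorem two_iff_GLS [ContinuousStar K] (hc : ∀ l, C.c l = thE e (Matrix.diagonal fun _ => c0 l))
    (he : C.e = thE e (Matrix.diagonal fun _ => k.Φ 1)) (hε : ∀ l, C.ε l * C.ε l = 1)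
    (hS : k.S = {a | ∀ l, a * c0 l = C.ε l • (c0 l * a)}) :
    SE.Two C.Y A ↔ SE.Two (GLS K lam) A := by
  let F : SysHom (GLS K lam) C.Y :=
    { φ := fun n (b : GLu K lam n) => ⟨thE (eT e n) ((k.mat _).Φ b.1), by
        rw [thE_star, KD.star_Φ, map_neg], ((k.mat _).isUnit_Φ b.2).map (thE (eT e n)),
        (mem_tw hc hS).2 ((k.mat _).PQ_S _ _)⟩
      cont := fun n => Continuous.subtype_mk ((continuous_thE _).comp
        ((k.mat _).continuous_Φ.comp continuous_subtype_val)) _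
      map_w := fun n => Subtype.ext (tw_e he n).symm
      map_st := fun n (b : GLu K lam n) => Subtype.ext (by
        change thE (eT e (n + 1)) ((k.mat _).Φ (cmpE (dg b.1 1 1))) =
          fl (dg (thE (eT e n) ((k.mat _).Φ b.1)) (C.tw n).e (C.tw n).e)
        rw [tw_e he, ← thE_cmpE]
        exact congrArg _ (mat_Φ_dg b.1)) }
  have hU : ∀ n (a : (C.tw n).U), (k.mat _).Φ ((k.mat _).p ((thE (eT e n)).symm a.1)) =
      (thE (eT e n)).symm a.1 := fun n a => by
    refine (k.mat _).Φ_p ((mem_tw hc hS).1 fun l => ?_) ?_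
    · rw [AlgEquiv.apply_symm_apply]; exact a.2.2.2 l
    · apply (thE (eT e n)).injective
      rw [← thE_star, map_neg, AlgEquiv.apply_symm_apply, a.2.1]
  have hV : ∀ n (a : (C.tw n).U), IsUnit ((k.mat _).p ((thE (eT e n)).symm a.1)) := fun n a => by
    obtain ⟨a', h1⟩ := a.2.2.1.exists_right_inv
    have h2 := mul_eq_one_comm.1 h1
    have h3 : (thE (eT e n)).symm a' ∈ (k.mat _).S := (mem_tw hc hS).1 fun l => by
      rw [AlgEquiv.apply_symm_apply]
      have := congrArg (fun z => (C.tw n).ε l • (a' * z * a')) (a.2.2.2 l)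
      beta_reduce at this
      rw [← mul_assoc, h2, one_mul, mul_smul_comm, smul_mul_assoc, smul_smul, tw_eps, hε,
        one_smul, mul_assoc, mul_assoc, h1, mul_one] at this
      rw [tw_eps, this]
    refine (k.mat _).isUnit_of_mul (h := (k.mat _).p ((thE (eT e n)).symm a'))
      (h' := (k.mat _).q ((thE (eT e n)).symm a')) ?_
    rw [hU, (k.mat _).mem_S _ h3, ← map_mul, h1, map_one]
  have hFb : ∀ n (a : (C.tw n).U), F.φ n ⟨(k.mat _).p ((thE (eT e n)).symm a.1), hV n a⟩ = a := fun n a =>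
    Subtype.ext (by
      change thE (eT e n) ((k.mat _).Φ ((k.mat _).p ((thE (eT e n)).symm a.1))) = a.1
      rw [hU, AlgEquiv.apply_symm_apply])
  have hbF : ∀ n (b : GLu K lam n), (⟨(k.mat _).p ((thE (eT e n)).symm (F.φ n b : (C.tw n).U).1), hV n (F.φ n b)⟩ :
      GLu K lam n) = b := fun n b => Subtype.ext (by
    change (k.mat _).p ((thE (eT e n)).symm (thE (eT e n) ((k.mat _).Φ b.1))) = b.1
    rw [AlgEquiv.symm_apply_apply, KD.p_Φ])
  let G : SysHom C.Y (GLS K lam) :=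
    { φ := fun n (a : (C.tw n).U) => ⟨(k.mat _).p ((thE (eT e n)).symm a.1), hV n a⟩
      cont := fun n => Continuous.subtype_mk ((k.mat _).p_cont.comp
        ((continuous_thE_symm _).comp continuous_subtype_val)) _
      map_w := fun n => (congrArg (fun a : (C.tw n).U =>
        (⟨(k.mat _).p ((thE (eT e n)).symm a.1), hV n a⟩ : GLu K lam n)) (F.map_w n).symm).trans
        (hbF n _)
      map_st := fun n (a : (C.tw n).U) => by
        obtain ⟨b, rfl⟩ : ∃ b : GLu K lam n, F.φ n b = a := ⟨_, hFb n a⟩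
        have h := F.map_st n b
        exact (congrArg (fun a : (C.tw (n + 1)).U => (⟨(k.mat _).p ((thE (eT e (n + 1))).symm a.1),
          hV _ a⟩ : GLu K lam (n + 1))) h.symm).trans
          ((hbF (n + 1) _).trans (congrArg _ (hbF n b).symm)) }
  exact ⟨.of_hom G F hFb hbF, .of_hom F G hbF hFb⟩

end tower

/-- The blocks of a matrix. -/
def blk {κ : Type} (a : Mat (Fin 2 × κ)) (i j : Fin 2) : Mat κ := fun x y => a (i, x) (j, y)

section
variable {κ : Type} [Fintype κ]

theorem blk_ext {a b : Mat (Fin 2 × κ)} (h : ∀ i j, blk a i j = blk b i j) : a = b := by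
  ext ⟨i, x⟩ ⟨j, y⟩
  exact congrFun (congrFun (h i j) x) y

theorem blk_mul_kr (a : Mat (Fin 2 × κ)) (u : Mat (Fin 2)) (v : Mat κ) (i j : Fin 2) :
    blk (a * (u ⊗ₖ v)) i j = ∑ l, u l j • (blk a i l * v) := by
  ext x y
  simp only [blk, Matrix.mul_apply, Fintype.sum_prod_type, Matrix.kroneckerMap_apply,
    Matrix.sum_apply, Matrix.smul_apply, smul_eq_mul, Finset.mul_sum]
  exact Finset.sum_congr rfl fun _ _ => Finset.sum_congr rfl fun _ _ => by ring

theorem blk_kr_mul (a : Mat (Fin 2 × κ)) (u : Mat (Fin 2)) (v : Mat κ) (i j : Fin 2) :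
    blk ((u ⊗ₖ v) * a) i j = ∑ l, u i l • (v * blk a l j) := by
  ext x y
  simp only [blk, Matrix.mul_apply, Fintype.sum_prod_type, Matrix.kroneckerMap_apply,
    Matrix.sum_apply, Matrix.smul_apply, smul_eq_mul, Finset.mul_sum]
  exact Finset.sum_congr rfl fun _ _ => Finset.sum_congr rfl fun _ _ => by ring

theorem blk_kr (u : Mat (Fin 2)) (v : Mat κ) (i j : Fin 2) : blk (u ⊗ₖ v) i j = u i j • v := rfl
theorem blk_add (a b : Mat (Fin 2 × κ)) (i j : Fin 2) :
    blk (a + b) i j = blk a i j + blk b i j := rfl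
theorem blk_smul (r : ℝ) (a : Mat (Fin 2 × κ)) (i j : Fin 2) : blk (r • a) i j = r • blk a i j := rfl

end

theorem mat_self_neg {κ : Type} {a : Mat κ} (h : a = -a) : a = 0 := by
  ext i j
  have : a i j = -a i j := congrFun (congrFun h i) j
  change a i j = 0
  linarith

def m01 : Mat (Fin 2) := !![0, 1; 0, 0]
def m10 : Mat (Fin 2) := !![0, 0; 1, 0]

theorem m01_m01 : m01 * m01 = 0 := by
  ext i j; fin_cases i <;> fin_cases j <;> simp [m01]
theorem m10_m10 : m10 * m10 = 0 := by
  ext i j; fin_cases i <;> fin_cases j <;> simp [m10]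
theorem m01_m10 : m01 * m10 + m10 * m01 = 1 := by simp [m01, m10, Matrix.one_fin_two]
theorem star_m01 : star m01 = m10 := by
  ext i j; fin_cases i <;> fin_cases j <;> simp [m01, m10, Matrix.star_apply]
theorem m01_mZ : m01 * mZ = -(mZ * m01) := by
  ext i j; fin_cases i <;> fin_cases j <;> simp [m01, mZ]
theorem m10_mZ : m10 * mZ = -(mZ * m10) := by
  ext i j; fin_cases i <;> fin_cases j <;> simp [m10, mZ]

/-- A column of a matrix as a quaternion. -/
def cq (N : Mat (Fin 4)) : ℍ[ℝ] := ⟨N 0 0, N 1 0, N 2 0, N 3 0⟩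

theorem cq_qL (h : ℍ[ℝ]) : cq (qL h) = h := by ext <;> simp [cq, qL]

theorem continuous_quat {X : Type*} [TopologicalSpace X] {a b c d : X → ℝ} (ha : Continuous a)
    (hb : Continuous b) (hc : Continuous c) (hd : Continuous d) :
    Continuous (Y := ℍ[ℝ]) fun x => ⟨a x, b x, c x, d x⟩ := by
  refine (Quaternion.linearIsometryEquivTuple.symm.continuous.comp
    ((PiLp.continuous_toLp 2 (fun _ : Fin 4 => ℝ)).comp
      (continuous_pi (f := fun x => ![a x, b x, c x, d x]) fun i => ?_))).congr fun x => rfl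
  fin_cases i
  exacts [ha, hb, hc, hd]

theorem continuous_cq : Continuous cq :=
  continuous_quat (continuous_id.matrix_elem _ _) (continuous_id.matrix_elem _ _)
    (continuous_id.matrix_elem _ _) (continuous_id.matrix_elem _ _)

theorem continuous_blk {κ : Type} (i j : Fin 2) : Continuous fun a : Mat (Fin 2 × κ) => blk a i j :=
  continuous_matrix fun _ _ => continuous_id.matrix_elem _ _

theorem continuous_qL : Continuous qL := by
  refine continuous_matrix fun i j => ?_
  have h0 := Quaternion.continuous_re
  have h1 := Quaternion.continuous_imI
  have h2 := Quaternion.continuous_imJ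
  have h3 := Quaternion.continuous_imK
  fin_cases i <;> fin_cases j <;>
    first | exact h0 | exact h1 | exact h2 | exact h3 | exact h1.neg | exact h2.neg | exact h3.neg

theorem continuous_kr {κ κ' : Type} (u : Mat κ) : Continuous fun v : Mat κ' => u ⊗ₖ v :=
  continuous_matrix fun _ _ => continuous_const.mul (continuous_id.matrix_elem _ _)

/-- The quaternionic parametrization. -/
def KD1 : KD ℍ[ℝ] (Mat Mx) where
  P := .mk' (fun h => m01 ⊗ₖ qL h) fun a b => by rw [qL_add, Matrix.kronecker_add]
  Q := .mk' (fun h => -(m10 ⊗ₖ qL h)) fun a b => by rw [qL_add, Matrix.kronecker_add, neg_add]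
  p a := cq (blk a 0 1)
  q a := -cq (blk a 1 0)
  S := {a | ∀ l, a * c1 l = ε3 l • (c1 l * a)}
  P_cont := (continuous_kr m01).comp continuous_qL
  Q_cont := ((continuous_kr m10).comp continuous_qL).neg
  p_cont := continuous_cq.comp (continuous_blk 0 1)
  p_PQ a b := by
    change cq (blk (m01 ⊗ₖ qL a + -(m10 ⊗ₖ qL b)) 0 1) = a
    rw [← kr_neg_left, blk_add, blk_kr, blk_kr]
    simp [m01, m10, cq_qL]
  q_PQ a b := by
    change -cq (blk (m01 ⊗ₖ qL a + -(m10 ⊗ₖ qL b)) 1 0) = b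
    rw [← kr_neg_right, ← qL_neg, blk_add, blk_kr, blk_kr]
    simp [m01, m10, cq_qL]
  star_P h := by
    change star (m01 ⊗ₖ qL h) = - -(m10 ⊗ₖ qL (star h))
    rw [kr_star, star_m01, qL_star, neg_neg]
  PP h h' := by
    change (m01 ⊗ₖ qL h) * (m01 ⊗ₖ qL h') = 0
    rw [kr_mul, m01_m01, Matrix.zero_kronecker]
  QQ h h' := by
    change -(m10 ⊗ₖ qL h) * -(m10 ⊗ₖ qL h') = 0
    rw [neg_mul_neg, kr_mul, m10_m10, Matrix.zero_kronecker]
  PQ h h' := by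
    change (m01 ⊗ₖ qL h) * -(m10 ⊗ₖ qL h') = (m01 ⊗ₖ qL 1) * -(m10 ⊗ₖ qL (h * h'))
    rw [mul_neg, mul_neg, kr_mul, kr_mul, ← qL_mul, ← qL_mul, one_mul]
  QP h h' := by
    change -(m10 ⊗ₖ qL h) * (m01 ⊗ₖ qL h') = -(m10 ⊗ₖ qL 1) * (m01 ⊗ₖ qL (h * h'))
    rw [neg_mul, neg_mul, kr_mul, kr_mul, ← qL_mul, ← qL_mul, one_mul]
  one := by
    change (m01 ⊗ₖ qL 1) * -(m10 ⊗ₖ qL 1) + -(m10 ⊗ₖ qL 1) * (m01 ⊗ₖ qL 1) = -1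
    rw [mul_neg, neg_mul, ← neg_add, kr_mul, kr_mul, ← Matrix.add_kronecker, m01_m10, ← qL_mul,
      one_mul, qL_one, Matrix.one_kronecker_one]
  mem_S a ha := by
    change m01 ⊗ₖ qL (cq (blk a 0 1)) + -(m10 ⊗ₖ qL (-cq (blk a 1 0))) = a
    have h0 := ha 0
    have h1 := ha 1
    have h2 := ha 2
    simp only [c1, ε3, Matrix.cons_val] at h0 h1 h2
    have H1 := fun i j => congrArg (blk · i j) h1
    have H2 := fun i j => congrArg (blk · i j) h2
    have H0 := fun i j => congrArg (blk · i j) h0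
    simp only [one_smul, neg_smul, ← kr_neg_left, ← neg_mul, blk_mul_kr, blk_kr_mul,
      Matrix.one_apply, ite_smul, zero_smul, Finset.sum_ite_eq, Finset.sum_ite_eq',
      Finset.mem_univ, if_true] at H1 H2 H0
    have H00 := H0 0 0
    have H11 := H0 1 1
    simp [mZ] at H00 H11
    have E := fun i j => eq_qL (H1 i j) (H2 i j)
    refine blk_ext fun i j => ?_
    rw [qL_neg, ← kr_neg_right, neg_neg, blk_add, blk_kr, blk_kr]
    fin_cases i <;> fin_cases j
    · simp [m01, m10]
      exact (mat_self_neg H00).symm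
    · simp [m01, m10]
      exact (E 0 1).symm
    · simp [m01, m10]
      exact (E 1 0).symm
    · simp [m01, m10]
      exact (mat_self_neg H11.symm).symm
  PQ_S a b l := by
    change (m01 ⊗ₖ qL a + -(m10 ⊗ₖ qL b)) * c1 l = ε3 l • (c1 l * (m01 ⊗ₖ qL a + -(m10 ⊗ₖ qL b)))
    rw [add_mul, mul_add, neg_mul, mul_neg, smul_add, smul_neg]
    congr 1
    · fin_cases l <;> simp [c1, ε3, kr_mul, m01_mZ, qL_comm_qR, kr_neg_left]
    · fin_cases l <;> simp [c1, ε3, kr_mul, m10_mZ, qL_comm_qR, kr_neg_left]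

theorem one_kr {κ : Type} [Fintype κ] [DecidableEq κ] (c : Mat κ) : (1 : Mat (Fin 2)) ⊗ₖ c =
    thE (Equiv.refl (Fin 2 × κ)) (Matrix.diagonal fun _ => c) := by
  refine blk_ext fun i j => ?_
  change (1 : Matrix (Fin 2) (Fin 2) ℝ) i j • c = Matrix.diagonal (fun _ => c) i j
  by_cases h : i = j
  · rw [h, Matrix.one_apply_eq, one_smul, Matrix.diagonal_apply_eq]
  · rw [Matrix.one_apply_ne h, zero_smul, Matrix.diagonal_apply_ne _ h]

theorem two_quat {X : Type} [TopologicalSpace X] {A : Set X} : SE.Two BD1.cd.Y A ↔ SE.Two (GLS ℍ[ℝ] (Fin 2)) A := by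
  refine two_iff_GLS (k := KD1) (e := Equiv.refl _) (c0 := c1) (fun l => one_kr _) ?_ BD1.ε_sq
    (Set.ext fun a => Iff.rfl)
  have : KD1.Φ 1 = mJ ⊗ₖ 1 := by
    change m01 ⊗ₖ qL 1 + -(m10 ⊗ₖ qL (star 1)) = _
    rw [star_one, ← kr_neg_left, ← Matrix.add_kronecker, qL_one]
    congr 1
    simp [m01, m10, mJ]
  rw [this]
  exact one_kr _

theorem eq_mX_kr {a : Mat Mx} (h : ∀ l, a * c1 l = ε3 l • (c1 l * a))
    (h1 : a * (mJ ⊗ₖ 1) = -((mJ ⊗ₖ 1) * a)) (h2 : a * (mX ⊗ₖ qL qi) = -((mX ⊗ₖ qL qi) * a))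
    (h3 : a * (mX ⊗ₖ qL qj) = -((mX ⊗ₖ qL qj) * a)) :
    a = mX ⊗ₖ qL (a (0, 3) (1, 0) • qk) := by
  have H : m01 ⊗ₖ qL (cq (blk a 0 1)) + -(m10 ⊗ₖ qL (-cq (blk a 1 0))) = a := KD1.mem_S a h
  rw [qL_neg, kr_neg_right, neg_neg] at H
  have H00 := congrArg (blk · 0 0) H
  have H11 := congrArg (blk · 1 1) H
  have H01 := congrArg (blk · 0 1) H
  simp [blk_add, blk_kr, m01, m10] at H00 H11 H01
  have G1 := congrArg (blk · 0 0) h1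
  have G2 := congrArg (blk · 0 0) h2
  have G3 := congrArg (blk · 0 0) h3
  simp only [← neg_mul, ← kr_neg_left, blk_mul_kr, blk_kr_mul, Fin.sum_univ_two] at G1 G2 G3
  simp [mJ, mX] at G1 G2 G3
  rw [← G1, ← H01, ← qL_mul, ← qL_mul, ← qL_neg] at G2 G3
  have K2 := congrArg cq G2
  have K3 := congrArg cq G3
  rw [cq_qL, cq_qL] at K2 K3
  have e : cq (blk a 0 1) = a (0, 3) (1, 0) • qk := by
    rw [Quaternion.ext_iff] at K2 K3
    simp at K2 K3
    ext
    · simp; linarith [K2.2]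
    · simp; linarith [K2.1]
    · simp; linarith [K3.1]
    · simp [cq, blk]
  rw [e] at H01
  refine blk_ext fun i j => ?_
  rw [blk_kr]
  fin_cases i <;> fin_cases j
  · simp [mX, ← H00]
  · simp [mX, ← H01]
  · simp [mX, ← H01, ← G1]
  · simp [mX, ← H11]

/-- The real parametrization. -/
def KD5 : KD ℝ (Mat Dx) where
  P := .mk' (fun h => m01 ⊗ₖ (mX ⊗ₖ qL (h • qk))) fun a b => by
    rw [add_smul, qL_add, Matrix.kronecker_add, Matrix.kronecker_add]
  Q := .mk' (fun h => m10 ⊗ₖ (mX ⊗ₖ qL (h • qk))) fun a b => by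
    rw [add_smul, qL_add, Matrix.kronecker_add, Matrix.kronecker_add]
  p a := a (0, 0, 3) (1, 1, 0)
  q a := a (1, 0, 3) (0, 1, 0)
  S := {a | ∀ l, a * BD4.cdp.c l = BD4.cdp.ε l • (BD4.cdp.c l * a)}
  P_cont := (continuous_kr m01).comp ((continuous_kr mX).comp (continuous_qL.comp
    (continuous_id.smul continuous_const)))
  Q_cont := (continuous_kr m10).comp ((continuous_kr mX).comp (continuous_qL.comp
    (continuous_id.smul continuous_const)))
  p_cont := continuous_id.matrix_elem _ _
  p_PQ a b := by
    simp [m01, m10, mX, qL]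
  q_PQ a b := by
    simp [m01, m10, mX, qL]
  star_P h := by
    change star (m01 ⊗ₖ (mX ⊗ₖ qL (h • qk))) = -(m10 ⊗ₖ (mX ⊗ₖ qL (star h • qk)))
    rw [kr_star, star_m01, kr_star, star_mX, qL_star, Quaternion.star_smul, star_trivial h, star_qk, smul_neg, qL_neg,
      kr_neg_right, kr_neg_right]
  PP h h' := by
    change (m01 ⊗ₖ _ : Mat Dx) * (m01 ⊗ₖ _) = 0
    rw [kr_mul, m01_m01, Matrix.zero_kronecker]
  QQ h h' := by
    change (m10 ⊗ₖ _ : Mat Dx) * (m10 ⊗ₖ _) = 0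
    rw [kr_mul, m10_m10, Matrix.zero_kronecker]
  PQ h h' := by
    change (m01 ⊗ₖ (mX ⊗ₖ qL (h • qk)) : Mat Dx) * (m10 ⊗ₖ (mX ⊗ₖ qL (h' • qk))) =
      (m01 ⊗ₖ (mX ⊗ₖ qL ((1 : ℝ) • qk))) * (m10 ⊗ₖ (mX ⊗ₖ qL ((h * h') • qk)))
    simp only [kr_mul, ← qL_mul, smul_mul_smul_comm, one_mul]
  QP h h' := by
    change (m10 ⊗ₖ (mX ⊗ₖ qL (h • qk)) : Mat Dx) * (m01 ⊗ₖ (mX ⊗ₖ qL (h' • qk))) =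
      (m10 ⊗ₖ (mX ⊗ₖ qL ((1 : ℝ) • qk))) * (m01 ⊗ₖ (mX ⊗ₖ qL ((h * h') • qk)))
    simp only [kr_mul, ← qL_mul, smul_mul_smul_comm, one_mul]
  one := by
    change (m01 ⊗ₖ (mX ⊗ₖ qL ((1 : ℝ) • qk)) : Mat Dx) * (m10 ⊗ₖ (mX ⊗ₖ qL ((1 : ℝ) • qk))) +
      (m10 ⊗ₖ (mX ⊗ₖ qL ((1 : ℝ) • qk))) * (m01 ⊗ₖ (mX ⊗ₖ qL ((1 : ℝ) • qk))) = -1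
    simp only [kr_mul, ← qL_mul, one_smul]
    rw [← Matrix.add_kronecker, m01_m10, mX_mX, qk_qk, qL_neg,
      qL_one, kr_neg_right, kr_neg_right, Matrix.one_kronecker_one, Matrix.one_kronecker_one]
  mem_S a ha := by
    change (m01 ⊗ₖ (mX ⊗ₖ qL (a (0, 0, 3) (1, 1, 0) • qk)) : Mat Dx) +
      (m10 ⊗ₖ (mX ⊗ₖ qL (a (1, 0, 3) (0, 1, 0) • qk))) = a
    have E1 : ∀ i j, blk a i j * (mJ ⊗ₖ 1) = -((mJ ⊗ₖ 1) * blk a i j) := fun i j => by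
      have h := congrArg (blk · i j) ((ha (some (some (some none)))).trans (neg_one_smul ℝ _))
      have e : BD4.cdp.c (some (some (some none))) = e1 := rfl
      simp only [e, e1, ← kr_neg_left, ← neg_mul, blk_mul_kr, blk_kr_mul,
        Matrix.neg_apply, Matrix.one_apply] at h
      simpa using h
    have E2 : ∀ i j, blk a i j * (mX ⊗ₖ qL qi) = -((mX ⊗ₖ qL qi) * blk a i j) := fun i j => by
      have h := congrArg (blk · i j) ((ha (some (some none))).trans (neg_one_smul ℝ _))
      have e : BD4.cdp.c (some (some none)) = e2 := rfl
      simp only [e, e2, ← kr_neg_left, ← neg_mul, blk_mul_kr, blk_kr_mul,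
        Matrix.neg_apply, Matrix.one_apply] at h
      simpa using h
    have E3 : ∀ i j, blk a i j * (mX ⊗ₖ qL qj) = -((mX ⊗ₖ qL qj) * blk a i j) := fun i j => by
      have h := congrArg (blk · i j) ((ha (some none)).trans (neg_one_smul ℝ _))
      have e : BD4.cdp.c (some none) = e3 := rfl
      simp only [e, e3, ← kr_neg_left, ← neg_mul, blk_mul_kr, blk_kr_mul,
        Matrix.neg_apply, Matrix.one_apply] at h
      simpa using h
    have E4 : ∀ i, blk a i i * (mX ⊗ₖ qL qk) = -((mX ⊗ₖ qL qk) * blk a i i) := fun i => by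
      have h := congrArg (blk · i i) ((ha none).trans (neg_one_smul ℝ _))
      have e : BD4.cdp.c none = e4 := rfl
      simp only [e, e4, ← kr_neg_left, ← neg_mul, blk_mul_kr, blk_kr_mul,
        Matrix.neg_apply] at h
      fin_cases i
      · simpa [mZ] using h
      · simp [mZ] at h
        change blk a 1 1 * (mX ⊗ₖ qL qk) = -((mX ⊗ₖ qL qk) * blk a 1 1)
        rw [← h, neg_neg]
    have Em : ∀ i j, ∀ l, blk a i j * c1 l = ε3 l • (c1 l * blk a i j) := fun i j l => by
      have h := congrArg (blk · i j) (ha (some (some (some (some l)))))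
      have e : BD4.cdp.c (some (some (some (some l)))) = (1 : Mat (Fin 2)) ⊗ₖ c1 l := rfl
      have e' : BD4.cdp.ε (some (some (some (some l)))) = ε3 l := rfl
      simp only [e, e', blk_smul, blk_mul_kr, blk_kr_mul, Matrix.one_apply] at h
      simpa using h
    have F : ∀ i j, blk a i j = mX ⊗ₖ qL (a (i, 0, 3) (j, 1, 0) • qk) := fun i j =>
      eq_mX_kr (Em i j) (E1 i j) (E2 i j) (E3 i j)
    have F0 : ∀ i, blk a i i = 0 := fun i => by
      have h' : blk a i i * (mX ⊗ₖ qL qk) = (mX ⊗ₖ qL qk) * blk a i i := by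
        rw [F, kr_mul, kr_mul, ← qL_mul, ← qL_mul, smul_mul_assoc, mul_smul_comm]
      have h0 : blk a i i * (mX ⊗ₖ qL qk) = 0 := mat_self_neg ((E4 i).trans (by rw [h']))
      have := congrArg (· * (mX ⊗ₖ qL (-qk) : Mat Mx)) h0
      simpa only [mul_assoc, kr_mul, mX_mX, ← qL_mul, mul_neg, qk_qk, neg_neg, qL_one,
        Matrix.one_kronecker_one, mul_one, zero_mul] using this
    refine blk_ext fun i j => ?_
    rw [blk_add, blk_kr, blk_kr]
    fin_cases i <;> fin_cases j
    · simp [m01, m10, F0]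
    · simp [m01, m10, F]
    · simp [m01, m10, F]
    · simp [m01, m10, F0]
  PQ_S a b l := by
    change (m01 ⊗ₖ (mX ⊗ₖ qL (a • qk)) + (m10 ⊗ₖ (mX ⊗ₖ qL (b • qk))) : Mat Dx) * BD4.cdp.c l =
      BD4.cdp.ε l • (BD4.cdp.c l * (m01 ⊗ₖ (mX ⊗ₖ qL (a • qk)) + (m10 ⊗ₖ (mX ⊗ₖ qL (b • qk)))))
    rw [add_mul, mul_add, smul_add]
    rcases l with _ | _ | _ | _ | l
    · change _ * e4 + _ * e4 = (-1 : ℝ) • (e4 * _) + (-1 : ℝ) • (e4 * _)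
      simp [e4, kr_mul, m01_mZ, m10_mZ, kr_neg_left, ← qL_mul]
    · change _ * e3 + _ * e3 = (-1 : ℝ) • (e3 * _) + (-1 : ℝ) • (e3 * _)
      simp [e3, kr_mul, kr_neg_right, ← qL_mul, qj_qk, qk_qj, qL_neg, smul_neg]
    · change _ * e2 + _ * e2 = (-1 : ℝ) • (e2 * _) + (-1 : ℝ) • (e2 * _)
      simp [e2, kr_mul, kr_neg_right, ← qL_mul, qi_qk, qk_qi, qL_neg, smul_neg]
    · change _ * e1 + _ * e1 = (-1 : ℝ) • (e1 * _) + (-1 : ℝ) • (e1 * _)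
      simp [e1, kr_mul, kr_neg_right, kr_neg_left, mX_mJ, mJ_mX]
    · exact congrArg₂ (· + ·) (e_c3 mX_anti l) (e_c3 mX_anti l)

theorem two_real {X : Type} [TopologicalSpace X] {A : Set X} : SE.Two BD4.cdp.Y A ↔ SE.Two (GLS ℝ Unit) A := by
  refine two_iff_GLS (k := KD5) (e := Equiv.punitProd Dx) (c0 := BD4.cdp.c)
    (fun l => ?_) ?_ (fun l => ?_) (Set.ext fun a => Iff.rfl)
  · ext i j
    exact (thE_apply (Equiv.punitProd Dx) (Matrix.diagonal fun _ => BD4.cdp.c l) () () i j).symm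
  · have : KD5.Φ 1 = e5 := by
      change (m01 ⊗ₖ (mX ⊗ₖ qL ((1 : ℝ) • qk)) : Mat Dx) + (m10 ⊗ₖ (mX ⊗ₖ qL (star (1 : ℝ) • qk))) = _
      rw [star_one, one_smul, ← Matrix.add_kronecker, e5]
      congr 1
      simp [m01, m10, mX]
    rw [this]
    ext i j
    exact (thE_apply (Equiv.punitProd Dx) (Matrix.diagonal fun _ => e5) () () i j).symm
  · rcases l with _ | l
    · exact (neg_one_mul _).trans (neg_neg 1)
    · exact BD4.ε_sq l

section
variable {K : Type} [NormedDivisionRing K] {ν : Type} [Fintype ν] [DecidableEq ν]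

/-- Block sum with the identity. -/
def sM (M : Matrix ν ν K) : Matrix (Fin 3 × ν) (Fin 3 × ν) K := cmpE (dg M 1 1)

/-- The leading block. -/
def rM (N : Matrix (Fin 3 × ν) (Fin 3 × ν) K) : Matrix ν ν K := fun p q => N (0, p) (0, q)

theorem isUnit_rM {M : Matrix ν ν K} (h : IsUnit (sM M)) : IsUnit M := by
  have h' : IsUnit (dg M 1 1) := by
    have := h.map (cmpE (ν := ν) (R := K)).symm
    rwa [sM, RingEquiv.symm_apply_apply] at this
  obtain ⟨N, h1, h2⟩ := isUnit_iff_exists.1 h'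
  have e1 := congrFun (congrFun h1 0) 0
  have e2 := congrFun (congrFun h2 0) 0
  rw [Matrix.mul_apply, Fin.sum_univ_three] at e1 e2
  simp [dg] at e1 e2
  exact isUnit_iff_exists.2 ⟨_, e1, e2⟩

theorem sM_apply_of_not {M : Matrix ν ν K} {t : Finset ν} (hM : M ∈ SG K t) (a b : Fin 3 × ν)
    (h : a ∉ t.image (Prod.mk 0) ∨ b ∉ t.image (Prod.mk 0)) :
    sM M a b = (1 : Matrix (Fin 3 × ν) (Fin 3 × ν) K) a b := by
  obtain ⟨i, p⟩ := a
  obtain ⟨j, q⟩ := b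
  have h1 : sM (1 : Matrix ν ν K) = 1 := by rw [sM, dg_one, map_one]
  rw [← h1]
  change (dg M 1 1 : M3 (Matrix ν ν K)) i j p q = (dg 1 1 1 : M3 (Matrix ν ν K)) i j p q
  by_cases hij : i = 0 ∧ j = 0
  · obtain ⟨rfl, rfl⟩ := hij
    exact hM.2 p q (h.imp (fun h h' => h (Finset.mem_image_of_mem _ h'))
      fun h h' => h (Finset.mem_image_of_mem _ h'))
  · fin_cases i <;> fin_cases j <;> first | rfl | exact absurd ⟨rfl, rfl⟩ hij

theorem sM_mem {M : Matrix ν ν K} {t : Finset ν} (hM : M ∈ SG K t) :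
    sM M ∈ SG K (t.image (Prod.mk (0 : Fin 3))) :=
  ⟨(isUnit_dg hM.1 isUnit_one isUnit_one).map cmpE, fun a b h => sM_apply_of_not hM a b h⟩

theorem sM_rM {N : Matrix (Fin 3 × ν) (Fin 3 × ν) K} {t : Finset ν}
    (hN : N ∈ SG K (t.image (Prod.mk (0 : Fin 3)))) : sM (rM N) = N := by
  ext ⟨i, p⟩ ⟨j, q⟩
  have h1 : sM (1 : Matrix ν ν K) = 1 := by rw [sM, dg_one, map_one]
  by_cases hij : i = 0 ∧ j = 0
  · obtain ⟨rfl, rfl⟩ := hij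
    rfl
  · rw [hN.2 (i, p) (j, q) (by
      simp only [Finset.mem_image, Prod.mk.injEq, not_exists, not_and]
      by_contra! h
      obtain ⟨⟨_, _, h, _⟩, ⟨_, _, h', _⟩⟩ := h
      exact hij ⟨h.symm, h'.symm⟩), ← h1]
    change (dg (rM N) 1 1 : M3 (Matrix ν ν K)) i j p q = (dg 1 1 1 : M3 (Matrix ν ν K)) i j p q
    fin_cases i <;> fin_cases j <;> first | rfl | exact absurd ⟨rfl, rfl⟩ hij

theorem rM_mem {N : Matrix (Fin 3 × ν) (Fin 3 × ν) K} {t : Finset ν}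
    (hN : N ∈ SG K (t.image (Prod.mk (0 : Fin 3)))) : rM N ∈ SG K t := by
  refine ⟨isUnit_rM ((sM_rM hN).symm ▸ hN.1), fun p q h => ?_⟩
  refine (hN.2 (0, p) (0, q) (by simpa using h)).trans ?_
  simp [Matrix.one_apply]

theorem continuous_rM : Continuous (rM : _ → Matrix ν ν K) :=
  continuous_matrix fun _ _ => continuous_id.matrix_elem _ _

end

section tower
variable {K : Type} [NormedDivisionRing K] {lam : Type} [Fintype lam] [DecidableEq lam] {n : ℕ}

/-- Images of an index set along the tower. -/
def tT (t : Finset (TT lam n)) : ∀ m, Finset (TT lam (n + m))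
  | 0 => t
  | m + 1 => (tT t m).image (Prod.mk (0 : Fin 3))

theorem card_tT (t : Finset (TT lam n)) (m : ℕ) : (tT t m).card = t.card := by
  induction m with
  | zero => rfl
  | succ m ih => exact (Finset.card_image_of_injective _ (Prod.mk_right_injective 0)).trans ih

/-- Iterated block sum with the identity. -/
def eM : ∀ m, Matrix (TT lam n) (TT lam n) K → Matrix (TT lam (n + m)) (TT lam (n + m)) K
  | 0, M => M
  | m + 1, M => sM (eM m M)

/-- Iterated leading block. -/
def lM : ∀ m, Matrix (TT lam (n + m)) (TT lam (n + m)) K → Matrix (TT lam n) (TT lam n) K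
  | 0, M => M
  | m + 1, M => lM m (rM M)

theorem lM_eM (m : ℕ) (M : Matrix (TT lam n) (TT lam n) K) : lM m (eM m M) = M := by
  induction m with
  | zero => rfl
  | succ m ih => exact ih

theorem eM_one (m : ℕ) : eM m (1 : Matrix (TT lam n) (TT lam n) K) = 1 := by
  induction m with
  | zero => rfl
  | succ m ih => exact (congrArg sM ih).trans ((congrArg cmpE dg_one).trans (map_one cmpE))

theorem continuous_lM (m : ℕ) : Continuous (lM (K := K) (lam := lam) (n := n) m) := by
  induction m with
  | zero => exact continuous_id
  | succ m ih => exact ih.comp continuous_rM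

theorem eM_mem {t : Finset (TT lam n)} (m : ℕ) {M : Matrix (TT lam n) (TT lam n) K}
    (hM : M ∈ SG K t) : eM m M ∈ SG K (tT t m) := by
  induction m with
  | zero => exact hM
  | succ m ih => exact sM_mem ih

theorem lM_mem {t : Finset (TT lam n)} (m : ℕ) {M : Matrix (TT lam (n + m)) (TT lam (n + m)) K}
    (hM : M ∈ SG K (tT t m)) : lM m M ∈ SG K t := by
  induction m with
  | zero => exact hM
  | succ m ih => exact ih (rM_mem hM)

theorem eM_lM {t : Finset (TT lam n)} (m : ℕ) {M : Matrix (TT lam (n + m)) (TT lam (n + m)) K}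
    (hM : M ∈ SG K (tT t m)) : eM m (lM m M) = M := by
  induction m with
  | zero => rfl
  | succ m ih => exact (congrArg sM (ih (rM_mem hM))).trans (sM_rM hM)

/-- The square matrices over `K` indexed by `TT lam n`. -/
abbrev MatT (K lam : Type) (n : ℕ) := Matrix (TT lam n) (TT lam n) K

/-- Families of matrices supported on a set of indices, trivial on the boundary. -/
def BM (t : Finset (TT lam n)) (k : ℕ) (f : Cb k → MatT K lam n) : Prop :=
  (∀ x, f x ∈ SG K t) ∧ ∀ x ∈ bd k, f x = 1

/-- Such a family as an element of the tower. -/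
def toG {k : ℕ} (f : Cb k → MatT K lam n) (hf : ∀ x, IsUnit (f x)) :
    Σ n, Cb k → (GLS K lam).W n := ⟨n, fun x => (⟨f x, hf x⟩ : GLu K lam n)⟩

theorem iter_toG {k : ℕ} (f : Cb k → MatT K lam n) (hf : ∀ x, IsUnit (f x))
    (m : ℕ) : ∃ h, (SE.up (GLS K lam) (Cb k))^[m] (toG f hf) = toG (n := n + m) (fun x => eM m (f x)) h := by
  induction m with
  | zero => exact ⟨hf, rfl⟩
  | succ m ih =>
    obtain ⟨h, e⟩ := ih
    rw [Function.iterate_succ_apply', e]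
    exact ⟨fun x => (isUnit_dg (h x) isUnit_one isUnit_one).map cmpE, rfl⟩

theorem toG_SE {k : ℕ} {f g : Cb k → MatT K lam n}
    (h : Htp (BM Finset.univ k) f g) (hf : ∀ x, IsUnit (f x)) (hg : ∀ x, IsUnit (g x)) :
    SE (GLS K lam) (bd k) (toG f hf) (toG g hg) := by
  obtain ⟨H, hc, h0, h1, hp⟩ := h
  subst h0 h1
  exact .htp ⟨fun t x => (⟨H t x, ((hp t).1 x).1⟩ : GLu K lam n), hc.subtype_mk _, rfl, rfl,
    fun t x hx => Subtype.ext ((hp t).2 x hx)⟩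

theorem mem_SG_univ {M : MatT K lam n} (h : IsUnit M) :
    M ∈ SG K Finset.univ := ⟨h, fun i j hij => by simp at hij⟩

variable [NormedAlgebra ℝ K] [StarRing K] [ContinuousStar K] [FiniteDimensional ℝ K]

/-- Stable homotopy is detected on large enough index sets. -/
theorem htp_of_SE (hK : ∀ a : K, star a * a = algebraMap ℝ K (‖a‖ ^ 2)) {k : ℕ}
    {t : Finset (TT lam n)} (hk : k + 2 < (t.card + 1) * Module.finrank ℝ K)
    {f g : Cb k → MatT K lam n}
    (hf : BM t k f) (hg : BM t k g)
    (h : SE (GLS K lam) (bd k) (toG f fun x => (hf.1 x).1) (toG g fun x => (hg.1 x).1)) :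
    Htp (BM t k) f g := by
  obtain ⟨m, l, h⟩ := h.exists_iter
  obtain ⟨h1, e1⟩ := iter_toG f (fun x => (hf.1 x).1) m
  obtain ⟨h2, e2⟩ := iter_toG g (fun x => (hg.1 x).1) l
  rw [e1, e2] at h
  have hml : m = l := by
    have : ∀ p q, SE.Hr (GLS K lam) (bd k) p q → p.1 = q.1 := by rintro _ _ ⟨⟩; rfl
    exact Nat.add_left_cancel (this _ _ h)
  subst hml
  obtain ⟨H, hc, h0, hh1, hp⟩ : Htp (fun f : Cb k → GLu K lam (n + m) => ∀ a ∈ bd k, f a = (GLS K lam).w (n + m))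
      (fun x => ⟨eM m (f x), h1 x⟩) (fun x => ⟨eM m (g x), h2 x⟩) := by
    unfold toG at h
    generalize (fun x => (⟨eM m (f x), h1 x⟩ : GLu K lam (n + m))) = P at h ⊢
    generalize (fun x => (⟨eM m (g x), h2 x⟩ : GLu K lam (n + m))) = Q at h ⊢
    cases h with
    | mk h => exact h
  have e0 : ∀ x, (H 0 x).1 = eM m (f x) := fun x => congrArg Subtype.val (congrFun h0 x)
  have e1 : ∀ x, (H 1 x).1 = eM m (g x) := fun x => congrArg Subtype.val (congrFun hh1 x)
  have eb : ∀ x ∈ bd k, ∀ s, (H s x).1 = 1 := fun x hx s => congrArg Subtype.val (hp s x hx)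
  have hb : ∀ x ∈ bd (k + 1), (H x.2 x.1).1 ∈ SG K (tT t m) := by
    rintro ⟨x, s⟩ (hx | hs | hs)
    · exact (eb x hx s).symm ▸ one_mem _
    · change s = 0 at hs
      subst hs
      exact (e0 x).symm ▸ eM_mem m (hf.1 x)
    · change s = 1 at hs
      subst hs
      exact (e1 x).symm ▸ eM_mem m (hg.1 x)
  obtain ⟨F', ⟨G, hGc, hG0, hG1, hGp⟩, hF'⟩ := stab hK (Finset.subset_univ (tT t m)) (k := k + 1)
    (by rw [card_tT]; exact hk)
    (F := fun x => (H x.2 x.1).1) (continuous_subtype_val.comp (hc.comp continuous_swap))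
    (fun x => mem_SG_univ (H x.2 x.1).2) hb
  have hFb : ∀ x ∈ bd (k + 1), F' x = (H x.2 x.1).1 := hG1 ▸ (hGp 1).2
  have hFc : Continuous F' := hG1 ▸ hGc.comp (Continuous.prodMk_right (1 : I))
  refine ⟨fun s x => lM m (F' (x, s)), (continuous_lM m).comp (hFc.comp continuous_swap), ?_, ?_,
    fun s => ⟨fun x => lM_mem m (hF' _), fun x hx => ?_⟩⟩
  · funext x
    beta_reduce
    rw [hFb (x, 0) (.inr (.inl rfl)), e0, lM_eM]
  · funext x
    beta_reduce
    rw [hFb (x, 1) (.inr (.inr rfl)), e1, lM_eM]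
  · beta_reduce
    rw [hFb (x, s) (.inl hx), eb x hx, ← eM_one m, lM_eM]

theorem SE_of_htp {k : ℕ} {t : Finset (TT lam n)} {f g : Cb k → MatT K lam n}
    (hf : ∀ x, IsUnit (f x)) (hg : ∀ x, IsUnit (g x)) (h : Htp (BM t k) f g) :
    SE (GLS K lam) (bd k) (toG f hf) (toG g hg) :=
  toG_SE (h.mono fun _ _ h => ⟨fun x => mem_SG_univ (h.1 x).1, h.2⟩) hf hg

theorem exists_SE (hK : ∀ a : K, star a * a = algebraMap ℝ K (‖a‖ ^ 2)) {k : ℕ}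
    {t : Finset (TT lam n)} (hk : k + 1 < (t.card + 1) * Module.finrank ℝ K)
    (p : Σ n, Cb k → (GLS K lam).W n) (hc : Continuous p.2)
    (hb : ∀ x ∈ bd k, p.2 x = (GLS K lam).w p.1) :
    ∃ f, Continuous f ∧ ∃ hf : BM t k f, SE (GLS K lam) (bd k) p (toG f fun x => (hf.1 x).1) := by
  obtain ⟨N, f, hN, hfc, hfb, hSE⟩ : ∃ N, ∃ f : Cb k → GLu K lam N, n ≤ N ∧ Continuous f ∧
      (∀ x ∈ bd k, (f x).1 = 1) ∧ SE (GLS K lam) (bd k) p ⟨N, f⟩ := by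
    clear hk
    induction n with
    | zero => exact ⟨p.1, p.2, Nat.zero_le _, hc, fun x hx => congrArg Subtype.val (hb x hx),
        .refl hc hb⟩
    | succ n ih =>
      obtain ⟨N, f, hN, hfc, hfb, hSE⟩ := ih (t := Finset.univ)
      have hb' : ∀ x ∈ bd k, f x = (GLS K lam).w N := fun x hx => Subtype.ext (hfb x hx)
      exact ⟨N + 1, (GLS K lam).st N ∘ f, Nat.succ_le_succ hN, ((GLS K lam).st_cont N).comp hfc,
        fun x hx => congrArg Subtype.val
          ((congrArg ((GLS K lam).st N) (hb' x hx)).trans ((GLS K lam).st_w N)),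
        hSE.trans (.st hfc hb')⟩
  obtain ⟨m, rfl⟩ := Nat.exists_eq_add_of_le hN
  obtain ⟨F', hF, hF'⟩ := stab hK (Finset.subset_univ (tT t m)) (k := k)
    (by rw [card_tT]; exact hk) (F := fun x => (f x).1) (continuous_subtype_val.comp hfc)
    (fun x => mem_SG_univ (f x).2) (fun x hx => (hfb x hx).symm ▸ one_mem _)
  have hF1 : ∀ x ∈ bd k, F' x = 1 := fun x hx => (hF.prop_right.2 x hx).trans (hfb x hx)
  have hBM : BM t k fun x => lM m (F' x) := ⟨fun x => lM_mem m (hF' x), fun x hx => by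
    beta_reduce
    rw [hF1 x hx, ← eM_one m, lM_eM]⟩
  have hcl : Continuous fun x => lM m (F' x) := (continuous_lM m).comp hF.cont_right
  refine ⟨fun x => lM m (F' x), hcl, hBM, hSE.trans ?_⟩
  have hS := toG_SE (hF.mono fun g _ hg => ⟨hg.1, fun x hx => (hg.2 x hx).trans (hfb x hx)⟩)
    (fun x => (f x).2) (fun x => (hF' x).1)
  refine SE.trans hS ?_
  obtain ⟨h, e⟩ := iter_toG (fun x => lM m (F' x)) (fun x => (hBM.1 x).1) m
  have h2 : toG F' (fun x => (hF' x).1) = toG (n := n + m) (fun x => eM m (lM m (F' x))) h := by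
    unfold toG
    congr 1
    exact funext fun x => Subtype.ext (eM_lM m (hF' x)).symm
  rw [h2, ← e]
  exact (SE.iter m (p := toG (fun x => lM m (F' x)) fun x => (hBM.1 x).1) (hcl.subtype_mk _)
    fun x hx => Subtype.ext (hBM.2 x hx)).2.2.symm

/-- Two stable classes amount to two unstable classes on large enough index sets. -/
theorem two_GLS_iff (hK : ∀ a : K, star a * a = algebraMap ℝ K (‖a‖ ^ 2)) {k : ℕ}
    (t : Finset (TT lam n)) (hk : k + 2 < (t.card + 1) * Module.finrank ℝ K) :
    SE.Two (GLS K lam) (bd k) ↔ ∃ p : Cb k → MatT K lam n, Continuous p ∧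
      BM t k p ∧ ¬ Htp (BM t k) p (fun _ => (1 : MatT K lam n)) ∧
      ∀ q, Continuous q → BM t k q →
        Htp (BM t k) q (fun _ => (1 : MatT K lam n)) ∨ Htp (BM t k) q p := by
  have h1 : BM t k (fun _ => (1 : MatT K lam n)) :=
    ⟨fun _ => one_mem _, fun _ _ => rfl⟩
  have hw : SE (GLS K lam) (bd k) (toG (fun _ => 1) fun x => (h1.1 x).1)
      ⟨0, fun _ => (GLS K lam).w 0⟩ := SE.const_aux n
  constructor
  · rintro ⟨P, hPc, hPb, hP0, hP⟩
    obtain ⟨p, hpc, hp, hSp⟩ := exists_SE hK (t := t) (by omega) P hPc hPb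
    refine ⟨p, hpc, hp, fun h => hP0 ?_, fun q hqc hq => ?_⟩
    · exact hSp.trans ((SE_of_htp _ _ h).trans hw)
    · refine (hP (toG q fun x => (hq.1 x).1) (hqc.subtype_mk _) fun x hx =>
        Subtype.ext (hq.2 x hx)).imp (fun h => ?_) fun h => ?_
      · exact htp_of_SE hK hk hq h1 (h.trans hw.symm)
      · exact htp_of_SE hK hk hq hp (h.trans hSp)
  · rintro ⟨p, hpc, hp, hp0, hpq⟩
    refine ⟨toG p fun x => (hp.1 x).1, hpc.subtype_mk _, fun x hx => Subtype.ext (hp.2 x hx),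
      fun h => hp0 (htp_of_SE hK hk hp h1 (h.trans hw.symm)),
      fun Q hQc hQb => ?_⟩
    obtain ⟨q, hqc, hq, hSq⟩ := exists_SE hK (t := t) (by omega) Q hQc hQb
    exact (hpq q hqc hq).imp (fun h => hSq.trans ((SE_of_htp _ _ h).trans hw))
      fun h => hSq.trans (SE_of_htp _ _ h)

end tower

/-- Maps of cubes into the nonzero quaternions, trivial on the boundary. -/
def BQ (k : ℕ) (f : Cb k → ℍ[ℝ]) : Prop := (∀ x, f x ≠ 0) ∧ ∀ x ∈ bd k, f x = 1

theorem quat_star_mul (a : ℍ[ℝ]) : star a * a = algebraMap ℝ ℍ[ℝ] (‖a‖ ^ 2) := by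
  rw [Quaternion.star_mul_self, Quaternion.normSq_eq_norm_mul_self, sq]; rfl

/-- Nonzero scalars as matrices. -/
def sing {ν : Type} [DecidableEq ν] (i : ν) (a : ℍ[ℝ]) : Matrix ν ν ℍ[ℝ] :=
  Matrix.diagonal (Function.update 1 i a)

theorem continuous_sing {ν : Type} [Fintype ν] [DecidableEq ν] (i : ν) :
    Continuous (sing i) :=
  (continuous_const.update i continuous_id).matrix_diagonal

theorem sing_one {ν : Type} [Fintype ν] [DecidableEq ν] (i : ν) : sing i 1 = 1 := by
  rw [sing, show (1 : ℍ[ℝ]) = (1 : ν → ℍ[ℝ]) i from rfl, Function.update_eq_self]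
  exact Matrix.diagonal_one

theorem sing_apply {ν : Type} [DecidableEq ν] (i : ν) (a : ℍ[ℝ]) : sing i a i i = a := by
  simp [sing]

theorem sing_mem {ν : Type} [Fintype ν] [DecidableEq ν] (i : ν) {a : ℍ[ℝ]} (ha : a ≠ 0) :
    sing i a ∈ SG ℍ[ℝ] {i} := by
  have key : ∀ b c : ℍ[ℝ], b * c = 1 → sing i b * sing i c = 1 := fun b c h => by
    rw [sing, sing, Matrix.diagonal_mul_diagonal, ← sing_one i, sing]
    congr 1
    funext j
    by_cases hj : j = i
    · subst hj; simp [h]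
    · simp [hj]
  refine ⟨isUnit_iff_exists.2 ⟨sing i a⁻¹, key _ _ (mul_inv_cancel₀ ha), key _ _ (inv_mul_cancel₀ ha)⟩,
    fun p q h => ?_⟩
  by_cases hpq : p = q
  · subst hpq
    have : p ≠ i := by simpa using h
    simp [sing, this]
  · simp [sing, hpq]

theorem mem_SG_sing {ν : Type} [Fintype ν] [DecidableEq ν] (i : ν) {M : Matrix ν ν ℍ[ℝ]}
    (hM : M ∈ SG ℍ[ℝ] {i}) : M = sing i (M i i) ∧ M i i ≠ 0 := by
  have h1 : M = sing i (M i i) := by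
    ext1 p q
    by_cases hpq : p = i ∧ q = i
    · obtain ⟨rfl, rfl⟩ := hpq
      rw [sing_apply]
    · rw [hM.2 p q (by simp only [Finset.mem_singleton]; tauto)]
      by_cases h : p = q
      · subst h
        have : p ≠ i := by simpa using hpq
        simp [sing, this]
      · simp [sing, h]
  refine ⟨h1, fun h0 => ?_⟩
  obtain ⟨N, hN, -⟩ := isUnit_iff_exists.1 hM.1
  have := congrFun (congrFun hN i) i
  rw [h1, h0, sing, Matrix.diagonal_mul] at this
  simp at this

theorem quat_five (H : SE.Two BD4.cdp.Y (bd 1)) :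
    ∃ p, Continuous p ∧ BQ 5 p ∧ ¬ Htp (BQ 5) p (fun _ => 1) ∧ ∀ q, Continuous q → BQ 5 q →
      Htp (BQ 5) q (fun _ => 1) ∨ Htp (BQ 5) q p := by
  let i : TT (Fin 2) 0 := (0 : Fin 2)
  obtain ⟨p, hpc, hp, hp0, hpq⟩ := (two_GLS_iff (n := 0) (lam := Fin 2) quat_star_mul {i}
    (k := 5) (by rw [Finset.card_singleton, Quaternion.finrank_eq_four]; norm_num)).1
    (two_quat.1 (bott_four H))
  have back : ∀ f g, Htp (BM {i} 5) f g → Htp (BQ 5) (fun x => f x i i) (fun x => g x i i) := by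
    rintro f g ⟨H, hc, rfl, rfl, hH⟩
    refine ⟨fun t x => H t x i i, hc.matrix_elem i i, rfl, rfl, fun t =>
      ⟨fun x => (mem_SG_sing i ((hH t).1 x)).2, fun x hx => ?_⟩⟩
    beta_reduce
    rw [(hH t).2 x hx, Matrix.one_apply_eq]
  have forth : ∀ f g, Htp (BQ 5) f g →
      Htp (BM {i} 5) (fun x => sing i (f x)) (fun x => sing i (g x)) := by
    rintro f g ⟨H, hc, rfl, rfl, hH⟩
    refine ⟨fun t x => sing i (H t x), (continuous_sing i).comp hc, rfl, rfl, fun t =>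
      ⟨fun x => sing_mem i ((hH t).1 x), fun x hx => ?_⟩⟩
    beta_reduce
    rw [(hH t).2 x hx, sing_one]
  have hpp : (fun x => sing i (p x i i)) = p := funext fun x => (mem_SG_sing i (hp.1 x)).1.symm
  have h1 : (fun _ : Cb 5 => sing i 1) = fun _ => 1 := funext fun _ => sing_one i
  refine ⟨fun x => p x i i, hpc.matrix_elem i i, ⟨fun x => (mem_SG_sing i (hp.1 x)).2, fun x hx => by
    beta_reduce
    rw [hp.2 x hx, Matrix.one_apply_eq]⟩, fun h => hp0 ?_, fun q hqc hq => ?_⟩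
  · have := forth _ _ h
    rwa [hpp, h1] at this
  · have hqq : (fun x => sing i (q x) i i) = q := funext fun x => sing_apply i _
    refine (hpq (fun x => sing i (q x)) ((continuous_sing i).comp hqc)
      ⟨fun x => sing_mem i (hq.1 x), fun x hx => by
        beta_reduce
        rw [hq.2 x hx, sing_one]⟩).imp (fun h => ?_) fun h => ?_
    · have := back _ _ h
      rw [hqq] at this
      simpa using this
    · have := back _ _ h
      rwa [hqq] at this

open Classical in
/-- Nonzero quaternions as units. -/
def un (q : ℍ[ℝ]) : ℍ[ℝ]ˣ := if h : q ≠ 0 then Units.mk0 q h else 1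

theorem val_un {q : ℍ[ℝ]} (h : q ≠ 0) : (un q : ℍ[ℝ]) = q := by rw [un, dif_pos h]; rfl

theorem continuousOn_un {X : Type*} [TopologicalSpace X] {f : X → ℍ[ℝ]} (hf : Continuous f) :
    ContinuousOn (fun x => un (f x)) {x | f x ≠ 0} := by
  rw [Units.isEmbedding_val₀.isInducing.continuousOn_iff]
  exact hf.continuousOn.congr fun x hx => val_un hx

/-- Conjugation. -/
def cj (q x : ℍ[ℝ]) : ℍ[ℝ] := q * x * q⁻¹

theorem cj_one_left (x : ℍ[ℝ]) : cj 1 x = x := by simp [cj]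
theorem cj_cj (q r x : ℍ[ℝ]) : cj q (cj r x) = cj (q * r) x := by simp [cj, mul_assoc]
theorem cj_mul {q : ℍ[ℝ]} (hq : q ≠ 0) (x y : ℍ[ℝ]) : cj q x * cj q y = cj q (x * y) := by
  simp [cj, mul_assoc, inv_mul_cancel_left₀ hq]
theorem cj_sub (q x y : ℍ[ℝ]) : cj q (x - y) = cj q x - cj q y := by simp [cj, mul_sub, sub_mul]
theorem cj_neg (q x : ℍ[ℝ]) : cj q (-x) = -cj q x := by simp [cj]
theorem cj_self {q : ℍ[ℝ]} (hq : q ≠ 0) : cj q 1 = 1 := by simp [cj, hq]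
theorem cj_eq {q x y : ℍ[ℝ]} (hq : q ≠ 0) (h : q * x = y * q) : cj q x = y := by
  rw [cj, h, mul_inv_cancel_right₀ hq]
theorem of_cj_eq {q x y : ℍ[ℝ]} (hq : q ≠ 0) (h : cj q x = y) : q * x = y * q := by
  rw [← h, cj, inv_mul_cancel_right₀ hq]
theorem re_cj {q : ℍ[ℝ]} (hq : q ≠ 0) (x : ℍ[ℝ]) : (cj q x).re = x.re := by
  have h : ∀ a b : ℍ[ℝ], (a * b).re = (b * a).re := fun a b => by simp; ring
  rw [cj, h, ← mul_assoc, inv_mul_cancel₀ hq, one_mul]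
theorem cj_smul {c : ℝ} (hc : c ≠ 0) (q x : ℍ[ℝ]) : cj (c • q) x = cj q x := by
  simp [cj, smul_smul, hc, smul_inv₀]

theorem continuous_cj {X : Type*} [TopologicalSpace X] {f g : X → ℍ[ℝ]} (hf : Continuous f)
    (hg : Continuous g) (h0 : ∀ x, f x ≠ 0) : Continuous fun x => cj (f x) (g x) :=
  (hf.mul hg).mul (hf.inv₀ h0)

theorem imag_sq {a : ℍ[ℝ]} (ha : a.re = 0) : a * a = -((‖a‖ ^ 2 : ℝ) : ℍ[ℝ]) := by
  have h : star a = -a := by ext <;> simp [ha]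
  have := quat_star_mul a
  rw [h, neg_mul] at this
  rw [← neg_neg (a * a), this]
  rfl

theorem imag_unit {a : ℍ[ℝ]} (ha : a.re = 0) (h0 : a ≠ 0) :
    (‖a‖⁻¹ • a) * (‖a‖⁻¹ • a) = -1 := by
  have h1 : ‖a‖ ≠ 0 := norm_ne_zero_iff.2 h0
  rw [smul_mul_smul_comm, imag_sq ha, smul_neg, ← Quaternion.coe_smul, smul_eq_mul]
  rw [show ‖a‖⁻¹ * ‖a‖⁻¹ * ‖a‖ ^ 2 = 1 by field_simp]
  simp

/-- Orthonormal pairs of imaginary quaternions. -/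
abbrev Fr : Type :=
  {z : ℍ[ℝ] × ℍ[ℝ] // z.1 * z.1 = -1 ∧ z.2 * z.2 = -1 ∧ z.1 * z.2 = -(z.2 * z.1)}

/-- Conjugation of orthonormal pairs. -/
def Fr.act (q : ℍ[ℝ]ˣ) (z : Fr) : Fr :=
  ⟨(cj q z.1.1, cj q z.1.2), by
    simp only [cj_mul q.ne_zero, z.2.1, z.2.2.1, cj_neg, cj_self q.ne_zero, true_and]
    rw [z.2.2.2, cj_neg]⟩

/-- The quaternion moving one orthonormal pair to another. -/
def Fr.mv (z : Fr × Fr) : ℍ[ℝ] :=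
  (4⁻¹ : ℝ) • (1 - z.2.1.1 * z.1.1.1 - z.2.1.2 * z.1.1.2
    + z.2.1.2 * z.2.1.1 * z.1.1.1 * z.1.1.2)

theorem Fr.lift {X : Type*} [PseudoMetricSpace X] [CompactSpace X] (h : I → X → Fr)
    (hc : Continuous fun p : I × X => h p.1 p.2) :
    ∃ G : I → X → ℍ[ℝ]ˣ, Continuous (fun p : I × X => G p.1 p.2) ∧ (∀ x, G 0 x = 1) ∧
      (∀ t x, Fr.act (G t x) (h 0 x) = h t x) ∧ ∀ x, (∀ t, h t x = h 0 x) → ∀ t, G t x = 1 := by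
  have hmc : Continuous Fr.mv := by unfold Fr.mv; fun_prop
  have hms : ∀ z : Fr, Fr.mv (z, z) = 1 := by
    rintro ⟨⟨u, v⟩, h1, h2, h3⟩
    simp only at h1 h2 h3
    have : v * u * u * v = 1 := by rw [mul_assoc v, h1]; simp [h2]
    simp only [Fr.mv, h1, h2, this]
    rw [show (1 : ℍ[ℝ]) - -1 - -1 + 1 = (4 : ℝ) • 1 by module, smul_smul]
    norm_num
  obtain ⟨G, h1, h2, h3, h4, -⟩ := hlp Fr.act
    (fun z => Subtype.ext (Prod.ext (cj_one_left _) (cj_one_left _)))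
    (fun q r z => Subtype.ext (Prod.ext (by simp [Fr.act, cj_cj]) (by simp [Fr.act, cj_cj])))
    (fun z => un (Fr.mv z)) {z | Fr.mv z ≠ 0} (isOpen_ne_fun hmc continuous_const)
    (continuousOn_un hmc)
    (fun z hz => by ext1; rw [val_un hz, hms]; rfl) (fun z hz => by
      have hz' : Fr.mv z ≠ 0 := hz
      have hv := val_un hz'
      obtain ⟨⟨⟨u, v⟩, h1, h2, h3⟩, ⟨⟨u', v'⟩, h1', h2', h3'⟩⟩ := z
      simp only at h1 h2 h3 h1' h2' h3'
      refine Subtype.ext (Prod.ext ?_ ?_) <;> refine cj_eq (Units.ne_zero _) ?_ <;>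
        rw [hv] <;> simp only [Fr.mv, smul_mul_assoc, mul_smul_comm] <;> congr 1
      · have e1 : v' * v * u = -(v' * u * v) := by rw [mul_assoc, mul_assoc, h3]; noncomm_ring
        have e2 : v' * u' * u * v * u = v' * u' * v := by
          rw [mul_assoc _ v u, ← neg_neg (v * u), ← h3, mul_neg, ← mul_assoc, mul_assoc _ u u, h1]
          simp
        have e3 : u' * (v' * u' * u * v) = v' * u * v := by
          simp only [← mul_assoc]
          rw [h3', neg_mul, neg_mul, neg_mul, mul_assoc v' u' u', h1']; simp
        have e4 : u' * (u' * u) = - u := by rw [← mul_assoc, h1']; simp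
        have e5 : u' * (v' * v) = -(v' * u' * v) := by rw [← mul_assoc, h3']; simp
        have e6 : u' * u * u = - u' := by rw [mul_assoc, h1]; simp
        simp only [add_mul, sub_mul, mul_add, mul_sub, e1, e2, e3, e4, e5, e6, one_mul, mul_one]
        abel
      · have e1 : v' * u' * u * v * v = -(v' * u' * u) := by rw [mul_assoc _ v v, h2]; simp
        have e2 : v' * v * v = - v' := by rw [mul_assoc, h2]; simp
        have e3 : v' * (v' * u' * u * v) = -(u' * u * v) := by
          simp only [← mul_assoc]; rw [h2']; simp
        have e4 : v' * (v' * v) = - v := by rw [← mul_assoc, h2']; simp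
        have e5 : v' * (u' * u) = v' * u' * u := (mul_assoc _ _ _).symm
        simp only [add_mul, sub_mul, mul_add, mul_sub, e1, e2, e3, e4, e5, one_mul, mul_one]
        abel) ⊤ h hc
    (fun t x => by change Fr.mv _ ≠ 0; rw [hms]; exact one_ne_zero) fun _ _ _ _ => trivial
  exact ⟨G, h1, h2, h3, h4⟩

/-- Twice the determinant of a triple of imaginary quaternions. -/
def dt (a b c : ℍ[ℝ]) : ℝ := -((a * b - b * a) * c).re

/-- The matrix with given imaginary quaternions as columns. -/
def mtx (a b c : ℍ[ℝ]) : Mat (Fin 3 × Unit) := fun p q =>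
  ![(![a, b, c] q.1).imI, (![a, b, c] q.1).imJ, (![a, b, c] q.1).imK] p.1

/-- Columns as imaginary quaternions. -/
@[simps]
def cl (M : Mat (Fin 3 × Unit)) (j : Fin 3) : ℍ[ℝ] :=
  ⟨0, M (0, ()) (j, ()), M (1, ()) (j, ()), M (2, ()) (j, ())⟩

theorem mtx_cl (M : Mat (Fin 3 × Unit)) : mtx (cl M 0) (cl M 1) (cl M 2) = M := by
  ext ⟨i, -⟩ ⟨j, -⟩
  fin_cases i <;> fin_cases j <;> rfl

theorem cl_mtx {a b c : ℍ[ℝ]} (ha : a.re = 0) (hb : b.re = 0) (hc : c.re = 0) :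
    cl (mtx a b c) 0 = a ∧ cl (mtx a b c) 1 = b ∧ cl (mtx a b c) 2 = c := by
  refine ⟨?_, ?_, ?_⟩ <;> ext <;> simp [cl, mtx, ha, hb, hc]

theorem isUnit_mtx {a b c : ℍ[ℝ]} : IsUnit (mtx a b c) ↔ dt a b c ≠ 0 := by
  rw [Matrix.isUnit_iff_isUnit_det, isUnit_iff_ne_zero,
    ← Matrix.det_reindex_self (Equiv.prodPUnit (Fin 3)), Matrix.det_fin_three]
  have : dt a b c = 2 * ((mtx a b c).reindex (Equiv.prodPUnit _) (Equiv.prodPUnit _)).det := by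
    rw [Matrix.det_fin_three]
    simp [dt, mtx]
    ring
  rw [this, Matrix.det_fin_three]
  simp

theorem continuous_mtx {X : Type*} [TopologicalSpace X] {a b c : X → ℍ[ℝ]} (ha : Continuous a)
    (hb : Continuous b) (hc : Continuous c) : Continuous fun x => mtx (a x) (b x) (c x) := by
  have h1 := Quaternion.continuous_imI
  have h2 := Quaternion.continuous_imJ
  have h3 := Quaternion.continuous_imK
  refine continuous_matrix ?_
  rintro ⟨i, -⟩ ⟨j, -⟩
  fin_cases i <;> fin_cases j <;> simp only [mtx] <;>
    first
    | exact h1.comp ha | exact h2.comp ha | exact h3.comp ha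
    | exact h1.comp hb | exact h2.comp hb | exact h3.comp hb
    | exact h1.comp hc | exact h2.comp hc | exact h3.comp hc

theorem continuous_cl {X : Type*} [TopologicalSpace X]
    {M : X → Mat (Fin 3 × Unit)} (h : Continuous M) (j : Fin 3) :
    Continuous fun x => cl (M x) j :=
  continuous_quat continuous_const (h.matrix_elem _ _) (h.matrix_elem _ _) (h.matrix_elem _ _)

theorem dt_cj {q : ℍ[ℝ]} (hq : q ≠ 0) (a b c : ℍ[ℝ]) :
    dt (cj q a) (cj q b) (cj q c) = dt a b c := by
  rw [dt, cj_mul hq, cj_mul hq, ← cj_sub, cj_mul hq, re_cj hq, dt]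

theorem pos_of_forall_ne_zero {f : I → ℝ} (hf : Continuous f) (h0 : ∀ t, f t ≠ 0) (h : 0 < f 0) (t : I) :
    0 < f t := by
  by_contra! ht
  obtain ⟨s, hs⟩ := mem_range_of_exists_le_of_exists_ge hf ⟨t, ht⟩ ⟨0, h.le⟩
  exact h0 s hs

theorem norm_cj {q : ℍ[ℝ]} (hq : q ≠ 0) (x : ℍ[ℝ]) : ‖cj q x‖ = ‖x‖ := by
  rw [cj, norm_mul, norm_mul, norm_inv, mul_right_comm, mul_inv_cancel₀ (norm_ne_zero_iff.2 hq),
    one_mul]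

/-- The rotation matrix of a quaternion. -/
def rho (g : ℍ[ℝ]) : Mat (Fin 3 × Unit) := mtx (cj g qi) (cj g qj) (cj g qk)

theorem dt_ijk : dt qi qj qk = 2 := by
  simp [dt]; norm_num

theorem isUnit_rho {g : ℍ[ℝ]} (hg : g ≠ 0) : IsUnit (rho g) := by
  rw [rho, isUnit_mtx, dt_cj hg, dt_ijk]
  norm_num

theorem rho_one : rho 1 = 1 := by
  simp only [rho, cj_one_left]
  ext ⟨i, -⟩ ⟨j, -⟩
  fin_cases i <;> fin_cases j <;> rfl

theorem rho_smul {c : ℝ} (hc : c ≠ 0) (q : ℍ[ℝ]) : rho (c • q) = rho q := by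
  simp only [rho, cj_smul hc]

theorem cl_rho {g : ℍ[ℝ]} (hg : g ≠ 0) :
    cl (rho g) 0 = cj g qi ∧ cl (rho g) 1 = cj g qj ∧ cl (rho g) 2 = cj g qk :=
  cl_mtx (re_cj hg _) (re_cj hg _) (re_cj hg _)

theorem continuous_rho {X : Type*} [TopologicalSpace X] {f : X → ℍ[ℝ]} (hf : Continuous f)
    (h0 : ∀ x, f x ≠ 0) : Continuous fun x => rho (f x) :=
  continuous_mtx (continuous_cj hf continuous_const h0) (continuous_cj hf continuous_const h0)
    (continuous_cj hf continuous_const h0)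

/-- The commutator of the first two columns. -/
def cmt (M : Mat (Fin 3 × Unit)) : ℍ[ℝ] := cl M 0 * cl M 1 - cl M 1 * cl M 0

theorem cmt_ne {M : Mat (Fin 3 × Unit)} (h : IsUnit M) : cmt M ≠ 0 := by
  rw [← mtx_cl M, isUnit_mtx, dt] at h
  intro h0
  rw [cmt] at h0
  simp [h0] at h

theorem cl_ne {M : Mat (Fin 3 × Unit)} (h : IsUnit M) : cl M 0 ≠ 0 := fun h0 =>
  cmt_ne h (by simp [cmt, h0])

theorem cl_cmt (M : Mat (Fin 3 × Unit)) :
    cl M 0 * cmt M = -(cmt M * cl M 0) := by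
  have h : cl M 0 * cl M 0 * cl M 1 = cl M 1 * (cl M 0 * cl M 0) := by
    rw [imag_sq (a := cl M 0) rfl, neg_mul, mul_neg, Quaternion.coe_commutes]
  rw [cmt, mul_sub, sub_mul, ← mul_assoc, h]
  noncomm_ring

/-- The orthonormal pair of an invertible matrix. -/
def frM (M : {M : Mat (Fin 3 × Unit) // IsUnit M}) : Fr :=
  ⟨(‖cl M.1 0‖⁻¹ • cl M.1 0, ‖cmt M.1‖⁻¹ • cmt M.1), imag_unit rfl (cl_ne M.2),
    imag_unit (by simp [cmt]; ring) (cmt_ne M.2), by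
      simp only [smul_mul_assoc, mul_smul_comm, cl_cmt, smul_neg]
      rw [smul_comm]⟩

theorem continuous_frM : Continuous frM := by
  have hc := fun j => continuous_cl continuous_subtype_val j
    (X := {M : Mat (Fin 3 × Unit) // IsUnit M})
  have hm : Continuous fun M : {M : Mat (Fin 3 × Unit) // IsUnit M} =>
      cmt M.1 := by unfold cmt; fun_prop
  exact (((hc 0).norm.inv₀ fun M => norm_ne_zero_iff.2 (cl_ne M.2)).smul (hc 0) |>.prodMk
    ((hm.norm.inv₀ fun M => norm_ne_zero_iff.2 (cmt_ne M.2)).smul hm)).subtype_mk _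

theorem frM_rho {g : ℍ[ℝ]} (hg : g ≠ 0) :
    (frM ⟨rho g, isUnit_rho hg⟩).1 = (cj g qi, cj g qk) := by
  obtain ⟨h0, h1, -⟩ := cl_rho hg
  have hi : ‖qi‖ = 1 := by
    rw [← sq_eq_sq₀ (norm_nonneg _) zero_le_one, sq, ← Quaternion.normSq_eq_norm_mul_self,
      Quaternion.normSq_def']; simp [qi]
  have hk : qi * qj - qj * qi = (2 : ℝ) • qk := by ext <;> simp; norm_num
  have hkn : ‖qk‖ = 1 := by
    rw [← sq_eq_sq₀ (norm_nonneg _) zero_le_one, sq, ← Quaternion.normSq_eq_norm_mul_self,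
      Quaternion.normSq_def']; simp [qk]
  simp only [frM, cmt, h0, h1, norm_cj hg, hi, cj_mul hg, ← cj_sub, hk, norm_smul, hkn]
  refine Prod.ext (by simp) ?_
  simp [cj, smul_smul]

theorem eq_re_of_cj {q : ℍ[ℝ]} (hq : q ≠ 0) (hi : cj q qi = qi) (hk : cj q qk = qk) :
    q = (q.re : ℍ[ℝ]) := by
  have h1 := of_cj_eq hq hi
  have h2 := of_cj_eq hq hk
  have e1 := congrArg (fun q : ℍ[ℝ] => q.imJ) h1
  have e2 := congrArg (fun q : ℍ[ℝ] => q.imK) h1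
  have e3 := congrArg (fun q : ℍ[ℝ] => q.imJ) h2
  simp at e1 e2 e3
  ext <;> simp <;> linarith

theorem dt_line {a b c u v : ℍ[ℝ]} {α ν s : ℝ} (hα : 0 < α) (hν : 0 < ν) (ha : a = α • u)
    (hab : a * b - b * a = ν • v) (hu : u * u = -1) (hv : v * v = -1) (huv : u * v = -(v * u))
    (h : 0 < dt a b c) (h0 : 0 ≤ s) (h1 : s ≤ 1) :
    0 < dt (a + s • (u - a)) (b + s • (v * u - b)) (c + s • (v - c)) := by
  have e1 : u * b - b * u = (ν / α) • v := by
    rw [ha, smul_mul_assoc, mul_smul_comm, ← smul_sub] at hab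
    rw [div_eq_inv_mul, mul_smul, ← hab, smul_smul, inv_mul_cancel₀ hα.ne', one_smul]
  have e2 : u * (v * u) - v * u * u = (2 : ℝ) • v := by
    rw [← mul_assoc, huv, neg_mul, mul_assoc, hu, mul_neg, mul_one]; module
  have e3 : (a + s • (u - a)) * (b + s • (v * u - b)) - (b + s • (v * u - b)) * (a + s • (u - a)) =
      ((α + s * (1 - α)) * ((1 - s) * (ν / α) + s * 2)) • v := by
    have : (a + s • (u - a)) = (α + s * (1 - α)) • u := by rw [ha]; module
    have e4 : u * (b + s • (v * u - b)) - (b + s • (v * u - b)) * u =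
        (1 - s) • (u * b - b * u) + s • (u * (v * u) - v * u * u) := by
      simp only [mul_add, add_mul, mul_sub, sub_mul, mul_smul_comm, smul_mul_assoc]
      module
    rw [this, smul_mul_assoc, mul_smul_comm, ← smul_sub, e4, e1, e2]
    module
  rw [dt, hab] at h
  rw [dt, e3]
  have h2 : (v * v).re = -1 := by rw [hv]; simp
  simp only [smul_mul_assoc, mul_add, mul_sub, mul_smul_comm, Quaternion.re_smul,
    Quaternion.re_add, Quaternion.re_sub, h2, smul_eq_mul] at h ⊢
  have h3 : 0 < -(v * c).re := by by_contra! hh; nlinarith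
  have h4 : 0 < α + s * (1 - α) := by
    rcases h0.eq_or_lt with rfl | h0
    · simpa using hα
    · have := mul_nonneg (show 0 ≤ 1 - s by linarith) hα.le
      linarith
  have h5 : 0 < (1 - s) * (ν / α) + s * 2 := by
    rcases h0.eq_or_lt with rfl | h0
    · simp; positivity
    · have : 0 ≤ 1 - s := by linarith
      positivity
  have h6 : 0 < (1 - s) * -(v * c).re + s := by
    rcases h0.eq_or_lt with rfl | h0
    · simpa using h3
    · have := mul_nonneg (show 0 ≤ 1 - s by linarith) h3.le
      linarith
  have := mul_pos (mul_pos h4 h5) h6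
  nlinarith

/-- Loops of invertible matrices of size three. -/
abbrev BR (f : Cb 1 → Mat (Fin 3 × Unit)) : Prop :=
  BM (K := ℝ) (lam := Unit) (n := 1) Finset.univ 1 f

theorem Fr.act_val (q : ℍ[ℝ]ˣ) (z : Fr) : (Fr.act q z).1 = (cj q z.1.1, cj q z.1.2) := rfl

theorem BR_iff {f : Cb 1 → Mat (Fin 3 × Unit)} :
    BR f ↔ (∀ x, IsUnit (f x)) ∧ f ((), 0) = 1 ∧ f ((), 1) = 1 := by
  refine ⟨fun h => ⟨fun x => (h.1 x).1, h.2 _ (.inr (.inl rfl)), h.2 _ (.inr (.inr rfl))⟩,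
    fun h => ⟨fun x => ⟨h.1 x, fun i j hij => by simp at hij⟩, ?_⟩⟩
  rintro ⟨⟨⟩, s⟩ (hs | hs | hs)
  · exact hs.elim
  · change s = 0 at hs
    exact hs ▸ h.2.1
  · change s = 1 at hs
    exact hs ▸ h.2.2

theorem rho_neg_one : rho (-1) = 1 := by
  rw [← rho_one, ← rho_smul (c := -1) (by norm_num) 1]
  simp

theorem loop_re_pos {g : Cb 1 → ℍ[ℝ]} (hg : Continuous g) (h0 : ∀ x, g x ≠ 0) (h1 : g ((), 0) = 1)
    (h : Htp BR (fun x => rho (g x)) fun _ => 1) : 0 < (g ((), 1)).re := by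
  obtain ⟨H, hc, H0, H1, hH⟩ := h.symm
  have hu : ∀ t x, IsUnit (H t x) := fun t x => (BR_iff.1 (hH t)).1 x
  have e0 : ∀ x, H 0 x = 1 := fun x => congrFun H0 x
  have e1 : ∀ x, H 1 x = rho (g x) := fun x => congrFun H1 x
  obtain ⟨G, hG, G0, G1, Gs⟩ := Fr.lift (fun t x => frM ⟨H t x, hu t x⟩)
    (continuous_frM.comp (hc.subtype_mk _))
  have hst : ∀ (q r : ℍ[ℝ]), q ≠ 0 → r ≠ 0 → cj q qi = cj r qi → cj q qk = cj r qk →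
      r⁻¹ * q = ((r⁻¹ * q).re : ℍ[ℝ]) := fun q r hq hr hi hk => by
    refine eq_re_of_cj (mul_ne_zero (inv_ne_zero hr) hq) ?_ ?_
    · rw [← cj_cj, hi, cj_cj, inv_mul_cancel₀ hr, cj_one_left]
    · rw [← cj_cj, hk, cj_cj, inv_mul_cancel₀ hr, cj_one_left]
  have key : ∀ x, (g x)⁻¹ * (G 1 x : ℍ[ℝ]) = (((g x)⁻¹ * (G 1 x : ℍ[ℝ])).re : ℍ[ℝ]) := fun x => by
    have h2 := congrArg Subtype.val (G1 1 x)
    have h3 : frM ⟨H 0 x, hu 0 x⟩ = frM ⟨rho 1, isUnit_rho one_ne_zero⟩ := by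
      congr 2
      rw [e0, rho_one]
    have h4 : frM ⟨H 1 x, hu 1 x⟩ = frM ⟨rho (g x), isUnit_rho (h0 x)⟩ := by
      congr 2
      exact e1 x
    rw [h3, h4, frM_rho (h0 x), Fr.act_val, frM_rho one_ne_zero] at h2
    simp only [cj_one_left, Prod.mk.injEq] at h2
    exact hst _ _ (Units.ne_zero _) (h0 x) h2.1 h2.2
  have hs1 : ∀ s : I, s = 0 ∨ s = 1 → G 1 ((), s) = 1 := fun s hs => Gs _ (fun t => by
    congr 2
    have h2 := (BR_iff.1 (hH t)).2
    have h3 := (BR_iff.1 (hH 0)).2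
    obtain rfl | rfl := hs
    · exact h2.1.trans h3.1.symm
    · exact h2.2.trans h3.2.symm) 1
  have hGc : Continuous fun s : I => (G 1 ((), s) : ℍ[ℝ]) := Units.continuous_val.comp
    (hG.comp (f := fun s : I => ((1 : I), (((), s) : Cb 1)))
      (continuous_const.prodMk (continuous_const.prodMk continuous_id)))
  have hgc : Continuous fun s : I => g ((), s) := hg.comp (continuous_const.prodMk continuous_id)
  have := pos_of_forall_ne_zero
    (f := fun s => ((g ((), s))⁻¹ * (G 1 ((), s) : ℍ[ℝ])).re)
    (Quaternion.continuous_re.comp ((hgc.inv₀ fun s => h0 _).mul hGc)) (fun s hs => by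
      have := key ((), s)
      rw [hs] at this
      exact mul_ne_zero (inv_ne_zero (h0 _)) (Units.ne_zero _) (this.trans (by simp)))
    (by simp [h1, hs1 0 (.inl rfl)]) 1
  have hk := key ((), 1)
  simp only [hs1 1 (.inr rfl), Units.val_one, mul_one] at this hk
  rw [← inv_inv (g ((), 1)), hk, ← Quaternion.coe_inv, Quaternion.re_coe]
  exact inv_pos.2 this

theorem loop_lift {q : Cb 1 → Mat (Fin 3 × Unit)} (hq : Continuous q)
    (h : BR q) : ∃ g : Cb 1 → ℍ[ℝ], Continuous g ∧ (∀ x, g x ≠ 0) ∧ g ((), 0) = 1 ∧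
      (g ((), 1) = 1 ∨ g ((), 1) = -1) ∧ Htp BR q fun x => rho (g x) := by
  obtain ⟨hu, hq0, hq1⟩ := BR_iff.1 h
  have hqc : Continuous fun s : I => q ((), s) := hq.comp (continuous_const.prodMk continuous_id)
  obtain ⟨G, hG, G0, G1, -⟩ := Fr.lift (fun t (_ : Unit) => frM ⟨q ((), t), hu _⟩)
    (continuous_frM.comp ((hqc.comp continuous_fst).subtype_mk _))
  have hGc : Continuous fun x : Cb 1 => (G x.2 () : ℍ[ℝ]) := Units.continuous_val.comp
    (hG.comp (f := fun x : Cb 1 => (x.2, ())) (continuous_snd.prodMk continuous_const))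
  have hn : ∀ x : Cb 1, ‖(G x.2 () : ℍ[ℝ])‖ ≠ 0 := fun x => norm_ne_zero_iff.2 (Units.ne_zero _)
  have he : frM ⟨q ((), 0), hu _⟩ = frM ⟨rho 1, isUnit_rho one_ne_zero⟩ := by
    congr 2
    exact hq0.trans rho_one.symm
  have hact : ∀ t, (cj (G t ()) qi, cj (G t ()) qk) = (frM ⟨q ((), t), hu _⟩).1 := fun t => by
    have h2 := congrArg Subtype.val (G1 t ())
    rw [he, Fr.act_val, frM_rho one_ne_zero] at h2
    simpa [cj_one_left] using h2
  have hg0 : ∀ x : Cb 1, ‖(G x.2 () : ℍ[ℝ])‖⁻¹ • (G x.2 () : ℍ[ℝ]) ≠ 0 := fun x =>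
    smul_ne_zero (inv_ne_zero (hn x)) (Units.ne_zero _)
  have hgc : Continuous fun x : Cb 1 => ‖(G x.2 () : ℍ[ℝ])‖⁻¹ • (G x.2 () : ℍ[ℝ]) :=
    (hGc.norm.inv₀ hn).smul hGc
  have hend : ‖(G 1 () : ℍ[ℝ])‖⁻¹ • (G 1 () : ℍ[ℝ]) = 1 ∨
      ‖(G 1 () : ℍ[ℝ])‖⁻¹ • (G 1 () : ℍ[ℝ]) = -1 := by
    have h1 := hact 1
    have h3 : frM ⟨q ((), 1), hu _⟩ = frM ⟨rho 1, isUnit_rho one_ne_zero⟩ := by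
      congr 2
      exact hq1.trans rho_one.symm
    rw [h3, frM_rho one_ne_zero] at h1
    simp only [cj_one_left, Prod.mk.injEq] at h1
    have h4 := eq_re_of_cj (Units.ne_zero _) h1.1 h1.2
    have h5 := hn ((), 1)
    change ‖(G 1 () : ℍ[ℝ])‖ ≠ 0 at h5
    generalize (G 1 () : ℍ[ℝ]) = z at h4 h5 ⊢
    rw [h4] at h5 ⊢
    rw [Quaternion.norm_coe, Real.norm_eq_abs, ← Quaternion.coe_smul, smul_eq_mul] at *
    rcases abs_choice z.re with h6 | h6
    · left
      rw [h6, inv_mul_cancel₀ (h6 ▸ h5)]; rfl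
    · right
      have : z.re ≠ 0 := by simpa using h5
      rw [h6, inv_neg, neg_mul, inv_mul_cancel₀ this]; simp
  refine ⟨_, hgc, hg0, by simp [G0], hend, ?_⟩
  · have hr := continuous_rho hgc hg0
    refine ⟨fun s x => q x + (s : ℝ) • (rho (‖(G x.2 () : ℍ[ℝ])‖⁻¹ • (G x.2 () : ℍ[ℝ])) - q x),
      (hq.comp continuous_snd).add ((continuous_subtype_val.comp continuous_fst).smul
        ((hr.comp continuous_snd).sub (hq.comp continuous_snd))), by simp, by simp,
      fun s => BR_iff.2 ⟨fun x => ?_, ?_, ?_⟩⟩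
    · beta_reduce
      rw [rho_smul (inv_ne_zero (hn x))]
      obtain ⟨⟨⟩, t⟩ := x
      have hne : (G t () : ℍ[ℝ]) ≠ 0 := Units.ne_zero _
      obtain ⟨c0, c1, c2⟩ := cl_rho hne
      have h2 := (frM ⟨q ((), t), hu _⟩).2
      have h3 := hact t
      have hcl : ∀ j, cl (q ((), t) + (s : ℝ) • (rho (G t ()) - q ((), t))) j =
          cl (q ((), t)) j + (s : ℝ) • (cl (rho (G t ())) j - cl (q ((), t)) j) := fun j => by
        ext <;> simp
      have hpos : 0 < dt (cl (q ((), t)) 0) (cl (q ((), t)) 1) (cl (q ((), t)) 2) := by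
        have hcc := fun j => continuous_cl hqc j
        refine pos_of_forall_ne_zero
          (f := fun t => dt (cl (q ((), t)) 0) (cl (q ((), t)) 1) (cl (q ((), t)) 2)) ?_
          (fun t => isUnit_mtx.1 ((mtx_cl (q ((), t))).symm ▸ hu _)) ?_ t
        · have h1 := hcc 0
          have h2 := hcc 1
          have h3 := hcc 2
          exact (Quaternion.continuous_re.comp (((h1.mul h2).sub (h2.mul h1)).mul h3)).neg
        · have : q ((), 0) = rho 1 := hq0.trans rho_one.symm
          obtain ⟨d0, d1, d2⟩ := cl_rho (g := 1) one_ne_zero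
          rw [this, d0, d1, d2, dt_cj one_ne_zero, dt_ijk]
          norm_num
      change IsUnit (q ((), t) + (s : ℝ) • (rho (G t ()) - q ((), t)))
      rw [← mtx_cl (q ((), t) + (s : ℝ) • (rho (G t ()) - q ((), t))), isUnit_mtx, hcl, hcl, hcl,
        c0, c1, c2]
      rw [← h3] at h2
      have hk : qk * qi = qj := by ext <;> simp
      rw [← hk, ← cj_mul hne]
      have h4 := Prod.ext_iff.1 h3
      have n0 := norm_ne_zero_iff.2 (cl_ne (hu ((), t)))
      have n1 := norm_ne_zero_iff.2 (cmt_ne (hu ((), t)))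
      refine (dt_line (α := ‖cl (q ((), t)) 0‖) (ν := ‖cmt (q ((), t))‖) (by positivity)
        (by positivity) ?_ ?_ h2.1 h2.2.1 h2.2.2 hpos s.2.1 s.2.2).ne'
      · rw [h4.1]; simp [frM, smul_smul, n0]
      · rw [h4.2]; simp [frM, smul_smul, n1]; rfl
    · simp [hq0, G0, rho_one]
    · have : rho (‖(G 1 () : ℍ[ℝ])‖⁻¹ • (G 1 () : ℍ[ℝ])) = 1 :=
        hend.elim (fun h => h ▸ rho_one) fun h => h ▸ rho_neg_one
      beta_reduce
      rw [hq1, this, sub_self, smul_zero, add_zero]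

theorem two_loops : SE.Two (GLS ℝ Unit) (bd 1) := by
  have hK : ∀ a : ℝ, star a * a = algebraMap ℝ ℝ (‖a‖ ^ 2) := fun a => by
    simp [sq]
  refine (two_GLS_iff (K := ℝ) (lam := Unit) (n := 1) hK (k := 1) Finset.univ ?_).2 ?_
  · rw [Finset.card_univ, Module.finrank_self]
    exact (by decide : 1 + 2 < (Fintype.card (Fin 3 × Unit) + 1) * 1)
  let g : Cb 1 → ℍ[ℝ] := fun x => ⟨Real.cos (Real.pi * x.2), Real.sin (Real.pi * x.2), 0, 0⟩
  have hgc : Continuous g := continuous_quat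
    (Real.continuous_cos.comp (continuous_const.mul (continuous_subtype_val.comp continuous_snd)))
    (Real.continuous_sin.comp (continuous_const.mul (continuous_subtype_val.comp continuous_snd)))
    continuous_const continuous_const
  have hg0 : ∀ x, g x ≠ 0 := fun x h => by
    have h1 := congrArg (fun q : ℍ[ℝ] => q.re) h
    have h2 := congrArg (fun q : ℍ[ℝ] => q.imI) h
    simp only [g, Quaternion.re_zero, Quaternion.imI_zero] at h1 h2
    have := Real.sin_sq_add_cos_sq (Real.pi * x.2)
    rw [h1, h2] at this
    norm_num at this
  have g0 : g ((), 0) = 1 := by ext <;> simp [g]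
  have g1 : g ((), 1) = -1 := by ext <;> simp [g]
  have hBR : BR fun x => rho (g x) := BR_iff.2 ⟨fun x => isUnit_rho (hg0 x), by
    rw [g0, rho_one], by rw [g1, rho_neg_one]⟩
  have hsame : ∀ g g' : Cb 1 → ℍ[ℝ], Continuous g → Continuous g' → (∀ x, g x ≠ 0) →
      (∀ x, g' x ≠ 0) → g ((), 0) = 1 → g' ((), 0) = 1 → g ((), 1) = g' ((), 1) →
      BR (fun x => rho (g' x)) → Htp BR (fun x => rho (g x)) fun x => rho (g' x) := by
    intro g g' hg hg' h0 h0' e0 e0' e1 hB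
    obtain ⟨H, hc, H0, H1, hH⟩ := htp_const (k := 1) (E := ℍ[ℝ]) (v := 1)
      (by rw [Quaternion.finrank_eq_four]; norm_num) (F := fun x => g x * (g' x)⁻¹)
      (hg.mul (hg'.inv₀ h0')) (fun x => mul_ne_zero (h0 x) (inv_ne_zero (h0' x))) one_ne_zero (by
        rintro ⟨⟨⟩, s⟩ (hs | hs | hs)
        · exact hs.elim
        · change s = 0 at hs
          subst hs
          simp [e0, e0']
        · change s = 1 at hs
          subst hs
          exact (congrArg (· * _) e1).trans (mul_inv_cancel₀ (h0' _)))
    have hne : ∀ t x, H t x * g' x ≠ 0 := fun t x => mul_ne_zero ((hH t).1 x) (h0' x)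
    refine ⟨fun t x => rho (H t x * g' x),
      continuous_rho (hc.mul (hg'.comp continuous_snd)) fun p => hne p.1 p.2, ?_, ?_, fun t =>
      BR_iff.2 ⟨fun x => isUnit_rho (hne t x), ?_, ?_⟩⟩
    · funext x
      simp [H0, h0']
    · funext x
      simp [H1]
    · beta_reduce
      rw [(hH t).2 ((), 0) (.inr (.inl rfl)), one_mul]
      exact (BR_iff.1 hB).2.1
    · beta_reduce
      rw [(hH t).2 ((), 1) (.inr (.inr rfl)), one_mul]
      exact (BR_iff.1 hB).2.2
  refine ⟨fun x => rho (g x), continuous_rho hgc hg0, hBR, fun h => ?_, fun q hq hqB => ?_⟩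
  · have := loop_re_pos hgc hg0 g0 h
    rw [g1] at this
    simp at this
    linarith
  · obtain ⟨g', hg', h0', e0, e1 | e1, h⟩ := loop_lift hq hqB
    · left
      have := hsame g' (fun _ => 1) hg' continuous_const h0' (fun _ => one_ne_zero) e0 rfl e1
        (BR_iff.2 ⟨fun _ => isUnit_rho one_ne_zero, rho_one, rho_one⟩)
      simp only [rho_one] at this
      exact h.trans this
    · exact .inr (h.trans (hsame g' g hg' hgc h0' hg0 e0 g0 (e1.trans g1.symm) hBR))

/-- The centred coordinates of a point of the cube. -/
def ctr (x : Cb 3) : Fin 3 → ℝ := ![2 * (x.1.1.2 : ℝ) - 1, 2 * (x.1.2 : ℝ) - 1, 2 * (x.2 : ℝ) - 1]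

theorem continuous_ctr : Continuous ctr := by
  unfold ctr
  have h1 : Continuous fun x : Cb 3 => x.1.1.2 :=
    continuous_snd.comp (continuous_fst.comp continuous_fst)
  have h2 : Continuous fun x : Cb 3 => x.1.2 := continuous_snd.comp continuous_fst
  have h3 : Continuous fun x : Cb 3 => x.2 := continuous_snd
  refine continuous_pi fun i => ?_
  fin_cases i <;> simp <;> fun_prop

theorem ctr_injective : Function.Injective ctr := by
  rintro ⟨⟨⟨⟨⟩, a⟩, b⟩, c⟩ ⟨⟨⟨⟨⟩, a'⟩, b'⟩, c'⟩ h
  have e0 := congrFun h 0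
  have e1 := congrFun h 1
  have e2 := congrFun h 2
  simp [ctr] at e0 e1 e2
  rw [Subtype.ext e0, Subtype.ext e1, Subtype.ext e2]

theorem norm_ctr_le (x : Cb 3) : ‖ctr x‖ ≤ 1 := by
  refine (pi_norm_le_iff_of_nonneg zero_le_one).2 fun i => ?_
  rw [Real.norm_eq_abs, abs_le]
  have h1 := x.1.1.2.2
  have h2 := x.1.2.2
  have h3 := x.2.2
  fin_cases i <;> simp [ctr] <;> constructor <;> linarith [h1.1, h1.2, h2.1, h2.2, h3.1, h3.2]

theorem exists_ctr {v : Fin 3 → ℝ} (h : ‖v‖ ≤ 1) : ∃ x, ctr x = v := by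
  have h' : ∀ i, (1 + v i) / 2 ∈ Set.Icc (0 : ℝ) 1 := fun i => by
    have := abs_le.1 ((norm_le_pi_norm v i).trans h)
    constructor <;> linarith
  refine ⟨((((), ⟨_, h' 0⟩), ⟨_, h' 1⟩), ⟨_, h' 2⟩), funext fun i => ?_⟩
  fin_cases i <;> simp [ctr] <;> ring

theorem mem_bd_iff (x : Cb 3) : x ∈ bd 3 ↔ ‖ctr x‖ = 1 := by
  have habs : ∀ a : I, |2 * (a : ℝ) - 1| = 1 ↔ a = 0 ∨ a = 1 := fun a => by
    rw [abs_eq zero_le_one]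
    constructor
    · rintro (h | h)
      · exact .inr (Subtype.ext (show (a : ℝ) = 1 by linarith))
      · exact .inl (Subtype.ext (show (a : ℝ) = 0 by linarith))
    · rintro (rfl | rfl) <;> norm_num
  have hle := norm_ctr_le x
  have h1 : ‖ctr x‖ = 1 ↔ ∃ i, |ctr x i| = 1 := by
    constructor
    · intro h
      by_contra! hn
      refine absurd h (ne_of_lt ((pi_norm_lt_iff zero_lt_one).2 fun i => ?_))
      exact lt_of_le_of_ne ((norm_le_pi_norm _ i).trans hle) (hn i)
    · rintro ⟨i, hi⟩
      exact le_antisymm hle (hi ▸ norm_le_pi_norm (ctr x) i)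
  rw [h1, Fin.exists_fin_succ, Fin.exists_fin_succ, Fin.exists_fin_succ]
  have h2 : x ∈ bd 3 ↔ (((False ∨ x.1.1.2 = 0 ∨ x.1.1.2 = 1) ∨ x.1.2 = 0 ∨ x.1.2 = 1) ∨ x.2 = 0 ∨ x.2 = 1) :=
    Iff.rfl
  rw [h2, ← habs x.1.1.2, ← habs x.1.2, ← habs x.2]
  simp [ctr]
  tauto

/-- The square length of a vector. -/
def sl (v : Fin 3 → ℝ) : ℝ := v 0 ^ 2 + v 1 ^ 2 + v 2 ^ 2

theorem sl_pos {v : Fin 3 → ℝ} (h : v ≠ 0) : 0 < sl v := by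
  by_contra! hn
  refine h (funext fun i => ?_)
  unfold sl at hn
  fin_cases i <;> simp <;> nlinarith [sq_nonneg (v 0), sq_nonneg (v 1), sq_nonneg (v 2)]

theorem den_pos (v : Fin 3 → ℝ) : 0 < sl v + (1 - ‖v‖) ^ 2 := by
  by_cases h : v = 0
  · subst h; simp [sl]
  · have := sl_pos h; positivity

/-- The collapse of the boundary of the cube. -/
def clp (x : Cb 3) : Metric.sphere (0 : EuclideanSpace ℝ (Fin (3 + 1))) 1 :=
  ⟨!₂[2 * (1 - ‖ctr x‖) * ctr x 0 / (sl (ctr x) + (1 - ‖ctr x‖) ^ 2),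
    2 * (1 - ‖ctr x‖) * ctr x 1 / (sl (ctr x) + (1 - ‖ctr x‖) ^ 2),
    2 * (1 - ‖ctr x‖) * ctr x 2 / (sl (ctr x) + (1 - ‖ctr x‖) ^ 2),
    (sl (ctr x) - (1 - ‖ctr x‖) ^ 2) / (sl (ctr x) + (1 - ‖ctr x‖) ^ 2)], by
    have h := (den_pos (ctr x)).ne'
    rw [mem_sphere_zero_iff_norm, ← sq_eq_sq₀ (norm_nonneg _) zero_le_one,
      EuclideanSpace.real_norm_sq_eq, Fin.sum_univ_four]
    simp
    field_simp
    simp only [sl]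
    ring⟩

theorem continuous_clp : Continuous clp := by
  refine Continuous.subtype_mk ((PiLp.continuous_toLp 2 _).comp (continuous_pi fun i => ?_)) _
  have h0 := continuous_ctr
  have h1 : ∀ i, Continuous fun x => ctr x i := fun i => (continuous_apply i).comp h0
  have h2 : Continuous fun x => sl (ctr x) := by unfold sl; fun_prop
  have h3 : ∀ x, sl (ctr x) + (1 - ‖ctr x‖) ^ 2 ≠ 0 := fun x => (den_pos _).ne'
  fin_cases i <;> refine Continuous.div ?_ ?_ h3 <;> fun_prop

theorem clp_eq {x y : Cb 3} (h : clp x = clp y) : x = y ∨ x ∈ bd 3 ∧ y ∈ bd 3 := by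
  have hd : ∀ x, (clp x).1 3 = 1 - 2 * (1 - ‖ctr x‖) ^ 2 / (sl (ctr x) + (1 - ‖ctr x‖) ^ 2) := by
    intro x
    have := (den_pos (ctr x)).ne'
    simp [clp]; field_simp; ring
  have hb : ∀ x, (clp x).1 3 = 1 ↔ x ∈ bd 3 := fun x => by
    rw [hd, mem_bd_iff, sub_eq_self, div_eq_zero_iff, or_iff_left (den_pos _).ne']
    rw [mul_eq_zero, or_iff_right two_ne_zero, sq_eq_zero_iff, sub_eq_zero, eq_comm]
  by_cases hx : x ∈ bd 3
  · exact .inr ⟨hx, (hb y).1 (h ▸ (hb x).2 hx)⟩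
  have hy : y ∉ bd 3 := fun hy => hx ((hb x).1 (h ▸ (hb y).2 hy))
  left
  have hl : ∀ x, x ∉ bd 3 → 0 < 1 - ‖ctr x‖ := fun x hx =>
    sub_pos.2 (lt_of_le_of_ne (norm_ctr_le x) fun h => hx ((mem_bd_iff x).2 h))
  have hw : ∀ x, x ∉ bd 3 → (1 - ‖ctr x‖)⁻¹ • ctr x =
      fun i => (clp x).1 i.castSucc / (1 - (clp x).1 3) := fun x hx => by
    have h1 := (hl x hx).ne'
    have h2 := (den_pos (ctr x)).ne'
    funext i
    rw [hd]
    fin_cases i <;> simp [clp] <;> field_simp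
  have hww : (1 - ‖ctr x‖)⁻¹ • ctr x = (1 - ‖ctr y‖)⁻¹ • ctr y := by
    rw [hw x hx, hw y hy, h]
  have h1 := hl x hx
  have h2 := hl y hy
  have hn := congrArg norm hww
  rw [norm_smul, norm_smul, norm_inv, norm_inv, Real.norm_of_nonneg h1.le,
    Real.norm_of_nonneg h2.le] at hn
  have hn' : ‖ctr x‖ = ‖ctr y‖ := by field_simp at hn; linarith
  rw [hn'] at hww
  exact ctr_injective (smul_right_injective _ (inv_ne_zero h2.ne') hww)

theorem clp_bd {x y : Cb 3} (hx : x ∈ bd 3) (hy : y ∈ bd 3) : clp x = clp y := by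
  have key : ∀ x, x ∈ bd 3 → (clp x).1 = !₂[0, 0, 0, 1] := fun x hx => by
    have h := (den_pos (ctr x)).ne'
    rw [(mem_bd_iff x).1 hx] at h
    simp at h
    simp [clp, (mem_bd_iff x).1 hx, h]
  exact Subtype.ext ((key x hx).trans (key y hy).symm)

theorem clp_surjective : Function.Surjective clp := by
  intro p
  have hp : p.1 0 ^ 2 + p.1 1 ^ 2 + p.1 2 ^ 2 + p.1 3 ^ 2 = 1 := by
    have := p.2
    rw [mem_sphere_zero_iff_norm, ← sq_eq_sq₀ (norm_nonneg _) zero_le_one,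
      EuclideanSpace.real_norm_sq_eq, Fin.sum_univ_four] at this
    simpa using this
  by_cases h3 : p.1 3 = 1
  · obtain ⟨x, hx⟩ := exists_ctr (v := fun _ => 1) (by simp)
    refine ⟨x, Subtype.ext (PiLp.ext fun i => ?_)⟩
    have e0 : p.1 0 = 0 := by nlinarith [sq_nonneg (p.1 0), sq_nonneg (p.1 1), sq_nonneg (p.1 2)]
    have e1 : p.1 1 = 0 := by nlinarith [sq_nonneg (p.1 0), sq_nonneg (p.1 1), sq_nonneg (p.1 2)]
    have e2 : p.1 2 = 0 := by nlinarith [sq_nonneg (p.1 0), sq_nonneg (p.1 1), sq_nonneg (p.1 2)]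
    fin_cases i <;> simp [clp, hx, e0, e1, e2, h3, sl] <;> norm_num
  · have h3' : 0 < 1 - p.1 3 := sub_pos.2 (lt_of_le_of_ne (by nlinarith [sq_nonneg (p.1 0), sq_nonneg (p.1 1), sq_nonneg (p.1 2)]) h3)
    let w : Fin 3 → ℝ := fun i => p.1 i.castSucc / (1 - p.1 3)
    have hw : 0 < 1 + ‖w‖ := by positivity
    have hl : ‖(1 + ‖w‖)⁻¹ • w‖ = 1 - (1 + ‖w‖)⁻¹ := by
      rw [norm_smul, norm_inv, Real.norm_of_nonneg hw.le]; field_simp; ring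
    obtain ⟨x, hx⟩ := exists_ctr (v := (1 + ‖w‖)⁻¹ • w) (by
      rw [hl]; have := inv_pos.2 hw; linarith)
    have hden : sl ((1 + ‖w‖)⁻¹ • w) + ((1 + ‖w‖)⁻¹) ^ 2 =
        ((1 + ‖w‖)⁻¹) ^ 2 * (2 / (1 - p.1 3)) := by
      have : sl w + 1 = 2 / (1 - p.1 3) := by
        simp [sl, w]
        field_simp
        linear_combination hp
      rw [← this]
      generalize (1 + ‖w‖)⁻¹ = l
      simp [sl]; ring
    have hwi := (inv_pos.2 hw).ne'
    refine ⟨x, Subtype.ext (PiLp.ext fun i => ?_)⟩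
    have h3n := h3'.ne'
    simp only [clp, hx, hl, sub_sub_cancel, hden]
    generalize (1 + ‖w‖)⁻¹ = l at hwi hden ⊢
    have e0 : w 0 = p.1 0 / (1 - p.1 3) := rfl
    have e1 : w 1 = p.1 1 / (1 - p.1 3) := rfl
    have e2 : w 2 = p.1 2 / (1 - p.1 3) := rfl
    have e3 : sl (l • w) = l ^ 2 * (2 / (1 - p.1 3)) - l ^ 2 := by linarith
    fin_cases i
    · simp [e0]; field_simp
    · simp [e1]; field_simp
    · simp [e2]; field_simp
    · simp [e3]; field_simp; ring

/-- Descent along the collapse. -/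
theorem exists_descent {Z M : Type*} [TopologicalSpace Z] [CompactSpace Z] [T2Space Z]
    [TopologicalSpace M] {F : Z → Cb 3 → M} (hF : Continuous fun p : Z × Cb 3 => F p.1 p.2)
    (h : ∀ z, ∀ x ∈ bd 3, ∀ y ∈ bd 3, F z x = F z y) :
    ∃ F' : Z → Metric.sphere (0 : EuclideanSpace ℝ (Fin (3 + 1))) 1 → M,
      (Continuous fun p : Z × Metric.sphere (0 : EuclideanSpace ℝ (Fin (3 + 1))) 1 =>
        F' p.1 p.2) ∧ ∀ z x, F' z (clp x) = F z x := by
  have key : ∀ z x, F z (Function.surjInv clp_surjective (clp x)) = F z x := fun z x => by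
    rcases clp_eq (Function.surjInv_eq clp_surjective (clp x)) with e | ⟨e1, e2⟩
    · rw [e]
    · exact h z _ e1 _ e2
  refine ⟨fun z p => F z (Function.surjInv clp_surjective p), ?_, key⟩
  have hc : Continuous (Prod.map id clp : Z × Cb 3 → _) := continuous_id.prodMap continuous_clp
  have hq := hc.isClosedMap.isQuotientMap hc (Function.surjective_id.prodMap clp_surjective)
  rw [hq.continuous_iff]
  exact hF.congr fun p => (key _ _).symm

/-- The three-sphere. -/
abbrev S3 : Type := Metric.sphere (0 : EuclideanSpace ℝ (Fin (3 + 1))) 1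

/-- Families of nonzero quaternions over the sphere, parametrised by the square and trivial on its
boundary. -/
def FD (D : (I × I) × S3 → ℍ[ℝ]) : Prop :=
  (∀ x, D x ≠ 0) ∧ ∀ s t y, (s = 0 ∨ s = 1) ∨ t = 0 ∨ t = 1 → D ((s, t), y) = 1

/-- A boundary point of the cube. -/
def c0 : Cb 3 := ((((), 0), 0), 0)

theorem c0_mem : c0 ∈ bd 3 := .inr (.inl rfl)

/-- The restriction of a family to the cube, normalised over the boundary. -/
def toBQ (D : (I × I) × S3 → ℍ[ℝ]) (x : Cb 5) : ℍ[ℝ] :=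
  D ((x.1.2, x.2), clp x.1.1) * (D ((x.1.2, x.2), clp c0))⁻¹

theorem BQ_toBQ {D : (I × I) × S3 → ℍ[ℝ]} (hD : FD D) : BQ 5 (toBQ D) := by
  refine ⟨fun x => mul_ne_zero (hD.1 _) (inv_ne_zero (hD.1 _)), fun x hx => ?_⟩
  have hx' : (x.1.1 ∈ bd 3 ∨ x.1.2 = 0 ∨ x.1.2 = 1) ∨ x.2 = 0 ∨ x.2 = 1 := hx
  rcases or_assoc.1 hx' with h | h
  · rw [toBQ, clp_bd h c0_mem, mul_inv_cancel₀ (hD.1 _)]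
  · rw [toBQ, hD.2 _ _ _ h, hD.2 _ _ _ h, inv_one, one_mul]

theorem continuous_toBQ {X : Type*} [TopologicalSpace X] {D : X → (I × I) × S3 → ℍ[ℝ]}
    (hD : Continuous fun p : X × (I × I) × S3 => D p.1 p.2) (h0 : ∀ x z, D x z ≠ 0) :
    Continuous fun p : X × Cb 5 => toBQ (D p.1) p.2 := by
  have h1 : Continuous fun p : X × Cb 5 => (p.2.1.2, p.2.2) :=
    (continuous_snd.comp (continuous_fst.comp continuous_snd)).prodMk
      (continuous_snd.comp continuous_snd)
  have h2 : Continuous fun p : X × Cb 5 => clp p.2.1.1 :=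
    continuous_clp.comp (continuous_fst.comp (continuous_fst.comp continuous_snd))
  exact (hD.comp (continuous_fst.prodMk (h1.prodMk h2))).mul
    ((hD.comp (continuous_fst.prodMk (h1.prodMk continuous_const))).inv₀ fun _ => h0 _ _)

theorem htp_toBQ {D D' : (I × I) × S3 → ℍ[ℝ]} (h : Htp FD D D') :
    Htp (BQ 5) (toBQ D) (toBQ D') := by
  obtain ⟨H, hc, rfl, rfl, hH⟩ := h
  exact ⟨fun r => toBQ (H r), continuous_toBQ hc fun r => (hH r).1, rfl, rfl, fun r => BQ_toBQ (hH r)⟩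

theorem htp_normalise {D : (I × I) × S3 → ℍ[ℝ]} (hc : Continuous D) (hD : FD D) :
    Htp FD D fun z => D z * (D (z.1, clp c0))⁻¹ := by
  have hk : Continuous fun x : Cb 2 => ((x.1.2, x.2), clp c0) :=
    ((continuous_snd.comp continuous_fst).prodMk continuous_snd).prodMk continuous_const
  obtain ⟨H, hHc, hH0, hH1, hH⟩ := htp_const (k := 2) (by rw [Quaternion.finrank_eq_four]; norm_num)
    (hc.comp hk) (fun x => hD.1 _) one_ne_zero (fun x hx => hD.2 _ _ _
      ((show (False ∨ x.1.2 = 0 ∨ x.1.2 = 1) ∨ x.2 = 0 ∨ x.2 = 1 from hx).imp_left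
        fun h => h.resolve_left id))
  have hd : Continuous fun z : (I × I) × S3 => (D (z.1, clp c0))⁻¹ :=
    (hc.comp (continuous_fst.prodMk continuous_const)).inv₀ fun z => hD.1 _
  have hq : Continuous fun p : I × (I × I) × S3 => H p.1 (((), p.2.1.1), p.2.1.2) :=
    hHc.comp (f := fun p : I × (I × I) × S3 => ((p.1, (((), p.2.1.1), p.2.1.2)) : I × Cb 2))
      (continuous_fst.prodMk ((continuous_const.prodMk (by fun_prop)).prodMk (by fun_prop)))
  refine ⟨fun r z => D z * (D (z.1, clp c0))⁻¹ * H r (((), z.1.1), z.1.2),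
    ((hc.comp continuous_snd).mul (hd.comp continuous_snd)).mul hq, funext fun z => ?_,
    funext fun z => ?_, fun r => ⟨fun z => ?_, fun s t y h => ?_⟩⟩
  · exact (congrArg (_ * ·) (congrFun hH0 _)).trans (inv_mul_cancel_right₀ (hD.1 _) _)
  · exact (congrArg (_ * ·) (congrFun hH1 _)).trans (mul_one _)
  · exact mul_ne_zero (mul_ne_zero (hD.1 _) (inv_ne_zero (hD.1 _))) ((hH r).1 _)
  · have e : H r (((), s), t) = 1 := (hH r).2 _ (h.imp_left Or.inr)
    beta_reduce
    rw [hD.2 _ _ _ h, hD.2 _ _ _ h]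
    exact (congrArg _ e).trans (by simp)

theorem htp_of_toBQ {D D' : (I × I) × S3 → ℍ[ℝ]} (hc : Continuous D) (hc' : Continuous D')
    (hD : FD D) (hD' : FD D') (h : Htp (BQ 5) (toBQ D) (toBQ D')) : Htp FD D D' := by
  refine (htp_normalise hc hD).trans (Htp.trans ?_ (htp_normalise hc' hD').symm)
  obtain ⟨H, hHc, hH0, hH1, hH⟩ := h
  obtain ⟨F', hF', hF⟩ := exists_descent (Z := I × I × I) (M := ℍ[ℝ])
    (F := fun z c => H z.1 ((c, z.2.1), z.2.2))
    (hHc.comp (f := fun p : (I × I × I) × Cb 3 => ((p.1.1, ((p.2, p.1.2.1), p.1.2.2)) : I × Cb 5))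
      (by exact (continuous_fst.comp continuous_fst).prodMk ((continuous_snd.prodMk
        (by fun_prop)).prodMk (by fun_prop))))
    (fun z x hx y hy => ((hH _).2 _ (.inl (.inl hx))).trans ((hH _).2 _ (.inl (.inl hy))).symm)
  refine ⟨fun r z => F' (r, z.1.1, z.1.2) z.2, hF'.comp
    (f := fun p : I × (I × I) × S3 => ((p.1, p.2.1.1, p.2.1.2), p.2.2)) (by fun_prop),
    funext ?_, funext ?_, fun r => ⟨?_, ?_⟩⟩
  · rintro ⟨⟨s, t⟩, y⟩
    obtain ⟨c, rfl⟩ := clp_surjective y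
    exact (hF _ c).trans (congrFun hH0 ((c, s), t))
  · rintro ⟨⟨s, t⟩, y⟩
    obtain ⟨c, rfl⟩ := clp_surjective y
    exact (hF _ c).trans (congrFun hH1 ((c, s), t))
  · rintro ⟨⟨s, t⟩, y⟩
    obtain ⟨c, rfl⟩ := clp_surjective y
    exact (hF (r, s, t) c).trans_ne ((hH r).1 _)
  · rintro s t y h
    obtain ⟨c, rfl⟩ := clp_surjective y
    exact (hF (r, s, t) c).trans ((hH r).2 _ (h.imp_left Or.inr))

/-- There are exactly two classes of families. -/
theorem two_FD : ∃ p, Continuous p ∧ FD p ∧ ¬ Htp FD p (fun _ => 1) ∧ ∀ q, Continuous q → FD q →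
    Htp FD q (fun _ => 1) ∨ Htp FD q p := by
  obtain ⟨p, hpc, hp, hp0, hpq⟩ := quat_five (two_real.2 two_loops)
  have h1 : FD fun _ => 1 := ⟨fun _ => one_ne_zero, fun _ _ _ _ => rfl⟩
  have e1 : toBQ (fun _ => 1) = fun _ => 1 := funext fun _ => by simp [toBQ]
  obtain ⟨F', hF', hF⟩ := exists_descent (Z := I × I) (M := ℍ[ℝ]) (F := fun z c => p ((c, z.1), z.2))
    (hpc.comp (f := fun p : (I × I) × Cb 3 => (((p.2, p.1.1), p.1.2) : Cb 5))
      (by exact (continuous_snd.prodMk (by fun_prop)).prodMk (by fun_prop)))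
    (fun z x hx y hy => (hp.2 _ (.inl (.inl hx))).trans (hp.2 _ (.inl (.inl hy))).symm)
  have e2 : toBQ (fun z => F' z.1 z.2) = p := by
    funext ⟨⟨c, s⟩, t⟩
    have h : F' (s, t) (clp c0) = 1 := (hF _ _).trans (hp.2 _ (.inl (.inl c0_mem)))
    simp only [toBQ, h, inv_one, mul_one]
    exact hF _ _
  have h2 : FD fun z => F' z.1 z.2 := by
    constructor
    · rintro ⟨⟨s, t⟩, y⟩
      obtain ⟨c, rfl⟩ := clp_surjective y
      exact (hF (s, t) c).trans_ne (hp.1 _)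
    · rintro s t y h
      obtain ⟨c, rfl⟩ := clp_surjective y
      exact (hF (s, t) c).trans (hp.2 _ (h.imp_left Or.inr))
  refine ⟨_, hF', h2, fun h => hp0 ?_, fun q hq hqD => ?_⟩
  · have := htp_toBQ h
    rwa [e1, e2] at this
  · have hqc : Continuous (toBQ q) :=
      (continuous_toBQ (X := Unit) (D := fun _ => q) (hq.comp continuous_snd) fun _ => hqD.1).comp
        (Continuous.prodMk_right ())
    refine (hpq _ hqc (BQ_toBQ hqD)).imp (fun h => ?_) fun h => ?_
    · exact htp_of_toBQ hq continuous_const hqD h1 (e1 ▸ h)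
    · exact htp_of_toBQ hq hF' hqD h2 (by rwa [e2])

/-- The complex exponential, as a quaternion. -/
def ec (z : ℂ) : ℍ[ℝ] := (Complex.exp z : ℂ)

theorem ec_add (z w : ℂ) : ec (z + w) = ec z * ec w := by
  simp [ec, Complex.exp_add, Quaternion.coeComplex_mul]
theorem ec_zero : ec 0 = 1 := by simp [ec]
theorem ec_mul_neg (z : ℂ) : ec z * ec (-z) = 1 := by rw [← ec_add, add_neg_cancel, ec_zero]
theorem ec_ne (z : ℂ) : ec z ≠ 0 := left_ne_zero_of_mul_eq_one (ec_mul_neg z)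
theorem continuous_ec : Continuous ec :=
  continuous_quat (Complex.continuous_re.comp Complex.continuous_exp)
    (Complex.continuous_im.comp Complex.continuous_exp) continuous_const continuous_const
theorem cj_ec (q : ℍ[ℝ]) (z : ℂ) : cj (q * ec z) qi = cj q qi := by
  rw [← cj_cj, cj_eq (ec_ne z) (y := qi)]
  ext <;> simp [ec]

theorem ec_eq_one {z : ℂ} (h : ec z = 1) : ∃ n : ℤ, z = n * (2 * Real.pi * Complex.I) := by
  refine Complex.exp_eq_one_iff.1 (Complex.ext ?_ ?_)
  · simpa [ec] using congrArg QuaternionAlgebra.re h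
  · simpa [ec] using congrArg QuaternionAlgebra.imI h

theorem ec_const {Z : Type*} [TopologicalSpace Z] [PreconnectedSpace Z] {L : Z → ℂ}
    (hL : Continuous L) (h : ∀ z, ec (L z) = 1) (z z' : Z) : L z = L z' := by
  choose n hn using fun z => ec_eq_one (h z)
  have hnc : Continuous n := by
    rw [Int.isClosedEmbedding_coe_real.isInducing.continuous_iff]
    refine ((Complex.continuous_im.comp hL).div_const (2 * Real.pi)).congr fun z => ?_
    have := Real.pi_ne_zero
    simp [hn z]
  rw [hn z, hn z', PreconnectedSpace.constant ‹_› hnc]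

theorem ec_inj {Z : Type*} [TopologicalSpace Z] [PreconnectedSpace Z] {L L' : Z → ℂ}
    (hL : Continuous L) (hL' : Continuous L') (h : ∀ z, ec (L z) = ec (L' z)) {z₀ : Z}
    (h0 : L z₀ = L' z₀) (z : Z) : L z = L' z := by
  have := ec_const (L := fun z => L z - L' z) (hL.sub hL') (fun z => by
    rw [sub_eq_add_neg, ec_add, h, ec_mul_neg]) z z₀
  beta_reduce at this
  rwa [h0, sub_self, sub_eq_zero] at this

section
variable {X : Type*} [PseudoMetricSpace X] [CompactSpace X]

theorem exists_log {c : I → X → ℍ[ℝ]} (hc : Continuous fun p : I × X => c p.1 p.2)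
    (h0 : ∀ t x, c t x ≠ 0) (hi : ∀ t x, cj (c t x) qi = qi) (h1 : ∀ x, c 0 x = 1) :
    ∃ L : I → X → ℂ, (Continuous fun p : I × X => L p.1 p.2) ∧ (∀ x, L 0 x = 0) ∧
      (∀ t x, ec (L t x) = c t x) ∧ ∀ x, (∀ t, c t x = 1) → ∀ t, L t x = 0 := by
  have hz : ∀ t x, c t x = ((⟨(c t x).re, (c t x).imI⟩ : ℂ) : ℍ[ℝ]) := fun t x => by
    have h := of_cj_eq (h0 t x) (hi t x)
    have hJ := congrArg QuaternionAlgebra.imJ h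
    have hK := congrArg QuaternionAlgebra.imK h
    simp at hJ hK
    ext <;> simp <;> linarith
  let d : I → X → {z : ℂ // z ≠ 0} := fun t x => ⟨⟨(c t x).re, (c t x).imI⟩, fun h =>
    h0 t x ((hz t x).trans (by rw [h]; simp))⟩
  have hd : Continuous fun p : I × X => d p.1 p.2 := by
    refine Continuous.subtype_mk (Complex.equivRealProdCLM.symm.continuous.comp
      ((Quaternion.continuous_re.comp hc).prodMk (Quaternion.continuous_imI.comp hc))) _
  have hq : Continuous fun z : {z : ℂ // z ≠ 0} × {z : ℂ // z ≠ 0} => (z.2 : ℂ) / z.1 :=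
    Continuous.div (by fun_prop) (by fun_prop) fun z => z.1.2
  obtain ⟨G, hG, hG0, hG1, hG2, -⟩ := hlp (M := Multiplicative ℂ) (B := {z : ℂ // z ≠ 0})
    (fun m b => ⟨Complex.exp m.toAdd * b, mul_ne_zero (Complex.exp_ne_zero _) b.2⟩)
    (fun b => by simp) (fun m n b => by simp [Complex.exp_add, mul_assoc])
    (fun z => .ofAdd (Complex.log (z.2 / z.1))) {z | (z.2 : ℂ) / z.1 ∈ Complex.slitPlane}
    (Complex.isOpen_slitPlane.preimage hq)
    (continuous_ofAdd.comp_continuousOn (hq.continuousOn.clog fun z hz => hz))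
    (fun b _ => by simp [div_self b.2])
    (fun z _ => Subtype.ext (by
      simp [Complex.exp_log (div_ne_zero z.2.2 z.1.2), div_mul_cancel₀ _ z.1.2]))
    ⊤ d hd (fun t x => by simp [div_self (d t x).2]) fun _ _ _ _ => trivial
  have hd0 : ∀ x, (d 0 x : ℂ) = 1 := fun x => by
    change (⟨(c 0 x).re, (c 0 x).imI⟩ : ℂ) = 1
    rw [h1]; rfl
  refine ⟨fun t x => (G t x).toAdd, continuous_toAdd.comp hG, fun x => congrArg Multiplicative.toAdd (hG0 x),
    fun t x => ?_, fun x h t => ?_⟩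
  · have := congrArg Subtype.val (hG1 t x)
    rw [hz, ec]
    congr 1
    simpa [hd0] using this
  · refine congrArg Multiplicative.toAdd (hG2 x (fun t => Subtype.ext ?_) t)
    change (⟨(c t x).re, (c t x).imI⟩ : ℂ) = ⟨(c 0 x).re, (c 0 x).imI⟩
    rw [h, h]

theorem exists_cmp {A B : I → X → ℍ[ℝ]} (hA : Continuous fun p : I × X => A p.1 p.2)
    (hB : Continuous fun p : I × X => B p.1 p.2) (hA0 : ∀ t x, A t x ≠ 0)
    (hB0 : ∀ t x, B t x ≠ 0) (h0 : ∀ x, A 0 x = B 0 x) (h : ∀ t x, cj (A t x) qi = cj (B t x) qi) :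
    ∃ L : I → X → ℂ, (Continuous fun p : I × X => L p.1 p.2) ∧ (∀ x, L 0 x = 0) ∧
      (∀ t x, B t x = A t x * ec (L t x)) ∧ ∀ x, (∀ t, A t x = B t x) → ∀ t, L t x = 0 := by
  obtain ⟨L, hL, hL0, hL1, hL2⟩ := exists_log (c := fun t x => (A t x)⁻¹ * B t x)
    ((hA.inv₀ fun p => hA0 _ _).mul hB) (fun t x => mul_ne_zero (inv_ne_zero (hA0 t x)) (hB0 t x))
    (fun t x => by rw [← cj_cj, ← h, cj_cj, inv_mul_cancel₀ (hA0 t x), cj_one_left])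
    (fun x => by rw [h0, inv_mul_cancel₀ (hB0 0 x)])
  refine ⟨L, hL, hL0, fun t x => by rw [hL1, mul_inv_cancel_left₀ (hA0 t x)], fun x hx => ?_⟩
  exact hL2 x fun t => by rw [hx, inv_mul_cancel₀ (hB0 t x)]

theorem exists_lft {h : I → X → ℍ[ℝ]} (hc : Continuous fun p : I × X => h p.1 p.2)
    (hh : ∀ t x, h t x * h t x = -1) {φ : X → ℍ[ℝ]} (hφ : Continuous φ) (h0 : ∀ x, φ x ≠ 0)
    (hi : ∀ x, cj (φ x) qi = h 0 x) :
    ∃ A : I → X → ℍ[ℝ], (Continuous fun p : I × X => A p.1 p.2) ∧ (∀ t x, A t x ≠ 0) ∧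
      (∀ x, A 0 x = φ x) ∧ (∀ t x, cj (A t x) qi = h t x) ∧
      ∀ x, (∀ t, h t x = h 0 x) → ∀ t, A t x = φ x := by
  let mv : {u : ℍ[ℝ] // u * u = -1} × {u : ℍ[ℝ] // u * u = -1} → ℍ[ℝ] := fun z =>
    (2⁻¹ : ℝ) • (1 - z.2.1 * z.1.1)
  have hmc : Continuous mv := by fun_prop
  have hms : ∀ z, mv (z, z) = 1 := fun z => by
    simp only [mv, z.2]
    rw [show (1 : ℍ[ℝ]) - -1 = (2 : ℝ) • 1 by module, smul_smul]
    norm_num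
  obtain ⟨G, hG, hG0, hG1, hG2, -⟩ := hlp (M := ℍ[ℝ]ˣ) (B := {u : ℍ[ℝ] // u * u = -1})
    (fun q z => ⟨cj q z, by rw [cj_mul q.ne_zero, z.2, cj_neg, cj_self q.ne_zero]⟩)
    (fun b => Subtype.ext (cj_one_left _)) (fun q r b => Subtype.ext (by simp [cj_cj]))
    (fun z => un (mv z)) {z | mv z ≠ 0} (isOpen_ne_fun hmc continuous_const)
    (continuousOn_un hmc) (fun z hz => by ext1; rw [val_un hz, hms]; rfl) (fun z hz => by
      refine Subtype.ext (cj_eq (Units.ne_zero _) ?_)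
      rw [val_un hz]
      obtain ⟨⟨u, hu⟩, ⟨v, hv⟩⟩ := z
      simp only [mv, smul_mul_assoc, mul_smul_comm]
      rw [sub_mul, mul_sub, mul_assoc, hu, ← mul_assoc, hv]
      congr 1
      noncomm_ring) ⊤ (fun t x => ⟨h t x, hh t x⟩) (hc.subtype_mk _)
    (fun t x => by change mv _ ≠ 0; rw [hms]; exact one_ne_zero) fun _ _ _ _ => trivial
  refine ⟨fun t x => G t x * φ x, (Units.continuous_val.comp hG).mul (hφ.comp continuous_snd),
    fun t x => mul_ne_zero (Units.ne_zero _) (h0 x), fun x => by simp [hG0], fun t x => ?_,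
    fun x hx t => ?_⟩
  · rw [← cj_cj, hi]
    exact congrArg Subtype.val (hG1 t x)
  · beta_reduce
    rw [hG2 x fun t => Subtype.ext (hx t), Units.val_one, one_mul]

end

instance : PreconnectedSpace (Cb 1) := inferInstanceAs (PreconnectedSpace (Unit × I))

/-- Every map from the three-sphere to imaginary units lifts. -/
theorem exists_lift {u : S3 → ℍ[ℝ]} (hu : Continuous u) (hu1 : ∀ y, u y * u y = -1) :
    ∃ φ : S3 → ℍ[ℝ], Continuous φ ∧ (∀ y, φ y ≠ 0) ∧ ∀ y, cj (φ y) qi = u y := by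
  obtain ⟨b, hb⟩ : ∃ b, b = u (clp c0) := ⟨_, rfl⟩
  have hv : ∀ x ∈ bd 3, u (clp x) = b := fun x hx => by rw [hb, clp_bd hx c0_mem]
  obtain ⟨r, hr, hrb⟩ : ∃ r : ℍ[ℝ], r ≠ 0 ∧ cj r qi = b := by
    have hi : qi * qi = -1 := by ext <;> simp
    by_cases h : 1 - b * qi = 0
    · have : b = -qi := by
        have h2 := congrArg (· * qi) h
        simp only [sub_mul, mul_assoc, hi] at h2
        simpa [add_eq_zero_iff_eq_neg'] using h2
      have hj : qj ≠ 0 := fun h => by simpa using congrArg QuaternionAlgebra.imJ h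
      refine ⟨qj, hj, cj_eq hj ?_⟩
      rw [this]; ext <;> simp
    · refine ⟨_, h, cj_eq h ?_⟩
      rw [sub_mul, mul_sub, mul_assoc, hi, ← mul_assoc, hb, hu1]
      noncomm_ring
  obtain ⟨A, hA, hA0, hA1, hA2, hA3⟩ := exists_lft (X := Cb 2) (h := fun t x => u (clp (x, t)))
    (hu.comp (continuous_clp.comp continuous_swap)) (fun _ _ => hu1 _) (φ := fun _ => r)
    continuous_const (fun _ => hr) (fun x => hrb.trans (hv _ (.inr (.inl rfl))).symm)
  have hAb : ∀ x ∈ bd 2, ∀ t, A t x = r := fun x hx => hA3 x fun t =>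
    (hv _ (.inl hx)).trans (hv _ (.inl hx)).symm
  obtain ⟨L, hL, hL0, hL1, hL2⟩ := exists_cmp (X := Cb 1) (A := fun _ _ => r)
    (B := fun t x => A 1 (x, t)) continuous_const
    (hA.comp (f := fun p : I × Cb 1 => ((1, (p.2, p.1)) : I × Cb 2))
      (continuous_const.prodMk continuous_swap)) (fun _ _ => hr) (fun _ _ => hA0 _ _)
    (fun x => (hAb _ (.inr (.inl rfl)) _).symm)
    (fun t x => hrb.trans ((hA2 _ _).trans (hv _ (.inr (.inr rfl)))).symm)
  have hLb : ∀ x ∈ bd 1, ∀ t, L t x = 0 := fun x hx => hL2 x fun t => (hAb (x, t) (.inl hx) 1).symm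
  have hL1' : ∀ x, L 1 x = 0 := fun x => by
    have hL3 : ∀ x, ec (L 1 x) = 1 := fun x => mul_left_cancel₀ hr
      (((hL1 1 x).symm.trans (hAb (x, 1) (.inr (.inr rfl)) 1)).trans (mul_one r).symm)
    have := ec_const (L := L 1) (hL.comp (Continuous.prodMk_right 1)) hL3 x (((), 0) : Unit × I)
    exact this.trans (hLb _ (.inr (.inl rfl)) 1)
  have hLB : ∀ x ∈ bd 2, L x.2 x.1 = 0 := by
    rintro ⟨x, t⟩ (h | rfl | rfl)
    exacts [hLb _ h _, hL0 _, hL1' _]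
  have hF : ∀ x ∈ bd 3, A x.2 x.1 * ec (-(x.2 * L x.1.2 x.1.1)) = r := by
    rintro ⟨⟨x, s⟩, t⟩ (h | rfl | rfl)
    · have e1 := hAb _ h t
      have e2 := hLB _ h
      dsimp only at e2
      simp [e1, e2, ec_zero]
    · simp [ec_zero]
      exact hA1 _
    · have e : A 1 (x, s) = r * ec (L s x) := hL1 s x
      simp only [e, mul_assoc]
      simp [ec_mul_neg]
  obtain ⟨φ, hφ, hφ1⟩ := exists_descent (Z := Unit) (M := ℍ[ℝ])
    (F := fun _ x => A x.2 x.1 * ec (-(x.2 * L x.1.2 x.1.1)))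
    ((((hA.comp continuous_swap).mul (continuous_ec.comp ((Complex.continuous_ofReal.comp
      (continuous_subtype_val.comp continuous_snd)).mul
        (hL.comp (continuous_swap.comp continuous_fst))).neg))).comp continuous_snd)
    (fun _ x hx y hy => (hF x hx).trans (hF y hy).symm)
  refine ⟨φ (), hφ.comp (Continuous.prodMk_right ()), fun y => ?_, fun y => ?_⟩ <;>
    obtain ⟨x, rfl⟩ := clp_surjective y
  · rw [hφ1]
    exact mul_ne_zero (hA0 _ _) (ec_ne _)
  · rw [hφ1, cj_ec]
    exact hA2 _ _

instance : PreconnectedSpace (Cb 3) :=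
  inferInstanceAs (PreconnectedSpace (((Unit × I) × I) × I))
instance : PreconnectedSpace S3 := clp_surjective.denseRange.preconnectedSpace continuous_clp

/-- A lift of a square of maps, starting at `φ` on three sides, and differing from `φ` by the
exponential of `θ` on the fourth side. -/
structure Lf (φ : S3 → ℍ[ℝ]) (A : I → I → S3 → ℍ[ℝ]) (θ : I → S3 → ℂ) : Prop where
  cont : Continuous fun p : I × I × S3 => A p.1 p.2.1 p.2.2
  ne : ∀ s t y, A s t y ≠ 0
  left : ∀ t y, A 0 t y = φ y
  bot : ∀ s y, A s 0 y = φ y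
  top : ∀ s y, A s 1 y = φ y
  right : ∀ t y, A 1 t y = φ y * ec (θ t y)
  cont_log : Continuous fun p : I × S3 => θ p.1 p.2
  log_zero : ∀ y, θ 0 y = 0

/-- The family associated with a lift. -/
def tD (φ : S3 → ℍ[ℝ]) (A : I → I → S3 → ℍ[ℝ]) (z : (I × I) × S3) : ℍ[ℝ] :=
  A z.1.1 z.1.2 z.2 * (φ z.2)⁻¹

section
variable {φ : S3 → ℍ[ℝ]} (hφ : Continuous φ) (hφ0 : ∀ y, φ y ≠ 0)
include hφ hφ0

theorem exists_Lf {g : I → I → S3 → ℍ[ℝ]} (hg : Continuous fun p : I × I × S3 => g p.1 p.2.1 p.2.2)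
    (hg1 : ∀ s t y, g s t y * g s t y = -1)
    (hb : ∀ s t y, (s = 0 ∨ s = 1) ∨ t = 0 ∨ t = 1 → g s t y = cj (φ y) qi) :
    ∃ A θ, Lf φ A θ ∧ ∀ s t y, cj (A s t y) qi = g s t y := by
  obtain ⟨A, hA, hA0, hA1, hA2, hA3⟩ := exists_lft (X := I × S3) (h := fun s x => g s x.1 x.2) hg
    (fun _ _ => hg1 _ _ _) (φ := fun x => φ x.2) (hφ.comp continuous_snd) (fun _ => hφ0 _)
    (fun x => (hb _ _ _ (.inl (.inl rfl))).symm)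
  have hAb : ∀ t, t = 0 ∨ t = 1 → ∀ s y, A s (t, y) = φ y := fun t ht s y => hA3 (t, y)
    (fun s => (hb _ _ _ (.inr ht)).trans (hb _ _ _ (.inr ht)).symm) s
  obtain ⟨θ, hθ, hθ0, hθ1, -⟩ := exists_cmp (X := S3) (A := fun _ y => φ y)
    (B := fun t y => A 1 (t, y)) (hφ.comp continuous_snd)
    (hA.comp (f := fun p : I × S3 => ((1 : I), p)) (by fun_prop)) (fun _ => hφ0) (fun _ _ => hA0 _ _)
    (fun y => (hAb 0 (.inl rfl) 1 y).symm)
    (fun t y => (hb 1 t y (.inl (.inr rfl))).symm.trans (hA2 1 (t, y)).symm)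
  exact ⟨fun s t y => A s (t, y), θ, ⟨hA, fun _ _ _ => hA0 _ _, fun _ _ => hA1 _,
    hAb 0 (.inl rfl), hAb 1 (.inr rfl), hθ1, hθ, hθ0⟩, fun _ _ _ => hA2 _ _⟩

omit hφ in
theorem Lf.exists_int {A : I → I → S3 → ℍ[ℝ]} {θ : I → S3 → ℂ} (h : Lf φ A θ) :
    ∃ n : ℤ, ∀ y, θ 1 y = n * (2 * Real.pi * Complex.I) := by
  have h1 : ∀ y, ec (θ 1 y) = 1 := fun y => mul_left_cancel₀ (hφ0 y)
    (((h.right 1 y).symm.trans (h.top 1 y)).trans (mul_one _).symm)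
  obtain ⟨n, hn⟩ := ec_eq_one (h1 (clp c0))
  exact ⟨n, fun y => (ec_const (h.cont_log.comp (Continuous.prodMk_right 1)) h1 y _).trans hn⟩

theorem Lf.compare {A A' : I → I → S3 → ℍ[ℝ]} {θ θ' : I → S3 → ℂ} (h : Lf φ A θ) (h' : Lf φ A' θ')
    {Γ : I → I → I → S3 → ℍ[ℝ]}
    (hΓ : Continuous fun p : I × I × I × S3 => Γ p.1 p.2.1 p.2.2.1 p.2.2.2)
    (hΓ1 : ∀ r s t y, Γ r s t y * Γ r s t y = -1)
    (hb : ∀ r s t y, (s = 0 ∨ s = 1) ∨ t = 0 ∨ t = 1 → Γ r s t y = cj (φ y) qi)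
    (hA : ∀ s t y, cj (A s t y) qi = Γ 0 s t y) (hA' : ∀ s t y, cj (A' s t y) qi = Γ 1 s t y) :
    (∀ y, θ 1 y = θ' 1 y) ∧
      ((∀ t y, θ t y = 0) → (∀ t y, θ' t y = 0) → Htp FD (tD φ A) (tD φ A')) := by
  obtain ⟨B, hB, hB0, hB1, hB2, hB3⟩ := exists_lft (X := I × I × S3)
    (h := fun s x => Γ x.1 s x.2.1 x.2.2)
    (hΓ.comp (f := fun p : I × I × I × S3 => (p.2.1, p.1, p.2.2)) (by fun_prop))
    (fun _ _ => hΓ1 _ _ _ _) (φ := fun x => φ x.2.2) (by fun_prop) (fun _ => hφ0 _)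
    (fun x => (hb _ _ _ _ (.inl (.inl rfl))).symm)
  have hBb : ∀ t, t = 0 ∨ t = 1 → ∀ s r y, B s (r, t, y) = φ y := fun t ht s r y =>
    hB3 (r, t, y) (fun s => (hb _ _ _ _ (.inr ht)).trans (hb _ _ _ _ (.inr ht)).symm) s
  obtain ⟨ℓ, hℓ, hℓ0, hℓ1, -⟩ := exists_cmp (X := I × S3) (A := fun _ x => φ x.2)
    (B := fun t x => B 1 (x.1, t, x.2)) (by fun_prop)
    (hB.comp (f := fun p : I × I × S3 => ((1 : I), (p.2.1, p.1, p.2.2))) (by fun_prop))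
    (fun _ _ => hφ0 _) (fun _ _ => hB0 _ _) (fun x => (hBb 0 (.inl rfl) 1 x.1 x.2).symm)
    (fun t x => (hb x.1 1 t x.2 (.inl (.inr rfl))).symm.trans (hB2 1 (x.1, t, x.2)).symm)
  have hℓc : ∀ r y, ℓ 1 (r, y) = ℓ 1 (0, y) := fun r y =>
    ec_const (L := fun r => ℓ 1 (r, y))
      (hℓ.comp (f := fun r : I => ((1 : I), (r, y))) (by fun_prop)) (fun r => mul_left_cancel₀ (hφ0 y)
        (((hℓ1 1 (r, y)).symm.trans (hBb 1 (.inr rfl) 1 r y)).trans (mul_one _).symm)) r 0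
  have side : ∀ {A : I → I → S3 → ℍ[ℝ]} {θ : I → S3 → ℂ} {r : I}, Lf φ A θ →
      (∀ s t y, cj (A s t y) qi = Γ r s t y) → ∃ δ : I → I × S3 → ℂ,
      (Continuous fun p : I × I × S3 => δ p.1 p.2) ∧ (∀ x, δ 0 x = 0) ∧
      (∀ t, t = 0 ∨ t = 1 → ∀ s y, δ s (t, y) = 0) ∧
      (∀ s t y, B s (r, t, y) = A s t y * ec (δ s (t, y))) ∧
      ∀ t y, ℓ t (r, y) = θ t y + δ 1 (t, y) := by
    intro A θ r h hA
    have hAb : ∀ t, t = 0 ∨ t = 1 → ∀ s y, A s t y = φ y := by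
      rintro t (rfl | rfl)
      exacts [h.bot, h.top]
    obtain ⟨δ, hδ, hδ0, hδ1, hδ2⟩ := exists_cmp (X := I × S3) (A := fun s x => A s x.1 x.2)
      (B := fun s x => B s (r, x)) h.cont
      (hB.comp (f := fun p : I × I × S3 => (p.1, (r, p.2))) (by fun_prop))
      (fun _ _ => h.ne _ _ _) (fun _ _ => hB0 _ _) (fun x => (h.left x.1 x.2).trans (hB1 (r, x)).symm)
      (fun s x => (hA _ _ _).trans (hB2 s (r, x)).symm)
    have hδb : ∀ t, t = 0 ∨ t = 1 → ∀ s y, δ s (t, y) = 0 := fun t ht s y =>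
      hδ2 (t, y) (fun s => (hAb t ht s y).trans (hBb t ht s r y).symm) s
    refine ⟨δ, hδ, hδ0, hδb, fun s t y => hδ1 s (t, y), fun t y => ?_⟩
    refine ec_inj (L := fun t => ℓ t (r, y)) (L' := fun t => θ t y + δ 1 (t, y)) (z₀ := 0)
      (hℓ.comp (f := fun t : I => (t, (r, y))) (by fun_prop))
      ((h.cont_log.comp (f := fun t : I => (t, y)) (by fun_prop)).add
        (hδ.comp (f := fun t : I => ((1 : I), (t, y))) (by fun_prop))) (fun t => ?_) ?_ t
    · refine mul_left_cancel₀ (hφ0 y) ?_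
      rw [ec_add, ← mul_assoc, ← h.right]
      exact (hℓ1 t (r, y)).symm.trans (hδ1 1 (t, y))
    · rw [hℓ0, h.log_zero, hδb 0 (.inl rfl), add_zero]
  obtain ⟨δ, hδ, hδ0, hδb, hδ1, hδ2⟩ := side h hA
  obtain ⟨δ', hδ', hδ0', hδb', hδ1', hδ2'⟩ := side h' hA'
  refine ⟨fun y => ?_, fun hθ hθ' => ?_⟩
  · have e := hℓc 1 y
    rw [hδ2, hδ2', hδb 1 (.inr rfl), hδb' 1 (.inr rfl), add_zero, add_zero] at e
    exact e.symm
  let E : I → (I × I) × S3 → ℂ := fun r z => (1 - (r : ℝ)) * δ z.1.1 (z.1.2, z.2) +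
    (r : ℝ) * δ' z.1.1 (z.1.2, z.2) + (z.1.1 : ℝ) * (ℓ z.1.2 (r, z.2) -
      (1 - (r : ℝ)) * δ 1 (z.1.2, z.2) - (r : ℝ) * δ' 1 (z.1.2, z.2))
  have hE : Continuous fun p : I × (I × I) × S3 => E p.1 p.2 := by
    have c1 := hδ.comp (f := fun p : I × (I × I) × S3 => (p.2.1.1, (p.2.1.2, p.2.2))) (by fun_prop)
    have c2 := hδ'.comp (f := fun p : I × (I × I) × S3 => (p.2.1.1, (p.2.1.2, p.2.2))) (by fun_prop)
    have c3 := hδ.comp (f := fun p : I × (I × I) × S3 => ((1 : I), (p.2.1.2, p.2.2))) (by fun_prop)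
    have c4 := hδ'.comp (f := fun p : I × (I × I) × S3 => ((1 : I), (p.2.1.2, p.2.2))) (by fun_prop)
    have c5 := hℓ.comp (f := fun p : I × (I × I) × S3 => (p.2.1.2, (p.1, p.2.2))) (by fun_prop)
    have d1 : Continuous fun p : I × (I × I) × S3 => (((p.1 : ℝ)) : ℂ) := by fun_prop
    have d2 : Continuous fun p : I × (I × I) × S3 => (((p.2.1.1 : ℝ)) : ℂ) := by fun_prop
    exact (((continuous_const.sub d1).mul c1).add (d1.mul c2)).add
      (d2.mul ((c5.sub ((continuous_const.sub d1).mul c3)).sub (d1.mul c4)))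
  refine ⟨fun r z => B z.1.1 (r, z.1.2, z.2) * ec (-E r z) * (φ z.2)⁻¹, ?_, funext fun z => ?_,
    funext fun z => ?_, fun r => ⟨fun z => mul_ne_zero (mul_ne_zero (hB0 _ _) (ec_ne _))
      (inv_ne_zero (hφ0 _)), fun s t y hst => ?_⟩⟩
  · exact ((hB.comp (f := fun p : I × (I × I) × S3 => (p.2.1.1, (p.1, p.2.1.2, p.2.2)))
      (by fun_prop)).mul (continuous_ec.comp hE.neg)).mul
        ((hφ.comp (by fun_prop)).inv₀ fun _ => hφ0 _)
  · have e : E 0 z = δ z.1.1 (z.1.2, z.2) := by simp [E, hδ2, hθ]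
    beta_reduce
    rw [e, hδ1, mul_assoc (A _ _ _), ec_mul_neg, mul_one, tD]
  · have e : E 1 z = δ' z.1.1 (z.1.2, z.2) := by simp [E, hδ2', hθ']
    beta_reduce
    rw [e, hδ1', mul_assoc (A' _ _ _), ec_mul_neg, mul_one, tD]
  · have key : B s (r, t, y) * ec (-E r ((s, t), y)) = φ y := by
      have hE1 : t = 0 ∨ t = 1 → E r ((s, t), y) = 0 := fun ht => by
        have e : ℓ t (r, y) = 0 := by
          rcases ht with rfl | rfl
          · exact hℓ0 _
          · rw [hℓc, hδ2, hθ, hδb 1 (.inr rfl), add_zero]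
        simp [E, hδb t ht, hδb' t ht, e]
      rcases hst with (rfl | rfl) | ht
      · have e : E r ((0, t), y) = 0 := by simp [E, hδ0, hδ0']
        rw [e, neg_zero, ec_zero, hB1, mul_one]
      · have e : E r ((1, t), y) = ℓ t (r, y) := by simp [E]
        have e2 : B 1 (r, t, y) = φ y * ec (ℓ t (r, y)) := hℓ1 t (r, y)
        rw [e, e2, mul_assoc, ec_mul_neg, mul_one]
      · rw [hE1 ht, hBb t ht, neg_zero, ec_zero, mul_one]
    exact (congrArg (· * (φ y)⁻¹) key).trans (mul_inv_cancel₀ (hφ0 y))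

theorem Lf.mul {A A' : I → I → S3 → ℍ[ℝ]} {θ θ' : I → S3 → ℂ} (h : Lf φ A θ) (h' : Lf φ A' θ') :
    Lf φ (fun s t y => A s (pj (2 * t)) y * (φ y)⁻¹ * A' s (pj (2 * t - 1)) y)
      fun t y => θ (pj (2 * t)) y + θ' (pj (2 * t - 1)) y where
  cont := by
    have c := continuous_pj
    exact ((h.cont.comp (f := fun p : I × I × S3 => (p.1, pj (2 * p.2.1), p.2.2)) (by fun_prop)).mul
      ((hφ.comp (by fun_prop)).inv₀ fun _ => hφ0 _)).mul
        (h'.cont.comp (f := fun p : I × I × S3 => (p.1, pj (2 * p.2.1 - 1), p.2.2)) (by fun_prop))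
  ne s t y := mul_ne_zero (mul_ne_zero (h.ne _ _ _) (inv_ne_zero (hφ0 _))) (h'.ne _ _ _)
  left t y := by rw [h.left, h'.left, mul_inv_cancel₀ (hφ0 y), one_mul]
  bot s y := by
    rw [pj_of_nonpos (by simp), pj_of_nonpos (by simp), h.bot, h'.bot, mul_inv_cancel₀ (hφ0 y),
      one_mul]
  top s y := by
    rw [pj_of_one_le (by simp), pj_of_one_le (by norm_num), h.top, h'.top,
      mul_inv_cancel₀ (hφ0 y), one_mul]
  right t y := by
    rw [h.right, h'.right, ec_add, ← mul_assoc, ← mul_assoc, inv_mul_cancel_right₀ (hφ0 y)]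
  cont_log := by
    have c := continuous_pj
    exact (h.cont_log.comp (f := fun p : I × S3 => (pj (2 * p.1), p.2)) (by fun_prop)).add
      (h'.cont_log.comp (f := fun p : I × S3 => (pj (2 * p.1 - 1), p.2)) (by fun_prop))
  log_zero y := by
    rw [pj_of_nonpos (by simp), pj_of_nonpos (by simp), h.log_zero, h'.log_zero, add_zero]

theorem exists_Lf_one : ∃ A, Lf φ A fun t _ => (t : ℝ) * (2 * Real.pi * Complex.I) := by
  let w : I → ℂ := fun t => ((t : ℝ) * Real.pi : ℝ) * Complex.I
  let R : I → ℍ[ℝ] := fun s => ⟨Real.cos (s * (Real.pi / 2)), 0, Real.sin (s * (Real.pi / 2)), 0⟩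
  have hw : Continuous w := by fun_prop
  have hR : Continuous R := continuous_quat (by fun_prop) continuous_const (by fun_prop)
    continuous_const
  have hR0 : ∀ s, R s ≠ 0 := fun s h => by
    have h1 := congrArg QuaternionAlgebra.re h
    have h2 := congrArg QuaternionAlgebra.imJ h
    simp only [R, Quaternion.re_zero, Quaternion.imJ_zero] at h1 h2
    have := Real.cos_sq_add_sin_sq (s * (Real.pi / 2))
    simp [h1, h2] at this
  have hw1 : ec (w 1) = -1 ∧ ec (-w 1) = -1 := by
    constructor <;> ext <;> simp [w, ec]
  have hw0 : w 0 = 0 := by simp [w]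
  have hj : ∀ t, R 1 * ec (-w t) = ec (w t) * R 1 := fun t => by
    have e : R 1 = qj := by ext <;> simp [R, qj]
    rw [e]
    ext <;> simp [w, ec, Complex.exp_re, Complex.exp_im]
  refine ⟨fun s t y => φ y * (ec (w t) * R s * ec (-w t) * (R s)⁻¹), ?_, fun s t y => ?_,
    fun t y => ?_, fun s y => ?_, fun s y => ?_, fun t y => ?_, by fun_prop, fun y => by simp⟩
  · exact (hφ.comp (by fun_prop)).mul ((((continuous_ec.comp (hw.comp (by fun_prop))).mul
      (hR.comp (by fun_prop))).mul (continuous_ec.comp (hw.comp (by fun_prop)).neg)).mul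
        ((hR.comp (by fun_prop)).inv₀ fun _ => hR0 _))
  · exact mul_ne_zero (hφ0 y) (mul_ne_zero (mul_ne_zero (mul_ne_zero (ec_ne _) (hR0 s)) (ec_ne _))
      (inv_ne_zero (hR0 s)))
  · have e : R 0 = 1 := by ext <;> simp [R]
    rw [e, mul_one, inv_one, mul_one, ec_mul_neg, mul_one]
  · rw [hw0, neg_zero, ec_zero, one_mul, mul_one, mul_inv_cancel₀ (hR0 s), mul_one]
  · rw [hw1.1, hw1.2, neg_one_mul, mul_neg_one, neg_neg, mul_inv_cancel₀ (hR0 s), mul_one]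
  · have e : (t : ℝ) * (2 * Real.pi * Complex.I) = w t + w t := by simp only [w]; push_cast; ring
    rw [e, ec_add, mul_assoc (ec _) (R 1), hj, ← mul_assoc (ec (w t)), mul_assoc (_ * _),
      mul_inv_cancel₀ (hR0 1), mul_one]
end

instance : CompactSpace (Sph 3) := inferInstanceAs (CompactSpace S3)

/-- The inclusion of the sphere of unit vectors in the imaginary quaternions. -/
@[simps]
def io (x : Sph 2) : ℍ[ℝ] := ⟨0, x.1 0, x.1 1, x.1 2⟩

theorem continuous_io : Continuous io :=
  continuous_quat continuous_const (by fun_prop) (by fun_prop) (by fun_prop)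

theorem io_mul_self (x : Sph 2) : io x * io x = -1 := by
  have h := mem_sphere_zero_iff_norm.1 x.2
  rw [EuclideanSpace.norm_eq, Real.sqrt_eq_one, Fin.sum_univ_three] at h
  simp only [Real.norm_eq_abs, sq_abs] at h
  ext <;> simp <;> linarith

theorem exists_io {q : ℍ[ℝ]} (h : q * q = -1) :
    q.re = 0 ∧ !₂[q.imI, q.imJ, q.imK] ∈ Sph 2 := by
  have h0 := congrArg QuaternionAlgebra.re h
  have h1 := congrArg QuaternionAlgebra.imI h
  have h2 := congrArg QuaternionAlgebra.imJ h
  have h3 := congrArg QuaternionAlgebra.imK h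
  simp at h0 h1 h2 h3
  have hr : q.re = 0 := by
    by_contra hr
    have e1 : q.imI = 0 := mul_left_cancel₀ hr (by linarith)
    have e2 : q.imJ = 0 := mul_left_cancel₀ hr (by linarith)
    have e3 : q.imK = 0 := mul_left_cancel₀ hr (by linarith)
    rw [e1, e2, e3] at h0
    nlinarith
  refine ⟨hr, mem_sphere_zero_iff_norm.2 ?_⟩
  rw [EuclideanSpace.norm_eq, Real.sqrt_eq_one, Fin.sum_univ_three]
  simp [hr] at h0 ⊢
  linarith

theorem exists_curry {Z : Type*} [TopologicalSpace Z] {F : Z → S3 → ℍ[ℝ]}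
    (hF : Continuous fun p : Z × S3 => F p.1 p.2) (h1 : ∀ z y, F z y * F z y = -1) :
    ∃ k : C(Z, C(Sph 3, Sph 2)), ∀ z y, io (k z y) = F z y := by
  refine ⟨ContinuousMap.curry ⟨fun p : Z × Sph 3 =>
    ⟨!₂[(F p.1 p.2).imI, (F p.1 p.2).imJ, (F p.1 p.2).imK], (exists_io (h1 _ _)).2⟩, ?_⟩,
    fun z y => ?_⟩
  · refine Continuous.subtype_mk ?_ _
    refine (PiLp.continuous_toLp 2 _).comp (continuous_pi fun i => ?_)
    fin_cases i
    exacts [Quaternion.continuous_imI.comp hF, Quaternion.continuous_imJ.comp hF,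
      Quaternion.continuous_imK.comp hF]
  · have := (exists_io (h1 z y)).1
    ext <;> simp [io, this]

theorem io_injective : Function.Injective io := fun x y h => Subtype.ext <| by
  have h1 := congrArg QuaternionAlgebra.imI h
  have h2 := congrArg QuaternionAlgebra.imJ h
  have h3 := congrArg QuaternionAlgebra.imK h
  ext i
  fin_cases i
  exacts [h1, h2, h3]

/-- Two-dimensional loops of maps `S³ → S²` at `f`. -/
abbrev Loop2 (f : C(Sph 3, Sph 2)) := GenLoop (Fin 2) C(Sph 3, Sph 2) f

section
variable {f : C(Sph 3, Sph 2)}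

/-- The square of maps represented by a two-dimensional loop. -/
def lsq (p : Loop2 f) (s t : I) (y : S3) : ℍ[ℝ] := io (p ![s, t] y)

theorem vec_eta (v : Fin 2 → I) : ![v 0, v 1] = v := by ext i; fin_cases i <;> rfl

theorem mem_boundary {s t : I} (h : (s = 0 ∨ s = 1) ∨ t = 0 ∨ t = 1) :
    ![s, t] ∈ Cube.boundary (Fin 2) := h.elim (fun h => ⟨0, h⟩) fun h => ⟨1, h⟩

theorem of_mem_boundary {v : Fin 2 → I} (h : v ∈ Cube.boundary (Fin 2)) :
    (v 0 = 0 ∨ v 0 = 1) ∨ v 1 = 0 ∨ v 1 = 1 := by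
  obtain ⟨i, hi⟩ := h
  fin_cases i
  exacts [.inl hi, .inr hi]

theorem lsq_boundary (p : Loop2 f) (s t : I) (y : S3)
    (h : (s = 0 ∨ s = 1) ∨ t = 0 ∨ t = 1) : lsq p s t y = io (f y) :=
  congrArg (fun k : C(Sph 3, Sph 2) => io (k y)) (p.2 _ (mem_boundary h))

theorem continuous_vec {X : Type*} [TopologicalSpace X] {a b : X → I} (ha : Continuous a)
    (hb : Continuous b) : Continuous fun x => ![a x, b x] := continuous_pi fun i => by
  fin_cases i
  exacts [ha, hb]

theorem continuous_lsq (p : Loop2 f) :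
    Continuous fun x : I × I × S3 => lsq p x.1 x.2.1 x.2.2 := by
  refine continuous_io.comp (Continuous.eval (f := fun x : I × I × S3 => p ![x.1, x.2.1])
    (g := fun x : I × I × S3 => (x.2.2 : Sph 3)) ?_ (by fun_prop))
  exact p.1.continuous.comp (continuous_vec (by fun_prop) (by fun_prop))

theorem exists_loop {g : I → I → S3 → ℍ[ℝ]} (hg : Continuous fun p : I × I × S3 => g p.1 p.2.1 p.2.2)
    (hg1 : ∀ s t y, g s t y * g s t y = -1)
    (hb : ∀ s t y, (s = 0 ∨ s = 1) ∨ t = 0 ∨ t = 1 → g s t y = io (f y)) :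
    ∃ p : Loop2 f, ∀ s t y, lsq p s t y = g s t y := by
  obtain ⟨k, hk⟩ := exists_curry (Z := Fin 2 → I) (F := fun v => g (v 0) (v 1))
    (hg.comp (f := fun p : (Fin 2 → I) × S3 => (p.1 0, p.1 1, p.2)) (by fun_prop)) fun _ _ => hg1 _ _ _
  exact ⟨⟨k, fun v hv => ContinuousMap.ext fun y => io_injective
    ((hk v y).trans (hb _ _ _ (of_mem_boundary hv)))⟩, fun s t y => hk _ _⟩

theorem homotopic_of {p q : Loop2 f} {Γ : I → I → I → S3 → ℍ[ℝ]}
    (hΓ : Continuous fun p : I × I × I × S3 => Γ p.1 p.2.1 p.2.2.1 p.2.2.2)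
    (hΓ1 : ∀ r s t y, Γ r s t y * Γ r s t y = -1)
    (hb : ∀ r s t y, (s = 0 ∨ s = 1) ∨ t = 0 ∨ t = 1 → Γ r s t y = io (f y))
    (h0 : ∀ s t y, lsq p s t y = Γ 0 s t y) (h1 : ∀ s t y, lsq q s t y = Γ 1 s t y) :
    GenLoop.Homotopic p q := by
  obtain ⟨k, hk⟩ := exists_curry (Z := I × (Fin 2 → I)) (F := fun z => Γ z.1 (z.2 0) (z.2 1))
    (hΓ.comp (f := fun p : (I × (Fin 2 → I)) × S3 => (p.1.1, p.1.2 0, p.1.2 1, p.2)) (by fun_prop))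
    fun _ _ => hΓ1 _ _ _ _
  refine ⟨⟨⟨k, fun v => ContinuousMap.ext fun y => io_injective ?_,
    fun v => ContinuousMap.ext fun y => io_injective ?_⟩, fun r v hv => ContinuousMap.ext fun y =>
      io_injective ?_⟩⟩
  · refine (hk (0, v) y).trans ((h0 (v 0) (v 1) y).symm.trans ?_)
    exact congrArg (fun w => io (p w y)) (vec_eta v)
  · refine (hk (1, v) y).trans ((h1 (v 0) (v 1) y).symm.trans ?_)
    exact congrArg (fun w => io (q w y)) (vec_eta v)
  · refine (hk (r, v) y).trans ((hb _ _ _ _ (of_mem_boundary hv)).trans ?_)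
    exact congrArg (fun k : C(Sph 3, Sph 2) => io (k y)) (p.2 _ hv).symm

theorem exists_of_homotopic {p q : Loop2 f} (h : GenLoop.Homotopic p q) :
    ∃ Γ : I → I → I → S3 → ℍ[ℝ], (Continuous fun p : I × I × I × S3 => Γ p.1 p.2.1 p.2.2.1 p.2.2.2) ∧
      (∀ r s t y, Γ r s t y * Γ r s t y = -1) ∧
      (∀ r s t y, (s = 0 ∨ s = 1) ∨ t = 0 ∨ t = 1 → Γ r s t y = io (f y)) ∧
      (∀ s t y, lsq p s t y = Γ 0 s t y) ∧ ∀ s t y, lsq q s t y = Γ 1 s t y := by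
  obtain ⟨H⟩ := h
  refine ⟨fun r s t y => io (H (r, ![s, t]) y), ?_, fun _ _ _ _ => io_mul_self _, fun r s t y hst => ?_,
    fun s t y => ?_, fun s t y => ?_⟩
  · refine continuous_io.comp (Continuous.eval
      (f := fun x : I × I × I × S3 => H (x.1, ![x.2.1, x.2.2.1]))
      (g := fun x : I × I × I × S3 => (x.2.2.2 : Sph 3)) ?_ (by fun_prop))
    exact H.continuous.comp (Continuous.prodMk (by fun_prop)
      (continuous_vec (by fun_prop) (by fun_prop)))
  · exact congrArg (fun k : C(Sph 3, Sph 2) => io (k y))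
      ((H.eq_fst r (mem_boundary hst)).trans (p.2 _ (mem_boundary hst)))
  · exact congrArg (fun k : C(Sph 3, Sph 2) => io (k y)) (H.apply_zero _).symm
  · exact congrArg (fun k : C(Sph 3, Sph 2) => io (k y)) (H.apply_one _).symm
end

section
variable {f : C(Sph 3, Sph 2)} {φ : S3 → ℍ[ℝ]}

/-- The class `q` is represented by a loop whose lift has winding number `n`. -/
def Wn (φ : S3 → ℍ[ℝ]) (q : π_ 2 C(Sph 3, Sph 2) f) (n : ℤ) : Prop :=
  ∃ p, (⟦p⟧ : π_ 2 C(Sph 3, Sph 2) f) = q ∧ ∃ A θ, Lf φ A θ ∧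
    (∀ s t y, cj (A s t y) qi = lsq p s t y) ∧ ∀ y, θ 1 y = n * (2 * Real.pi * Complex.I)

/-- The loop `p` is the conjugate of the base point by the family `D`. -/
def Rp (φ : S3 → ℍ[ℝ]) (D : (I × I) × S3 → ℍ[ℝ]) (p : Loop2 f) : Prop :=
  ∀ s t y, lsq p s t y = cj (D ((s, t), y) * φ y) qi

theorem lsq_mul_self (p : Loop2 f) (s t : I) (y : S3) :
    lsq p s t y * lsq p s t y = -1 := io_mul_self _

theorem lsq_transAt (p p' : Loop2 f) (s t : I) (y : S3) :
    lsq (GenLoop.transAt 1 p p') s t y = if (t : ℝ) ≤ 1 / 2 then lsq p s (pj (2 * t)) y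
      else lsq p' s (pj (2 * t - 1)) y := by
  have e : ∀ r, Function.update ![s, t] 1 r = ![s, r] := fun r => by
    ext i; fin_cases i <;> simp
  simp only [lsq, GenLoop.transAt, GenLoop.coe_copy, e]
  exact apply_ite (fun k : C(Sph 3, Sph 2) => io (k y)) _ _ _

variable (hφ : Continuous φ) (hφ0 : ∀ y, φ y ≠ 0) (hu : ∀ y, cj (φ y) qi = io (f y))
include hφ hφ0 hu

theorem exists_Wn (q : π_ 2 C(Sph 3, Sph 2) f) : ∃ n, Wn φ q n := by
  induction q using Quotient.inductionOn with | _ p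
  obtain ⟨A, θ, h, hA⟩ := exists_Lf hφ hφ0 (continuous_lsq p) (lsq_mul_self p)
    fun s t y hst => (lsq_boundary p s t y hst).trans (hu y).symm
  obtain ⟨n, hn⟩ := h.exists_int hφ0
  exact ⟨n, p, rfl, A, θ, h, hA, hn⟩

theorem Wn.unique {q : π_ 2 C(Sph 3, Sph 2) f} {n m : ℤ} (h : Wn φ q n) (h' : Wn φ q m) : n = m := by
  obtain ⟨p, rfl, A, θ, h, hA, hn⟩ := h
  obtain ⟨p', hp, A', θ', h', hA', hm⟩ := h'
  obtain ⟨Γ, hΓ, hΓ1, hΓb, h0, h1⟩ := exists_of_homotopic (Quotient.exact hp.symm)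
  have e := (h.compare hφ hφ0 h' hΓ hΓ1 (fun r s t y hst => (hΓb r s t y hst).trans (hu y).symm)
    (fun s t y => (hA s t y).trans (h0 s t y)) fun s t y => (hA' s t y).trans (h1 s t y)).1 (clp c0)
  rw [hn, hm] at e
  exact_mod_cast mul_right_cancel₀ Complex.two_pi_I_ne_zero e

omit hu in
theorem Wn.mul {q q' : π_ 2 C(Sph 3, Sph 2) f} {n m : ℤ} (h : Wn φ q n) (h' : Wn φ q' m) :
    Wn φ (q * q') (n + m) := by
  obtain ⟨p, rfl, A, θ, h, hA, hn⟩ := h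
  obtain ⟨p', rfl, A', θ', h', hA', hm⟩ := h'
  refine ⟨_, (HomotopyGroup.mul_spec (i := 1)).symm, _, _, h'.mul hφ hφ0 h, fun s t y => ?_,
    fun y => ?_⟩
  · rw [lsq_transAt]
    split_ifs with ht
    · rw [pj_of_nonpos (x := 2 * t - 1) (by linarith), h.bot, inv_mul_cancel_right₀ (hφ0 y), hA']
    · rw [pj_of_one_le (x := 2 * t) (by linarith), h'.top, mul_inv_cancel₀ (hφ0 y), one_mul, hA]
  · rw [pj_of_one_le (by simp), pj_of_one_le (by norm_num), hn, hm]
    push_cast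
    ring

theorem exists_Wn_one : ∃ q : π_ 2 C(Sph 3, Sph 2) f, Wn φ q 1 := by
  obtain ⟨A, h⟩ := exists_Lf_one hφ hφ0
  obtain ⟨p, hp⟩ := exists_loop (f := f) (g := fun s t y => cj (A s t y) qi)
    (continuous_cj h.cont continuous_const fun _ => h.ne _ _ _)
    (fun s t y => by rw [cj_mul (h.ne _ _ _), qi_qi, cj_neg, cj_self (h.ne _ _ _)])
    (fun s t y hst => by
      rw [← hu]
      rcases hst with (rfl | rfl) | rfl | rfl
      exacts [by rw [h.left], by rw [h.right, cj_ec], by rw [h.bot], by rw [h.top]])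
  exact ⟨_, p, rfl, A, _, h, fun s t y => (hp s t y).symm, fun y => by simp⟩

theorem exists_Rp {D : (I × I) × S3 → ℍ[ℝ]} (hD : Continuous D) (hD1 : FD D) :
    ∃ p : Loop2 f, Rp φ D p := by
  have h0 : ∀ s t y, D ((s, t), y) * φ y ≠ 0 := fun s t y => mul_ne_zero (hD1.1 _) (hφ0 y)
  exact exists_loop (f := f) (g := fun s t y => cj (D ((s, t), y) * φ y) qi)
    (continuous_cj ((hD.comp (f := fun p : I × I × S3 => ((p.1, p.2.1), p.2.2)) (by fun_prop)).mul
      (hφ.comp (by fun_prop))) continuous_const fun _ => h0 _ _ _)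
    (fun s t y => by rw [cj_mul (h0 _ _ _), qi_qi, cj_neg, cj_self (h0 _ _ _)])
    fun s t y hst => by rw [hD1.2 s t y hst, one_mul, hu]

theorem Rp.homotopic {D D' : (I × I) × S3 → ℍ[ℝ]} {p p' : Loop2 f}
    (h : Rp φ D p) (h' : Rp φ D' p') (hD : Htp FD D D') : GenLoop.Homotopic p p' := by
  obtain ⟨H, hH, rfl, rfl, hH1⟩ := hD
  have h0 : ∀ r s t y, H r ((s, t), y) * φ y ≠ 0 := fun r s t y =>
    mul_ne_zero ((hH1 r).1 _) (hφ0 y)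
  exact homotopic_of (f := f) (Γ := fun r s t y => cj (H r ((s, t), y) * φ y) qi)
    (continuous_cj ((hH.comp (f := fun p : I × I × I × S3 => (p.1, ((p.2.1, p.2.2.1), p.2.2.2)))
      (by fun_prop)).mul (hφ.comp (by fun_prop))) continuous_const fun _ => h0 _ _ _ _)
    (fun r s t y => by rw [cj_mul (h0 _ _ _ _), qi_qi, cj_neg, cj_self (h0 _ _ _ _)])
    (fun r s t y hst => by rw [(hH1 r).2 s t y hst, one_mul, hu]) h h'

omit hφ hφ0 in
theorem Rp_one : Rp φ (fun _ => 1) (GenLoop.const : Loop2 f) :=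
  fun s t y => by rw [one_mul, hu]; rfl

omit hu in
theorem Rp.lf {D : (I × I) × S3 → ℍ[ℝ]} (hD : Continuous D) (hD1 : FD D) :
    Lf φ (fun s t y => D ((s, t), y) * φ y) fun _ _ => 0 where
  cont := (hD.comp (f := fun p : I × I × S3 => ((p.1, p.2.1), p.2.2)) (by fun_prop)).mul
      (hφ.comp (by fun_prop))
  ne s t y := mul_ne_zero (hD1.1 _) (hφ0 y)
  left t y := by rw [hD1.2 _ _ _ (.inl (.inl rfl)), one_mul]
  bot s y := by rw [hD1.2 _ _ _ (.inr (.inl rfl)), one_mul]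
  top s y := by rw [hD1.2 _ _ _ (.inr (.inr rfl)), one_mul]
  right t y := by rw [hD1.2 _ _ _ (.inl (.inr rfl)), one_mul, ec_zero, mul_one]
  cont_log := continuous_const
  log_zero _ := rfl

theorem Rp.htp {D D' : (I × I) × S3 → ℍ[ℝ]} {p p' : Loop2 f}
    (h : Rp φ D p) (h' : Rp φ D' p') (hD : Continuous D) (hD1 : FD D) (hD' : Continuous D')
    (hD1' : FD D') (hp : GenLoop.Homotopic p p') : Htp FD D D' := by
  obtain ⟨Γ, hΓ, hΓ1, hΓb, h0, h1⟩ := exists_of_homotopic hp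
  have e := ((Rp.lf hφ hφ0 hD hD1).compare hφ hφ0 (Rp.lf hφ hφ0 hD' hD1') hΓ hΓ1
    (fun r s t y hst => (hΓb r s t y hst).trans (hu y).symm)
    (fun s t y => (h s t y).symm.trans (h0 s t y)) fun s t y => (h' s t y).symm.trans (h1 s t y)).2
    (fun _ _ => rfl) fun _ _ => rfl
  have e2 : ∀ D : (I × I) × S3 → ℍ[ℝ], tD φ (fun s t y => D ((s, t), y) * φ y) = D := fun D =>
    funext fun z => mul_inv_cancel_right₀ (hφ0 z.2) _
  rwa [e2, e2] at e

omit hu in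
theorem Wn.exists_Rp {q : π_ 2 C(Sph 3, Sph 2) f} (h : Wn φ q 0) :
    ∃ p D, (⟦p⟧ : π_ 2 C(Sph 3, Sph 2) f) = q ∧ Continuous D ∧ FD D ∧ Rp φ D p := by
  obtain ⟨p, rfl, A, θ, h, hA, hn⟩ := h
  refine ⟨p, fun z => A z.1.1 z.1.2 z.2 * ec (-((z.1.1 : ℝ) * θ z.1.2 z.2)) * (φ z.2)⁻¹, rfl, ?_,
    ⟨fun z => mul_ne_zero (mul_ne_zero (h.ne _ _ _) (ec_ne _)) (inv_ne_zero (hφ0 _)),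
      fun s t y hst => ?_⟩, fun s t y => ?_⟩
  · refine ((h.cont.comp (f := fun z : (I × I) × S3 => (z.1.1, z.1.2, z.2)) (by fun_prop)).mul
      (continuous_ec.comp (Continuous.neg (Continuous.mul (by fun_prop) (h.cont_log.comp
        (f := fun z : (I × I) × S3 => (z.1.2, z.2)) (by fun_prop)))))).mul
          ((hφ.comp (by fun_prop)).inv₀ fun _ => hφ0 _)
  · have key : A s t y * ec (-((s : ℝ) * θ t y)) = φ y := by
      rcases hst with (rfl | rfl) | rfl | rfl
      · simp [h.left, ec_zero]
      · rw [h.right, mul_assoc]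
        simp [ec_mul_neg]
      · simp [h.bot, h.log_zero, ec_zero]
      · simp [h.top, hn, ec_zero]
    exact (congrArg (· * (φ y)⁻¹) key).trans (mul_inv_cancel₀ (hφ0 y))
  · beta_reduce
    rw [inv_mul_cancel_right₀ (hφ0 y), cj_ec, hA]

theorem exists_kernel : ∃ κ : π_ 2 C(Sph 3, Sph 2) f, Wn φ κ 0 ∧ κ ≠ 1 ∧
    ∀ q : π_ 2 C(Sph 3, Sph 2) f, Wn φ q 0 → q = 1 ∨ q = κ := by
  obtain ⟨P, hP, hP1, hP2, hP3⟩ := two_FD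
  obtain ⟨p, hp⟩ := exists_Rp hφ hφ0 hu hP hP1
  refine ⟨⟦p⟧, ⟨p, rfl, _, _, Rp.lf hφ hφ0 hP hP1, fun s t y => (hp s t y).symm, fun y => by simp⟩,
    fun e => hP2 ?_, fun q hq => ?_⟩
  · exact hp.htp hφ hφ0 hu (Rp_one hu) hP hP1 continuous_const ⟨fun _ => one_ne_zero,
      fun _ _ _ _ => rfl⟩ (Quotient.exact (e.trans HomotopyGroup.one_def))
  · obtain ⟨p', D, rfl, hD, hD1, hD2⟩ := hq.exists_Rp hφ hφ0
    refine (hP3 D hD hD1).imp (fun h => ?_) fun h => Quotient.sound (hD2.homotopic hφ hφ0 hu hp h)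
    exact (Quotient.sound (hD2.homotopic hφ hφ0 hu (Rp_one hu) h)).trans HomotopyGroup.one_def.symm
end

theorem nonempty_mulEquiv {G : Type*} [CommGroup G] {W : G → ℤ → Prop} (hex : ∀ q, ∃ n, W q n)
    (huniq : ∀ {q n m}, W q n → W q m → n = m)
    (hmul : ∀ {q q' n m}, W q n → W q' m → W (q * q') (n + m)) {a κ : G} (ha : W a 1)
    (hκ : W κ 0) (hκ1 : κ ≠ 1) (hk : ∀ q, W q 0 → q = 1 ∨ q = κ) :
    Nonempty (G ≃* Multiplicative ℤ × Multiplicative (ZMod 2)) := by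
  choose d hd using hex
  let δ : G →* Multiplicative ℤ := MonoidHom.mk' (fun q => Multiplicative.ofAdd (d q))
    fun q q' => congrArg _ (huniq (hd _) (hmul (hd q) (hd q')))
  have hδ : ∀ {q n}, W q n → δ q = Multiplicative.ofAdd n := fun h =>
    congrArg Multiplicative.ofAdd (huniq (hd _) h)
  have hδk : ∀ q, δ q = 1 → q = 1 ∨ q = κ := fun q h => hk q (by
    have e : d q = 0 := Multiplicative.ofAdd.injective h
    exact e ▸ hd q)
  have hκ2 : κ * κ = 1 := (hk _ (hmul hκ hκ)).resolve_right fun h => hκ1 (mul_eq_left.1 h)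
  let k : Multiplicative (ZMod 2) →* G := MonoidHom.mk'
    (fun e => if e.toAdd = 0 then 1 else κ) (by
      have : ∀ x y : ZMod 2, (if x + y = 0 then 1 else κ) =
          (if x = 0 then 1 else κ) * if y = 0 then 1 else κ := by
        intro x y
        have h2 : ∀ x y : ZMod 2, x ≠ 0 → y ≠ 0 → x + y = 0 := by decide
        by_cases hx : x = 0
        · simp [hx]
        by_cases hy : y = 0
        · simp [hx, hy]
        rw [if_pos (h2 x y hx hy), if_neg hx, if_neg hy, hκ2]
      exact fun x y => this x.toAdd y.toAdd)
  have hδ1 : ∀ n e, δ (zpowersHom G a n * k e) = n := fun n e => by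
    have e1 : δ (k e) = 1 := by
      by_cases h : e.toAdd = 0
      · exact (congrArg δ (if_pos h)).trans (map_one δ)
      · exact (congrArg δ (if_neg h)).trans (hδ hκ)
    rw [map_mul, e1, mul_one, zpowersHom_apply, map_zpow, hδ ha, ← ofAdd_zsmul, smul_eq_mul, mul_one,
      ofAdd_toAdd]
  let F : Multiplicative ℤ × Multiplicative (ZMod 2) →* G := (zpowersHom G a).coprod k
  refine ⟨(MulEquiv.ofBijective F ⟨(injective_iff_map_eq_one F).2 fun ⟨n, e⟩ h => ?_, fun q => ?_⟩).symm⟩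
  · obtain rfl : n = 1 := (hδ1 n e).symm.trans ((congrArg δ h).trans (map_one δ))
    have h1 : k e = 1 := by simpa [F] using h
    by_cases he : e.toAdd = 0
    · exact Prod.ext rfl (Multiplicative.toAdd.injective he)
    · exact absurd ((if_neg he).symm.trans h1) hκ1
  · have h0 : δ (q * (zpowersHom G a (δ q))⁻¹) = 1 := by
      have e1 := hδ1 (δ q) 1
      rw [map_one, mul_one] at e1
      rw [map_mul, map_inv, e1, mul_inv_cancel]
    rcases hδk _ h0 with h | h
    · exact ⟨(δ q, 1), by simpa [F] using (mul_inv_eq_one.1 h).symm⟩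
    · refine ⟨(δ q, Multiplicative.ofAdd 1), ?_⟩
      have e1 : k (Multiplicative.ofAdd 1) = κ :=
        if_neg (t := (1 : G)) (one_ne_zero (α := ZMod 2))
      rw [mul_inv_eq_iff_eq_mul] at h
      exact (congrArg _ e1).trans ((mul_comm _ _).trans h.symm)

end

/-- For every `f ∈ C(S³, S²)`, `π₂(C(S³, S²), f) ≅ ℤ × ℤ/2ℤ`. -/
theorem stmt9 (f : C(Sph 3, Sph 2)) :
    Nonempty ((π_ 2 C(Sph 3, Sph 2) f) ≃* Multiplicative ℤ × Multiplicative (ZMod 2)) := by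
  obtain ⟨φ, hφ, hφ0, hu⟩ := exists_lift (u := fun y => io (f y))
    (continuous_io.comp f.continuous) fun _ => io_mul_self _
  obtain ⟨a, ha⟩ := exists_Wn_one hφ hφ0 hu
  obtain ⟨κ, hκ, hκ1, hk⟩ := exists_kernel hφ hφ0 hu
  exact nonempty_mulEquiv (exists_Wn hφ hφ0 hu) (fun h h' => h.unique hφ hφ0 hu h')
    (fun h h' => h.mul hφ hφ0 h') ha hκ hκ1 hk
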